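/- Let 𝔸 and 𝔹 be generalized algebraic theories and let J, J' be derivable judgments of 𝔸, 𝔹 respectively for which J ⊙* J' is defined (i.e. (J,J') is of one of the admissible kinds of Table 1). Then the judgment J ⊙* J' is derivable in the generalized algebraic theory 𝔸 ⊗ 𝔹. -/

import Mathlib

set_option linter.unusedVariables false

/-! # Syntax of generalized algebraic theories (following Cartmell / the paper's appendix) -/

namespace GATPaper

/-- A sort-and-term alphabet: a countably infinite set of variables, a set of sort
symbols and a set of term symbols. -/
structure Alphabet : Type 1 where
  Var : Type
  SortSym : Type
  TermSym : Type
  var_infinite : Infinite Var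
  var_countable : Countable Var

attribute [instance] Alphabet.var_infinite Alphabet.var_countable

variable {A B : Alphabet}

/-- Term expressions over an alphabet. -/
inductive Expr (A : Alphabet) : Type where
  | var : A.Var → Expr A
  | app : A.TermSym → List (Expr A) → Expr A

/-- Sort expressions: a sort symbol applied to a list of term expressions. -/
structure SortE (A : Alphabet) : Type where
  head : A.SortSym
  args : List (Expr A)

/-- Occurrence of a variable in a term expression. -/
inductive Occurs (x : A.Var) : Expr A → Prop where
  | var : Occurs x (Expr.var x)
  | app {t : A.TermSym} {es : List (Expr A)} {e : Expr A} :
      e ∈ es → Occurs x e → Occurs x (Expr.app t es)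

/-- Occurrence of a variable in a sort expression. -/
def SOccurs (x : A.Var) (U : SortE A) : Prop := ∃ e ∈ U.args, Occurs x e

/-- Simultaneous substitution along a function on variables. -/
def Expr.subst (σ : A.Var → Expr A) : Expr A → Expr A
  | .var x => σ x
  | .app t es => .app t (es.attach.map fun e => Expr.subst σ e.1)
termination_by e => sizeOf e
decreasing_by
  have := List.sizeOf_lt_of_mem e.2
  simp only [Expr.app.sizeOf_spec]
  omega

def SortE.subst (σ : A.Var → Expr A) (U : SortE A) : SortE A :=
  ⟨U.head, U.args.map (Expr.subst σ)⟩

open Classical in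
/-- The function on variables determined by a finite list of substitution pairs
`(zᵢ, uᵢ)` (substituting `uᵢ` for `zᵢ`, first matching pair winning, all other
variables unchanged). -/
noncomputable def lookupV : List (A.Var × Expr A) → A.Var → Expr A
  | [], x => .var x
  | p :: ps, x => if p.1 = x then p.2 else lookupV ps x

/-- The simultaneous substitution `e[u₁ | z₁, …, u_k | z_k]` where
`ps = [(z₁,u₁),…,(z_k,u_k)]`. -/
noncomputable def Expr.substL (e : Expr A) (ps : List (A.Var × Expr A)) : Expr A :=
  e.subst (lookupV ps)

noncomputable def SortE.substL (U : SortE A) (ps : List (A.Var × Expr A)) : SortE A :=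
  U.subst (lookupV ps)

/-- A (pre)context is a finite list of (variable, sort expression) pairs. -/
abbrev PreCtx (A : Alphabet) := List (A.Var × SortE A)

/-- The list of variables of a precontext, as term expressions. -/
def ctxVars (X : PreCtx A) : List (Expr A) := X.map fun p => Expr.var p.1

/-- The scoping condition of a precontext: the `i`-th sort expression only contains
variables among the first `i` variables. -/
def IsPreCtx (X : PreCtx A) : Prop :=
  ∀ i (hi : i < X.length) (v : A.Var),
    SOccurs v (X[i]'hi).2 → v ∈ (X.take i).map Prod.fst

/-- Substitution pairs sending the variables of `X` to the entries of `f`. -/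
def mkSub (X : PreCtx A) (f : List (Expr A)) : List (A.Var × Expr A) :=
  (X.map Prod.fst).zip f

/-- `Xᵢ[f₁ | x₁, …, f_{i-1} | x_{i-1}]` (0-based: the `i`-th sort of `X`
substituted along the first `i` entries of `f`). -/
noncomputable def subPre (X : PreCtx A) (f : List (Expr A)) (i : ℕ) (hi : i < X.length) :
    SortE A :=
  ((X[i]'hi).2).substL (mkSub (X.take i) (f.take i))

/-- Judgments: context judgments and the four kinds of standard judgments. -/
inductive Judg (A : Alphabet) : Type where
  | ctx (X : PreCtx A)
  | sort (X : PreCtx A) (U : SortE A)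
  | term (X : PreCtx A) (u : Expr A) (U : SortE A)
  | sortEq (X : PreCtx A) (U V : SortE A)
  | termEq (X : PreCtx A) (u v : Expr A) (U : SortE A)

/-- The context of a judgment. -/
def Judg.ctxOf : Judg A → PreCtx A
  | .ctx X => X
  | .sort X _ => X
  | .term X _ _ => X
  | .sortEq X _ _ => X
  | .termEq X _ _ _ => X

/-- The judgment introducing a sort symbol over the context `X`. -/
def introSort (X : PreCtx A) (S : A.SortSym) : Judg A := .sort X ⟨S, ctxVars X⟩

/-- The judgment introducing a term symbol over the context `X`, with sort `U`. -/
def introTerm (X : PreCtx A) (t : A.TermSym) (U : SortE A) : Judg A :=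
  .term X (.app t (ctxVars X)) U

/-- A set of axioms is a pretheory if: no axiom is a context judgment, every
axiom's context is a precontext, every sort symbol has a unique introducing sort
axiom and there are no other sort axioms, and likewise for term symbols. -/
structure IsPretheory (Ax : Set (Judg A)) : Prop where
  no_ctx : ∀ X : PreCtx A, Judg.ctx X ∉ Ax
  wf_ctx : ∀ J ∈ Ax, IsPreCtx J.ctxOf
  sort_intro : ∀ S : A.SortSym, ∃! X : PreCtx A, introSort X S ∈ Ax
  sort_shape : ∀ (X : PreCtx A) (U : SortE A), Judg.sort X U ∈ Ax → U.args = ctxVars X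
  term_intro : ∀ t : A.TermSym, ∃! p : PreCtx A × SortE A, introTerm p.1 t p.2 ∈ Ax
  term_shape : ∀ (X : PreCtx A) (u : Expr A) (U : SortE A), Judg.term X u U ∈ Ax →
      ∃ t : A.TermSym, u = Expr.app t (ctxVars X)

/-- One inference step of the paper's system: `Step Ax D J` holds when `J` is the
conclusion of an instance of one of the sixteen rules all of whose premises
satisfy `D`. -/
inductive Step (Ax : Set (Judg A)) (D : Judg A → Prop) : Judg A → Prop where
  | ctx_nil : Step Ax D (.ctx [])
  | ctx_cons {X : PreCtx A} {U : SortE A} {x : A.Var}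
      (hs : D (.sort X U)) (hfresh : ∀ p ∈ X, p.1 ≠ x)
      (hpre : IsPreCtx (X ++ [(x, U)])) :
      Step Ax D (.ctx (X ++ [(x, U)]))
  | s1 {X : PreCtx A} {U : SortE A} (h : D (.sort X U)) : Step Ax D (.sortEq X U U)
  | s2 {X : PreCtx A} {U V : SortE A} (h : D (.sortEq X U V)) : Step Ax D (.sortEq X V U)
  | s3 {X : PreCtx A} {U V W : SortE A}
      (h1 : D (.sortEq X U V)) (h2 : D (.sortEq X V W)) : Step Ax D (.sortEq X U W)
  | t1 {X : PreCtx A} {u : Expr A} {U : SortE A}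
      (h : D (.term X u U)) : Step Ax D (.termEq X u u U)
  | t2 {X : PreCtx A} {u v : Expr A} {U : SortE A}
      (h : D (.termEq X u v U)) : Step Ax D (.termEq X v u U)
  | t3 {X : PreCtx A} {u v w : Expr A} {U : SortE A}
      (h1 : D (.termEq X u v U)) (h2 : D (.termEq X v w U)) : Step Ax D (.termEq X u w U)
  | seqt {X : PreCtx A} {U U' : SortE A} {u : Expr A}
      (h1 : D (.sortEq X U U')) (h2 : D (.term X u U)) : Step Ax D (.term X u U')
  | seqteq {X : PreCtx A} {U U' : SortE A} {u u' : Expr A}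
      (h1 : D (.sortEq X U U')) (h2 : D (.termEq X u u' U))
      (h3 : D (.term X u U')) (h4 : D (.term X u' U')) : Step Ax D (.termEq X u u' U')
  | var {X : PreCtx A} {i : ℕ} (hi : i < X.length)
      (h : D (.sort X (X[i]'hi).2)) :
      Step Ax D (.term X (.var (X[i]'hi).1) (X[i]'hi).2)
  | sA {X : PreCtx A} {U : SortE A} (hax : Judg.sort X U ∈ Ax) (h : D (.ctx X))
      (hv : ∀ i (hi : i < X.length), D (.term X (.var (X[i]'hi).1) (X[i]'hi).2)) :
      Step Ax D (.sort X U)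
  | tA {X : PreCtx A} {u : Expr A} {U : SortE A} (hax : Judg.term X u U ∈ Ax)
      (h : D (.sort X U))
      (hv : ∀ i (hi : i < X.length), D (.term X (.var (X[i]'hi).1) (X[i]'hi).2)) :
      Step Ax D (.term X u U)
  | seqA {X : PreCtx A} {U U' : SortE A} (hax : Judg.sortEq X U U' ∈ Ax)
      (h1 : D (.sort X U)) (h2 : D (.sort X U')) : Step Ax D (.sortEq X U U')
  | teqA {X : PreCtx A} {u u' : Expr A} {U : SortE A} (hax : Judg.termEq X u u' U ∈ Ax)
      (h1 : D (.term X u U)) (h2 : D (.term X u' U)) : Step Ax D (.termEq X u u' U)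
  | sSub {X : PreCtx A} {S : A.SortSym} (hax : introSort X S ∈ Ax)
      {Y : PreCtx A} (hY : IsPreCtx Y) {f : List (Expr A)} (hlen : f.length = X.length)
      (hJ : D (introSort X S)) (hYc : D (.ctx Y))
      (hargs : ∀ i (hi : i < X.length) (hif : i < f.length),
        D (.term Y (f[i]'hif) (subPre X f i hi))) :
      Step Ax D (.sort Y ⟨S, f⟩)
  | tSub {X : PreCtx A} {t : A.TermSym} {U : SortE A} (hax : introTerm X t U ∈ Ax)
      {Y : PreCtx A} (hY : IsPreCtx Y) {f : List (Expr A)} (hlen : f.length = X.length)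
      (hJ : D (introTerm X t U))
      (hU : D (.sort Y (U.substL (mkSub X f))))
      (hargs : ∀ i (hi : i < X.length) (hif : i < f.length),
        D (.term Y (f[i]'hif) (subPre X f i hi))) :
      Step Ax D (.term Y (.app t f) (U.substL (mkSub X f)))
  | seqSub1 {X : PreCtx A} {U U' : SortE A} (hax : Judg.sortEq X U U' ∈ Ax)
      {Y : PreCtx A} (hY : IsPreCtx Y) {f : List (Expr A)} (hlen : f.length = X.length)
      (hJ : D (.sortEq X U U'))
      (h1 : D (.sort Y (U.substL (mkSub X f)))) (h2 : D (.sort Y (U'.substL (mkSub X f))))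
      (hargs : ∀ i (hi : i < X.length) (hif : i < f.length),
        D (.term Y (f[i]'hif) (subPre X f i hi))) :
      Step Ax D (.sortEq Y (U.substL (mkSub X f)) (U'.substL (mkSub X f)))
  | seqSub2 {X : PreCtx A} {S : A.SortSym} (hax : introSort X S ∈ Ax)
      {Y : PreCtx A} (hY : IsPreCtx Y) {f g : List (Expr A)}
      (hlf : f.length = X.length) (hlg : g.length = X.length)
      (hJ : D (introSort X S))
      (h1 : D (.sort Y ⟨S, f⟩)) (h2 : D (.sort Y ⟨S, g⟩))
      (hargs : ∀ i (hi : i < X.length) (hif : i < f.length) (hig : i < g.length),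
        D (.termEq Y (f[i]'hif) (g[i]'hig) (subPre X f i hi))) :
      Step Ax D (.sortEq Y ⟨S, f⟩ ⟨S, g⟩)
  | teqSub1 {X : PreCtx A} {u u' : Expr A} {U : SortE A}
      (hax : Judg.termEq X u u' U ∈ Ax)
      {Y : PreCtx A} (hY : IsPreCtx Y) {f : List (Expr A)} (hlen : f.length = X.length)
      (hJ : D (.termEq X u u' U))
      (h1 : D (.term Y (u.substL (mkSub X f)) (U.substL (mkSub X f))))
      (h2 : D (.term Y (u'.substL (mkSub X f)) (U.substL (mkSub X f))))
      (hargs : ∀ i (hi : i < X.length) (hif : i < f.length),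
        D (.term Y (f[i]'hif) (subPre X f i hi))) :
      Step Ax D (.termEq Y (u.substL (mkSub X f)) (u'.substL (mkSub X f))
        (U.substL (mkSub X f)))
  | teqSub2 {X : PreCtx A} {t : A.TermSym} {U : SortE A} (hax : introTerm X t U ∈ Ax)
      {Y : PreCtx A} (hY : IsPreCtx Y) {f g : List (Expr A)}
      (hlf : f.length = X.length) (hlg : g.length = X.length)
      (hJ : D (introTerm X t U))
      (h1 : D (.term Y (.app t f) (U.substL (mkSub X f))))
      (h2 : D (.term Y (.app t g) (U.substL (mkSub X f))))
      (hargs : ∀ i (hi : i < X.length) (hif : i < f.length) (hig : i < g.length),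
        D (.termEq Y (f[i]'hif) (g[i]'hig) (subPre X f i hi))) :
      Step Ax D (.termEq Y (.app t f) (.app t g) (U.substL (mkSub X f)))

/-- `DerAt Ax n J`: `J` is the conclusion of an inference step in the `n`-th stage
`𝒟ₙ` of the recursive construction of the derivable judgments. -/
def DerAt (Ax : Set (Judg A)) : ℕ → Judg A → Prop
  | 0, _ => False
  | n + 1, J => DerAt Ax n J ∨ Step Ax (DerAt Ax n) J

/-- A judgment is derivable if it is the conclusion of a step of some stage. -/
def Derivable (Ax : Set (Judg A)) (J : Judg A) : Prop := ∃ n, DerAt Ax n J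

/-- The height of a (derivable) judgment: the least stage at which it appears. -/
noncomputable def ht (Ax : Set (Judg A)) (J : Judg A) : ℕ := sInf {n | DerAt Ax n J}

/-- The height of a context: `0` for the empty context, and the height of
`∂X ⊢ Xₙ sort` otherwise. -/
noncomputable def htCtx (Ax : Set (Judg A)) (X : PreCtx A) : ℕ :=
  match X with
  | [] => 0
  | p :: X' =>
      ht Ax (.sort ((p :: X').dropLast) (((p :: X').getLast (List.cons_ne_nil p X')).2))

/-- A generalized algebraic theory: a pretheory all of whose axioms are derivable. -/
def IsGAT (Ax : Set (Judg A)) : Prop := IsPretheory Ax ∧ ∀ J ∈ Ax, Derivable Ax J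

/-- The partial term judgment `X ⊢ u term` is derivable. -/
def DerTerm (Ax : Set (Judg A)) (X : PreCtx A) (u : Expr A) : Prop :=
  ∃ U, Derivable Ax (.term X u U)

/-- The partial term equality judgment `X ⊢ u ≡ v term` is derivable. -/
def DerTermEq (Ax : Set (Judg A)) (X : PreCtx A) (u v : Expr A) : Prop :=
  ∃ U, Derivable Ax (.termEq X u v U)

/-- Height of a derivable partial term judgment: the minimum of the heights of
`X ⊢ u : U` over all `U`. -/
noncomputable def htTerm (Ax : Set (Judg A)) (X : PreCtx A) (u : Expr A) : ℕ :=
  sInf {n | ∃ U, DerAt Ax n (.term X u U)}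

/-- `f` is a context morphism from `X` to `Y`. -/
def IsMor (Ax : Set (Judg A)) (X Y : PreCtx A) (f : List (Expr A)) : Prop :=
  Derivable Ax (.ctx X) ∧ Derivable Ax (.ctx Y) ∧ f.length = Y.length ∧
  ∀ i (hi : i < Y.length) (hif : i < f.length),
    Derivable Ax (.term X (f[i]'hif) (subPre Y f i hi))

/-- The morphism equality `f ≡ g : X → Y` is derivable. -/
def MorEq (Ax : Set (Judg A)) (X Y : PreCtx A) (f g : List (Expr A)) : Prop :=
  IsMor Ax X Y f ∧ IsMor Ax X Y g ∧
  ∀ i (hi : i < Y.length) (hif : i < f.length) (hig : i < g.length),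
    Derivable Ax (.termEq X (f[i]'hif) (g[i]'hig) (subPre Y f i hi))

/-- The context equality `X ≡ Y ctx` is derivable. -/
def CtxEq (Ax : Set (Judg A)) (X Y : PreCtx A) : Prop :=
  X.length = Y.length ∧ Derivable Ax (.ctx X) ∧ Derivable Ax (.ctx Y) ∧
  ∀ i (hX : i < X.length) (hY : i < Y.length),
    Derivable Ax (.sortEq (X.take i) (X[i]'hX).2
      (((Y[i]'hY).2).substL (mkSub (Y.take i) (ctxVars (X.take i)))))

/-- Height of a context morphism. -/
noncomputable def htMor (Ax : Set (Judg A)) (X Y : PreCtx A) (f : List (Expr A)) : ℕ :=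
  max (htCtx Ax X) (max (htCtx Ax Y)
    ((Finset.range Y.length).sup fun i =>
      if h : i < Y.length ∧ i < f.length then
        ht Ax (.term X (f[i]'h.2) (subPre Y f i h.1))
      else 0))

/-- Height of a morphism equality. -/
noncomputable def htMorEq (Ax : Set (Judg A)) (X Y : PreCtx A) (f g : List (Expr A)) : ℕ :=
  max (htMor Ax X Y f) (max (htMor Ax X Y g)
    ((Finset.range Y.length).sup fun i =>
      if h : i < Y.length ∧ i < f.length ∧ i < g.length then
        ht Ax (.termEq X (f[i]'h.2.1) (g[i]'h.2.2) (subPre Y f i h.1))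
      else 0))

/-- The composite `g ∘ f` of tuples of term expressions, where `f : X → Y` and
`g : Y → Z`: the `i`-th entry is `gᵢ[f]`. -/
noncomputable def compMor (Y : PreCtx A) (f g : List (Expr A)) : List (Expr A) :=
  g.map fun e => e.substL (mkSub Y f)

/-- The canonical sort `𝒮(u)` of a term in a context (as a relation). -/
inductive CanonSort (Ax : Set (Judg A)) (X : PreCtx A) : Expr A → SortE A → Prop where
  | var {i : ℕ} (hi : i < X.length) : CanonSort Ax X (.var (X[i]'hi).1) (X[i]'hi).2
  | app {t : A.TermSym} {f : List (Expr A)} {Xa : PreCtx A} {V : SortE A}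
      (hax : introTerm Xa t V ∈ Ax) :
      CanonSort Ax X (.app t f) (V.substL (mkSub Xa f))


/-! ## The tensor product of generalized algebraic theories (§2 of the paper) -/

/-- The tensor product of two sort-and-term alphabets. -/
abbrev Alphabet.tensor (A B : Alphabet) : Alphabet :=
  { Var := A.Var × B.Var
    SortSym := A.SortSym × B.SortSym
    TermSym := (A.SortSym × B.TermSym) ⊕ (A.TermSym × B.SortSym)
    var_infinite := inferInstance
    var_countable := inferInstance }

/-- An input for the tensor term operations `⊗_t`, `●_t`: a derivable term judgment
`X ⊢ u : U` (notation `u^U`), or an augmented derivable sort judgment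
`(X ⊢ U sort, x)` (notation `x^U`), represented with `tm = var x`. -/
structure TArg (A : Alphabet) : Type where
  ctx : PreCtx A
  tm : Expr A
  srt : SortE A

/-- `L` is the lexicographically ordered `m × n` grid whose `(i,j)` entry is `M i j`. -/
def IsGrid {γ : Type} (m n : ℕ) (M : ℕ → ℕ → γ) (L : List γ) : Prop :=
  L.length = m * n ∧
  ∀ i j (hi : i < m) (hj : j < n) (h : i * n + j < L.length), L[i * n + j]'h = M i j

/-- Substitution pairs `[g 1 | x y₁, …, g n | x yₙ]` where the `yⱼ` are the
variables of `Y`. -/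
def pairsR (x : A.Var) (Y : PreCtx B) (g : ℕ → Expr (A.tensor B)) :
    List ((A.tensor B).Var × Expr (A.tensor B)) :=
  (List.finRange Y.length).map fun j => ((x, (Y.get j).1), g j.1)

/-- Substitution pairs `[g 1 | x₁ y, …, g m | x_m y]` where the `xᵢ` are the
variables of `X`. -/
def pairsL (X : PreCtx A) (y : B.Var) (g : ℕ → Expr (A.tensor B)) :
    List ((A.tensor B).Var × Expr (A.tensor B)) :=
  (List.finRange X.length).map fun i => (((X.get i).1, y), g i.1)

variable {A B : Alphabet}

/-- The graph of the tensor term operation on pairs of (augmented sort / term)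
judgments: `TTg TA TB false a b e` means `e = a ⊗_t b` and
`TTg TA TB true a b e` means `e = a ⊗*_t b` (the variant of §8 in which the two
defining substitution formulas for non-variable terms are interchanged). -/
inductive TTg (TA : Set (Judg A)) (TB : Set (Judg B)) :
    Bool → TArg A → TArg B → Expr (A.tensor B) → Prop where
  | varvar {b : Bool} {X : PreCtx A} {U : SortE A} {x : A.Var}
      {Y : PreCtx B} {V : SortE B} {y : B.Var} :
      TTg TA TB b ⟨X, .var x, U⟩ ⟨Y, .var y, V⟩ (.var (x, y))
  | varapp {b : Bool} {X : PreCtx A} {x : A.Var} {S : A.SortSym} {ss : List (Expr A)}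
      {Y : PreCtx B} {t : B.TermSym} {ts : List (Expr B)} {V : SortE B}
      (SS : ℕ → SortE A) (TSf : ℕ → SortE B)
      (hSS : ∀ i (hi : i < ss.length), CanonSort TA X (ss[i]'hi) (SS i))
      (hTS : ∀ j (hj : j < ts.length), CanonSort TB Y (ts[j]'hj) (TSf j))
      (M : ℕ → ℕ → Expr (A.tensor B)) (out : List (Expr (A.tensor B)))
      (hM : ∀ i (hi : i < ss.length), ∀ j (hj : j < ts.length),
          TTg TA TB b ⟨X, ss[i]'hi, SS i⟩ ⟨Y, ts[j]'hj, TSf j⟩ (M i j))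
      (hMx : ∀ j (hj : j < ts.length),
          TTg TA TB b ⟨X, .var x, ⟨S, ss⟩⟩ ⟨Y, ts[j]'hj, TSf j⟩ (M ss.length j))
      (hout : IsGrid (ss.length + 1) ts.length M out) :
      TTg TA TB b ⟨X, .var x, ⟨S, ss⟩⟩ ⟨Y, .app t ts, V⟩ (.app (Sum.inl (S, t)) out)
  | appvar {b : Bool} {X : PreCtx A} {s : A.TermSym} {ss : List (Expr A)} {U : SortE A}
      {Y : PreCtx B} {y : B.Var} {T : B.SortSym} {ts : List (Expr B)}
      (SS : ℕ → SortE A) (TSf : ℕ → SortE B)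
      (hSS : ∀ i (hi : i < ss.length), CanonSort TA X (ss[i]'hi) (SS i))
      (hTS : ∀ j (hj : j < ts.length), CanonSort TB Y (ts[j]'hj) (TSf j))
      (M : ℕ → ℕ → Expr (A.tensor B)) (out : List (Expr (A.tensor B)))
      (hM : ∀ i (hi : i < ss.length), ∀ j (hj : j < ts.length),
          TTg TA TB b ⟨X, ss[i]'hi, SS i⟩ ⟨Y, ts[j]'hj, TSf j⟩ (M i j))
      (hMy : ∀ i (hi : i < ss.length),
          TTg TA TB b ⟨X, ss[i]'hi, SS i⟩ ⟨Y, .var y, ⟨T, ts⟩⟩ (M i ts.length))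
      (hout : IsGrid ss.length (ts.length + 1) M out) :
      TTg TA TB b ⟨X, .app s ss, U⟩ ⟨Y, .var y, ⟨T, ts⟩⟩ (.app (Sum.inr (s, T)) out)
  | appapp_base {X : PreCtx A} {s : A.TermSym} {ss : List (Expr A)} {U : SortE A}
      {Y : PreCtx B} {t : B.TermSym} {ts : List (Expr B)} {V : SortE B} {x : A.Var}
      (hx : ∀ p ∈ X, p.1 ≠ x)
      (e0 : Expr (A.tensor B))
      (h0 : TTg TA TB false ⟨X, .var x, U⟩ ⟨Y, .app t ts, V⟩ e0)
      (g : ℕ → Expr (A.tensor B))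
      (hg : ∀ j (hj : j < Y.length),
          TTg TA TB false ⟨X, .app s ss, U⟩
            ⟨Y.take j, .var (Y[j]'hj).1, (Y[j]'hj).2⟩ (g j)) :
      TTg TA TB false ⟨X, .app s ss, U⟩ ⟨Y, .app t ts, V⟩ (e0.substL (pairsR x Y g))
  | appapp_star {X : PreCtx A} {s : A.TermSym} {ss : List (Expr A)} {U : SortE A}
      {Y : PreCtx B} {t : B.TermSym} {ts : List (Expr B)} {V : SortE B} {y : B.Var}
      (hy : ∀ p ∈ Y, p.1 ≠ y)
      (e0 : Expr (A.tensor B))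
      (h0 : TTg TA TB true ⟨X, .app s ss, U⟩ ⟨Y, .var y, V⟩ e0)
      (g : ℕ → Expr (A.tensor B))
      (hg : ∀ i (hi : i < X.length),
          TTg TA TB true ⟨X.take i, .var (X[i]'hi).1, (X[i]'hi).2⟩
            ⟨Y, .app t ts, V⟩ (g i)) :
      TTg TA TB true ⟨X, .app s ss, U⟩ ⟨Y, .app t ts, V⟩ (e0.substL (pairsL X y g))

/-- The graph of the operation `●_t` (flag `false`), resp. of `●*_t` (flag `true`). -/
inductive TTd (TA : Set (Judg A)) (TB : Set (Judg B)) :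
    Bool → TArg A → TArg B → Expr (A.tensor B) → Prop where
  | varL {b : Bool} {X : PreCtx A} {x : A.Var} {U : SortE A} {bArg : TArg B}
      {e : Expr (A.tensor B)}
      (h : TTg TA TB b ⟨X, .var x, U⟩ bArg e) : TTd TA TB b ⟨X, .var x, U⟩ bArg e
  | varR {b : Bool} {aArg : TArg A} {Y : PreCtx B} {y : B.Var} {V : SortE B}
      {e : Expr (A.tensor B)}
      (h : TTg TA TB b aArg ⟨Y, .var y, V⟩ e) : TTd TA TB b aArg ⟨Y, .var y, V⟩ e
  | appapp_base {X : PreCtx A} {s : A.TermSym} {ss : List (Expr A)} {U : SortE A}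
      {Y : PreCtx B} {t : B.TermSym} {ts : List (Expr B)} {V : SortE B} {y : B.Var}
      (hy : ∀ p ∈ Y, p.1 ≠ y)
      (e0 : Expr (A.tensor B))
      (h0 : TTg TA TB false ⟨X, .app s ss, U⟩ ⟨Y, .var y, V⟩ e0)
      (g : ℕ → Expr (A.tensor B))
      (hg : ∀ i (hi : i < X.length),
          TTg TA TB false ⟨X.take i, .var (X[i]'hi).1, (X[i]'hi).2⟩
            ⟨Y, .app t ts, V⟩ (g i)) :
      TTd TA TB false ⟨X, .app s ss, U⟩ ⟨Y, .app t ts, V⟩ (e0.substL (pairsL X y g))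
  | appapp_star {X : PreCtx A} {s : A.TermSym} {ss : List (Expr A)} {U : SortE A}
      {Y : PreCtx B} {t : B.TermSym} {ts : List (Expr B)} {V : SortE B} {x : A.Var}
      (hx : ∀ p ∈ X, p.1 ≠ x)
      (e0 : Expr (A.tensor B))
      (h0 : TTg TA TB true ⟨X, .var x, U⟩ ⟨Y, .app t ts, V⟩ e0)
      (g : ℕ → Expr (A.tensor B))
      (hg : ∀ j (hj : j < Y.length),
          TTg TA TB true ⟨X, .app s ss, U⟩
            ⟨Y.take j, .var (Y[j]'hj).1, (Y[j]'hj).2⟩ (g j)) :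
      TTd TA TB true ⟨X, .app s ss, U⟩ ⟨Y, .app t ts, V⟩ (e0.substL (pairsR x Y g))

/-- The graph of the tensor sort operation `⊗_s` (resp. `⊗*_s` for flag `true`):
`TSo TA TB b X x U Y y V W` means `W = U^x ⊗ V^y`. -/
inductive TSo (TA : Set (Judg A)) (TB : Set (Judg B)) :
    Bool → PreCtx A → A.Var → SortE A → PreCtx B → B.Var → SortE B →
    SortE (A.tensor B) → Prop where
  | mk {b : Bool} {X : PreCtx A} {x : A.Var} {S : A.SortSym} {ss : List (Expr A)}
      {Y : PreCtx B} {y : B.Var} {T : B.SortSym} {ts : List (Expr B)}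
      (hx : ∀ p ∈ X, p.1 ≠ x) (hy : ∀ p ∈ Y, p.1 ≠ y)
      (SS : ℕ → SortE A) (TSf : ℕ → SortE B)
      (hSS : ∀ i (hi : i < ss.length), CanonSort TA X (ss[i]'hi) (SS i))
      (hTS : ∀ j (hj : j < ts.length), CanonSort TB Y (ts[j]'hj) (TSf j))
      (M : ℕ → ℕ → Expr (A.tensor B)) (out : List (Expr (A.tensor B)))
      (hM : ∀ i (hi : i < ss.length), ∀ j (hj : j < ts.length),
          TTg TA TB b ⟨X, ss[i]'hi, SS i⟩ ⟨Y, ts[j]'hj, TSf j⟩ (M i j))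
      (hMx : ∀ j (hj : j < ts.length),
          TTg TA TB b ⟨X, .var x, ⟨S, ss⟩⟩ ⟨Y, ts[j]'hj, TSf j⟩ (M ss.length j))
      (hMy : ∀ i (hi : i < ss.length),
          TTg TA TB b ⟨X, ss[i]'hi, SS i⟩ ⟨Y, .var y, ⟨T, ts⟩⟩ (M i ts.length))
      (hout : IsGrid (ss.length + 1) (ts.length + 1) M out) :
      TSo TA TB b X x ⟨S, ss⟩ Y y ⟨T, ts⟩ ⟨(S, T), out.dropLast⟩

/-- The tensor precontext `Z = X ⊗ Y`, with entries `xᵢyⱼ : Xᵢ ⊗ Yⱼ` ordered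
lexicographically. -/
def TCtx (TA : Set (Judg A)) (TB : Set (Judg B)) (b : Bool)
    (X : PreCtx A) (Y : PreCtx B) (Z : PreCtx (A.tensor B)) : Prop :=
  Z.length = X.length * Y.length ∧
  ∀ i j (hi : i < X.length) (hj : j < Y.length) (h : i * Y.length + j < Z.length),
    (Z[i * Y.length + j]'h).1 = ((X[i]'hi).1, (Y[j]'hj).1) ∧
    TSo TA TB b (X.take i) (X[i]'hi).1 (X[i]'hi).2
      (Y.take j) (Y[j]'hj).1 (Y[j]'hj).2 (Z[i * Y.length + j]'h).2

/-- The graph of the tensor operation `⊙` on pairs of judgments of the admissible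
kinds of Table 1 (flag `false`), resp. of the interchanged operation `⊙*` of §8
(flag `true`).  `chA` and `chB` are the functions choosing, for each context, a
variable not occurring in it. -/
inductive TJudg (TA : Set (Judg A)) (TB : Set (Judg B))
    (chA : PreCtx A → A.Var) (chB : PreCtx B → B.Var) :
    Bool → Judg A → Judg B → Judg (A.tensor B) → Prop where
  /- sort ⊙ sort -/
  | ss {b : Bool} {X : PreCtx A} {U : SortE A} {Y : PreCtx B} {V : SortE B}
      {Z : PreCtx (A.tensor B)} {W : SortE (A.tensor B)}
      (hZ : TCtx TA TB b (X ++ [(chA X, U)]) (Y ++ [(chB Y, V)]) Z)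
      (hW : TSo TA TB b X (chA X) U Y (chB Y) V W) :
      TJudg TA TB chA chB b (.sort X U) (.sort Y V) (.sort Z.dropLast W)
  /- sort ⊙ term -/
  | st {b : Bool} {X : PreCtx A} {U : SortE A} {Y : PreCtx B} {v : Expr B} {V : SortE B}
      {Z : PreCtx (A.tensor B)} {e : Expr (A.tensor B)} {W : SortE (A.tensor B)}
      {g : ℕ → Expr (A.tensor B)}
      (hZ : TCtx TA TB b (X ++ [(chA X, U)]) Y Z)
      (he : TTg TA TB b ⟨X, .var (chA X), U⟩ ⟨Y, v, V⟩ e)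
      (hW : TSo TA TB b X (chA X) U Y (chB Y) V W)
      (hg : ∀ i (hi : i < X.length),
          TTg TA TB b ⟨X.take i, .var (X[i]'hi).1, (X[i]'hi).2⟩ ⟨Y, v, V⟩ (g i)) :
      TJudg TA TB chA chB b (.sort X U) (.term Y v V)
        (.term Z e (W.substL (pairsL X (chB Y) g)))
  /- term ⊙ sort -/
  | ts {b : Bool} {X : PreCtx A} {u : Expr A} {U : SortE A} {Y : PreCtx B} {V : SortE B}
      {Z : PreCtx (A.tensor B)} {e : Expr (A.tensor B)} {W : SortE (A.tensor B)}
      {g : ℕ → Expr (A.tensor B)}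
      (hZ : TCtx TA TB b X (Y ++ [(chB Y, V)]) Z)
      (he : TTg TA TB b ⟨X, u, U⟩ ⟨Y, .var (chB Y), V⟩ e)
      (hW : TSo TA TB b X (chA X) U Y (chB Y) V W)
      (hg : ∀ j (hj : j < Y.length),
          TTg TA TB b ⟨X, u, U⟩ ⟨Y.take j, .var (Y[j]'hj).1, (Y[j]'hj).2⟩ (g j)) :
      TJudg TA TB chA chB b (.term X u U) (.sort Y V)
        (.term Z e (W.substL (pairsR (chA X) Y g)))
  /- term ⊙ term -/
  | tt {b : Bool} {X : PreCtx A} {u : Expr A} {U : SortE A}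
      {Y : PreCtx B} {v : Expr B} {V : SortE B}
      {Z : PreCtx (A.tensor B)} {e1 e2 : Expr (A.tensor B)} {W : SortE (A.tensor B)}
      {gx gy : ℕ → Expr (A.tensor B)}
      (hZ : TCtx TA TB b X Y Z)
      (he1 : TTg TA TB b ⟨X, u, U⟩ ⟨Y, v, V⟩ e1)
      (he2 : TTd TA TB b ⟨X, u, U⟩ ⟨Y, v, V⟩ e2)
      (hW : TSo TA TB b X (chA X) U Y (chB Y) V W)
      (hgx : ∀ i (hi : i < X.length),
          TTg TA TB b ⟨X.take i, .var (X[i]'hi).1, (X[i]'hi).2⟩ ⟨Y, v, V⟩ (gx i))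
      (hgy : ∀ j (hj : j < Y.length),
          TTg TA TB b ⟨X, u, U⟩ ⟨Y.take j, .var (Y[j]'hj).1, (Y[j]'hj).2⟩ (gy j)) :
      TJudg TA TB chA chB b (.term X u U) (.term Y v V)
        (.termEq Z e1 e2 (W.substL (pairsL X (chB Y) gx ++ pairsR (chA X) Y gy)))
  /- sort ⊙ sort equality -/
  | sseq {b : Bool} {X : PreCtx A} {U : SortE A} {Y : PreCtx B} {V V' : SortE B}
      {Z : PreCtx (A.tensor B)} {W W' : SortE (A.tensor B)}
      (hZ : TCtx TA TB b (X ++ [(chA X, U)]) (Y ++ [(chB Y, V)]) Z)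
      (hW : TSo TA TB b X (chA X) U Y (chB Y) V W)
      (hW' : TSo TA TB b X (chA X) U Y (chB Y) V' W') :
      TJudg TA TB chA chB b (.sort X U) (.sortEq Y V V') (.sortEq Z.dropLast W W')
  /- sort equality ⊙ sort -/
  | seqs {b : Bool} {X : PreCtx A} {U U' : SortE A} {Y : PreCtx B} {V : SortE B}
      {Z : PreCtx (A.tensor B)} {W W' : SortE (A.tensor B)}
      (hZ : TCtx TA TB b (X ++ [(chA X, U)]) (Y ++ [(chB Y, V)]) Z)
      (hW : TSo TA TB b X (chA X) U Y (chB Y) V W)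
      (hW' : TSo TA TB b X (chA X) U' Y (chB Y) V W') :
      TJudg TA TB chA chB b (.sortEq X U U') (.sort Y V) (.sortEq Z.dropLast W W')
  /- sort ⊙ term equality -/
  | steq {b : Bool} {X : PreCtx A} {U : SortE A} {Y : PreCtx B} {v v' : Expr B}
      {V : SortE B} {Z : PreCtx (A.tensor B)} {e e' : Expr (A.tensor B)}
      {W : SortE (A.tensor B)} {g : ℕ → Expr (A.tensor B)}
      (hZ : TCtx TA TB b (X ++ [(chA X, U)]) Y Z)
      (he : TTg TA TB b ⟨X, .var (chA X), U⟩ ⟨Y, v, V⟩ e)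
      (he' : TTg TA TB b ⟨X, .var (chA X), U⟩ ⟨Y, v', V⟩ e')
      (hW : TSo TA TB b X (chA X) U Y (chB Y) V W)
      (hg : ∀ i (hi : i < X.length),
          TTg TA TB b ⟨X.take i, .var (X[i]'hi).1, (X[i]'hi).2⟩ ⟨Y, v, V⟩ (g i)) :
      TJudg TA TB chA chB b (.sort X U) (.termEq Y v v' V)
        (.termEq Z e e' (W.substL (pairsL X (chB Y) g)))
  /- term equality ⊙ sort -/
  | teqs {b : Bool} {X : PreCtx A} {u u' : Expr A} {U : SortE A} {Y : PreCtx B}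
      {V : SortE B} {Z : PreCtx (A.tensor B)} {e e' : Expr (A.tensor B)}
      {W : SortE (A.tensor B)} {g : ℕ → Expr (A.tensor B)}
      (hZ : TCtx TA TB b X (Y ++ [(chB Y, V)]) Z)
      (he : TTg TA TB b ⟨X, u, U⟩ ⟨Y, .var (chB Y), V⟩ e)
      (he' : TTg TA TB b ⟨X, u', U⟩ ⟨Y, .var (chB Y), V⟩ e')
      (hW : TSo TA TB b X (chA X) U Y (chB Y) V W)
      (hg : ∀ j (hj : j < Y.length),
          TTg TA TB b ⟨X, u, U⟩ ⟨Y.take j, .var (Y[j]'hj).1, (Y[j]'hj).2⟩ (g j)) :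
      TJudg TA TB chA chB b (.termEq X u u' U) (.sort Y V)
        (.termEq Z e e' (W.substL (pairsR (chA X) Y g)))
  /- sort equality ⊙ term -/
  | seqt {b : Bool} {X : PreCtx A} {U U' : SortE A} {Y : PreCtx B} {v : Expr B}
      {V : SortE B} {Z : PreCtx (A.tensor B)} {e e' : Expr (A.tensor B)}
      {W : SortE (A.tensor B)} {g : ℕ → Expr (A.tensor B)}
      (hZ : TCtx TA TB b (X ++ [(chA X, U)]) Y Z)
      (he : TTg TA TB b ⟨X, .var (chA X), U⟩ ⟨Y, v, V⟩ e)
      (he' : TTg TA TB b ⟨X, .var (chA X), U'⟩ ⟨Y, v, V⟩ e')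
      (hW : TSo TA TB b X (chA X) U Y (chB Y) V W)
      (hg : ∀ i (hi : i < X.length),
          TTg TA TB b ⟨X.take i, .var (X[i]'hi).1, (X[i]'hi).2⟩ ⟨Y, v, V⟩ (g i)) :
      TJudg TA TB chA chB b (.sortEq X U U') (.term Y v V)
        (.termEq Z e e' (W.substL (pairsL X (chB Y) g)))
  /- term ⊙ sort equality -/
  | tseq {b : Bool} {X : PreCtx A} {u : Expr A} {U : SortE A} {Y : PreCtx B}
      {V V' : SortE B} {Z : PreCtx (A.tensor B)} {e e' : Expr (A.tensor B)}
      {W : SortE (A.tensor B)} {g : ℕ → Expr (A.tensor B)}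
      (hZ : TCtx TA TB b X (Y ++ [(chB Y, V)]) Z)
      (he : TTg TA TB b ⟨X, u, U⟩ ⟨Y, .var (chB Y), V⟩ e)
      (he' : TTg TA TB b ⟨X, u, U⟩ ⟨Y, .var (chB Y), V'⟩ e')
      (hW : TSo TA TB b X (chA X) U Y (chB Y) V W)
      (hg : ∀ j (hj : j < Y.length),
          TTg TA TB b ⟨X, u, U⟩ ⟨Y.take j, .var (Y[j]'hj).1, (Y[j]'hj).2⟩ (g j)) :
      TJudg TA TB chA chB b (.term X u U) (.sortEq Y V V')
        (.termEq Z e e' (W.substL (pairsR (chA X) Y g)))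

/-- A choice, for every precontext, of a variable not contained in it. -/
def FreshCh {A : Alphabet} (ch : PreCtx A → A.Var) : Prop :=
  ∀ X : PreCtx A, ∀ p ∈ X, p.1 ≠ ch X

/-- The set of axioms of the pretheory `𝔸 ⊗ 𝔹`: the judgments `J ⊙ J'` for `J` an
axiom of `𝔸` and `J'` an axiom of `𝔹`. -/
def tensorAx (TA : Set (Judg A)) (TB : Set (Judg B))
    (chA : PreCtx A → A.Var) (chB : PreCtx B → B.Var) : Set (Judg (A.tensor B)) :=
  {K | ∃ J J', J ∈ TA ∧ J' ∈ TB ∧ TJudg TA TB chA chB false J J' K}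

/-- The pair `(𝔸, 𝔹)` is `h`-derivable: `J ⊙ J'` is derivable in the pretheory
`𝔸 ⊗ 𝔹` whenever `J`, `J'` are derivable judgments of `𝔸`, `𝔹` (of admissible
kinds) with `ht J * ht J' ≤ h`. -/
def hDerivable (TA : Set (Judg A)) (TB : Set (Judg B))
    (chA : PreCtx A → A.Var) (chB : PreCtx B → B.Var) (h : ℕ) : Prop :=
  ∀ (J : Judg A) (J' : Judg B) (K : Judg (A.tensor B)),
    Derivable TA J → Derivable TB J' → ht TA J * ht TB J' ≤ h →
    TJudg TA TB chA chB false J J' K → Derivable (tensorAx TA TB chA chB) K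

/-- The tensor `out = f ⊗ g` of two tuples of derivable terms, each entry being
the tensor of terms taken at their canonical sorts, ordered lexicographically. -/
def TMor (TA : Set (Judg A)) (TB : Set (Judg B)) (b : Bool)
    (X : PreCtx A) (f : List (Expr A)) (Y : PreCtx B) (g : List (Expr B))
    (out : List (Expr (A.tensor B))) : Prop :=
  out.length = f.length * g.length ∧
  ∀ i j (hi : i < f.length) (hj : j < g.length) (h : i * g.length + j < out.length),
    ∃ U V, CanonSort TA X (f[i]'hi) U ∧ CanonSort TB Y (g[j]'hj) V ∧
      TTg TA TB b ⟨X, f[i]'hi, U⟩ ⟨Y, g[j]'hj, V⟩ (out[i * g.length + j]'h)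

/-- The tensor `out = f ⊗ Y` of a tuple of derivable terms of `𝔸` with a context
of `𝔹`: entries `fᵢ^{𝒮(fᵢ)} ⊗ yⱼ^{Yⱼ}`. -/
def TMorCtx (TA : Set (Judg A)) (TB : Set (Judg B)) (b : Bool)
    (X : PreCtx A) (f : List (Expr A)) (Y : PreCtx B)
    (out : List (Expr (A.tensor B))) : Prop :=
  out.length = f.length * Y.length ∧
  ∀ i j (hi : i < f.length) (hj : j < Y.length) (h : i * Y.length + j < out.length),
    ∃ U, CanonSort TA X (f[i]'hi) U ∧
      TTg TA TB b ⟨X, f[i]'hi, U⟩ ⟨Y.take j, .var (Y[j]'hj).1, (Y[j]'hj).2⟩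
        (out[i * Y.length + j]'h)

/-- The tensor `out = X ⊗ g` of a context of `𝔸` with a tuple of derivable terms
of `𝔹`: entries `xᵢ^{Xᵢ} ⊗ gⱼ^{𝒮(gⱼ)}`. -/
def TCtxMor (TA : Set (Judg A)) (TB : Set (Judg B)) (b : Bool)
    (X : PreCtx A) (Y : PreCtx B) (g : List (Expr B))
    (out : List (Expr (A.tensor B))) : Prop :=
  out.length = X.length * g.length ∧
  ∀ i j (hi : i < X.length) (hj : j < g.length) (h : i * g.length + j < out.length),
    ∃ V, CanonSort TB Y (g[j]'hj) V ∧
      TTg TA TB b ⟨X.take i, .var (X[i]'hi).1, (X[i]'hi).2⟩ ⟨Y, g[j]'hj, V⟩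
        (out[i * g.length + j]'h)

/-- The tensor `out = (x₁,…,x_m,u^U) ⊗ Y` of the section determined by a term
`X ⊢ u : U` with a context of `𝔹`. -/
def TSecL (TA : Set (Judg A)) (TB : Set (Judg B)) (b : Bool)
    (X : PreCtx A) (u : Expr A) (U : SortE A) (Y : PreCtx B)
    (out : List (Expr (A.tensor B))) : Prop :=
  out.length = (X.length + 1) * Y.length ∧
  (∀ i j (hi : i < X.length) (hj : j < Y.length) (h : i * Y.length + j < out.length),
      TTg TA TB b ⟨X.take i, .var (X[i]'hi).1, (X[i]'hi).2⟩
        ⟨Y.take j, .var (Y[j]'hj).1, (Y[j]'hj).2⟩ (out[i * Y.length + j]'h)) ∧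
  (∀ j (hj : j < Y.length) (h : X.length * Y.length + j < out.length),
      TTg TA TB b ⟨X, u, U⟩ ⟨Y.take j, .var (Y[j]'hj).1, (Y[j]'hj).2⟩
        (out[X.length * Y.length + j]'h))

/-- The tensor `out = X ⊗ (y₁,…,yₙ,v^V)` of a context of `𝔸` with the section
determined by a term `Y ⊢ v : V` of `𝔹`. -/
def TSecR (TA : Set (Judg A)) (TB : Set (Judg B)) (b : Bool)
    (X : PreCtx A) (Y : PreCtx B) (v : Expr B) (V : SortE B)
    (out : List (Expr (A.tensor B))) : Prop :=
  out.length = X.length * (Y.length + 1) ∧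
  (∀ i j (hi : i < X.length) (hj : j < Y.length)
      (h : i * (Y.length + 1) + j < out.length),
      TTg TA TB b ⟨X.take i, .var (X[i]'hi).1, (X[i]'hi).2⟩
        ⟨Y.take j, .var (Y[j]'hj).1, (Y[j]'hj).2⟩ (out[i * (Y.length + 1) + j]'h)) ∧
  (∀ i (hi : i < X.length) (h : i * (Y.length + 1) + Y.length < out.length),
      TTg TA TB b ⟨X.take i, .var (X[i]'hi).1, (X[i]'hi).2⟩ ⟨Y, v, V⟩
        (out[i * (Y.length + 1) + Y.length]'h))

end GATPaper

namespace GATPaper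

/-! ## Substitution -/

section Expressions

variable {A : Alphabet}

@[elab_as_elim]
theorem Expr.induct {motive : Expr A → Prop} (var : ∀ x, motive (.var x))
    (app : ∀ t es, (∀ e ∈ es, motive e) → motive (.app t es)) : ∀ e, motive e
  | .var x => var x
  | .app t es => app t es fun e _ => Expr.induct var app e
termination_by e => sizeOf e
decreasing_by
  have := List.sizeOf_lt_of_mem ‹e ∈ es›
  simp only [Expr.app.sizeOf_spec]
  omega

@[simp] theorem Expr.subst_var (σ : A.Var → Expr A) (x : A.Var) :
    (Expr.var x).subst σ = σ x := by rw [Expr.subst]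

@[simp] theorem Expr.subst_app (σ : A.Var → Expr A) (t : A.TermSym) (es : List (Expr A)) :
    (Expr.app t es).subst σ = .app t (es.map (Expr.subst σ)) := by
  rw [Expr.subst]
  congr 1
  exact List.attach_map_val (f := Expr.subst σ)

@[simp] theorem occurs_var {x y : A.Var} : Occurs x (Expr.var y) ↔ x = y :=
  ⟨fun h => by cases h; rfl, fun h => h ▸ .var⟩

@[simp] theorem occurs_app {x : A.Var} {t : A.TermSym} {es : List (Expr A)} :
    Occurs x (Expr.app t es) ↔ ∃ e ∈ es, Occurs x e :=
  ⟨fun h => by cases h with | app h1 h2 => exact ⟨_, h1, h2⟩, fun ⟨_, h1, h2⟩ => .app h1 h2⟩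

theorem Expr.subst_congr {σ τ : A.Var → Expr A} (e : Expr A) :
    (∀ x, Occurs x e → σ x = τ x) → e.subst σ = e.subst τ := by
  induction e using Expr.induct with
  | var x => intro h; simpa using h x .var
  | app t es ih =>
    intro h
    simp only [subst_app, Expr.app.injEq, true_and]
    exact List.map_congr_left fun e he => ih e he fun x hx => h x (.app he hx)

theorem Expr.subst_subst (σ τ : A.Var → Expr A) (e : Expr A) :
    (e.subst σ).subst τ = e.subst fun x => (σ x).subst τ := by
  induction e using Expr.induct with
  | var x => simp
  | app t es ih =>
    simp only [subst_app, Expr.app.injEq, true_and, List.map_map]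
    exact List.map_congr_left fun e he => ih e he

@[simp] theorem Expr.subst_id (e : Expr A) : e.subst Expr.var = e := by
  induction e using Expr.induct with
  | var x => simp
  | app t es ih =>
    simp only [subst_app, Expr.app.injEq, true_and]
    exact (List.map_congr_left fun e he => ih e he).trans (List.map_id _)

theorem Expr.occurs_subst {σ : A.Var → Expr A} {y : A.Var} (e : Expr A) :
    Occurs y (e.subst σ) → ∃ x, Occurs x e ∧ Occurs y (σ x) := by
  induction e using Expr.induct with
  | var x => intro h; exact ⟨x, .var, by simpa using h⟩
  | app t es ih =>
    simp only [subst_app, occurs_app, List.mem_map]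
    rintro ⟨_, ⟨e, he, rfl⟩, h⟩
    obtain ⟨x, hx, hy⟩ := ih e he h
    exact ⟨x, ⟨e, he, hx⟩, hy⟩

@[simp] theorem SortE.subst_mk (σ : A.Var → Expr A) (S : A.SortSym) (es : List (Expr A)) :
    (SortE.mk S es).subst σ = ⟨S, es.map (Expr.subst σ)⟩ := rfl

@[simp] theorem SortE.subst_head (σ : A.Var → Expr A) (U : SortE A) :
    (U.subst σ).head = U.head := rfl

@[simp] theorem SortE.subst_args (σ : A.Var → Expr A) (U : SortE A) :
    (U.subst σ).args = U.args.map (Expr.subst σ) := rfl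

theorem SortE.subst_congr {σ τ : A.Var → Expr A} (U : SortE A)
    (h : ∀ x, SOccurs x U → σ x = τ x) : U.subst σ = U.subst τ := by
  simp only [SortE.subst, SortE.mk.injEq, true_and]
  exact List.map_congr_left fun e he => e.subst_congr fun x hx => h x ⟨e, he, hx⟩

theorem SortE.subst_subst (σ τ : A.Var → Expr A) (U : SortE A) :
    (U.subst σ).subst τ = U.subst fun x => (σ x).subst τ := by
  simp only [SortE.subst, SortE.mk.injEq, true_and, List.map_map]
  exact List.map_congr_left fun e he => e.subst_subst σ τ

@[simp] theorem SortE.subst_id (U : SortE A) : U.subst Expr.var = U := by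
  cases U
  simp only [SortE.subst, SortE.mk.injEq, true_and]
  exact (List.map_congr_left fun e he => e.subst_id).trans (List.map_id _)

/-! ## Declarations -/

/-- The variables declared by a precontext. -/
abbrev names (X : PreCtx A) : List A.Var := X.map Prod.fst

/-- `X` declares `x : U` after the initial segment `P`. -/
def Decl (X P : PreCtx A) (x : A.Var) (U : SortE A) : Prop := P ++ [(x, U)] <+: X

theorem Decl.mono {X X' P : PreCtx A} {x : A.Var} {U : SortE A} (h : Decl X P x U)
    (hX : X <+: X') : Decl X' P x U := h.trans hX

theorem Decl.isPre {X P : PreCtx A} {x : A.Var} {U : SortE A} (h : Decl X P x U) :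
    P <+: X := (List.prefix_append _ _).trans h

theorem Decl.mem {X P : PreCtx A} {x : A.Var} {U : SortE A} (h : Decl X P x U) :
    x ∈ names X := by
  obtain ⟨Q, rfl⟩ := h
  simp

theorem decl_snoc_self (X : PreCtx A) (x : A.Var) (U : SortE A) : Decl (X ++ [(x, U)]) X x U :=
  List.prefix_refl _

theorem decl_snoc {X P : PreCtx A} {x z : A.Var} {U Z : SortE A} :
    Decl (X ++ [(x, U)]) P z Z ↔ Decl X P z Z ∨ (P = X ∧ z = x ∧ Z = U) := by
  constructor
  · intro h
    unfold Decl at h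
    rcases List.prefix_concat_iff.1 h with h | h
    · right
      have := List.append_inj' h rfl
      simpa using this
    · exact Or.inl h
  · rintro (h | ⟨rfl, rfl, rfl⟩)
    · exact h.mono (List.prefix_append _ _)
    · exact decl_snoc_self _ _ _

theorem decl_nil {P : PreCtx A} {x : A.Var} {U : SortE A} : ¬ Decl [] P x U := by
  intro h; simpa using h.mem

theorem decl_getElem {X : PreCtx A} {i : ℕ} (hi : i < X.length) :
    Decl X (X.take i) X[i].1 X[i].2 := by
  unfold Decl
  have : X.take i ++ [(X[i].1, X[i].2)] = X.take (i + 1) := by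
    rw [List.take_succ_eq_append_getElem hi]
  rw [this]
  exact ⟨_, List.take_append_drop _ _⟩

theorem Decl.getElem {X P : PreCtx A} {x : A.Var} {U : SortE A} (h : Decl X P x U) :
    ∃ i, ∃ hi : i < X.length, P = X.take i ∧ x = X[i].1 ∧ U = X[i].2 := by
  obtain ⟨Q, rfl⟩ := h
  exact ⟨P.length, by simp, by simp, by simp, by simp⟩

theorem exists_decl {X : PreCtx A} {x : A.Var} (h : x ∈ names X) : ∃ P U, Decl X P x U := by
  obtain ⟨i, hi, rfl⟩ := List.getElem_of_mem h
  simp only [List.length_map] at hi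
  exact ⟨_, _, by simpa using decl_getElem hi⟩

theorem Decl.uniq {X P P' : PreCtx A} {x : A.Var} {U U' : SortE A} (hn : (names X).Nodup)
    (h : Decl X P x U) (h' : Decl X P' x U') : P = P' ∧ U = U' := by
  obtain ⟨i, hi, rfl, rfl, rfl⟩ := h.getElem
  obtain ⟨j, hj, rfl, e, rfl⟩ := h'.getElem
  have : i = j := by
    apply (List.Nodup.getElem_inj_iff hn (hi := by simpa) (hj := by simpa)).1
    simpa using e
  subst this
  exact ⟨rfl, rfl⟩

theorem nodup_of_isPre {P X : PreCtx A} (h : P <+: X) (hn : (names X).Nodup) : (names P).Nodup :=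
  hn.sublist (h.sublist.map _)

theorem names_mono {P X : PreCtx A} (h : P <+: X) {x : A.Var} (hx : x ∈ names P) :
    x ∈ names X := (h.sublist.map _).subset hx

theorem Decl.notMem {X P : PreCtx A} {x : A.Var} {U : SortE A} (hn : (names X).Nodup)
    (h : Decl X P x U) : x ∉ names P := by
  have := nodup_of_isPre h hn
  simp only [names, List.map_append, List.map_cons, List.map_nil] at this
  rw [List.nodup_append] at this
  intro hx
  exact this.2.2 x hx x (by simp) rfl

/-- A declaration restricts to any initial segment declaring the variable. -/
theorem Decl.restrict {X Q P : PreCtx A} {x : A.Var} {U : SortE A} (hn : (names X).Nodup)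
    (h : Decl X P x U) (hQ : Q <+: X) (hx : x ∈ names Q) : Decl Q P x U := by
  obtain ⟨P', U', h'⟩ := exists_decl hx
  obtain ⟨rfl, rfl⟩ := Decl.uniq hn h (h'.mono hQ)
  exact h'

theorem isPreCtx_iff {X : PreCtx A} :
    IsPreCtx X ↔ ∀ P x U, Decl X P x U → ∀ v, SOccurs v U → v ∈ names P := by
  constructor
  · intro h P x U hd v hv
    obtain ⟨i, hi, rfl, rfl, rfl⟩ := hd.getElem
    exact h i hi v hv
  · intro h i hi v hv
    exact h _ _ _ (decl_getElem hi) v hv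

/-! ## Lookup -/

theorem lookupV_append_mem {ps qs : List (A.Var × Expr A)} {x : A.Var}
    (h : x ∈ ps.map Prod.fst) : lookupV (ps ++ qs) x = lookupV ps x := by
  induction ps with
  | nil => simp at h
  | cons p ps ih =>
    simp only [List.cons_append, lookupV]
    split_ifs with hp
    · rfl
    · apply ih
      simp only [List.map_cons, List.mem_cons] at h
      exact h.resolve_left (fun e => hp e.symm)

theorem lookupV_append_notMem {ps qs : List (A.Var × Expr A)} {x : A.Var}
    (h : x ∉ ps.map Prod.fst) : lookupV (ps ++ qs) x = lookupV qs x := by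
  induction ps with
  | nil => rfl
  | cons p ps ih =>
    simp only [List.map_cons, List.mem_cons, not_or] at h
    simp only [List.cons_append, lookupV]
    rw [if_neg (fun e => h.1 e.symm)]
    exact ih h.2

theorem lookupV_notMem {ps : List (A.Var × Expr A)} {x : A.Var}
    (h : x ∉ ps.map Prod.fst) : lookupV ps x = .var x := by
  simpa [lookupV] using lookupV_append_notMem (qs := []) h

theorem lookupV_map {ps : List (A.Var × Expr A)} {F : A.Var → Expr A} {x : A.Var}
    (h : x ∈ ps.map Prod.fst) (hF : ∀ p ∈ ps, p.2 = F p.1) : lookupV ps x = F x := by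
  induction ps with
  | nil => simp at h
  | cons p ps ih =>
    simp only [lookupV]
    split_ifs with hp
    · rw [hF p (by simp), hp]
    · simp only [List.map_cons, List.mem_cons] at h
      exact ih (h.resolve_left (fun e => hp e.symm)) fun q hq => hF q (by simp [hq])

theorem mkSub_fst {X : PreCtx A} {f : List (Expr A)} (h : f.length = X.length) :
    (mkSub X f).map Prod.fst = names X := by
  unfold mkSub
  rw [List.map_fst_zip]
  simp [h]

theorem mkSub_map (X : PreCtx A) (F : A.Var → Expr A) {x : A.Var} (hx : x ∈ names X) :
    lookupV (mkSub X (X.map fun p => F p.1)) x = F x := by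
  apply lookupV_map
  · rwa [mkSub_fst (by simp)]
  · intro p hp
    unfold mkSub at hp
    rw [List.zip_map', List.mem_map] at hp
    obtain ⟨q, -, rfl⟩ := hp
    rfl

/-- The substitution function determined by a tuple of expressions. -/
noncomputable def tup (X : PreCtx A) (f : List (Expr A)) : A.Var → Expr A := lookupV (mkSub X f)

theorem tup_getElem {X : PreCtx A} {f : List (Expr A)} (hn : (names X).Nodup)
    (hl : f.length = X.length) {i : ℕ} (hi : i < X.length) :
    tup X f X[i].1 = f[i]'(hl ▸ hi) := by
  have hs : mkSub X f = mkSub (X.take i) (f.take i) ++ mkSub (X.drop i) (f.drop i) := by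
    unfold mkSub
    rw [List.map_take, List.map_drop, ← List.zip_append, List.take_append_drop,
      List.take_append_drop]
    simp [hl]
  unfold tup
  rw [hs, lookupV_append_notMem]
  · unfold mkSub
    rw [List.drop_eq_getElem_cons hi, List.drop_eq_getElem_cons (i := i) (l := f) (by omega)]
    simp only [List.map_cons, List.zip_cons_cons, lookupV, if_true]
  · rw [mkSub_fst (by simp [hl])]
    exact (decl_getElem hi).notMem hn

theorem tup_map {X : PreCtx A} {f : List (Expr A)} (hn : (names X).Nodup)
    (hl : f.length = X.length) : f = X.map fun p => tup X f p.1 := by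
  apply List.ext_getElem
  · simp [hl]
  · intro i h1 h2
    simp [tup_getElem hn hl (hl ▸ h1)]

theorem subPre_eq {X : PreCtx A} {f : List (Expr A)} (hX : IsPreCtx X)
    (hl : f.length = X.length) {i : ℕ} (hi : i < X.length) :
    subPre X f i hi = X[i].2.subst (tup X f) := by
  unfold subPre SortE.substL
  apply SortE.subst_congr
  intro v hv
  have hs : mkSub X f = mkSub (X.take i) (f.take i) ++ mkSub (X.drop i) (f.drop i) := by
    unfold mkSub
    rw [List.map_take, List.map_drop, ← List.zip_append, List.take_append_drop,
      List.take_append_drop]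
    simp [hl]
  unfold tup
  rw [hs, lookupV_append_mem]
  rw [mkSub_fst (by simp [hl])]
  exact hX i hi v hv

theorem ctxVars_subst {X : PreCtx A} (σ : A.Var → Expr A) :
    (ctxVars X).map (Expr.subst σ) = X.map fun p => σ p.1 := by
  simp [ctxVars]

end Expressions

/-! ## Structure of derivations -/

section Derivations

variable {A : Alphabet} {Ax : Set (Judg A)}

theorem DerAt.succ {n : ℕ} {J : Judg A} (h : DerAt Ax n J) : DerAt Ax (n + 1) J := Or.inl h

theorem DerAt.mono {n m : ℕ} (hnm : n ≤ m) {J : Judg A} (h : DerAt Ax n J) : DerAt Ax m J := by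
  induction hnm with
  | refl => exact h
  | step _ ih => exact ih.succ

theorem DerAt.pos {n : ℕ} {J : Judg A} (h : DerAt Ax n J) : ∃ k, n = k + 1 := by
  cases n with
  | zero => exact h.elim
  | succ k => exact ⟨k, rfl⟩

theorem DerAt.ctx_of_sort {n : ℕ} {X : PreCtx A} {U : SortE A}
    (h : DerAt Ax (n + 1) (.sort X U)) : DerAt Ax n (.ctx X) := by
  induction n with
  | zero => rcases h with h | h <;> cases h <;> assumption
  | succ n ih =>
    rcases h with h | h
    · exact (ih h).succ
    · cases h <;> assumption

theorem DerAt.sorts_of_sortEq {n : ℕ} {X : PreCtx A} {U V : SortE A}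
    (h : DerAt Ax (n + 1) (.sortEq X U V)) :
    DerAt Ax n (.sort X U) ∧ DerAt Ax n (.sort X V) := by
  induction n generalizing U V with
  | zero =>
    rcases h with h | h
    · exact h.elim
    · cases h with
      | s1 h => exact h.elim
      | s2 h => exact h.elim
      | s3 h _ => exact h.elim
      | seqA _ h _ => exact h.elim
      | seqSub1 _ _ _ h => exact h.elim
      | seqSub2 _ _ _ _ h => exact h.elim
  | succ n ih =>
    rcases h with h | h
    · exact ⟨(ih h).1.succ, (ih h).2.succ⟩
    · cases h with
      | s1 h => exact ⟨h, h⟩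
      | s2 h => exact ⟨(ih h).2.succ, (ih h).1.succ⟩
      | s3 h h' => exact ⟨(ih h).1.succ, (ih h').2.succ⟩
      | seqA _ h h' => exact ⟨h, h'⟩
      | seqSub1 _ _ _ _ h h' => exact ⟨h, h'⟩
      | seqSub2 _ _ _ _ _ h h' => exact ⟨h, h'⟩

theorem DerAt.sort_of_term {n : ℕ} {X : PreCtx A} {u : Expr A} {U : SortE A}
    (h : DerAt Ax (n + 1) (.term X u U)) : DerAt Ax n (.sort X U) := by
  induction n generalizing U with
  | zero =>
    rcases h with h | h
    · exact h.elim
    · cases h with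
      | seqt h => exact h.elim
      | var _ h => exact h
      | tA _ h => exact h
      | tSub _ _ _ _ h => exact h
  | succ n ih =>
    rcases h with h | h
    · exact (ih h).succ
    · cases h with
      | seqt h => exact h.sorts_of_sortEq.2.succ
      | var _ h => exact h
      | tA _ h => exact h
      | tSub _ _ _ _ h => exact h

theorem DerAt.terms_of_termEq {n : ℕ} {X : PreCtx A} {u v : Expr A} {U : SortE A}
    (h : DerAt Ax (n + 1) (.termEq X u v U)) :
    DerAt Ax n (.term X u U) ∧ DerAt Ax n (.term X v U) := by
  induction n generalizing u v U with
  | zero =>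
    rcases h with h | h
    · exact h.elim
    · cases h with
      | t1 h => exact h.elim
      | t2 h => exact h.elim
      | t3 h _ => exact h.elim
      | seqteq h => exact h.elim
      | teqA _ h _ => exact h.elim
      | teqSub1 _ _ _ h => exact h.elim
      | teqSub2 _ _ _ _ h => exact h.elim
  | succ n ih =>
    rcases h with h | h
    · exact ⟨(ih h).1.succ, (ih h).2.succ⟩
    · cases h with
      | t1 h => exact ⟨h, h⟩
      | t2 h => exact ⟨(ih h).2.succ, (ih h).1.succ⟩
      | t3 h h' => exact ⟨(ih h).1.succ, (ih h').2.succ⟩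
      | seqteq _ _ h h' => exact ⟨h, h'⟩
      | teqA _ h h' => exact ⟨h, h'⟩
      | teqSub1 _ _ _ _ h h' => exact ⟨h, h'⟩
      | teqSub2 _ _ _ _ _ h h' => exact ⟨h, h'⟩

/-- A derivable context is a precontext without repetitions, and all of its declarations
are derivable. -/
theorem DerAt.ctx_wf {n : ℕ} {X : PreCtx A} (h : DerAt Ax (n + 1) (.ctx X)) :
    (names X).Nodup ∧ IsPreCtx X ∧ ∀ P x U, Decl X P x U → DerAt Ax n (.sort P U) := by
  induction n generalizing X with
  | zero =>
    rcases h with h | h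
    · exact h.elim
    · cases h with
      | ctx_nil =>
        exact ⟨List.nodup_nil, fun i hi => absurd hi (by simp), fun P x U h => (decl_nil h).elim⟩
      | ctx_cons h => exact h.elim
  | succ n ih =>
    rcases h with h | h
    · obtain ⟨h1, h2, h3⟩ := ih h
      exact ⟨h1, h2, fun P x U hd => (h3 P x U hd).succ⟩
    · cases h with
      | ctx_nil =>
        exact ⟨List.nodup_nil, fun i hi => absurd hi (by simp), fun P x U h => (decl_nil h).elim⟩
      | @ctx_cons X U x h hf hp =>
        obtain ⟨k, rfl⟩ := h.ctx_of_sort.pos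
        obtain ⟨h1, h2, h3⟩ := ih h.ctx_of_sort.succ
        refine ⟨?_, hp, ?_⟩
        · simp only [names, List.map_append, List.map_cons, List.map_nil]
          rw [List.nodup_append]
          refine ⟨h1, by simp, ?_⟩
          rintro a ha b hb rfl
          simp only [List.mem_singleton] at hb
          subst hb
          obtain ⟨p, hpX, rfl⟩ := List.mem_map.1 ha
          exact hf p hpX rfl
        · intro P z Z hd
          rcases decl_snoc.1 hd with hd | ⟨rfl, rfl, rfl⟩
          · exact (h3 P z Z hd).succ
          · exact h

theorem DerAt.sort_wf {n : ℕ} {X : PreCtx A} {U : SortE A} (h : DerAt Ax n (.sort X U)) :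
    (names X).Nodup ∧ IsPreCtx X ∧ ∀ P x V, Decl X P x V → DerAt Ax n (.sort P V) := by
  obtain ⟨n, rfl⟩ := h.pos
  obtain ⟨k, rfl⟩ := h.ctx_of_sort.pos
  obtain ⟨h1, h2, h3⟩ := h.ctx_of_sort.ctx_wf
  exact ⟨h1, h2, fun P x U hd => (h3 P x U hd).succ.succ⟩

/-- Declarations in the context of a judgment appear at an earlier stage. -/
theorem DerAt.sort_decl {n : ℕ} {X : PreCtx A} {U : SortE A} (h : DerAt Ax (n + 1) (.sort X U))
    {P x V} (hd : Decl X P x V) : DerAt Ax n (.sort P V) := by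
  obtain ⟨k, rfl⟩ := h.ctx_of_sort.pos
  exact (h.ctx_of_sort.ctx_wf.2.2 P x V hd).succ

/-- The restrictions on the shape of axioms used in the analysis of derivations. -/
structure Shaped (Ax : Set (Judg A)) : Prop where
  sort_shape : ∀ (X : PreCtx A) (U : SortE A), Judg.sort X U ∈ Ax → U.args = ctxVars X
  term_shape : ∀ (X : PreCtx A) (u : Expr A) (U : SortE A), Judg.term X u U ∈ Ax →
      ∃ t : A.TermSym, u = Expr.app t (ctxVars X)

theorem IsPretheory.shaped (h : IsPretheory Ax) : Shaped Ax := ⟨h.sort_shape, h.term_shape⟩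

theorem occurs_ctxVars {X : PreCtx A} {e : Expr A} (he : e ∈ ctxVars X) {v : A.Var}
    (hv : Occurs v e) : v ∈ names X := by
  simp only [ctxVars, List.mem_map] at he
  obtain ⟨p, hp, rfl⟩ := he
  simp only [occurs_var] at hv
  subst hv
  exact List.mem_map_of_mem hp

theorem DerAt.scoped (hAx : Shaped Ax) {n : ℕ} :
    (∀ X U, DerAt Ax n (.sort X U) → ∀ v, SOccurs v U → v ∈ names X) ∧
    (∀ X u U, DerAt Ax n (.term X u U) → ∀ v, Occurs v u → v ∈ names X) := by
  induction n with
  | zero => exact ⟨fun _ _ h => h.elim, fun _ _ _ h => h.elim⟩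
  | succ n ih =>
    constructor
    · rintro X U (h | h) v hv
      · exact ih.1 X U h v hv
      · cases h with
        | sA hax h _ =>
          obtain ⟨e, he, hv⟩ := hv
          rw [hAx.sort_shape _ _ hax] at he
          exact occurs_ctxVars he hv
        | sSub hax hY hl _ _ ha =>
          obtain ⟨e, he, hv⟩ := hv
          obtain ⟨i, hi, rfl⟩ := List.getElem_of_mem he
          exact ih.2 _ _ _ (ha i (hl ▸ hi) hi) v hv
    · rintro X u U (h | h) v hv
      · exact ih.2 X u U h v hv
      · cases h with
        | seqt _ h => exact ih.2 _ _ _ h v hv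
        | var hi h =>
          simp only [occurs_var] at hv
          subst hv
          exact List.mem_map_of_mem (List.getElem_mem _)
        | tA hax _ _ =>
          obtain ⟨t, rfl⟩ := hAx.term_shape _ _ _ hax
          obtain ⟨e, he, hv⟩ := occurs_app.1 hv
          exact occurs_ctxVars he hv
        | tSub hax hY hl _ _ ha =>
          obtain ⟨e, he, hv⟩ := occurs_app.1 hv
          obtain ⟨i, hi, rfl⟩ := List.getElem_of_mem he
          exact ih.2 _ _ _ (ha i (hl ▸ hi) hi) v hv

theorem DerAt.sort_scoped (hAx : Shaped Ax) {n : ℕ} {X U} (h : DerAt Ax n (.sort X U)) :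
    ∀ v, SOccurs v U → v ∈ names X := (DerAt.scoped hAx).1 X U h

theorem DerAt.term_scoped (hAx : Shaped Ax) {n : ℕ} {X u U} (h : DerAt Ax n (.term X u U)) :
    ∀ v, Occurs v u → v ∈ names X := (DerAt.scoped hAx).2 X u U h

end Derivations

end GATPaper

namespace GATPaper

section Inversion

variable {A : Alphabet} {Ax : Set (Judg A)}

/-- `u : U` over an initial segment of `P`, or a variable of `X` declared with sort `U` over
an initial segment of `P`. -/
def Arg (Ax : Set (Judg A)) (n : ℕ) (P X : PreCtx A) (u : Expr A) (U : SortE A) : Prop :=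
  P <+: X ∧ ((∃ P0, P0 <+: P ∧ DerAt Ax n (.term P0 u U)) ∨
    ∃ P0 x, P0 <+: P ∧ Decl X P0 x U ∧ u = .var x ∧ DerAt Ax n (.sort P0 U))

/-- `F` is a substitution of terms over `P` for the variables of `XS`. -/
def MorAt (Ax : Set (Judg A)) (n : ℕ) (P XS : PreCtx A) (F : A.Var → Expr A) : Prop :=
  ∀ P1 z Z, Decl XS P1 z Z → DerAt Ax n (.term P (F z) (Z.subst F))

def ArgMor (Ax : Set (Judg A)) (n : ℕ) (P XS : PreCtx A) (F : A.Var → Expr A) : Prop :=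
  ∀ P1 z Z, Decl XS P1 z Z → Arg Ax n P P (F z) (Z.subst F)

theorem Arg.mono {n m : ℕ} (hnm : n ≤ m) {P X P' X' : PreCtx A} {u : Expr A} {U : SortE A}
    (h : Arg Ax n P X u U) (hP : P <+: P') (hX : X <+: X') (hPX : P' <+: X') :
    Arg Ax m P' X' u U := by
  refine ⟨hPX, ?_⟩
  rcases h.2 with ⟨P0, h0, hd⟩ | ⟨P0, x, h0, hd, hu, hs⟩
  · exact Or.inl ⟨P0, h0.trans hP, hd.mono hnm⟩
  · exact Or.inr ⟨P0, x, h0.trans hP, hd.mono hX, hu, hs.mono hnm⟩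

theorem Arg.of_term {n : ℕ} {P X : PreCtx A} {u : Expr A} {U : SortE A} (hPX : P <+: X)
    (h : DerAt Ax n (.term P u U)) : Arg Ax n P X u U :=
  ⟨hPX, Or.inl ⟨P, List.prefix_refl _, h⟩⟩

theorem Arg.of_decl {n : ℕ} {P X : PreCtx A} {x : A.Var} {U : SortE A}
    (h : Decl X P x U) (hs : DerAt Ax n (.sort P U)) : Arg Ax n P X (.var x) U :=
  ⟨h.isPre, Or.inr ⟨P, x, List.prefix_refl _, h, rfl, hs⟩⟩

theorem Arg.pos {n : ℕ} {P X : PreCtx A} {u : Expr A} {U : SortE A} (h : Arg Ax n P X u U) :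
    ∃ k, n = k + 1 := by
  rcases h.2 with ⟨P0, h0, hd⟩ | ⟨P0, x, h0, hd, hu, hs⟩
  · exact hd.pos
  · exact hs.pos

theorem Arg.sort {n : ℕ} {P X : PreCtx A} {u : Expr A} {U : SortE A} (h : Arg Ax n P X u U) :
    ∃ P0, P0 <+: P ∧ DerAt Ax n (.sort P0 U) := by
  rcases h.2 with ⟨P0, h0, hd⟩ | ⟨P0, x, h0, hd, hu, hs⟩
  · obtain ⟨k, rfl⟩ := hd.pos
    exact ⟨P0, h0, hd.sort_of_term.succ⟩
  · exact ⟨P0, h0, hs⟩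

theorem MorAt.mono {n m : ℕ} (hnm : n ≤ m) {P XS : PreCtx A} {F : A.Var → Expr A}
    (h : MorAt Ax n P XS F) : MorAt Ax m P XS F :=
  fun P1 z Z hd => (h P1 z Z hd).mono hnm

theorem MorAt.argMor {n : ℕ} {P XS : PreCtx A} {F : A.Var → Expr A}
    (h : MorAt Ax n P XS F) : ArgMor Ax n P XS F :=
  fun P1 z Z hd => Arg.of_term (List.prefix_refl _) (h P1 z Z hd)

theorem ArgMor.mono {n m : ℕ} (hnm : n ≤ m) {P XS : PreCtx A} {F : A.Var → Expr A}
    (h : ArgMor Ax n P XS F) : ArgMor Ax m P XS F :=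
  fun P1 z Z hd => (h P1 z Z hd).mono hnm (List.prefix_refl _) (List.prefix_refl _)
    (List.prefix_refl _)

theorem argMor_var {n : ℕ} {X : PreCtx A}
    (h : ∀ P x V, Decl X P x V → DerAt Ax n (.sort P V)) : ArgMor Ax n X X .var := by
  intro P z Z hd
  rw [SortE.subst_id]
  exact (Arg.of_decl hd (h _ _ _ hd)).mono le_rfl hd.isPre (List.prefix_refl _)
    (List.prefix_refl _)

theorem morAt_var {n : ℕ} {X : PreCtx A}
    (hv : ∀ i (hi : i < X.length), DerAt Ax n (.term X (.var (X[i]'hi).1) (X[i]'hi).2)) :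
    MorAt Ax n X X .var := by
  intro P z Z hd
  obtain ⟨i, hi, rfl, rfl, rfl⟩ := hd.getElem
  rw [SortE.subst_id]
  exact hv i hi

theorem morAt_tup {n : ℕ} {X Y : PreCtx A} {f : List (Expr A)} (hn : (names X).Nodup)
    (hX : IsPreCtx X) (hl : f.length = X.length)
    (hargs : ∀ i (hi : i < X.length) (hif : i < f.length),
      DerAt Ax n (.term Y (f[i]'hif) (subPre X f i hi))) : MorAt Ax n Y X (tup X f) := by
  intro P z Z hd
  obtain ⟨i, hi, rfl, rfl, rfl⟩ := hd.getElem
  have := hargs i hi (hl ▸ hi)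
  rwa [subPre_eq hX hl, ← tup_getElem hn hl hi] at this

theorem morEq_tup {n : ℕ} {X Y : PreCtx A} {f g : List (Expr A)} (hn : (names X).Nodup)
    (hX : IsPreCtx X) (hl : f.length = X.length) (hlg : g.length = X.length)
    (hargs : ∀ i (hi : i < X.length) (hif : i < f.length) (hig : i < g.length),
      DerAt Ax n (.termEq Y (f[i]'hif) (g[i]'hig) (subPre X f i hi)))
    {P z Z} (hd : Decl X P z Z) :
    DerAt Ax n (.termEq Y (tup X f z) (tup X g z) (Z.subst (tup X f))) := by
  obtain ⟨i, hi, rfl, rfl, rfl⟩ := hd.getElem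
  have := hargs i hi (hl ▸ hi) (hlg ▸ hi)
  rwa [subPre_eq hX hl, ← tup_getElem hn hl hi, ← tup_getElem hn hlg hi] at this

theorem sort_inv (hAx : Shaped Ax) {n : ℕ} {P : PreCtx A} {S : A.SortSym} {ss : List (Expr A)}
    (h : DerAt Ax (n + 1) (.sort P ⟨S, ss⟩)) :
    ∃ XS F, introSort XS S ∈ Ax ∧ DerAt Ax (n + 1) (introSort XS S) ∧
      ss = XS.map (fun p => F p.1) ∧ MorAt Ax n P XS F := by
  induction n with
  | zero =>
    rcases h with h | h
    · exact h.elim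
    · cases h with
      | sA _ h => exact h.elim
      | sSub _ _ _ h => exact h.elim
  | succ n ih =>
    rcases h with h | h
    · obtain ⟨XS, F, h1, h2, h3, h4⟩ := ih h
      exact ⟨XS, F, h1, h2.succ, h3, h4.mono (Nat.le_succ _)⟩
    · cases h with
      | sA hax h hv =>
        have := hAx.sort_shape _ _ hax
        simp only at this
        subst this
        exact ⟨P, .var, hax, .inr (.sA hax h hv), rfl, morAt_var hv⟩
      | @sSub XS _ hax _ hY f hl hJ hYc hargs =>
        obtain ⟨hn, hp, _⟩ := hJ.sort_wf
        exact ⟨XS, tup XS ss, hax, hJ.succ, tup_map hn hl, morAt_tup hn hp hl hargs⟩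

theorem term_inv (hAx : Shaped Ax) {n : ℕ} {X : PreCtx A} {u : Expr A} {U : SortE A}
    (h : DerAt Ax (n + 1) (.term X u U)) :
    (∃ U0, DerAt Ax n (.sortEq X U0 U) ∧ DerAt Ax n (.term X u U0)) ∨
    (∃ P x, Decl X P x U ∧ u = .var x ∧ DerAt Ax n (.sort X U)) ∨
    ∃ XT t UT F, introTerm XT t UT ∈ Ax ∧ DerAt Ax (n + 1) (introTerm XT t UT) ∧
      DerAt Ax n (.sort XT UT) ∧ u = .app t (XT.map fun p => F p.1) ∧ U = UT.subst F ∧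
      MorAt Ax n X XT F ∧ DerAt Ax n (.sort X U) := by
  induction n with
  | zero =>
    rcases h with h | h
    · exact h.elim
    · cases h with
      | seqt h => exact h.elim
      | var _ h => exact h.elim
      | tA _ h => exact h.elim
      | tSub _ _ _ h => exact h.elim
  | succ n ih =>
    rcases h with h | h
    · rcases ih h with ⟨U0, h1, h2⟩ | ⟨P, x, h1, h2, h3⟩ | ⟨XT, t, UT, F, h1, h2, h3, h4, h5, h6, h7⟩
      · exact .inl ⟨U0, h1.succ, h2.succ⟩
      · exact .inr (.inl ⟨P, x, h1, h2, h3.succ⟩)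
      · exact .inr (.inr ⟨XT, t, UT, F, h1, h2.succ, h3.succ, h4, h5, h6.mono (Nat.le_succ _),
          h7.succ⟩)
    · cases h with
      | seqt h1 h2 => exact .inl ⟨_, h1, h2⟩
      | var hi h => exact .inr (.inl ⟨_, _, decl_getElem hi, rfl, h⟩)
      | tA hax h hv =>
        obtain ⟨t, rfl⟩ := hAx.term_shape _ _ _ hax
        exact .inr (.inr ⟨X, t, U, .var, hax, .inr (.tA hax h hv), h, rfl, by simp,
          morAt_var hv, h⟩)
      | @tSub XT t UT hax _ hY f hl hJ hU hargs =>
        obtain ⟨hn, hp, _⟩ := hJ.sort_of_term.succ.sort_wf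
        refine .inr (.inr ⟨XT, t, UT, tup XT f, hax, hJ.succ, hJ.sort_of_term.succ, ?_, rfl,
          morAt_tup hn hp hl hargs, hU⟩)
        rw [← tup_map hn hl]

theorem sortEq_inv {n : ℕ} {P : PreCtx A} {U U' : SortE A}
    (h : DerAt Ax (n + 1) (.sortEq P U U')) :
    DerAt Ax n (.sortEq P U U') ∨ (U = U' ∧ DerAt Ax n (.sort P U)) ∨
    DerAt Ax n (.sortEq P U' U) ∨
    (∃ V, DerAt Ax n (.sortEq P U V) ∧ DerAt Ax n (.sortEq P V U')) ∨
    (∃ X1 U1 U1' F, Judg.sortEq X1 U1 U1' ∈ Ax ∧ DerAt Ax (n + 1) (.sortEq X1 U1 U1') ∧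
      U = U1.subst F ∧ U' = U1'.subst F ∧ ArgMor Ax n P X1 F) ∨
    (∃ XS S, ∃ F G : A.Var → Expr A, introSort XS S ∈ Ax ∧ DerAt Ax n (introSort XS S) ∧
      U = ⟨S, XS.map fun p => F p.1⟩ ∧ U' = ⟨S, XS.map fun p => G p.1⟩ ∧
      DerAt Ax n (.sort P U) ∧ DerAt Ax n (.sort P U') ∧
      ∀ P1 z Z, Decl XS P1 z Z → DerAt Ax n (.termEq P (F z) (G z) (Z.subst F))) := by
  rcases h with h | h
  · exact .inl h
  · cases h with
    | s1 h => exact .inr (.inl ⟨rfl, h⟩)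
    | s2 h => exact .inr (.inr (.inl h))
    | s3 h1 h2 => exact .inr (.inr (.inr (.inl ⟨_, h1, h2⟩)))
    | seqA hax h1 h2 =>
      exact .inr (.inr (.inr (.inr (.inl ⟨P, U, U', .var, hax, .inr (.seqA hax h1 h2), by simp,
        by simp, argMor_var h1.sort_wf.2.2⟩))))
    | @seqSub1 X1 U1 U1' hax _ hY f hl hJ h1 h2 hargs =>
      obtain ⟨k, rfl⟩ := hJ.pos
      obtain ⟨hn, hp, _⟩ := hJ.sorts_of_sortEq.1.sort_wf
      exact .inr (.inr (.inr (.inr (.inl ⟨X1, U1, U1', tup X1 f, hax, hJ.succ, rfl,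
        rfl, (morAt_tup hn hp hl hargs).argMor⟩))))
    | @seqSub2 XS S hax _ hY f g hl hlg hJ h1 h2 hargs =>
      obtain ⟨hn, hp, _⟩ := hJ.sort_wf
      refine .inr (.inr (.inr (.inr (.inr ⟨XS, S, tup XS f, tup XS g, hax, hJ, ?_, ?_, h1, h2,
        fun P1 z Z hd => morEq_tup hn hp hl hlg hargs hd⟩))))
      · rw [← tup_map hn hl]
      · rw [← tup_map hn hlg]

theorem termEq_inv {n : ℕ} {P : PreCtx A} {u u' : Expr A} {U : SortE A}
    (h : DerAt Ax (n + 1) (.termEq P u u' U)) :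
    DerAt Ax n (.termEq P u u' U) ∨ (u = u' ∧ DerAt Ax n (.term P u U)) ∨
    DerAt Ax n (.termEq P u' u U) ∨
    (∃ v, DerAt Ax n (.termEq P u v U) ∧ DerAt Ax n (.termEq P v u' U)) ∨
    (∃ U0, DerAt Ax n (.sortEq P U0 U) ∧ DerAt Ax n (.termEq P u u' U0)) ∨
    (∃ X1 u1 u1' U1 F, Judg.termEq X1 u1 u1' U1 ∈ Ax ∧
      DerAt Ax (n + 1) (.termEq X1 u1 u1' U1) ∧
      u = u1.subst F ∧ u' = u1'.subst F ∧ U = U1.subst F ∧ ArgMor Ax n P X1 F) ∨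
    (∃ XT t UT, ∃ F G : A.Var → Expr A, introTerm XT t UT ∈ Ax ∧
      DerAt Ax n (introTerm XT t UT) ∧
      u = .app t (XT.map fun p => F p.1) ∧ u' = .app t (XT.map fun p => G p.1) ∧
      U = UT.subst F ∧ DerAt Ax n (.term P u U) ∧ DerAt Ax n (.term P u' U) ∧
      ∀ P1 z Z, Decl XT P1 z Z → DerAt Ax n (.termEq P (F z) (G z) (Z.subst F))) := by
  rcases h with h | h
  · exact .inl h
  · cases h with
    | t1 h => exact .inr (.inl ⟨rfl, h⟩)
    | t2 h => exact .inr (.inr (.inl h))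
    | t3 h1 h2 => exact .inr (.inr (.inr (.inl ⟨_, h1, h2⟩)))
    | seqteq h1 h2 _ _ => exact .inr (.inr (.inr (.inr (.inl ⟨_, h1, h2⟩))))
    | teqA hax h1 h2 =>
      obtain ⟨k, rfl⟩ := h1.pos
      exact .inr (.inr (.inr (.inr (.inr (.inl ⟨P, u, u', U, .var, hax, .inr (.teqA hax h1 h2),
        by simp, by simp, by simp, argMor_var h1.sort_of_term.succ.sort_wf.2.2⟩)))))
    | @teqSub1 X1 u1 u1' U1 hax _ hY f hl hJ h1 h2 hargs =>
      obtain ⟨k, rfl⟩ := hJ.pos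
      obtain ⟨l, rfl⟩ := hJ.terms_of_termEq.1.pos
      obtain ⟨hn, hp, _⟩ := hJ.terms_of_termEq.1.sort_of_term.sort_wf
      exact .inr (.inr (.inr (.inr (.inr (.inl ⟨X1, u1, u1', U1, tup X1 f, hax, hJ.succ, rfl,
        rfl, rfl, (morAt_tup hn hp hl hargs).argMor⟩)))))
    | @teqSub2 XT t UT hax _ hY f g hl hlg hJ h1 h2 hargs =>
      obtain ⟨k, rfl⟩ := hJ.pos
      obtain ⟨hn, hp, _⟩ := hJ.sort_of_term.sort_wf
      refine .inr (.inr (.inr (.inr (.inr (.inr ⟨XT, t, UT, tup XT f, tup XT g, hax, hJ, ?_, ?_,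
        rfl, h1, h2, fun P1 z Z hd => morEq_tup hn hp hl hlg hargs hd⟩)))))
      · rw [← tup_map hn hl]
      · rw [← tup_map hn hlg]

/-! ## Canonical sorts -/

theorem canonSort_var {X : PreCtx A} {x : A.Var} {U : SortE A} :
    CanonSort Ax X (.var x) U ↔ ∃ P, Decl X P x U := by
  constructor
  · generalize hu : Expr.var x = u
    intro h
    cases h with
    | var hi =>
      simp only [Expr.var.injEq] at hu
      subst hu
      exact ⟨_, decl_getElem hi⟩
    | app hax => simp at hu
  · rintro ⟨P, hd⟩
    obtain ⟨i, hi, rfl, rfl, rfl⟩ := hd.getElem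
    exact .var hi

theorem canonSort_app {X : PreCtx A} {t : A.TermSym} {ts : List (Expr A)} {U : SortE A} :
    CanonSort Ax X (.app t ts) U ↔
      ∃ XT V, introTerm XT t V ∈ Ax ∧ U = V.subst (tup XT ts) := by
  constructor
  · generalize hu : Expr.app t ts = u
    intro h
    cases h with
    | var hi => simp at hu
    | app hax =>
      simp only [Expr.app.injEq] at hu
      obtain ⟨rfl, rfl⟩ := hu
      exact ⟨_, _, hax, rfl⟩
  · rintro ⟨XT, V, hax, rfl⟩
    exact .app hax

theorem CanonSort.mono {P X : PreCtx A} (hPX : P <+: X) {u : Expr A} {U : SortE A}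
    (h : CanonSort Ax P u U) : CanonSort Ax X u U := by
  cases u with
  | var x =>
    obtain ⟨P0, hd⟩ := canonSort_var.1 h
    exact canonSort_var.2 ⟨P0, hd.mono hPX⟩
  | app t ts => exact canonSort_app.2 (canonSort_app.1 h)

theorem introTerm_unique (hA : IsPretheory Ax) {t : A.TermSym} {X X' : PreCtx A} {U U' : SortE A}
    (h : introTerm X t U ∈ Ax) (h' : introTerm X' t U' ∈ Ax) : X = X' ∧ U = U' := by
  have := (hA.term_intro t).unique (y₁ := (X, U)) (y₂ := (X', U')) h h'
  simpa using this

theorem CanonSort.uniq (hA : IsPretheory Ax) {X : PreCtx A} (hn : (names X).Nodup)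
    {u : Expr A} {U U' : SortE A} (h : CanonSort Ax X u U) (h' : CanonSort Ax X u U') :
    U = U' := by
  cases u with
  | var x =>
    obtain ⟨P, hd⟩ := canonSort_var.1 h
    obtain ⟨P', hd'⟩ := canonSort_var.1 h'
    exact (hd.uniq hn hd').2
  | app t ts =>
    obtain ⟨XT, V, hax, rfl⟩ := canonSort_app.1 h
    obtain ⟨XT', V', hax', rfl⟩ := canonSort_app.1 h'
    obtain ⟨rfl, rfl⟩ := introTerm_unique hA hax hax'
    rfl

theorem subst_tup_map {X : PreCtx A} {U : SortE A} (hU : ∀ v, SOccurs v U → v ∈ names X)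
    (F : A.Var → Expr A) : U.subst (tup X (X.map fun p => F p.1)) = U.subst F :=
  U.subst_congr fun v hv => mkSub_map X F (hU v hv)

/-- The axioms of a generalized algebraic theory introducing term symbols. -/
theorem IsGAT.introTerm_sort (hA : IsGAT Ax) {X : PreCtx A} {t : A.TermSym} {U : SortE A}
    (h : introTerm X t U ∈ Ax) : ∃ n, DerAt Ax n (.sort X U) := by
  obtain ⟨n, hn⟩ := hA.2 _ h
  obtain ⟨k, rfl⟩ := hn.pos
  exact ⟨k, hn.sort_of_term⟩

theorem IsGAT.introTerm_scoped (hA : IsGAT Ax) {X : PreCtx A} {t : A.TermSym} {U : SortE A}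
    (h : introTerm X t U ∈ Ax) : ∀ v, SOccurs v U → v ∈ names X := by
  obtain ⟨n, hn⟩ := hA.introTerm_sort h
  exact hn.sort_scoped hA.1.shaped

theorem canonSort_app_map (hA : IsGAT Ax) {X XT : PreCtx A} {t : A.TermSym} {UT : SortE A}
    (h : introTerm XT t UT ∈ Ax) (F : A.Var → Expr A) :
    CanonSort Ax X (.app t (XT.map fun p => F p.1)) (UT.subst F) :=
  canonSort_app.2 ⟨XT, UT, h, (subst_tup_map (hA.introTerm_scoped h) F).symm⟩

/-- A derivable term is derivable with its canonical sort, not later. -/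
theorem DerAt.canon (hA : IsGAT Ax) {n : ℕ} {X : PreCtx A} {u : Expr A} {U : SortE A}
    (h : DerAt Ax n (.term X u U)) :
    ∃ U0, CanonSort Ax X u U0 ∧ DerAt Ax n (.term X u U0) := by
  induction n generalizing U with
  | zero => exact h.elim
  | succ n ih =>
    rcases term_inv hA.1.shaped h with ⟨U0, _, h2⟩ | ⟨P, x, h1, rfl, h3⟩ |
      ⟨XT, t, UT, F, h1, h2, h3, rfl, rfl, h6, h7⟩
    · obtain ⟨U1, hc, hd⟩ := ih h2
      exact ⟨U1, hc, hd.succ⟩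
    · exact ⟨U, canonSort_var.2 ⟨P, h1⟩, h⟩
    · exact ⟨_, canonSort_app_map hA h1 F, h⟩

theorem Arg.canon (hA : IsGAT Ax) {n : ℕ} {P X : PreCtx A} {u : Expr A} {U : SortE A}
    (h : Arg Ax n P X u U) : ∃ U0, CanonSort Ax X u U0 ∧ Arg Ax n P X u U0 := by
  rcases h.2 with ⟨P0, h0, hd⟩ | ⟨P0, x, h0, hd, rfl, hs⟩
  · obtain ⟨U0, hc, hd⟩ := hd.canon hA
    exact ⟨U0, hc.mono (h0.trans h.1), h.1, Or.inl ⟨P0, h0, hd⟩⟩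
  · exact ⟨U, canonSort_var.2 ⟨_, hd⟩, h⟩

/-- Analysis of a derivable compound term, disregarding its sort. -/
theorem DerAt.app_inv (hA : Shaped Ax) {n : ℕ} {P : PreCtx A} {t : A.TermSym}
    {ts : List (Expr A)} {U : SortE A} (h : DerAt Ax (n + 1) (.term P (.app t ts) U)) :
    ∃ XT UT F, introTerm XT t UT ∈ Ax ∧ DerAt Ax (n + 1) (introTerm XT t UT) ∧
      DerAt Ax n (.sort XT UT) ∧ ts = XT.map (fun p => F p.1) ∧
      MorAt Ax n P XT F ∧ DerAt Ax n (.sort P (UT.subst F)) := by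
  induction n generalizing U with
  | zero =>
    rcases term_inv hA h with ⟨U0, h1, _⟩ | ⟨P, x, h1, h2, h3⟩ |
      ⟨XT, t, UT, F, h1, h2, h3, h4, h5, h6, h7⟩
    · exact h1.elim
    · exact h3.elim
    · exact h7.elim
  | succ n ih =>
    rcases term_inv hA h with ⟨U0, _, h2⟩ | ⟨P, x, h1, h2, h3⟩ |
      ⟨XT, t, UT, F, h1, h2, h3, h4, rfl, h6, h7⟩
    · obtain ⟨XT, UT, F, h1, h2, h3, h4, h5, h6⟩ := ih h2
      exact ⟨XT, UT, F, h1, h2.succ, h3.succ, h4, h5.mono (Nat.le_succ _), h6.succ⟩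
    · simp at h2
    · simp only [Expr.app.injEq] at h4
      obtain ⟨rfl, rfl⟩ := h4
      exact ⟨XT, UT, F, h1, h2, h3, rfl, h6, h7⟩

theorem Arg.term_of_app {n : ℕ} {P X : PreCtx A} {t : A.TermSym}
    {ts : List (Expr A)} {U : SortE A} (h : Arg Ax n P X (.app t ts) U) :
    ∃ P0, P0 <+: P ∧ DerAt Ax n (.term P0 (.app t ts) U) := by
  rcases h.2 with h | ⟨P0, x, h0, hd, h, hs⟩
  · exact h
  · simp at h

end Inversion

end GATPaper

namespace GATPaper

/-! ## Interpretations of pairs of theories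

The tensor operations are analysed in a setting symmetric under exchanging the two theories:
a `Dom` interprets the symbols of the tensor alphabet as operations on matrices. -/

/-- A pair of generalized algebraic theories with a target in which the symbols of the tensor
alphabet are interpreted. -/
structure Dom where
  A : Alphabet
  B : Alphabet
  TA : Set (Judg A)
  TB : Set (Judg B)
  hA : IsGAT TA
  hB : IsGAT TB
  chA : PreCtx A → A.Var
  chB : PreCtx B → B.Var
  hchA : FreshCh chA
  hchB : FreshCh chB
  Tm : Type
  Ty : Type
  TyEq : Ty → Ty → Prop
  TmEq : Ty → Tm → Tm → Prop
  ty_symm : ∀ {V W}, TyEq V W → TyEq W V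
  ty_trans : ∀ {V W Z}, TyEq V W → TyEq W Z → TyEq V Z
  tm_symm : ∀ {W a b}, TmEq W a b → TmEq W b a
  tm_trans : ∀ {W a b c}, TmEq W a b → TmEq W b c → TmEq W a c
  conv : ∀ {V W a b}, TyEq V W → TmEq V a b → TmEq W a b
  ss : A.SortSym → B.SortSym → ℕ → ℕ → (ℕ → ℕ → Tm) → Ty
  st : A.SortSym → B.TermSym → ℕ → ℕ → (ℕ → ℕ → Tm) → Tm
  ts : A.TermSym → B.SortSym → ℕ → ℕ → (ℕ → ℕ → Tm) → Tm

namespace Dom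

/-- Exchanging the two theories transposes all matrices. -/
@[reducible] def swap (D : Dom) : Dom where
  A := D.B
  B := D.A
  TA := D.TB
  TB := D.TA
  hA := D.hB
  hB := D.hA
  chA := D.chB
  chB := D.chA
  hchA := D.hchB
  hchB := D.hchA
  Tm := D.Tm
  Ty := D.Ty
  TyEq := D.TyEq
  TmEq := D.TmEq
  ty_symm := D.ty_symm
  ty_trans := D.ty_trans
  tm_symm := D.tm_symm
  tm_trans := D.tm_trans
  conv := D.conv
  ss S T m n M := D.ss T S n m fun i j => M j i
  st S t m n M := D.ts t S n m fun i j => M j i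
  ts s T m n M := D.st T s n m fun i j => M j i

variable {D : Dom}

/-- Values of pairs of variables. -/
abbrev Env (D : Dom) := D.A.Var → D.B.Var → D.Tm

/-- Transposed values. -/
def Env.tr (σ : D.Env) : D.swap.Env := fun y x => σ x y

/-- A matrix all of whose entries are related to the corresponding entries of two lists. -/
def Mat {α β γ : Type} (Q : α → β → γ → Prop) (us : List α) (vs : List β) (M : ℕ → ℕ → γ) :
    Prop :=
  ∀ i (hi : i < us.length), ∀ j (hj : j < vs.length), Q (us[i]'hi) (vs[j]'hj) (M i j)

theorem Mat.imp {α β γ : Type} {Q Q' : α → β → γ → Prop} {us : List α} {vs : List β}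
    {M : ℕ → ℕ → γ} (h : Mat Q us vs M)
    (hQ : ∀ u ∈ us, ∀ v ∈ vs, ∀ e, Q u v e → Q' u v e) : Mat Q' us vs M :=
  fun i hi j hj => hQ _ (List.getElem_mem _) _ (List.getElem_mem _) _ (h i hi j hj)

theorem Mat.tr {α β γ : Type} {Q : α → β → γ → Prop} {us : List α} {vs : List β}
    {M : ℕ → ℕ → γ} (h : Mat Q us vs M) :
    Mat (fun v u e => Q u v e) vs us fun i j => M j i :=
  fun i hi j hj => h j hj i hi

theorem Mat.left {α β γ : Type} {Q : α → β → γ → Prop} {us us' : List α} {vs : List β}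
    {M : ℕ → ℕ → γ} (h : Mat Q (us ++ us') vs M) : Mat Q us vs M := by
  intro i hi j hj
  have := h i (by simp; omega) j hj
  rwa [List.getElem_append_left hi] at this

theorem mat_exists {α β γ : Type} {Q : α → β → γ → Prop} {us : List α} {vs : List β}
    (h : ∀ u ∈ us, ∀ v ∈ vs, ∃ e, Q u v e) (e0 : γ) : ∃ M, Mat Q us vs M := by
  classical
  refine ⟨fun i j => if h : ∃ (hi : i < us.length) (hj : j < vs.length), ∃ e, Q us[i] vs[j] e
    then h.choose_spec.choose_spec.choose else e0, ?_⟩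
  intro i hi j hj
  have : ∃ (hi : i < us.length) (hj : j < vs.length), ∃ e, Q us[i] vs[j] e :=
    ⟨hi, hj, h _ (List.getElem_mem _) _ (List.getElem_mem _)⟩
  simp only [this, dite_true]
  exact this.choose_spec.choose_spec.choose_spec

/-- `D.Ev σ X Y u v e`: the term `e` is a value of `u ⊗ v`. On a pair of compound terms both
ways of computing the tensor product are allowed. -/
inductive Ev (D : Dom) (σ : D.Env) (X : PreCtx D.A) (Y : PreCtx D.B) :
    Expr D.A → Expr D.B → D.Tm → Prop where
  | vv {x : D.A.Var} {y : D.B.Var} (hx : x ∈ names X) (hy : y ∈ names Y) :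
      Ev D σ X Y (.var x) (.var y) (σ x y)
  | L {u : Expr D.A} {S : D.A.SortSym} {ss : List (Expr D.A)} {t : D.B.TermSym}
      {ts : List (Expr D.B)} {M : ℕ → ℕ → D.Tm} (hc : CanonSort D.TA X u ⟨S, ss⟩)
      (hM : ∀ i (hi : i < (ss ++ [u]).length), ∀ j (hj : j < ts.length),
        Ev D σ X Y ((ss ++ [u])[i]'hi) (ts[j]'hj) (M i j)) :
      Ev D σ X Y u (.app t ts) (D.st S t (ss.length + 1) ts.length M)
  | R {v : Expr D.B} {T : D.B.SortSym} {ts : List (Expr D.B)} {s : D.A.TermSym}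
      {h : List (Expr D.A)} {M : ℕ → ℕ → D.Tm} (hc : CanonSort D.TB Y v ⟨T, ts⟩)
      (hM : ∀ i (hi : i < h.length), ∀ j (hj : j < (ts ++ [v]).length),
        Ev D σ X Y (h[i]'hi) ((ts ++ [v])[j]'hj) (M i j)) :
      Ev D σ X Y (.app s h) v (D.ts s T h.length (ts.length + 1) M)

theorem Ev.mono {σ : D.Env} {X X' : PreCtx D.A} {Y Y' : PreCtx D.B} (hX : X <+: X')
    (hY : Y <+: Y') {u v e} (h : D.Ev σ X Y u v e) : D.Ev σ X' Y' u v e := by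
  induction h with
  | vv hx hy => exact .vv (names_mono hX hx) (names_mono hY hy)
  | L hc _ ih => exact .L (hc.mono hX) ih
  | R hc _ ih => exact .R (hc.mono hY) ih

theorem Ev.congr {σ σ' : D.Env} {X : PreCtx D.A} {Y : PreCtx D.B}
    (hσ : ∀ x ∈ names X, ∀ y ∈ names Y, σ x y = σ' x y) {u v e} (h : D.Ev σ X Y u v e) :
    D.Ev σ' X Y u v e := by
  induction h with
  | vv hx hy => rw [hσ _ hx _ hy]; exact .vv hx hy
  | L hc _ ih => exact .L hc ih
  | R hc _ ih => exact .R hc ih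

theorem Ev.tr {σ : D.Env} {X : PreCtx D.A} {Y : PreCtx D.B} {u v e}
    (h : D.Ev σ X Y u v e) : D.swap.Ev σ.tr Y X v u e := by
  induction h with
  | vv hx hy => exact Ev.vv (D := D.swap) (σ := Env.tr _) hy hx
  | @L u S ss t ts M hc _ ih =>
    exact Ev.R (D := D.swap) (σ := Env.tr _) (M := fun i j => M j i) hc
      fun i hi j hj => ih j hj i hi
  | @R v T ts s h M hc _ ih =>
    exact Ev.L (D := D.swap) (σ := Env.tr _) (M := fun i j => M j i) hc
      fun i hi j hj => ih j hj i hi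

/-- Values computed by recursion on a compound term of the second theory. -/
def EvL (D : Dom) (σ : D.Env) (X : PreCtx D.A) (Y : PreCtx D.B) (u : Expr D.A) (v : Expr D.B)
    (e : D.Tm) : Prop :=
  ∃ S ss t ts M, v = .app t ts ∧ CanonSort D.TA X u ⟨S, ss⟩ ∧
    Mat (D.Ev σ X Y) (ss ++ [u]) ts M ∧ e = D.st S t (ss.length + 1) ts.length M

/-- Values computed by recursion on a compound term of the first theory. -/
def EvR (D : Dom) (σ : D.Env) (X : PreCtx D.A) (Y : PreCtx D.B) (u : Expr D.A) (v : Expr D.B)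
    (e : D.Tm) : Prop := D.swap.EvL σ.tr Y X v u e

theorem EvL.ev {σ : D.Env} {X : PreCtx D.A} {Y : PreCtx D.B} {u v e}
    (h : D.EvL σ X Y u v e) : D.Ev σ X Y u v e := by
  obtain ⟨S, ss, t, ts, M, rfl, hc, hM, rfl⟩ := h
  exact .L hc hM

theorem EvR.ev {σ : D.Env} {X : PreCtx D.A} {Y : PreCtx D.B} {u v e}
    (h : D.EvR σ X Y u v e) : D.Ev σ X Y u v e := (EvL.ev h).tr

theorem ev_cases {σ : D.Env} {X : PreCtx D.A} {Y : PreCtx D.B} {u v e}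
    (h : D.Ev σ X Y u v e) :
    (∃ x y, u = .var x ∧ v = .var y ∧ x ∈ names X ∧ y ∈ names Y ∧ e = σ x y) ∨
      D.EvL σ X Y u v e ∨ D.EvR σ X Y u v e := by
  cases h with
  | vv hx hy => exact .inl ⟨_, _, rfl, rfl, hx, hy, rfl⟩
  | L hc hM => exact .inr (.inl ⟨_, _, _, _, _, rfl, hc, hM, rfl⟩)
  | @R v T ts s h M hc hM =>
    exact .inr (.inr ⟨T, ts, s, h, fun i j => M j i, rfl, hc, fun i hi j hj => (hM j hj i hi).tr,
      rfl⟩)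

/-- A matrix of values for the sort expression `U ⊗ V`, with respect to `u : U` and `v : V`. The
sort `U` lives in `P` and `u` in `X`; likewise for `V`, `R`, `v`, `Y`. -/
def TyMat {α β γ : Type} (Q : PreCtx D.A → PreCtx D.B → α → β → γ → Prop)
    (P X : PreCtx D.A) (R Y : PreCtx D.B) (us : List α) (u : α) (vs : List β) (v : β)
    (M : ℕ → ℕ → γ) : Prop :=
  Mat (Q X R) (us ++ [u]) vs M ∧ Mat (Q P Y) us (vs ++ [v]) M

/-- The sort `U ⊗ V` with a prescribed matrix of arguments. -/
def tyOf (D : Dom) (U : SortE D.A) (V : SortE D.B) (M : ℕ → ℕ → D.Tm) : D.Ty :=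
  D.ss U.head V.head (U.args.length + 1) (V.args.length + 1) M

/-- `W` is a value of the sort `U ⊗ V`. -/
def EvTy (D : Dom) (σ : D.Env) (P X : PreCtx D.A) (R Y : PreCtx D.B) (u : Expr D.A)
    (U : SortE D.A) (v : Expr D.B) (V : SortE D.B) (W : D.Ty) : Prop :=
  ∃ M, W = D.tyOf U V M ∧ TyMat (D.Ev σ) P X R Y U.args u V.args v M

theorem EvTy.mono {σ : D.Env} {P X P' X' : PreCtx D.A} {R Y R' Y' : PreCtx D.B}
    (hP : P <+: P') (hX : X <+: X') (hR : R <+: R') (hY : Y <+: Y') {u U v V W}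
    (h : D.EvTy σ P X R Y u U v V W) : D.EvTy σ P' X' R' Y' u U v V W := by
  obtain ⟨M, rfl, h1, h2⟩ := h
  exact ⟨M, rfl, h1.imp fun _ _ _ _ _ h => h.mono hX hR, h2.imp fun _ _ _ _ _ h => h.mono hP hY⟩

theorem EvTy.congr {σ σ' : D.Env} {P X : PreCtx D.A} {R Y : PreCtx D.B}
    (h1 : ∀ x ∈ names X, ∀ y ∈ names R, σ x y = σ' x y)
    (h2 : ∀ x ∈ names P, ∀ y ∈ names Y, σ x y = σ' x y) {u U v V W}
    (h : D.EvTy σ P X R Y u U v V W) : D.EvTy σ' P X R Y u U v V W := by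
  obtain ⟨M, rfl, h3, h4⟩ := h
  exact ⟨M, rfl, h3.imp fun _ _ _ _ _ h => h.congr h1, h4.imp fun _ _ _ _ _ h => h.congr h2⟩

theorem EvTy.tr {σ : D.Env} {P X : PreCtx D.A} {R Y : PreCtx D.B} {u U v V W}
    (h : D.EvTy σ P X R Y u U v V W) : D.swap.EvTy σ.tr R Y P X v V u U W := by
  obtain ⟨M, rfl, h1, h2⟩ := h
  exact ⟨fun i j => M j i, rfl, fun i hi j hj => (h2 j hj i hi).tr,
    fun i hi j hj => (h1 j hj i hi).tr⟩

/-- The two environments agree on `X ⊗ Y`, up to derivable equality. -/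
def CtxRel (D : Dom) (σ σ' : D.Env) (X : PreCtx D.A) (Y : PreCtx D.B) : Prop :=
  (names X).Nodup ∧ (names Y).Nodup ∧ ∀ P x U R y V, Decl X P x U → Decl Y R y V →
    ∃ W, D.EvTy σ P (P ++ [(x, U)]) R (R ++ [(y, V)]) (.var x) U (.var y) V W ∧
      D.TmEq W (σ x y) (σ' x y)

theorem CtxRel.mono {σ σ' : D.Env} {X X' : PreCtx D.A} {Y Y' : PreCtx D.B}
    (h : D.CtxRel σ σ' X Y) (hX : X' <+: X) (hY : Y' <+: Y) : D.CtxRel σ σ' X' Y' :=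
  ⟨nodup_of_isPre hX h.1, nodup_of_isPre hY h.2.1,
    fun P x U R y V h1 h2 => h.2.2 P x U R y V (h1.mono hX) (h2.mono hY)⟩

theorem CtxRel.refl {σ σ' : D.Env} {X : PreCtx D.A} {Y : PreCtx D.B}
    (h : D.CtxRel σ σ' X Y) : D.CtxRel σ σ X Y :=
  ⟨h.1, h.2.1, fun P x U R y V h1 h2 =>
    let ⟨W, hW, he⟩ := h.2.2 P x U R y V h1 h2
    ⟨W, hW, D.tm_trans he (D.tm_symm he)⟩⟩

theorem CtxRel.tr {σ σ' : D.Env} {X : PreCtx D.A} {Y : PreCtx D.B}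
    (h : D.CtxRel σ σ' X Y) : D.swap.CtxRel σ.tr σ'.tr Y X :=
  ⟨h.2.1, h.1, fun P x U R y V h1 h2 =>
    let ⟨W, hW, he⟩ := h.2.2 R y V P x U h2 h1
    ⟨W, hW.tr, he⟩⟩

theorem CtxRel.congr {σ σ' τ τ' : D.Env} {X : PreCtx D.A} {Y : PreCtx D.B}
    (h : D.CtxRel σ σ' X Y) (h1 : ∀ x ∈ names X, ∀ y ∈ names Y, σ x y = τ x y)
    (h2 : ∀ x ∈ names X, ∀ y ∈ names Y, σ' x y = τ' x y) : D.CtxRel τ τ' X Y := by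
  refine ⟨h.1, h.2.1, fun P x U R y V hx hy => ?_⟩
  obtain ⟨W, hW, he⟩ := h.2.2 P x U R y V hx hy
  refine ⟨W, hW.congr ?_ ?_, ?_⟩
  · intro a ha b hb
    exact h1 a (names_mono hx ha) b (names_mono hy.isPre hb)
  · intro a ha b hb
    exact h1 a (names_mono hx.isPre ha) b (names_mono hy hb)
  · rwa [← h1 x hx.mem y hy.mem, ← h2 x hx.mem y hy.mem]

/-- `e0` is equal to all values of `u ⊗ v`, at its canonical sort. -/
def Near (D : Dom) (σ : D.Env) (X : PreCtx D.A) (Y : PreCtx D.B) (u : Expr D.A) (v : Expr D.B)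
    (e0 : D.Tm) : Prop :=
  ∀ U V W e, CanonSort D.TA X u U → CanonSort D.TB Y v V → D.EvTy σ X X Y Y u U v V W →
    D.Ev σ X Y u v e → D.TmEq W e0 e

theorem Near.anti {σ : D.Env} {X X' : PreCtx D.A} {Y Y' : PreCtx D.B} {u v e0}
    (h : D.Near σ X' Y' u v e0) (hX : X <+: X') (hY : Y <+: Y') : D.Near σ X Y u v e0 :=
  fun U V W e hU hV hW he =>
    h U V W e (hU.mono hX) (hV.mono hY) (hW.mono hX hX hY hY) (he.mono hX hY)

theorem Near.tr {σ : D.Env} {X : PreCtx D.A} {Y : PreCtx D.B} {u v e0}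
    (h : D.Near σ X Y u v e0) : D.swap.Near σ.tr Y X v u e0 :=
  fun U V W e hU hV hW he => h V U W e hV hU hW.tr he.tr

theorem Near.congr {σ σ' : D.Env} {X : PreCtx D.A} {Y : PreCtx D.B} {u v e0}
    (h : D.Near σ X Y u v e0) (hσ : ∀ x ∈ names X, ∀ y ∈ names Y, σ x y = σ' x y) :
    D.Near σ' X Y u v e0 := by
  have h' : ∀ x ∈ names X, ∀ y ∈ names Y, σ' x y = σ x y := fun x hx y hy => (hσ x hx y hy).symm
  exact fun U V W e hU hV hW he => h U V W e hU hV (hW.congr h' h') (he.congr h')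

theorem TyMat.tr {Q : PreCtx D.A → PreCtx D.B → Expr D.A → Expr D.B → D.Tm → Prop}
    {P X : PreCtx D.A} {R Y : PreCtx D.B} {us u vs v M} (h : TyMat (D := D) Q P X R Y us u vs v M) :
    TyMat (D := D.swap) (fun Y X v u e => Q X Y u v e) R Y P X vs v us u fun i j => M j i :=
  ⟨h.2.tr, h.1.tr⟩

end Dom

/-- `U` is a sort over an initial segment of `P`. -/
def SortAt {A : Alphabet} (Ax : Set (Judg A)) (n : ℕ) (P : PreCtx A) (U : SortE A) : Prop :=
  ∃ P0, P0 <+: P ∧ DerAt Ax n (.sort P0 U)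

/-- `u` is a term over an initial segment of `X`, or one of the declared variables. -/
def Has {A : Alphabet} (Ax : Set (Judg A)) (n : ℕ) (X : PreCtx A) (u : Expr A) : Prop :=
  ∃ U, Arg Ax n X X u U

section Has

variable {A : Alphabet} {Ax : Set (Judg A)}

theorem Has.mono {n m : ℕ} (hnm : n ≤ m) {X X' : PreCtx A} (hX : X <+: X') {u : Expr A}
    (h : Has Ax n X u) : Has Ax m X' u :=
  let ⟨U, hU⟩ := h
  ⟨U, hU.mono hnm hX hX (List.prefix_refl _)⟩

theorem Arg.has {n : ℕ} {P X : PreCtx A} {u : Expr A} {U : SortE A} (h : Arg Ax n P X u U) :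
    Has Ax n X u := ⟨U, h.mono le_rfl h.1 (List.prefix_refl _) (List.prefix_refl _)⟩

theorem Arg.sortAt {n : ℕ} {P X : PreCtx A} {u : Expr A} {U : SortE A} (h : Arg Ax n P X u U) :
    SortAt Ax n P U := h.sort

theorem SortAt.mono {n m : ℕ} (hnm : n ≤ m) {P P' : PreCtx A} (hP : P <+: P') {U : SortE A}
    (h : SortAt Ax n P U) : SortAt Ax m P' U :=
  let ⟨P0, h0, hs⟩ := h
  ⟨P0, h0.trans hP, hs.mono hnm⟩

theorem SortAt.args (hAx : Shaped Ax) {n : ℕ} {P : PreCtx A} {U : SortE A}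
    (h : SortAt Ax (n + 1) P U) {e : Expr A} (he : e ∈ U.args) : Has Ax n P e := by
  obtain ⟨P0, h0, hs⟩ := h
  obtain ⟨XS, F, h1, h2, h3, h4⟩ := sort_inv hAx (S := U.head) (ss := U.args) hs
  rw [h3] at he
  obtain ⟨p, hp, rfl⟩ := List.mem_map.1 he
  obtain ⟨P1, Z, hd⟩ := exists_decl (List.mem_map_of_mem (f := Prod.fst) hp)
  exact ⟨_, (Arg.of_term h0 (h4 _ _ _ hd)).mono le_rfl h0 (List.prefix_refl _)
    (List.prefix_refl _)⟩

theorem Has.app_args (hAx : Shaped Ax) {n : ℕ} {X : PreCtx A} {t : A.TermSym}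
    {ts : List (Expr A)} (h : Has Ax (n + 1) X (.app t ts)) {e : Expr A} (he : e ∈ ts) :
    Has Ax n X e := by
  obtain ⟨U, hU⟩ := h
  obtain ⟨P0, h0, hd⟩ := hU.term_of_app
  obtain ⟨XT, UT, F, h1, h2, h3, rfl, h5, h6⟩ := hd.app_inv hAx
  obtain ⟨p, hp, rfl⟩ := List.mem_map.1 he
  obtain ⟨P1, Z, hd⟩ := exists_decl (List.mem_map_of_mem (f := Prod.fst) hp)
  exact ⟨_, (Arg.of_term h0 (h5 _ _ _ hd)).mono le_rfl h0 (List.prefix_refl _)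
    (List.prefix_refl _)⟩

theorem Has.canon (hA : IsGAT Ax) {n : ℕ} {X : PreCtx A} {u : Expr A} (h : Has Ax n X u) :
    ∃ U, CanonSort Ax X u U ∧ Arg Ax n X X u U :=
  let ⟨_, hU⟩ := h
  hU.canon hA

theorem Has.canon_arg (hA : IsGAT Ax) {n : ℕ} {X : PreCtx A} (hn : (names X).Nodup) {u : Expr A}
    (h : Has Ax n X u) {U : SortE A} (hc : CanonSort Ax X u U) : Arg Ax n X X u U := by
  obtain ⟨U', hc', ha⟩ := h.canon hA
  rwa [hc.uniq hA.1 hn hc']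

theorem Has.pos {n : ℕ} {X : PreCtx A} {u : Expr A} (h : Has Ax n X u) : ∃ k, n = k + 1 :=
  let ⟨_, hU⟩ := h
  hU.pos

theorem Has.var_mem {n : ℕ} {X : PreCtx A} {x : A.Var} (hAx : Shaped Ax) (h : Has Ax n X (.var x)) :
    x ∈ names X := by
  obtain ⟨U, hX, ⟨P0, h0, hd⟩ | ⟨P0, y, h0, hd, hu, _⟩⟩ := h
  · exact names_mono h0 (hd.term_scoped hAx x .var)
  · simp only [Expr.var.injEq] at hu
    subst hu
    exact hd.mem

end Has

namespace Dom

variable {D : Dom}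

theorem ev_total (σ : D.Env) {n m : ℕ} {X : PreCtx D.A} {Y : PreCtx D.B} {u v}
    (hu : Has D.TA n X u) (hv : Has D.TB m Y v) : ∃ e, D.Ev σ X Y u v e := by
  induction hk : n + m using Nat.strong_induction_on generalizing n m u v with
  | _ k ih =>
    obtain ⟨n, rfl⟩ := hu.pos
    obtain ⟨m, rfl⟩ := hv.pos
    have hA := D.hA.1.shaped
    have hB := D.hB.1.shaped
    by_cases hvv : ∃ x y, u = .var x ∧ v = .var y
    · obtain ⟨x, y, rfl, rfl⟩ := hvv
      exact ⟨_, .vv (hu.var_mem hA) (hv.var_mem hB)⟩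
    · cases v with
      | app t ts =>
        obtain ⟨⟨S, ss⟩, hc, ha⟩ := hu.canon D.hA
        by_cases hts : ts = []
        · subst hts
          cases u with
          | var x => exact ⟨_, Ev.L (M := fun _ y => σ x (D.chB [])) hc fun i hi j hj => by simp at hj⟩
          | app s h =>
            exact ⟨_, Ev.L (M := fun _ y => σ (D.chA []) (D.chB [])) hc
              fun i hi j hj => by simp at hj⟩
        · obtain ⟨M, hM⟩ := mat_exists (Q := D.Ev σ X Y) (us := ss ++ [u]) (vs := ts) (by
            intro a ha' b hb
            have hb' := hv.app_args hB hb
            rcases List.mem_append.1 ha' with ha' | ha'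
            · exact ih _ (by omega) (ha.sortAt.args hA (U := ⟨S, ss⟩) ha') hb' rfl
            · simp only [List.mem_singleton] at ha'
              subst ha'
              exact ih _ (by omega) hu hb' rfl) (σ (D.chA []) (D.chB []))
          exact ⟨_, .L hc hM⟩
      | var y =>
        cases u with
        | var x => exact absurd ⟨x, y, rfl, rfl⟩ hvv
        | app s h =>
          obtain ⟨⟨T, ts⟩, hc, ha⟩ := hv.canon D.hB
          obtain ⟨M, hM⟩ := mat_exists (Q := D.Ev σ X Y) (us := h) (vs := ts ++ [.var y]) (by
            intro b hb a ha'
            have hb' := hu.app_args hA hb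
            rcases List.mem_append.1 ha' with ha' | ha'
            · exact ih _ (by omega) hb' (ha.sortAt.args hB (U := ⟨T, ts⟩) ha') rfl
            · simp only [List.mem_singleton] at ha'
              subst ha'
              exact ih _ (by omega) hb' hv rfl) (σ (D.chA []) (D.chB []))
          exact ⟨_, .R hc hM⟩

theorem evTy_total (σ : D.Env) {n m : ℕ} {P X : PreCtx D.A} {R Y : PreCtx D.B} {u U v V}
    (hu : Arg D.TA n P X u U) (hv : Arg D.TB m R Y v V) :
    ∃ W, D.EvTy σ P X R Y u U v V W := by
  obtain ⟨n, rfl⟩ := hu.pos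
  obtain ⟨m, rfl⟩ := hv.pos
  have hA := D.hA.1.shaped
  have hB := D.hB.1.shaped
  have e0 := σ (D.chA []) (D.chB [])
  obtain ⟨M1, hM1⟩ := mat_exists (Q := D.Ev σ P R) (us := U.args) (vs := V.args) (fun a ha b hb =>
    ev_total σ (hu.sortAt.args hA ha) (hv.sortAt.args hB hb)) e0
  obtain ⟨M2, hM2⟩ := mat_exists (Q := D.Ev σ X R) (us := [u]) (vs := V.args) (fun a ha b hb => by
    rw [List.mem_singleton.1 ha]; exact ev_total σ hu.has (hv.sortAt.args hB hb)) e0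
  obtain ⟨M3, hM3⟩ := mat_exists (Q := D.Ev σ P Y) (us := U.args) (vs := [v]) (fun a ha b hb => by
    rw [List.mem_singleton.1 hb]; exact ev_total σ (hu.sortAt.args hA ha) hv.has) e0
  refine ⟨_, fun i j => if i < U.args.length then (if j < V.args.length then M1 i j else M3 i 0)
    else M2 0 j, rfl, ?_, ?_⟩
  · intro i hi j hj
    by_cases h : i < U.args.length
    · simp only [h, hj, if_true, List.getElem_append_left h]
      exact (hM1 i h j hj).mono hu.1 (List.prefix_refl _)
    · simp only [h, if_false]
      rw [List.getElem_append_right (by omega)]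
      simpa using hM2 0 (by simp) j hj
  · intro i hi j hj
    simp only [hi, if_true]
    by_cases h : j < V.args.length
    · simp only [h, if_true, List.getElem_append_left h]
      exact (hM1 i hi j h).mono (List.prefix_refl _) hv.1
    · simp only [h, if_false]
      rw [List.getElem_append_right (by omega)]
      simpa using hM3 i hi 0 (by simp)

end Dom
end GATPaper

namespace GATPaper

theorem Decl.ne {A : Alphabet} {X P : PreCtx A} {x z : A.Var} {U Z : SortE A}
    (hx : x ∉ names X) (h : Decl X P z Z) : z ≠ x := fun e => hx (e ▸ h.mem)

theorem nodup_snoc {A : Alphabet} {X : PreCtx A} (hn : (names X).Nodup) {x : A.Var}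
    (hx : x ∉ names X) (U : SortE A) : (names (X ++ [(x, U)])).Nodup := by
  rw [names, List.map_append]
  exact List.Nodup.append hn (by simp) (by simpa using hx)

theorem DerAt.arg {A : Alphabet} {Ax : Set (Judg A)} {n : ℕ} {X : PreCtx A} {u : Expr A}
    {U : SortE A} (h : DerAt Ax n (.term X u U)) : Arg Ax n X X u U :=
  Arg.of_term (List.prefix_refl _) h

theorem Arg.up {A : Alphabet} {Ax : Set (Judg A)} {n : ℕ} {P X : PreCtx A} {u : Expr A}
    {U : SortE A} (h : Arg Ax n P X u U) : Arg Ax n X X u U :=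
  h.mono le_rfl h.1 (List.prefix_refl _) (List.prefix_refl _)

theorem Arg.decl {A : Alphabet} {Ax : Set (Judg A)} {n : ℕ} {X P : PreCtx A} {x : A.Var}
    {U : SortE A} (hd : Decl X P x U) (hs : DerAt Ax n (.sort P U)) : Arg Ax n P (P ++ [(x, U)]) (.var x) U :=
  Arg.of_decl (decl_snoc_self P x U) hs

namespace Dom

variable {D : Dom}

theorem Mat.snoc_left {α β γ : Type} {Q : α → β → γ → Prop} {us : List α} {u : α} {vs : List β}
    {M : ℕ → ℕ → γ} (h : Mat Q us vs M)
    (hu : ∀ j (hj : j < vs.length), Q u vs[j] (M us.length j)) : Mat Q (us ++ [u]) vs M := by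
  intro i hi j hj
  by_cases h' : i < us.length
  · rw [List.getElem_append_left h']; exact h i h' j hj
  · have : i = us.length := by simp at hi; omega
    subst this
    simpa using hu j hj

theorem Mat.last {α β γ : Type} {Q : α → β → γ → Prop} {us : List α} {u : α} {vs : List β}
    {M : ℕ → ℕ → γ} (h : Mat Q (us ++ [u]) vs M) (j) (hj : j < vs.length) :
    Q u vs[j] (M us.length j) := by
  have := h us.length (by simp) j hj
  simpa using this

theorem Mat.map {α β γ α' β' : Type} {Q : α → β → γ → Prop} {us : List α'} {vs : List β'}
    {f : α' → α} {g : β' → β} {M : ℕ → ℕ → γ} :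
    Mat Q (us.map f) (vs.map g) M ↔ Mat (fun a b e => Q (f a) (g b) e) us vs M := by
  constructor
  · intro h i hi j hj
    have := h i (by simpa using hi) j (by simpa using hj)
    simp only [List.getElem_map] at this
    exact this
  · intro h i hi j hj
    simpa using h i (by simpa using hi) j (by simpa using hj)

/-- Substitutions `f`, `g` from `X1`, `Y1` to `X`, `Y`, and values `σ0` of the terms `f ⊗ g`. -/
structure SubHyp (D : Dom) (n m : ℕ) (σ : D.Env) (X : PreCtx D.A) (Y : PreCtx D.B)
    (f : D.A.Var → Expr D.A) (g : D.B.Var → Expr D.B) (σ0 : D.Env) (X1 : PreCtx D.A)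
    (Y1 : PreCtx D.B) : Prop where
  rel : D.CtxRel σ σ X Y
  srcA : ∀ {P z Z}, Decl X1 P z Z → DerAt D.TA n (.sort P Z)
  srcB : ∀ {P z Z}, Decl Y1 P z Z → DerAt D.TB m (.sort P Z)
  hf : ArgMor D.TA n X X1 f
  hg : ArgMor D.TB m Y Y1 g
  near : ∀ {z w}, z ∈ names X1 → w ∈ names Y1 → D.Near σ X Y (f z) (g w) (σ0 z w)

theorem SubHyp.mono {n m n' m' : ℕ} (hn : n ≤ n') (hm : m ≤ m') {σ X Y f g σ0 X1 Y1}
    (h : SubHyp D n m σ X Y f g σ0 X1 Y1) : SubHyp D n' m' σ X Y f g σ0 X1 Y1 :=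
  ⟨h.rel, fun hd => (h.srcA hd).mono hn, fun hd => (h.srcB hd).mono hm, h.hf.mono hn, h.hg.mono hm,
    h.near⟩

theorem SubHyp.restrict {n m : ℕ} {σ X Y f g σ0 X1 Y1 X2 Y2}
    (h : SubHyp D n m σ X Y f g σ0 X1 Y1) (hX : X2 <+: X1) (hY : Y2 <+: Y1) :
    SubHyp D n m σ X Y f g σ0 X2 Y2 :=
  ⟨h.rel, fun hd => h.srcA (hd.mono hX), fun hd => h.srcB (hd.mono hY),
    fun _ _ _ hd => h.hf _ _ _ (hd.mono hX), fun _ _ _ hd => h.hg _ _ _ (hd.mono hY),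
    fun hz hw => h.near (names_mono hX hz) (names_mono hY hw)⟩

theorem SubHyp.tr {n m : ℕ} {σ X Y f g σ0 X1 Y1} (h : SubHyp D n m σ X Y f g σ0 X1 Y1) :
    SubHyp D.swap m n σ.tr Y X g f σ0.tr Y1 X1 :=
  ⟨h.rel.tr, h.srcB, h.srcA, h.hg, h.hf, fun hw hz => (h.near hz hw).tr⟩

/-- Tensor products of sorts are well defined up to equality. -/
structure TyInv (D : Dom) (n m : ℕ) : Prop where
  ct : ∀ {σ P X R Y u U v V M0 W}, Arg D.TA n P X u U → Arg D.TB m R Y v V →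
    D.CtxRel σ σ X R → D.CtxRel σ σ P Y →
    TyMat (D.Near σ) P X R Y U.args u V.args v M0 → D.EvTy σ P X R Y u U v V W →
    D.TyEq (D.tyOf U V M0) W
  h1 : ∀ {σ σ' P X R Y u U v V W W'}, Arg D.TA n P X u U → Arg D.TB m R Y v V →
    D.CtxRel σ σ' X R → D.CtxRel σ σ' P Y →
    D.EvTy σ P X R Y u U v V W → D.EvTy σ' P X R Y u U v V W' → D.TyEq W' W

/-- Tensor products of sorts of given terms do not depend on the choice of the sorts. -/
structure ConvInv (D : Dom) (n m : ℕ) : Prop where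
  conv : ∀ {σ X Y u U Uc v V Vc W Wc}, Arg D.TA n X X u U → CanonSort D.TA X u Uc →
    Arg D.TB m Y Y v V → CanonSort D.TB Y v Vc → D.CtxRel σ σ X Y →
    D.EvTy σ X X Y Y u U v V W → D.EvTy σ X X Y Y u Uc v Vc Wc → D.TyEq W Wc

/-- Any two values of a tensor product of terms are equal. -/
structure ValInv (D : Dom) (n m : ℕ) : Prop where
  h2 : ∀ {σ σ' X Y u v e'}, Has D.TA n X u → Has D.TB m Y v → D.CtxRel σ σ' X Y →
    D.Ev σ' X Y u v e' → D.Near σ X Y u v e'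

/-- Tensor products of terms are well defined up to equality, and may be computed from their
entries. -/
structure TmInv (D : Dom) (n m : ℕ) : Prop extends ValInv D n m where
  cl : ∀ {σ X Y u S ss t ts M0}, D.CtxRel σ σ X Y → Arg D.TA n X X u ⟨S, ss⟩ →
    Has D.TB m Y (.app t ts) → Mat (D.Near σ X Y) (ss ++ [u]) ts M0 →
    D.Near σ X Y u (.app t ts) (D.st S t (ss.length + 1) ts.length M0)

/-- `v : V` over `R`, where `v` is a term over `Y = R` or the last variable of `Y`. -/
def ArgX {A : Alphabet} (Ax : Set (Judg A)) (m : ℕ) (R Y : PreCtx A) (v : Expr A) (V : SortE A) :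
    Prop :=
  (Y = R ∧ DerAt Ax m (.term R v V)) ∨
    ∃ y, y ∉ names R ∧ Y = R ++ [(y, V)] ∧ v = .var y ∧ DerAt Ax m (.sort R V)

/-- Tensor products of sorts respect derivable equality. -/
structure SrtInv (D : Dom) (n m : ℕ) : Prop where
  h3 : ∀ {σ P x U U' R Y v V W W'}, DerAt D.TA n (.sortEq P U U') → x ∉ names P →
    ArgX D.TB m R Y v V → D.CtxRel σ σ (P ++ [(x, U)]) R → D.CtxRel σ σ P Y →
    D.EvTy σ P (P ++ [(x, U)]) R Y (.var x) U v V W →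
    D.EvTy σ P (P ++ [(x, U')]) R Y (.var x) U' v V W' → D.TyEq W W'

/-- Tensor products respect derivable equality. -/
structure EqInv (D : Dom) (n m : ℕ) : Prop extends SrtInv D n m where
  h4 : ∀ {σ P x U U' R v V e'}, DerAt D.TA n (.sortEq P U U') → x ∉ names P →
    DerAt D.TB m (.term R v V) → D.CtxRel σ σ (P ++ [(x, U)]) R →
    D.Ev σ (P ++ [(x, U')]) R (.var x) v e' → D.Near σ (P ++ [(x, U)]) R (.var x) v e'
  h5 : ∀ {σ P u u' U Y v e'}, DerAt D.TA n (.termEq P u u' U) → Has D.TB m Y v →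
    D.CtxRel σ σ P Y → D.Ev σ P Y u' v e' → D.Near σ P Y u v e'

/-- All invariance properties up to the levels `n`, `m`. -/
structure Pack (D : Dom) (n m : ℕ) : Prop where
  ty : TyInv D n m
  ty' : TyInv D.swap m n
  cv : ConvInv D n m
  cv' : ConvInv D.swap m n
  tm : TmInv D n m
  tm' : TmInv D.swap m n
  eq : EqInv D n m
  eq' : EqInv D.swap m n

theorem Pack.swap {n m : ℕ} (h : Pack D n m) : Pack D.swap m n :=
  ⟨h.ty', h.ty, h.cv', h.cv, h.tm', h.tm, h.eq', h.eq⟩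

theorem ArgX.mono {A : Alphabet} {Ax : Set (Judg A)} {m m' : ℕ} (hm : m ≤ m') {R Y : PreCtx A}
    {v : Expr A} {V : SortE A} (h : ArgX Ax m R Y v V) : ArgX Ax m' R Y v V := by
  rcases h with ⟨h1, h2⟩ | ⟨y, h1, h2, h3, h4⟩
  · exact .inl ⟨h1, h2.mono hm⟩
  · exact .inr ⟨y, h1, h2, h3, h4.mono hm⟩

theorem ArgX.arg {A : Alphabet} {Ax : Set (Judg A)} {m : ℕ} {R Y : PreCtx A}
    {v : Expr A} {V : SortE A} (h : ArgX Ax m R Y v V) : Arg Ax m R Y v V := by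
  rcases h with ⟨rfl, h2⟩ | ⟨y, h1, rfl, rfl, h4⟩
  · exact h2.arg
  · exact Arg.of_decl (decl_snoc_self _ _ _) h4

theorem TyInv.mono {n m n' m' : ℕ} (hn : n ≤ n') (hm : m ≤ m') (h : TyInv D n' m') :
    TyInv D n m where
  ct hu hv := h.ct (hu.mono hn (List.prefix_refl _) (List.prefix_refl _) hu.1)
    (hv.mono hm (List.prefix_refl _) (List.prefix_refl _) hv.1)
  h1 hu hv := h.h1 (hu.mono hn (List.prefix_refl _) (List.prefix_refl _) hu.1)
    (hv.mono hm (List.prefix_refl _) (List.prefix_refl _) hv.1)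

theorem ConvInv.mono {n m n' m' : ℕ} (hn : n ≤ n') (hm : m ≤ m') (h : ConvInv D n' m') :
    ConvInv D n m where
  conv hu hc hv := h.conv (hu.mono hn (List.prefix_refl _) (List.prefix_refl _) hu.1) hc
    (hv.mono hm (List.prefix_refl _) (List.prefix_refl _) hv.1)

theorem TmInv.mono {n m n' m' : ℕ} (hn : n ≤ n') (hm : m ≤ m') (h : TmInv D n' m') :
    TmInv D n m where
  h2 hu hv := h.h2 (hu.mono hn (List.prefix_refl _)) (hv.mono hm (List.prefix_refl _))
  cl hr hu hv := h.cl hr (hu.mono hn (List.prefix_refl _) (List.prefix_refl _) hu.1)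
    (hv.mono hm (List.prefix_refl _))

theorem EqInv.mono {n m n' m' : ℕ} (hn : n ≤ n') (hm : m ≤ m') (h : EqInv D n' m') :
    EqInv D n m where
  h3 he hx hv := h.h3 (he.mono hn) hx (hv.mono hm)
  h4 he hx hv := h.h4 (he.mono hn) hx (hv.mono hm)
  h5 he hv := h.h5 (he.mono hn) (hv.mono hm (List.prefix_refl _))

theorem Pack.mono {n m n' m' : ℕ} (hn : n ≤ n') (hm : m ≤ m') (h : Pack D n' m') :
    Pack D n m :=
  ⟨h.ty.mono hn hm, h.ty'.mono hm hn, h.cv.mono hn hm, h.cv'.mono hm hn, h.tm.mono hn hm,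
    h.tm'.mono hm hn, h.eq.mono hn hm, h.eq'.mono hm hn⟩

/-! ### Substitution -/

theorem TmInv.cr {n m : ℕ} (h : TmInv D.swap m n) {σ X Y v T ts s hh M0}
    (hr : D.CtxRel σ σ X Y) (hv : Arg D.TB m Y Y v ⟨T, ts⟩) (hu : Has D.TA n X (.app s hh))
    (hM : Mat (D.Near σ X Y) hh (ts ++ [v]) M0) :
    D.Near σ X Y (.app s hh) v (D.ts s T hh.length (ts.length + 1) M0) :=
  (h.cl (M0 := fun i j => M0 j i) hr.tr hv hu fun i hi j hj => (hM j hj i hi).tr).tr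

/-- The canonical sort of a substituted term. -/
theorem ArgMor.canon {A : Alphabet} {Ax : Set (Judg A)} (hA : IsGAT Ax) {n : ℕ} {X X1 : PreCtx A}
    {f : A.Var → Expr A} (hf : ArgMor Ax n X X1 f) {u : Expr A} {U : SortE A}
    (hc : CanonSort Ax X1 u U) (hn : (names X).Nodup) (hu : Has Ax n X (u.subst f)) :
    Arg Ax n X X (u.subst f) (U.subst f) := by
  cases u with
  | var z =>
    obtain ⟨P, hP⟩ := canonSort_var.1 hc
    rw [Expr.subst_var]
    exact hf _ _ _ hP
  | app s h =>
    obtain ⟨XT, V, hax, rfl⟩ := canonSort_app.1 hc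
    obtain ⟨n, rfl⟩ := hu.pos
    obtain ⟨U', hU'⟩ := hu
    rw [Expr.subst_app] at hU'
    obtain ⟨P0, hP0, hd⟩ := hU'.term_of_app
    obtain ⟨XT', V', F, hax', hd', -, hh, hF, -⟩ := hd.app_inv hA.1.shaped
    obtain ⟨rfl, rfl⟩ := introTerm_unique hA.1 hax hax'
    have hl : h.length = XT.length := by simpa using congrArg List.length hh
    obtain ⟨k, hk⟩ := hd'.pos
    have hwf := (DerAt.sort_of_term (n := n) hd').sort_wf
    have e : (V.subst (tup XT h)).subst f = V.subst (tup XT (h.map (Expr.subst f))) := by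
      rw [SortE.subst_subst]
      refine SortE.subst_congr _ fun x hx => ?_
      obtain ⟨i, hi, rfl⟩ := List.mem_iff_getElem.1 (IsGAT.introTerm_scoped hA hax x hx)
      have hi' : i < XT.length := by simpa using hi
      simp only [List.getElem_map]
      rw [tup_getElem hwf.1 hl hi', tup_getElem hwf.1 (by simpa using hl) hi', List.getElem_map]
    rw [Expr.subst_app, e]
    exact Has.canon_arg hA hn ⟨_, hU'.up⟩ (canonSort_app.2 ⟨XT, V, hax, rfl⟩)

theorem sb {n m : ℕ} (hL : TmInv D n m) (hR : TmInv D.swap m n) {σ X Y f g σ0 X1 Y1}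
    (h : SubHyp D n m σ X Y f g σ0 X1 Y1) {u v e} (he : D.Ev σ0 X1 Y1 u v e)
    (hu : Has D.TA n X (u.subst f)) (hv : Has D.TB m Y (v.subst g)) :
    D.Near σ X Y (u.subst f) (v.subst g) e := by
  obtain ⟨n, rfl⟩ := hu.pos
  obtain ⟨m, rfl⟩ := hv.pos
  have hA := D.hA.1.shaped
  have hB := D.hB.1.shaped
  induction he with
  | vv hx hy => simpa using h.near hx hy
  | @L u S ss t ts M hc hM ih =>
    have ha := ArgMor.canon D.hA h.hf hc h.rel.1 hu
    rw [SortE.subst_mk] at ha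
    rw [Expr.subst_app] at hv ⊢
    have := hL.cl (M0 := M) h.rel ha hv (by
      rw [show ss.map (Expr.subst f) ++ [u.subst f] = (ss ++ [u]).map (Expr.subst f) by simp,
        Mat.map]
      intro i hi j hj
      refine ih i hi j hj ?_ ((hv.app_args hB (List.mem_map_of_mem (List.getElem_mem hj))).mono
        (Nat.le_succ _) (List.prefix_refl _))
      rcases List.mem_append.1 (List.getElem_mem hi) with hi' | hi'
      · exact (ha.sortAt.args hA (List.mem_map_of_mem hi')).mono
          (Nat.le_succ _) (List.prefix_refl _)
      · rw [List.mem_singleton.1 hi']; exact hu)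
    simpa using this
  | @R v T ts s hh M hc hM ih =>
    have ha := ArgMor.canon D.hB h.hg hc h.rel.2.1 hv
    rw [SortE.subst_mk] at ha
    rw [Expr.subst_app] at hu ⊢
    have := hR.cr (M0 := M) h.rel ha hu (by
      rw [show ts.map (Expr.subst g) ++ [v.subst g] = (ts ++ [v]).map (Expr.subst g) by simp,
        Mat.map]
      intro i hi j hj
      refine ih i hi j hj ((hu.app_args hA (List.mem_map_of_mem (List.getElem_mem hi))).mono
        (Nat.le_succ _) (List.prefix_refl _)) ?_
      rcases List.mem_append.1 (List.getElem_mem hj) with hj' | hj'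
      · exact (ha.sortAt.args hB (List.mem_map_of_mem hj')).mono
          (Nat.le_succ _) (List.prefix_refl _)
      · rw [List.mem_singleton.1 hj']; exact hv)
    simpa using this

theorem tySub {n m n1 m1 : ℕ} (hn : n ≤ n1 + 1) (hm : m ≤ m1 + 1) (hn' : n1 ≤ n) (hm' : m1 ≤ m)
    (hT : TyInv D n m)
    (hL1 : TmInv D n m1) (hR1 : TmInv D.swap m1 n) (hL2 : TmInv D n1 m) (hR2 : TmInv D.swap m n1)
    {σ P X R Y f g σ0 P1 X1 R1 Y1 u U v V W1 W2}
    (h1 : SubHyp D n m1 σ X R f g σ0 X1 R1) (h2 : SubHyp D n1 m σ P Y f g σ0 P1 Y1)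
    (hu : Arg D.TA n P X (u.subst f) (U.subst f)) (hv : Arg D.TB m R Y (v.subst g) (V.subst g))
    (hW1 : D.EvTy σ0 P1 X1 R1 Y1 u U v V W1)
    (hW2 : D.EvTy σ P X R Y (u.subst f) (U.subst f) (v.subst g) (V.subst g) W2) :
    D.TyEq W1 W2 := by
  obtain ⟨M, rfl, hM1, hM2⟩ := hW1
  have hA := D.hA.1.shaped
  have hB := D.hB.1.shaped
  have hua : ∀ a ∈ U.args, Has D.TA n1 P (a.subst f) := fun a ha =>
    SortAt.args hA (hu.sortAt.mono hn (List.prefix_refl _))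
      (by rw [SortE.subst_args]; exact List.mem_map_of_mem ha)
  have hva : ∀ a ∈ V.args, Has D.TB m1 R (a.subst g) := fun a ha =>
    SortAt.args hB (hv.sortAt.mono hm (List.prefix_refl _))
      (by rw [SortE.subst_args]; exact List.mem_map_of_mem ha)
  have := hT.ct (M0 := M) hu hv h1.rel h2.rel (by
    constructor
    · rw [SortE.subst_args, SortE.subst_args,
        show U.args.map (Expr.subst f) ++ [u.subst f] = (U.args ++ [u]).map (Expr.subst f) by simp,
        Mat.map]
      refine hM1.imp fun a ha b hb e he => sb hL1 hR1 h1 he ?_ (hva b hb)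
      rcases List.mem_append.1 ha with ha | ha
      · exact (hua a ha).mono hn' hu.1
      · rw [List.mem_singleton.1 ha]; exact hu.has
    · rw [SortE.subst_args, SortE.subst_args,
        show V.args.map (Expr.subst g) ++ [v.subst g] = (V.args ++ [v]).map (Expr.subst g) by simp,
        Mat.map]
      refine hM2.imp fun a ha b hb e he => sb hL2 hR2 h2 he (hua a ha) ?_
      rcases List.mem_append.1 hb with hb | hb
      · exact (hva b hb).mono hm' hv.1
      · rw [List.mem_singleton.1 hb]; exact hv.has) hW2
  simpa [tyOf, SortE.subst_args] using this

/-! ### Consequences for values near a tensor product -/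

theorem Near.any {n m : ℕ} (hC : ConvInv D n m) {σ P X R Y u U v V W e0 e}
    (h : D.Near σ X Y u v e0) (hr : D.CtxRel σ σ X Y) (hu : Arg D.TA n P X u U)
    (hv : Arg D.TB m R Y v V) (hW : D.EvTy σ P X R Y u U v V W) (he : D.Ev σ X Y u v e) :
    D.TmEq W e0 e := by
  obtain ⟨Uc, hUc, hau⟩ := hu.up.canon D.hA
  obtain ⟨Vc, hVc, hav⟩ := hv.up.canon D.hB
  obtain ⟨Wc, hWc⟩ := evTy_total σ hau hav
  have hW' := hW.mono hu.1 (List.prefix_refl _) hv.1 (List.prefix_refl _)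
  exact D.conv (D.ty_symm (hC.conv hu.up hUc hv.up hVc hr hW' hWc)) (h _ _ _ _ hUc hVc hWc he)

theorem near_of_eq {n m : ℕ} (hC : ConvInv D n m) (hT : ValInv D n m)
    {σ P X R Y u U v V W e0 e}
    (hr : D.CtxRel σ σ X Y) (hu : Arg D.TA n P X u U)
    (hv : Arg D.TB m R Y v V) (hW : D.EvTy σ P X R Y u U v V W) (he : D.Ev σ X Y u v e)
    (h : D.TmEq W e0 e) : D.Near σ X Y u v e0 := by
  intro Uc Vc Wc e' hUc hVc hWc he'
  have hW' := hW.mono hu.1 (List.prefix_refl _) hv.1 (List.prefix_refl _)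
  exact D.tm_trans (D.conv (hC.conv hu.up hUc hv.up hVc hr hW' hWc) h)
    (hT.h2 hu.has hv.has hr he _ _ _ _ hUc hVc hWc he')

theorem Near.trans {n m : ℕ} (hC : ConvInv D n m) (hT : ValInv D n m)
    {σ P X R Y u U v V W e0 e1} (h : D.Near σ X Y u v e0)
    (hr : D.CtxRel σ σ X Y) (hu : Arg D.TA n P X u U)
    (hv : Arg D.TB m R Y v V) (hW : D.EvTy σ P X R Y u U v V W)
    (he : D.TmEq W e1 e0) : D.Near σ X Y u v e1 := by
  obtain ⟨e, hev⟩ := ev_total σ hu.has hv.has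
  exact near_of_eq hC hT hr hu hv hW hev (D.tm_trans he (h.any hC hr hu hv hW hev))

theorem Near.up {n m : ℕ} (hC : ConvInv D n m) (hT : ValInv D n m)
    {σ X Y X' Y' u v e0} (hX : X <+: X') (hY : Y <+: Y') (h : D.Near σ X Y u v e0)
    (hr : D.CtxRel σ σ X' Y') (hu : Has D.TA n X u) (hv : Has D.TB m Y v) :
    D.Near σ X' Y' u v e0 := by
  obtain ⟨e, hev⟩ := ev_total σ hu hv
  obtain ⟨U, hU⟩ := hu
  obtain ⟨V, hV⟩ := hv
  obtain ⟨W, hW⟩ := evTy_total σ hU hV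
  exact near_of_eq hC hT hr (hU.mono le_rfl hX hX (List.prefix_refl _))
    (hV.mono le_rfl hY hY (List.prefix_refl _)) (hW.mono hX hX hY hY) (hev.mono hX hY)
    (h.any hC (hr.mono hX hY) hU hV hW hev)

theorem SubHyp.ctxRel {n m : ℕ} (p : Pack D n m) {σ X Y f g σ0 σ0' X1 Y1}
    (h : SubHyp D n m σ X Y f g σ0 X1 Y1) (hX1 : (names X1).Nodup) (hY1 : (names Y1).Nodup)
    (h' : ∀ {z w}, z ∈ names X1 → w ∈ names Y1 → D.Near σ X Y (f z) (g w) (σ0' z w)) :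
    D.CtxRel σ0 σ0' X1 Y1 := by
  refine ⟨hX1, hY1, fun P z Z R w V hz hw => ?_⟩
  obtain ⟨W, hW⟩ := evTy_total σ0 (Arg.decl hz (h.srcA hz)) (Arg.decl hw (h.srcB hw))
  obtain ⟨e, he⟩ := ev_total σ (h.hf _ _ _ hz).has (h.hg _ _ _ hw).has
  obtain ⟨W2, hW2⟩ := evTy_total σ (h.hf _ _ _ hz) (h.hg _ _ _ hw)
  refine ⟨W, hW, D.conv (D.ty_symm (tySub (f := f) (g := g) (u := .var z)
    (U := Z) (v := .var w) (V := V) (Nat.le_succ _) (Nat.le_succ _) le_rfl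
    le_rfl p.ty p.tm p.tm' p.tm p.tm' (h.restrict hz hw.isPre) (h.restrict hz.isPre hw)
    (by simpa using h.hf _ _ _ hz) (by simpa using h.hg _ _ _ hw) hW (by simpa using hW2))) ?_⟩
  exact D.tm_trans ((h.near hz.mem hw.mem).any p.cv h.rel (h.hf _ _ _ hz) (h.hg _ _ _ hw) hW2 he)
    (D.tm_symm ((h' hz.mem hw.mem).any p.cv h.rel (h.hf _ _ _ hz) (h.hg _ _ _ hw) hW2 he))

end Dom
end GATPaper

namespace GATPaper

open Classical in
/-- Changing the value of a function at one variable. -/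
noncomputable def upd {A : Alphabet} {β : Type} (F : A.Var → β) (z : A.Var) (u : β) : A.Var → β :=
  fun x => if x = z then u else F x

section

variable {A : Alphabet} {Ax : Set (Judg A)}

theorem upd_same {β : Type} (F : A.Var → β) (z : A.Var) (u : β) : upd F z u z = u := by
  simp [upd]

theorem upd_ne {β : Type} (F : A.Var → β) {z x : A.Var} (u : β) (h : x ≠ z) :
    upd F z u x = F x := by simp [upd, h]

theorem upd_of_mem {β : Type} (F : A.Var → β) {X : PreCtx A} {z x : A.Var} (u : β)
    (hz : z ∉ names X) (h : x ∈ names X) : upd F z u x = F x :=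
  upd_ne F u fun e => hz (e ▸ h)

theorem names_snoc (X : PreCtx A) (x : A.Var) (U : SortE A) :
    names (X ++ [(x, U)]) = names X ++ [x] := by simp [names]

theorem ArgMor.up {n : ℕ} {P P' XS : PreCtx A} {F : A.Var → Expr A} (h : ArgMor Ax n P XS F)
    (hP : P <+: P') : ArgMor Ax n P' XS F :=
  fun _ _ _ hd => (h _ _ _ hd).mono le_rfl hP hP (List.prefix_refl _)

theorem ArgMor.congr {n : ℕ} {P XS : PreCtx A} {F G : A.Var → Expr A} (h : ArgMor Ax n P XS F)
    (hXS : IsPreCtx XS) (hFG : ∀ z ∈ names XS, F z = G z) : ArgMor Ax n P XS G := by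
  intro P1 z Z hd
  rw [← hFG z hd.mem, ← Z.subst_congr fun x hx =>
    hFG x (names_mono hd.isPre (isPreCtx_iff.1 hXS _ _ _ hd x hx))]
  exact h _ _ _ hd

theorem ArgMor.snoc {n : ℕ} {P XS : PreCtx A} {F : A.Var → Expr A} {z0 : A.Var} {Z0 : SortE A}
    {u : Expr A} (h : ArgMor Ax n P XS F) (hXS : IsPreCtx XS) (hz0 : z0 ∉ names XS)
    (hZ0 : ∀ v, SOccurs v Z0 → v ∈ names XS) (hu : Arg Ax n P P u (Z0.subst F)) :
    ArgMor Ax n P (XS ++ [(z0, Z0)]) (upd F z0 u) := by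
  intro P1 z Z hd
  rcases decl_snoc.1 hd with hd | ⟨rfl, rfl, rfl⟩
  · exact h.congr hXS (fun z hz => (upd_of_mem F u hz0 hz).symm) _ _ _ hd
  · rw [upd_same, SortE.subst_congr _ fun x hx => upd_of_mem F u hz0 (hZ0 x hx)]
    exact hu

theorem FreshCh.notMem {ch : PreCtx A → A.Var} (h : FreshCh ch) (X : PreCtx A) :
    ch X ∉ names X := by
  intro hx
  obtain ⟨p, hp, he⟩ := List.mem_map.1 hx
  exact h X p hp he

theorem map_names {γ : Type} (X : PreCtx A) (F : A.Var → γ) :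
    X.map (fun p => F p.1) = (names X).map F := by simp

theorem Has.of_mem {n : ℕ} {X : PreCtx A} {x : A.Var}
    (hs : ∀ P z Z, Decl X P z Z → DerAt Ax n (.sort P Z)) (hx : x ∈ names X) :
    Has Ax n X (.var x) := by
  obtain ⟨P, U, hd⟩ := exists_decl hx
  exact ⟨U, (Arg.of_decl hd (hs _ _ _ hd)).up⟩

/-- A sort expression is an instance of an introduced one. -/
theorem Arg.frame (hA : Shaped Ax) {ch : PreCtx A → A.Var} (hch : FreshCh ch) {n : ℕ}
    {P X : PreCtx A} {u : Expr A} {U : SortE A} (h : Arg Ax (n + 1) P X u U) :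
    ∃ XS S F, introSort XS S ∈ Ax ∧ DerAt Ax (n + 1) (introSort XS S) ∧
      U = ⟨S, (names XS).map F⟩ ∧ F (ch XS) = u ∧ ArgMor Ax n P XS F ∧
      ArgMor Ax (n + 1) X (XS ++ [(ch XS, ⟨S, ctxVars XS⟩)]) F ∧
      (names (XS ++ [(ch XS, ⟨S, ctxVars XS⟩)])).Nodup ∧
      (∀ {P z Z}, Decl XS P z Z → DerAt Ax n (.sort P Z)) ∧
      (∀ {P z Z}, Decl (XS ++ [(ch XS, ⟨S, ctxVars XS⟩)]) P z Z → DerAt Ax (n + 1) (.sort P Z)) := by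
  obtain ⟨P0, h0, hs⟩ := h.sort
  obtain ⟨S, ss⟩ := U
  obtain ⟨XS, F, hax, hd, rfl, hF⟩ := sort_inv hA hs
  have hwf := DerAt.sort_wf hd
  have hz := hch.notMem XS
  have hcg : ∀ z ∈ names XS, F z = upd F (ch XS) u z := fun z hz' => (upd_of_mem F u hz hz').symm
  refine ⟨XS, S, upd F (ch XS) u, hax, hd, ?_, upd_same _ _ _,
    (hF.argMor.up h0).congr hwf.2.1 hcg, ?_, nodup_snoc hwf.1 hz _,
    fun hd' => DerAt.sort_decl hd hd', ?_⟩
  · rw [map_names, List.map_congr_left hcg]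
  · refine ArgMor.snoc ((hF.argMor.up (h0.trans h.1)).mono (Nat.le_succ _)) hwf.2.1 hz ?_ ?_
    · rintro v ⟨e, he, hv⟩
      exact occurs_ctxVars he hv
    · rw [SortE.subst_mk, ctxVars_subst]
      exact h.up
  · intro P z Z hz'
    rcases decl_snoc.1 hz' with hz' | ⟨rfl, rfl, rfl⟩
    · exact (DerAt.sort_decl hd hz').succ
    · exact hd

theorem Has.app_frame (hA : IsGAT Ax) {n : ℕ} {X : PreCtx A} {t : A.TermSym} {ts : List (Expr A)}
    (h : Has Ax (n + 1) X (.app t ts)) :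
    ∃ XT UT F, introTerm XT t UT ∈ Ax ∧ DerAt Ax (n + 1) (introTerm XT t UT) ∧
      ts = (names XT).map F ∧ ArgMor Ax n X XT F ∧ (names XT).Nodup ∧
      (∀ {P z Z}, Decl XT P z Z → DerAt Ax n (.sort P Z)) ∧
      (∀ v, SOccurs v UT → v ∈ names XT) ∧ DerAt Ax n (.sort XT UT) ∧
      (∀ {X'}, CanonSort Ax X' (.app t ts) (UT.subst F)) ∧
      Arg Ax (n + 1) X X (.app t ts) (UT.subst F) := by
  obtain ⟨U, hU⟩ := id h
  obtain ⟨P0, h0, hd⟩ := hU.term_of_app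
  obtain ⟨XT, UT, F, hax, hd', hs, rfl, hF, -⟩ := hd.app_inv hA.1.shaped
  have hc : ∀ {X'}, CanonSort Ax X' (.app t (XT.map fun p => F p.1)) (UT.subst F) :=
    fun {X'} => canonSort_app_map hA hax F
  obtain ⟨U0, hU0, hd0⟩ := hd.canon hA
  have := hU0.uniq hA.1 (DerAt.sort_wf (DerAt.sort_of_term (n := n) hd)).1 hc
  subst this
  exact ⟨XT, UT, F, hax, hd', map_names _ _, hF.argMor.up h0, (DerAt.sort_wf hs).1,
    fun hd => (DerAt.sort_wf hs).2.2 _ _ _ hd, hA.introTerm_scoped hax, hs, hc,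
    (Arg.of_term h0 hd0).up⟩

theorem SortE.subst_var_id (U : SortE A) : U.subst .var = U := SortE.subst_id U

end

namespace Dom

variable {D : Dom}

open Classical in
/-- The environment whose values are the entries of a matrix. -/
noncomputable def envOf (D : Dom) (us : List D.A.Var) (vs : List D.B.Var) (M : ℕ → ℕ → D.Tm) :
    D.Env :=
  fun z w => M (us.idxOf z) (vs.idxOf w)

theorem envOf_mat {us us' : List D.A.Var} {vs vs' : List D.B.Var} {M : ℕ → ℕ → D.Tm}
    (hu : us.Nodup) (hv : vs.Nodup) (hus : us' <+: us) (hvs : vs' <+: vs) :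
    Mat (fun z w e => e = D.envOf us vs M z w) us' vs' M := by
  classical
  intro i hi j hj
  have h1 : us'[i] = us[i]'(hi.trans_le hus.length_le) := hus.getElem hi
  have h2 : vs'[j] = vs[j]'(hj.trans_le hvs.length_le) := hvs.getElem hj
  simp only [envOf]
  rw [h1, h2]
  congr 1
  · convert (hu.idxOf_getElem i _).symm
  · convert (hv.idxOf_getElem j _).symm

theorem Mat.envOf {α β : Type} {Q : α → β → D.Tm → Prop} {us us' : List D.A.Var}
    {vs vs' : List D.B.Var} {F : D.A.Var → α} {G : D.B.Var → β} {M : ℕ → ℕ → D.Tm}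
    (h : Mat Q (us'.map F) (vs'.map G) M) (hus : us' <+: us) (hvs : vs' <+: vs) {z w}
    (hz : z ∈ us') (hw : w ∈ vs') : Q (F z) (G w) (D.envOf us vs M z w) := by
  classical
  have h1 := List.idxOf_lt_length_of_mem hz
  have h2 := List.idxOf_lt_length_of_mem hw
  have := Mat.map.1 h _ h1 _ h2
  simp only [List.getElem_idxOf] at this
  obtain ⟨l1, rfl⟩ := hus
  obtain ⟨l2, rfl⟩ := hvs
  simp only [Dom.envOf]
  convert this using 2
  · convert List.idxOf_append_of_mem hz
  · convert List.idxOf_append_of_mem hw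

/-- The sort equations of the target which come from pairs of introducing sort axioms. -/
def AxSort (D : Dom) (n m : ℕ) : Prop :=
  ∀ {XS S YT T σ0 σ1 M0 M1}, introSort XS S ∈ D.TA → DerAt D.TA n (introSort XS S) →
    introSort YT T ∈ D.TB → DerAt D.TB m (introSort YT T) →
    D.CtxRel σ0 σ1 (XS ++ [(D.chA XS, ⟨S, ctxVars XS⟩)]) YT →
    D.CtxRel σ0 σ1 XS (YT ++ [(D.chB YT, ⟨T, ctxVars YT⟩)]) →
    Mat (fun z w e => e = σ0 z w) (names XS ++ [D.chA XS]) (names YT) M0 →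
    Mat (fun z w e => e = σ0 z w) (names XS) (names YT ++ [D.chB YT]) M0 →
    Mat (fun z w e => e = σ1 z w) (names XS ++ [D.chA XS]) (names YT) M1 →
    Mat (fun z w e => e = σ1 z w) (names XS) (names YT ++ [D.chB YT]) M1 →
    D.TyEq (D.ss S T (XS.length + 1) (YT.length + 1) M0) (D.ss S T (XS.length + 1) (YT.length + 1) M1)

/-- The equations of the target which come from pairs of a sort equality axiom and an introducing
sort axiom. -/
def AxSrt (D : Dom) (n m : ℕ) : Prop :=
  ∀ {X U U' YT T σ0}, Judg.sortEq X U U' ∈ D.TA → DerAt D.TA n (.sortEq X U U') →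
    introSort YT T ∈ D.TB → DerAt D.TB m (introSort YT T) →
    D.CtxRel σ0 σ0 (X ++ [(D.chA X, U)]) YT →
    D.CtxRel σ0 σ0 X (YT ++ [(D.chB YT, ⟨T, ctxVars YT⟩)]) →
    ∃ W W', D.EvTy σ0 X (X ++ [(D.chA X, U)]) YT (YT ++ [(D.chB YT, ⟨T, ctxVars YT⟩)])
        (.var (D.chA X)) U (.var (D.chB YT)) ⟨T, ctxVars YT⟩ W ∧
      D.EvTy σ0 X (X ++ [(D.chA X, U')]) YT (YT ++ [(D.chB YT, ⟨T, ctxVars YT⟩)])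
        (.var (D.chA X)) U' (.var (D.chB YT)) ⟨T, ctxVars YT⟩ W' ∧ D.TyEq W W'

/-- The other equations of the target which come from pairs of axioms. -/
structure Axs (D : Dom) (n m : ℕ) : Prop where
  st : ∀ {XS S YT t VT σ0 σ1 M0 M1}, introSort XS S ∈ D.TA → DerAt D.TA n (introSort XS S) →
    introTerm YT t VT ∈ D.TB → DerAt D.TB m (introTerm YT t VT) →
    D.CtxRel σ0 σ1 (XS ++ [(D.chA XS, ⟨S, ctxVars XS⟩)]) YT →
    Mat (fun z w e => e = σ0 z w) (names XS ++ [D.chA XS]) (names YT) M0 →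
    Mat (fun z w e => e = σ1 z w) (names XS ++ [D.chA XS]) (names YT) M1 →
    ∃ W, D.EvTy σ0 XS (XS ++ [(D.chA XS, ⟨S, ctxVars XS⟩)]) YT YT (.var (D.chA XS))
        ⟨S, ctxVars XS⟩ (.app t (ctxVars YT)) VT W ∧
      D.TmEq W (D.st S t (XS.length + 1) YT.length M0) (D.st S t (XS.length + 1) YT.length M1)
  tt : ∀ {XT s UT YT t VT σ0}, introTerm XT s UT ∈ D.TA → DerAt D.TA n (introTerm XT s UT) →
    introTerm YT t VT ∈ D.TB → DerAt D.TB m (introTerm YT t VT) → D.CtxRel σ0 σ0 XT YT →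
    ∃ eL eR W, D.EvL σ0 XT YT (.app s (ctxVars XT)) (.app t (ctxVars YT)) eL ∧
      D.EvR σ0 XT YT (.app s (ctxVars XT)) (.app t (ctxVars YT)) eR ∧
      D.EvTy σ0 XT XT YT YT (.app s (ctxVars XT)) UT (.app t (ctxVars YT)) VT W ∧ D.TmEq W eL eR
  es : AxSrt D n m
  et : ∀ {X U U' YT t VT σ0}, Judg.sortEq X U U' ∈ D.TA → DerAt D.TA n (.sortEq X U U') →
    introTerm YT t VT ∈ D.TB → DerAt D.TB m (introTerm YT t VT) →
    D.CtxRel σ0 σ0 (X ++ [(D.chA X, U)]) YT →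
    ∃ e e' W, D.Ev σ0 (X ++ [(D.chA X, U)]) YT (.var (D.chA X)) (.app t (ctxVars YT)) e ∧
      D.Ev σ0 (X ++ [(D.chA X, U')]) YT (.var (D.chA X)) (.app t (ctxVars YT)) e' ∧
      D.EvTy σ0 X (X ++ [(D.chA X, U)]) YT YT (.var (D.chA X)) U (.app t (ctxVars YT)) VT W ∧
      D.TmEq W e e'
  qs : ∀ {X u u' U YT T σ0}, Judg.termEq X u u' U ∈ D.TA → DerAt D.TA n (.termEq X u u' U) →
    introSort YT T ∈ D.TB → DerAt D.TB m (introSort YT T) →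
    D.CtxRel σ0 σ0 X (YT ++ [(D.chB YT, ⟨T, ctxVars YT⟩)]) →
    ∃ e e' W, D.Ev σ0 X (YT ++ [(D.chB YT, ⟨T, ctxVars YT⟩)]) u (.var (D.chB YT)) e ∧
      D.Ev σ0 X (YT ++ [(D.chB YT, ⟨T, ctxVars YT⟩)]) u' (.var (D.chB YT)) e' ∧
      D.EvTy σ0 X X YT (YT ++ [(D.chB YT, ⟨T, ctxVars YT⟩)]) u U (.var (D.chB YT))
        ⟨T, ctxVars YT⟩ W ∧ D.TmEq W e e'

/-- The part of the induction hypothesis that compares tensor products of sorts. -/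
structure Low (D : Dom) (n m : ℕ) : Prop where
  p1 : Pack D (n + 1) m
  p2 : Pack D n (m + 1)
  ty : TyInv D (n + 1) (m + 1)

theorem Low.p0 {n m : ℕ} (h : Low D n m) : Pack D n m := h.p1.mono (Nat.le_succ _) le_rfl

theorem Pack.low {n m : ℕ} (h : Pack D (n + 1) (m + 1)) : Low D n m :=
  ⟨h.mono le_rfl m.le_succ, h.mono n.le_succ le_rfl, h.ty⟩

/-- The hypotheses of the induction step. -/
structure Lvl (D : Dom) (n m : ℕ) : Prop where
  p1 : Pack D (n + 1) m
  p2 : Pack D n (m + 1)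
  ty : TyInv D (n + 1) (m + 1)
  ty' : TyInv D.swap (m + 1) (n + 1)
  ax : Axs D (n + 1) (m + 1)
  ax' : Axs D.swap (m + 1) (n + 1)

theorem Lvl.swap {n m : ℕ} (h : Lvl D n m) : Lvl D.swap m n :=
  ⟨h.p2.swap, h.p1.swap, h.ty', h.ty, h.ax', h.ax⟩

theorem Lvl.low {n m : ℕ} (h : Lvl D n m) : Low D n m := ⟨h.p1, h.p2, h.ty⟩

theorem Lvl.p0 {n m : ℕ} (h : Lvl D n m) : Pack D n m := h.p1.mono (Nat.le_succ _) le_rfl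

variable {n m : ℕ}

theorem tyInv_ct (hp1 : Pack D (n + 1) m) (hp2 : Pack D n (m + 1))
    (ss : AxSort D (n + 1) (m + 1)) {σ P X R Y u U v V M0 W} (hu : Arg D.TA (n + 1) P X u U)
    (hv : Arg D.TB (m + 1) R Y v V) (hXR : D.CtxRel σ σ X R) (hPY : D.CtxRel σ σ P Y)
    (hM0 : TyMat (D.Near σ) P X R Y U.args u V.args v M0) (hW : D.EvTy σ P X R Y u U v V W) :
    D.TyEq (D.tyOf U V M0) W := by
  have hA := D.hA.1.shaped
  have hB := D.hB.1.shaped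
  have hua : ∀ a ∈ U.args, Has D.TA n P a := fun a ha => hu.sortAt.args hA ha
  have hva : ∀ a ∈ V.args, Has D.TB m R a := fun a ha => hv.sortAt.args hB ha
  obtain ⟨M, rfl, hM⟩ := hW
  have hM1 : TyMat (D.Near σ) P X R Y U.args u V.args v M := by
    refine ⟨hM.1.imp fun a ha b hb e he => hp1.tm.h2 ?_ (hva b hb) hXR he,
      hM.2.imp fun a ha b hb e he => hp2.tm.h2 (hua a ha) ?_ hPY he⟩
    · rcases List.mem_append.1 ha with ha | ha
      · exact (hua a ha).mono (Nat.le_succ _) hu.1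
      · rw [List.mem_singleton.1 ha]; exact hu.has
    · rcases List.mem_append.1 hb with hb | hb
      · exact (hva b hb).mono (Nat.le_succ _) hv.1
      · rw [List.mem_singleton.1 hb]; exact hv.has
  obtain ⟨XS, S, F, haxS, hdS, rfl, rfl, hF, hF', hn1, hs1, hs1'⟩ := hu.frame hA D.hchA
  obtain ⟨YT, T, G, haxT, hdT, rfl, rfl, hG, hG', hn2, hs2, hs2'⟩ := hv.frame hB D.hchB
  have e1 : (names XS).map F ++ [F (D.chA XS)] =
    (names (XS ++ [(D.chA XS, ⟨S, ctxVars XS⟩)])).map F := by simp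
  have e2 : (names YT).map G ++ [G (D.chB YT)] =
    (names (YT ++ [(D.chB YT, ⟨T, ctxVars YT⟩)])).map G := by simp
  have p1 : names XS <+: names (XS ++ [(D.chA XS, ⟨S, ctxVars XS⟩)]) := by
    rw [names_snoc]; exact List.prefix_append _ _
  have p2 : names YT <+: names (YT ++ [(D.chB YT, ⟨T, ctxVars YT⟩)]) := by
    rw [names_snoc]; exact List.prefix_append _ _
  have q1 : names XS ++ [D.chA XS] <+: names (XS ++ [(D.chA XS, ⟨S, ctxVars XS⟩)]) := by
    rw [names_snoc]
  have q2 : names YT ++ [D.chB YT] <+: names (YT ++ [(D.chB YT, ⟨T, ctxVars YT⟩)]) := by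
    rw [names_snoc]
  simp only [TyMat, e1, e2] at hM0 hM1
  have c1 := SubHyp.ctxRel hp1 (σ0 := D.envOf _ _ M0) (σ0' := D.envOf _ _ M)
    ⟨hXR, hs1', hs2, hF', hG, fun hz hw => hM0.1.envOf (List.prefix_refl _) p2 hz hw⟩ hn1
    (p2.sublist.nodup hn2) fun hz hw => hM1.1.envOf (List.prefix_refl _) p2 hz hw
  have c2 := SubHyp.ctxRel hp2 (σ0 := D.envOf _ _ M0) (σ0' := D.envOf _ _ M)
    ⟨hPY, hs1, hs2', hF, hG', fun hz hw => hM0.2.envOf p1 (List.prefix_refl _) hz hw⟩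
    (p1.sublist.nodup hn1) hn2 fun hz hw => hM1.2.envOf p1 (List.prefix_refl _) hz hw
  have := ss haxS hdS haxT hdT c1 c2
    (envOf_mat hn1 hn2 q1 p2) (envOf_mat hn1 hn2 p1 q2)
    (envOf_mat hn1 hn2 q1 p2) (envOf_mat hn1 hn2 p1 q2)
  simpa [tyOf] using this

theorem tyInv_step (hp1 : Pack D (n + 1) m) (hp2 : Pack D n (m + 1))
    (ss : AxSort D (n + 1) (m + 1)) : TyInv D (n + 1) (m + 1) where
  ct := tyInv_ct hp1 hp2 ss
  h1 := by
    intro σ σ' P X R Y u U v V W W' hu hv hXR hPY hW hW'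
    obtain ⟨M', rfl, hM'⟩ := hW'
    have hA := D.hA.1.shaped
    have hB := D.hB.1.shaped
    have hua : ∀ a ∈ U.args, Has D.TA n P a := fun a ha => hu.sortAt.args hA ha
    have hva : ∀ a ∈ V.args, Has D.TB m R a := fun a ha => hv.sortAt.args hB ha
    refine tyInv_ct hp1 hp2 ss hu hv hXR.refl hPY.refl
      ⟨hM'.1.imp fun a ha b hb e he => hp1.tm.h2 ?_ (hva b hb) hXR he,
      hM'.2.imp fun a ha b hb e he => hp2.tm.h2 (hua a ha) ?_ hPY he⟩ hW
    · rcases List.mem_append.1 ha with ha | ha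
      · exact (hua a ha).mono (Nat.le_succ _) hu.1
      · rw [List.mem_singleton.1 ha]; exact hu.has
    · rcases List.mem_append.1 hb with hb | hb
      · exact (hva b hb).mono (Nat.le_succ _) hv.1
      · rw [List.mem_singleton.1 hb]; exact hv.has

end Dom
end GATPaper

namespace GATPaper

namespace Dom

variable {D : Dom} {n m : ℕ}

theorem ctxVars_eq {A : Alphabet} (X : PreCtx A) (F : A.Var → Expr A) :
    (ctxVars X).map (Expr.subst F) = (names X).map F := by
  rw [ctxVars_subst, map_names]

theorem Lvl.wCL (h : Lvl D n m) {σ X Y u S ss t ts Vc M0 M1 W} (hr : D.CtxRel σ σ X Y)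
    (hu : Arg D.TA (n + 1) X X u ⟨S, ss⟩) (hv : Has D.TB (m + 1) Y (.app t ts))
    (hVc : CanonSort D.TB Y (.app t ts) Vc) (hM0 : Mat (D.Near σ X Y) (ss ++ [u]) ts M0)
    (hM1 : Mat (D.Near σ X Y) (ss ++ [u]) ts M1)
    (hW : D.EvTy σ X X Y Y u ⟨S, ss⟩ (.app t ts) Vc W) :
    D.TmEq W (D.st S t (ss.length + 1) ts.length M0) (D.st S t (ss.length + 1) ts.length M1) := by
  obtain ⟨XS, S, F, haxS, hdS, hU, rfl, hF, hF', hn1, hs1, hs1'⟩ := hu.frame D.hA.1.shaped D.hchA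
  cases hU
  obtain ⟨YT, VT, G, haxT, hdT, rfl, hG, hn2, hs2, -, -, hc, hav⟩ := hv.app_frame D.hB
  obtain rfl := hVc.uniq D.hB.1 hr.2.1 hc
  have e1 : (names XS).map F ++ [F (D.chA XS)] =
    (names (XS ++ [(D.chA XS, ⟨S, ctxVars XS⟩)])).map F := by simp
  have q1 : names XS ++ [D.chA XS] <+: names (XS ++ [(D.chA XS, ⟨S, ctxVars XS⟩)]) := by
    rw [names_snoc]
  rw [e1] at hM0 hM1
  have hS : SubHyp D (n + 1) m σ X Y F G (D.envOf _ _ M0) _ YT := ⟨hr, hs1', hs2, hF', hG, fun hz hw =>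
    hM0.envOf (List.prefix_refl _) (List.prefix_refl _) hz hw⟩
  have c1 := SubHyp.ctxRel h.p1 (σ0' := D.envOf _ _ M1) hS hn1 hn2
    fun hz hw => hM1.envOf (List.prefix_refl _) (List.prefix_refl _) hz hw
  obtain ⟨W0, hW0, he⟩ := h.ax.st haxS hdS haxT hdT c1 (envOf_mat hn1 hn2 q1 (List.prefix_refl _))
    (envOf_mat hn1 hn2 q1 (List.prefix_refl _))
  have hS2 : SubHyp D n (m + 1) σ X Y F G (D.envOf _ _ M0) XS YT :=
    ⟨hr, hs1, fun hd => (hs2 hd).succ, hF, hG.mono (Nat.le_succ _),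
      (hS.restrict (List.prefix_append _ _) (List.prefix_refl _)).near⟩
  have := tySub (Nat.le_refl _) (Nat.le_refl _) (Nat.le_succ _) (Nat.le_succ _) h.ty h.p1.tm
    h.p1.tm' h.p2.tm h.p2.tm' hS hS2 (u := .var (D.chA XS)) (U := ⟨S, ctxVars XS⟩)
    (v := .app t (ctxVars YT)) (V := VT)
    (by rw [Expr.subst_var, SortE.subst_mk, ctxVars_eq]; exact hu)
    (by rw [Expr.subst_app, ctxVars_eq]; exact hav) hW0
    (by
      rw [Expr.subst_var, SortE.subst_mk, Expr.subst_app, ctxVars_eq, ctxVars_eq]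
      exact hW)
  simpa using D.conv this he

theorem Lvl.LL (h : Lvl D n m) {σ σ' X Y u v U V W e' e} (hr : D.CtxRel σ σ' X Y)
    (hu : Has D.TA (n + 1) X u) (hv : Has D.TB (m + 1) Y v) (hU : CanonSort D.TA X u U)
    (hV : CanonSort D.TB Y v V) (hW : D.EvTy σ X X Y Y u U v V W) (he' : D.EvL σ' X Y u v e')
    (he : D.EvL σ X Y u v e) : D.TmEq W e' e := by
  obtain ⟨S, ss, t, ts, M', rfl, hc', hM', rfl⟩ := he'
  obtain ⟨S1, ss1, t1, ts1, M, hv1, hc, hM, rfl⟩ := he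
  cases hv1
  cases hc.uniq D.hA.1 hr.1 hc'
  cases hU.uniq D.hA.1 hr.1 hc'
  have ha := hu.canon_arg D.hA hr.1 hc
  have hua : ∀ a ∈ ss ++ [u], Has D.TA (n + 1) X a := by
    intro a ha'
    rcases List.mem_append.1 ha' with ha' | ha'
    · exact (ha.sortAt.args D.hA.1.shaped ha').mono (Nat.le_succ _) (List.prefix_refl _)
    · rw [List.mem_singleton.1 ha']; exact hu
  exact h.wCL hr.refl ha hv hV
    (hM'.imp fun a ha b hb e he => h.p1.tm.h2 (hua a ha) (hv.app_args D.hB.1.shaped hb) hr he)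
    (hM.imp fun a ha b hb e he => h.p1.tm.h2 (hua a ha) (hv.app_args D.hB.1.shaped hb) hr.refl he)
    hW

theorem Lvl.RR (h : Lvl D n m) {σ σ' X Y u v U V W e' e} (hr : D.CtxRel σ σ' X Y)
    (hu : Has D.TA (n + 1) X u) (hv : Has D.TB (m + 1) Y v) (hU : CanonSort D.TA X u U)
    (hV : CanonSort D.TB Y v V) (hW : D.EvTy σ X X Y Y u U v V W) (he' : D.EvR σ' X Y u v e')
    (he : D.EvR σ X Y u v e) : D.TmEq W e' e :=
  h.swap.LL hr.tr hv hu hV hU hW.tr he' he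

theorem Lvl.subL (h : Lvl D n m) {σ X Y u v f g σ0 X1 Y1 U V W e e'}
    (hS : SubHyp D (n + 1) m σ X Y f g σ0 X1 Y1)
    (hu : Has D.TA (n + 1) X (u.subst f)) (hv : Has D.TB (m + 1) Y (v.subst g))
    (hcs : ∀ U1, CanonSort D.TA X1 u U1 → CanonSort D.TA X (u.subst f) (U1.subst f))
    (hU : CanonSort D.TA X (u.subst f) U) (hV : CanonSort D.TB Y (v.subst g) V)
    (hW : D.EvTy σ X X Y Y (u.subst f) U (v.subst g) V W)
    (he : D.EvL σ0 X1 Y1 u v e) (he' : D.EvL σ X Y (u.subst f) (v.subst g) e') :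
    D.TmEq W e e' := by
  have hr := hS.rel
  obtain ⟨S, ss, t, ts, M, rfl, hc, hM, rfl⟩ := he
  rw [Expr.subst_app] at *
  obtain ⟨S1, ss1, t1, ts1, M', hv1, hc', hM', rfl⟩ := he'
  cases hv1
  cases (hcs _ hc).uniq D.hA.1 hr.1 hc'
  cases hU.uniq D.hA.1 hr.1 hc'
  have ha := hu.canon_arg D.hA hr.1 hc'
  have hua : ∀ a ∈ ss.map (Expr.subst f) ++ [u.subst f], Has D.TA (n + 1) X a := by
    intro a ha'
    rcases List.mem_append.1 ha' with ha' | ha'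
    · exact (ha.sortAt.args D.hA.1.shaped ha').mono (Nat.le_succ _) (List.prefix_refl _)
    · rw [List.mem_singleton.1 ha']; exact hu
  have hva : ∀ b ∈ ts.map (Expr.subst g), Has D.TB m Y b := fun b hb =>
    hv.app_args D.hB.1.shaped hb
  have e1 : ss.map (Expr.subst f) ++ [u.subst f] = (ss ++ [u]).map (Expr.subst f) := by simp
  have := h.wCL (M0 := M) hr ha hv hV (by
      rw [e1, Mat.map]
      refine hM.imp fun a ha b hb e he => sb h.p1.tm h.p1.tm' hS he (hua _ ?_)
        (hva _ (List.mem_map_of_mem hb))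
      rw [e1]
      exact List.mem_map_of_mem ha)
    (hM'.imp fun a ha b hb e he => h.p1.tm.h2 (hua a ha) (hva b hb) hr he) hW
  simpa using this

theorem exists_env {Q : Expr D.A → Expr D.B → D.Tm → Prop} {X : PreCtx D.A} {Y : PreCtx D.B}
    {F : D.A.Var → Expr D.A} {G : D.B.Var → Expr D.B} (σ : D.Env)
    (h : ∀ z ∈ names X, ∀ w ∈ names Y, ∃ e, Q (F z) (G w) e) :
    ∃ σ0 : D.Env, ∀ z ∈ names X, ∀ w ∈ names Y, Q (F z) (G w) (σ0 z w) := by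
  classical
  refine ⟨fun z w => if h : ∃ e, Q (F z) (G w) e then h.choose else σ z w, fun z hz w hw => ?_⟩
  simp only [h z hz w hw, dite_true]
  exact (h z hz w hw).choose_spec

theorem ArgMor.has {A : Alphabet} {Ax : Set (Judg A)} {X X1 : PreCtx A}
    {F : A.Var → Expr A} (hF : ArgMor Ax n X X1 F) {z : A.Var} (hz : z ∈ names X1) :
    Has Ax n X (F z) :=
  let ⟨_, _, hd⟩ := exists_decl hz
  (hF _ _ _ hd).has

theorem Lvl.LR (h : Lvl D n m) {σ X Y u v U V W e e'} (hr : D.CtxRel σ σ X Y)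
    (hu : Has D.TA (n + 1) X u) (hv : Has D.TB (m + 1) Y v) (hU : CanonSort D.TA X u U)
    (hV : CanonSort D.TB Y v V) (hW : D.EvTy σ X X Y Y u U v V W) (he : D.EvL σ X Y u v e)
    (he' : D.EvR σ X Y u v e') : D.TmEq W e e' := by
  obtain ⟨t, ts, rfl⟩ : ∃ t ts, v = .app t ts := by
    obtain ⟨S, ss, t, ts, M, rfl, -⟩ := he
    exact ⟨_, _, rfl⟩
  obtain ⟨s, hh, rfl⟩ : ∃ s hh, u = .app s hh := by
    obtain ⟨T, ts, s, hh, M, rfl, -⟩ := he'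
    exact ⟨_, _, rfl⟩
  obtain ⟨XT, UT, F, haxA, hdA, rfl, hF, hn1, hs1, hsc1, -, hcA, haA⟩ := hu.app_frame D.hA
  obtain ⟨YT, VT, G, haxB, hdB, rfl, hG, hn2, hs2, hsc2, -, hcB, haB⟩ := hv.app_frame D.hB
  obtain rfl := hU.uniq D.hA.1 hr.1 hcA
  obtain rfl := hV.uniq D.hB.1 hr.2.1 hcB
  obtain ⟨σ0, hσ0⟩ := exists_env (Q := D.Ev σ X Y) σ fun z hz w hw =>
    ev_total σ (ArgMor.has hF hz) (ArgMor.has hG hw)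
  have hS : SubHyp D n m σ X Y F G σ0 XT YT := ⟨hr, hs1, hs2, hF, hG, fun {z w} hz hw =>
    h.p0.tm.h2 (ArgMor.has hF hz) (ArgMor.has hG hw) hr (hσ0 z hz w hw)⟩
  obtain ⟨eL, eR, W0, heL, heR, hW0, hLR⟩ := h.ax.tt haxA hdA haxB hdB
    (hS.ctxRel h.p0 hn1 hn2 hS.near)
  have e1 : (Expr.app s (ctxVars XT)).subst F = .app s ((names XT).map F) := by
    rw [Expr.subst_app, ctxVars_eq]
  have e2 : (Expr.app t (ctxVars YT)).subst G = .app t ((names YT).map G) := by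
    rw [Expr.subst_app, ctxVars_eq]
  have hcA' : ∀ {X'}, CanonSort D.TA X' (.app s (ctxVars XT)) UT := by
    intro X'
    simpa [SortE.subst_var_id, ctxVars] using canonSort_app_map D.hA haxA (X := X') .var
  have hcB' : ∀ {X'}, CanonSort D.TB X' (.app t (ctxVars YT)) VT := by
    intro X'
    simpa [SortE.subst_var_id, ctxVars] using canonSort_app_map D.hB haxB (X := X') .var
  have hS1 := hS.mono (Nat.le_succ n) (Nat.le_refl m)
  have hS2 := hS.mono (Nat.le_refl n) (Nat.le_succ m)
  have hT := tySub (Nat.le_refl _) (Nat.le_refl _) (Nat.le_succ _) (Nat.le_succ _) h.ty h.p1.tm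
    h.p1.tm' h.p2.tm h.p2.tm' hS1 hS2 (by rw [e1]; exact haA) (by rw [e2]; exact haB) hW0
    (by rw [e1, e2]; exact hW)
  have l1 := h.subL (V := VT.subst G) (W := W) (e' := e) hS1 (by rw [e1]; exact hu)
    (by rw [e2]; exact hv) (fun U1 hU1 => by
      obtain rfl := hU1.uniq D.hA.1 hn1 hcA'
      rw [e1]
      exact hcA) (by rw [e1]; exact hcA) (by rw [e2]; exact hcB) (by rw [e1, e2]; exact hW)
    heL (by rw [e1, e2]; exact he)
  have l2 := h.swap.subL (V := UT.subst F) (W := W) (e' := e') hS2.tr (by rw [e2]; exact hv)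
    (by rw [e1]; exact hu) (fun U1 hU1 => by
      obtain rfl := hU1.uniq D.hB.1 hn2 hcB'
      rw [e2]
      exact hcB) (by rw [e2]; exact hcB) (by rw [e1]; exact hcA) (by rw [e1, e2]; exact hW.tr)
    heR (by rw [e1, e2]; exact he')
  exact D.tm_trans (D.tm_symm l1) (D.tm_trans (D.conv hT hLR) l2)

theorem evL_total (σ : D.Env) {X : PreCtx D.A} {Y : PreCtx D.B} {u t ts}
    (hu : Has D.TA (n + 1) X u) (hv : Has D.TB (m + 1) Y (.app t ts)) :
    ∃ e, D.EvL σ X Y u (.app t ts) e := by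
  obtain ⟨⟨S, ss⟩, hc, ha⟩ := hu.canon D.hA
  obtain ⟨M, hM⟩ := mat_exists (Q := D.Ev σ X Y) (us := ss ++ [u]) (vs := ts) (by
    intro a ha' b hb
    have hb' := hv.app_args D.hB.1.shaped hb
    rcases List.mem_append.1 ha' with ha' | ha'
    · exact ev_total σ (ha.sortAt.args D.hA.1.shaped (U := ⟨S, ss⟩) ha') hb'
    · rw [List.mem_singleton.1 ha']
      exact ev_total σ hu hb') (σ (D.chA []) (D.chB []))
  exact ⟨_, S, ss, t, ts, M, rfl, hc, hM, rfl⟩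

theorem Lvl.LR' (h : Lvl D n m) {σ σ' X Y u v U V W e e'} (hr : D.CtxRel σ σ' X Y)
    (hu : Has D.TA (n + 1) X u) (hv : Has D.TB (m + 1) Y v) (hU : CanonSort D.TA X u U)
    (hV : CanonSort D.TB Y v V) (hW : D.EvTy σ X X Y Y u U v V W) (he' : D.EvL σ' X Y u v e')
    (he : D.EvR σ X Y u v e) : D.TmEq W e' e := by
  obtain ⟨t, ts, rfl⟩ : ∃ t ts, v = .app t ts := by
    obtain ⟨S, ss, t, ts, M, rfl, -⟩ := he'
    exact ⟨_, _, rfl⟩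
  obtain ⟨e1, he1⟩ := evL_total σ hu hv
  exact D.tm_trans (h.LL hr hu hv hU hV hW he' he1) (h.LR hr.refl hu hv hU hV hW he1 he)

theorem Lvl.val (h : Lvl D n m) : ValInv D (n + 1) (m + 1) where
  h2 := by
    intro σ σ' X Y u v e' hu hv hr he' U V W e hU hV hW he
    rcases ev_cases he' with ⟨x, y, rfl, rfl, hx, hy, rfl⟩ | he' | he'
    · obtain ⟨P, hP⟩ := canonSort_var.1 hU
      obtain ⟨R, hR⟩ := canonSort_var.1 hV
      obtain ⟨W', hW', hσ⟩ := hr.2.2 _ _ _ _ _ _ hP hR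
      have : e = σ x y := by
        cases he
        rfl
      rw [this]
      have hW2 := hW'.mono hP.isPre hP hR.isPre hR
      exact D.conv (h.ty.h1 (hu.canon_arg D.hA hr.1 hU) (hv.canon_arg D.hB hr.2.1 hV)
        hr.refl hr.refl hW hW2) (D.tm_symm hσ)
    · rcases ev_cases he with ⟨x, y, rfl, rfl, hx, hy, rfl⟩ | he | he
      · obtain ⟨S, ss, t, ts, M, hv1, -⟩ := he'
        cases hv1
      · exact h.LL hr hu hv hU hV hW he' he
      · exact h.LR' hr hu hv hU hV hW he' he
    · rcases ev_cases he with ⟨x, y, rfl, rfl, hx, hy, rfl⟩ | he | he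
      · obtain ⟨S, ss, t, ts, M, hv1, -⟩ := he'
        cases hv1
      · exact h.swap.LR' hr.tr hv hu hV hU hW.tr he' he
      · exact h.RR hr hu hv hU hV hW he' he

end Dom
end GATPaper

namespace GATPaper

namespace Dom

section

variable {A : Alphabet} {Ax : Set (Judg A)}

theorem SortE.subst_upd {P : PreCtx A} {U : SortE A} (hU : ∀ v, SOccurs v U → v ∈ names P)
    {x : A.Var} (hx : x ∉ names P) (u : Expr A) : U.subst (upd .var x u) = U := by
  rw [SortE.subst_congr (τ := .var) U fun v hv => upd_of_mem .var u hx (hU v hv), SortE.subst_var_id]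

theorem ArgX.wf (hA : Shaped Ax) {m : ℕ} {R Y : PreCtx A} {v : Expr A} {V : SortE A}
    (h : ArgX Ax (m + 1) R Y v V) : R <+: Y ∧ (names R).Nodup ∧ (names Y).Nodup ∧
      (∀ {P z Z}, Decl R P z Z → DerAt Ax m (.sort P Z)) ∧
      (∀ {P z Z}, Decl Y P z Z → DerAt Ax (m + 1) (.sort P Z)) := by
  rcases h with ⟨rfl, h2⟩ | ⟨y, hy, rfl, rfl, h4⟩
  · have hwf := DerAt.sort_wf (DerAt.sort_of_term (n := m) h2)
    exact ⟨List.prefix_refl _, hwf.1, hwf.1, fun hd => hwf.2.2 _ _ _ hd,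
      fun hd => (hwf.2.2 _ _ _ hd).succ⟩
  · have hwf := DerAt.sort_wf h4
    refine ⟨List.prefix_append _ _, hwf.1, nodup_snoc hwf.1 hy _, fun hd => DerAt.sort_decl h4 hd,
      fun hd => ?_⟩
    rcases decl_snoc.1 hd with hd | ⟨rfl, rfl, rfl⟩
    · exact hwf.2.2 _ _ _ hd
    · exact h4

theorem Arg.exact {m : ℕ} {Y : PreCtx A} (hn : (names Y).Nodup) {v : Expr A} {V : SortE A}
    (h : Arg Ax m Y Y v V) : ∃ R0 Y0, R0 <+: Y ∧ Y0 <+: Y ∧ ArgX Ax m R0 Y0 v V := by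
  obtain ⟨-, ⟨P0, h0, hd⟩ | ⟨P0, y, h0, hd, rfl, hs⟩⟩ := h
  · exact ⟨P0, P0, h0, h0, .inl ⟨rfl, hd⟩⟩
  · exact ⟨P0, _, h0, hd, .inr ⟨y, hd.notMem hn, rfl, rfl, hs⟩⟩

end

variable {D : Dom} {n m k l : ℕ}

theorem EvTy.up {σ : D.Env} {P X : PreCtx D.A} {R Y : PreCtx D.B} (hP : P <+: X) (hR : R <+: Y)
    {u U v V W} (h : D.EvTy σ P X R Y u U v V W) : D.EvTy σ X X Y Y u U v V W :=
  h.mono hP (List.prefix_refl _) hR (List.prefix_refl _)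

/-- Extending an environment by values of `u` at a new variable. -/
theorem row_exists (σ : D.Env) {P : PreCtx D.A} {R : PreCtx D.B} {u} (hu : Has D.TA k P u)
    (hsR : ∀ {P z Z}, Decl R P z Z → DerAt D.TB l (.sort P Z)) {x : D.A.Var} (hx : x ∉ names P) :
    ∃ σ' : D.Env, (∀ z ∈ names P, ∀ w, σ z w = σ' z w) ∧
      ∀ w ∈ names R, D.Ev σ P R u (.var w) (σ' x w) := by
  classical
  have H : ∀ w ∈ names R, ∃ e, D.Ev σ P R u (.var w) e := fun w hw =>
    ev_total σ hu (Has.of_mem (fun _ _ _ hd => hsR hd) hw)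
  refine ⟨fun z w => if z = x then (if h : ∃ e, D.Ev σ P R u (.var w) e then h.choose else σ z w)
    else σ z w, fun z hz w => ?_, fun w hw => ?_⟩
  · have hzx : z ≠ x := fun e => hx (e ▸ hz)
    simp [hzx]
  · simp only [if_true, H w hw, dite_true]
    exact (H w hw).choose_spec

theorem colHyp (hT : ValInv D k l) {σ σ' P Y x u} (hr : D.CtxRel σ σ P Y) (hx : x ∉ names P)
    (hsA : ∀ {P1 z Z}, Decl P P1 z Z → DerAt D.TA k (.sort P1 Z))
    (hsB : ∀ {P z Z}, Decl Y P z Z → DerAt D.TB l (.sort P Z))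
    (h1 : ∀ z ∈ names P, ∀ w, σ z w = σ' z w) :
    SubHyp D k l σ P Y (upd .var x u) .var σ' P Y where
  rel := hr
  srcA := hsA
  srcB := hsB
  hf := by
    intro P1 z Z hd
    have := argMor_var (fun _ _ _ hd => hsA hd) _ _ _ hd
    rwa [upd_of_mem _ _ hx hd.mem, SortE.subst_upd (DerAt.sort_scoped D.hA.1.shaped (hsA hd))
      (fun hz => hx (names_mono (List.IsPrefix.trans (List.prefix_append _ _) hd) hz)),
      ← SortE.subst_var_id Z]
  hg := argMor_var fun _ _ _ hd => hsB hd
  near {z w} hz hw := by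
    rw [upd_of_mem _ _ hx hz, ← h1 z hz]
    exact hT.h2 (Has.of_mem (fun _ _ _ hd => hsA hd) hz) (Has.of_mem (fun _ _ _ hd => hsB hd) hw) hr
      (.vv hz hw)

theorem rowHyp (hT : ValInv D k l) {σ σ' P R x u U} (hr : D.CtxRel σ σ P R) (hx : x ∉ names P)
    (hsA : ∀ {P1 z Z}, Decl P P1 z Z → DerAt D.TA k (.sort P1 Z)) (hsU : DerAt D.TA k (.sort P U))
    (hsB : ∀ {P z Z}, Decl R P z Z → DerAt D.TB l (.sort P Z)) (hu : Arg D.TA k P P u U)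
    (h1 : ∀ z ∈ names P, ∀ w, σ z w = σ' z w)
    (h2 : ∀ w ∈ names R, D.Ev σ P R u (.var w) (σ' x w)) :
    SubHyp D k l σ P R (upd .var x u) .var σ' (P ++ [(x, U)]) R where
  rel := hr
  srcA {P1 z Z} hd := by
    rcases decl_snoc.1 hd with hd | ⟨rfl, rfl, rfl⟩
    · exact hsA hd
    · exact hsU
  srcB := hsB
  hf := by
    intro P1 z Z hd
    rcases decl_snoc.1 hd with hd | ⟨rfl, rfl, rfl⟩
    · exact (colHyp hT hr hx hsA hsB h1).hf _ _ _ hd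
    · rwa [upd_same, SortE.subst_upd (DerAt.sort_scoped D.hA.1.shaped hsU) hx]
  hg := argMor_var fun _ _ _ hd => hsB hd
  near {z w} hz hw := by
    rw [names_snoc] at hz
    rcases List.mem_append.1 hz with hz | hz
    · exact (colHyp hT hr hx hsA hsB h1).near hz hw
    · rw [List.mem_singleton.1 hz, upd_same]
      exact hT.h2 hu.has (Has.of_mem (fun _ _ _ hd => hsB hd) hw) hr (h2 w hw)

/-- Replacing a sort of `u` by an equal one. -/
theorem Lvl.seqStep (h : Lvl D n m) {σ P u U0 U R Y v V W0 W} (hs : DerAt D.TA n (.sortEq P U0 U))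
    (hu0 : DerAt D.TA n (.term P u U0)) (hu : DerAt D.TA (n + 1) (.term P u U))
    (hv : ArgX D.TB (m + 1) R Y v V) (hr : D.CtxRel σ σ P Y)
    (hW0 : D.EvTy σ P P R Y u U0 v V W0) (hW : D.EvTy σ P P R Y u U v V W) : D.TyEq W0 W := by
  obtain ⟨hRY, hnR, hnY, hsR, hsY⟩ := hv.wf D.hB.1.shaped
  have hr' := hr.mono (List.prefix_refl _) hRY
  obtain ⟨k, rfl⟩ := hs.pos
  obtain ⟨hsU0, hsU⟩ := hs.sorts_of_sortEq
  have hx := D.hchA.notMem P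
  have hsP : ∀ {P1 z Z}, Decl P P1 z Z → DerAt D.TA k (.sort P1 Z) := fun hd =>
    (DerAt.sort_wf hsU0).2.2 _ _ _ hd
  obtain ⟨σ', h1, h2⟩ := row_exists σ hu0.arg.has hsR hx
  have hsc0 := DerAt.sort_scoped D.hA.1.shaped hsU0
  have hsc := DerAt.sort_scoped D.hA.1.shaped hsU
  have S0 := rowHyp h.p0.tm.toValInv hr' hx (fun hd => (hsP hd).succ) hsU0.succ hsR hu0.arg h1 h2
  have S1 := rowHyp h.p1.tm.toValInv hr' hx (fun hd => (hsP hd).succ.succ) hsU.succ.succ hsR hu.arg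
    h1 h2
  have C := colHyp (u := u) h.p2.tm.toValInv hr hx (fun hd => (hsP hd).succ) hsY h1
  have hnx := nodup_snoc hr.1 hx U0
  have c1 := S0.ctxRel h.p0 hnx hnR S0.near
  have c2 : D.CtxRel σ' σ' P Y := hr.congr (fun z hz w _ => h1 z hz w) (fun z hz w _ => h1 z hz w)
  have a0 := Arg.of_decl (decl_snoc_self P (D.chA P) U0) hsU0.succ
  have a1 := Arg.of_decl (decl_snoc_self P (D.chA P) U) hsU.succ
  obtain ⟨Wa, hWa⟩ := evTy_total σ' a0 hv.arg
  obtain ⟨Wb, hWb⟩ := evTy_total σ' a1 hv.arg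
  have hab := h.p2.eq.h3 hs hx hv c1 c2 hWa hWb
  have ta := tySub (Nat.le_succ _) (Nat.le_refl _) (Nat.le_refl _) (Nat.le_succ _) h.p2.ty h.p0.tm
    h.p0.tm' h.p2.tm h.p2.tm' S0 C
    (by rw [Expr.subst_var, upd_same, SortE.subst_upd hsc0 hx]; exact hu0.arg)
    (by rw [Expr.subst_id, SortE.subst_id]; exact hv.arg) hWa
    (by
      rw [Expr.subst_var, upd_same, SortE.subst_upd hsc0 hx, Expr.subst_id, SortE.subst_id]
      exact hW0)
  have tb := tySub (Nat.le_refl _) (Nat.le_refl _) (Nat.le_succ _) (Nat.le_succ _) h.ty h.p1.tm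
    h.p1.tm' h.p2.tm h.p2.tm' S1 C
    (by rw [Expr.subst_var, upd_same, SortE.subst_upd hsc hx]; exact hu.arg)
    (by rw [Expr.subst_id, SortE.subst_id]; exact hv.arg) hWb
    (by
      rw [Expr.subst_var, upd_same, SortE.subst_upd hsc hx, Expr.subst_id, SortE.subst_id]
      exact hW)
  exact D.ty_trans (D.ty_symm ta) (D.ty_trans hab tb)

/-- The ways in which a term can have a sort. -/
theorem Arg.sort_cases {A : Alphabet} {Ax : Set (Judg A)} (hA : IsGAT Ax) {X : PreCtx A} {u U}
    (hu : Arg Ax (n + 1) X X u U) : CanonSort Ax X u U ∨ ∃ P U0, P <+: X ∧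
      DerAt Ax n (.sortEq P U0 U) ∧ DerAt Ax n (.term P u U0) ∧ DerAt Ax (n + 1) (.term P u U) := by
  obtain ⟨-, ⟨P0, h0, hd⟩ | ⟨P0, y, h0, hd, rfl, hs⟩⟩ := hu
  · rcases term_inv hA.1.shaped hd with ⟨U0, h1, h2⟩ | ⟨P, x, hx, rfl, -⟩ |
      ⟨XT, t, UT, F, hax, -, -, rfl, rfl, -⟩
    · exact .inr ⟨P0, U0, h0, h1, h2, hd⟩
    · exact .inl (canonSort_var.2 ⟨P, hx.mono h0⟩)
    · exact .inl (canonSort_app_map hA hax F)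
  · exact .inl (canonSort_var.2 ⟨_, hd⟩)

theorem Lvl.convA (h : Lvl D n m) {σ X Y u U Uc v V W Wc} (hu : Arg D.TA (n + 1) X X u U)
    (hc : CanonSort D.TA X u Uc) (hv : Arg D.TB (m + 1) Y Y v V) (hr : D.CtxRel σ σ X Y)
    (hW : D.EvTy σ X X Y Y u U v V W) (hWc : D.EvTy σ X X Y Y u Uc v V Wc) : D.TyEq W Wc := by
  rcases Arg.sort_cases D.hA hu with hU | ⟨P, U0, hP, hs, hu0, hu1⟩
  · cases hU.uniq D.hA.1 hr.1 hc
    exact h.ty.h1 hu hv hr hr hWc hW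
  · obtain ⟨R, Y0, hR, hY0, hvX⟩ := Arg.exact hr.2.1 hv
    obtain ⟨W0, hW0⟩ := evTy_total σ hu0.arg hvX.arg
    obtain ⟨W1, hW1⟩ := evTy_total σ hu1.arg hvX.arg
    have e1 := h.seqStep hs hu0 hu1 hvX (hr.mono hP hY0) hW0 hW1
    have hW0' := hW0.mono hP hP hR hY0
    have hW1' := hW1.mono hP hP hR hY0
    have e2 := h.ty.h1 hu hv hr hr hW1' hW
    obtain ⟨Vc, hVc, hav⟩ := hv.canon D.hB
    have hu0' : Arg D.TA n X X u U0 := (Arg.of_term hP hu0).up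
    have huc : Arg D.TA n X X u Uc := hu0'.has.canon_arg D.hA hr.1 hc
    obtain ⟨Wcc, hWcc⟩ := evTy_total σ huc hav
    exact D.ty_trans e2 (D.ty_trans (D.ty_symm e1)
      (D.ty_trans (h.p2.cv.conv hu0' hc hv hVc hr hW0' hWcc)
        (D.ty_symm (h.p2.cv.conv huc hc hv hVc hr hWc hWcc))))

theorem Lvl.cv (h : Lvl D n m) : ConvInv D (n + 1) (m + 1) where
  conv {σ X Y u U Uc v V Vc W Wc} hu hUc hv hVc hr hW hWc := by
    have huc := hu.has.canon_arg D.hA hr.1 hUc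
    obtain ⟨W1, hW1⟩ := evTy_total σ huc hv
    exact D.ty_trans (h.convA hu hUc hv hr hW hW1) (h.swap.convA hv hVc huc hr.tr hW1.tr hWc.tr)

theorem Lvl.cl (h : Lvl D n m) {σ X Y u S ss t ts M0} (hr : D.CtxRel σ σ X Y)
    (hu : Arg D.TA (n + 1) X X u ⟨S, ss⟩) (hv : Has D.TB (m + 1) Y (.app t ts))
    (hM0 : Mat (D.Near σ X Y) (ss ++ [u]) ts M0) :
    D.Near σ X Y u (.app t ts) (D.st S t (ss.length + 1) ts.length M0) := by
  have hua : ∀ {X}, Arg D.TA (n + 1) X X u ⟨S, ss⟩ → ∀ a ∈ ss ++ [u], Has D.TA (n + 1) X a := by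
    intro X hu a ha
    rcases List.mem_append.1 ha with ha | ha
    · exact (hu.sortAt.args D.hA.1.shaped ha).mono (Nat.le_succ _) (List.prefix_refl _)
    · rw [List.mem_singleton.1 ha]; exact hu.has
  rcases Arg.sort_cases D.hA hu with hcU | ⟨P, U0, hP, hs, hu0, hu1⟩
  · intro U V W e hU hV hW he
    obtain rfl := hcU.uniq D.hA.1 hr.1 hU
    obtain ⟨e1, he1⟩ := evL_total σ hu.has hv
    obtain ⟨S1, ss1, t1, ts1, M1, hv1, hc1, hM1, rfl⟩ := id he1
    cases hv1
    cases hc1.uniq D.hA.1 hr.1 hU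
    exact D.tm_trans (h.wCL hr hu hv hV hM0 (hM1.imp fun a ha b hb e he =>
      h.p1.tm.h2 (hua hu a ha) (hv.app_args D.hB.1.shaped hb) hr he) hW)
      (h.val.h2 hu.has hv hr he1.ev _ _ _ _ hU hV hW he)
  · obtain ⟨V1, hV1⟩ := id hv
    obtain ⟨R, hR, hdv⟩ := hV1.term_of_app
    obtain ⟨V, hVc, hdV⟩ := hdv.canon D.hB
    have hvX : ArgX D.TB (m + 1) R R (.app t ts) V := .inl ⟨rfl, hdV⟩
    have hr' := hr.mono hP hR
    have hv' := hdV.arg.has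
    have hM0' : Mat (D.Near σ P R) (ss ++ [u]) ts M0 := hM0.imp fun _ _ _ _ _ h => h.anti hP hR
    refine Near.up h.cv h.val hP hR ?_ hr hu1.arg.has hv'
    obtain ⟨hRY, hnR, hnY, hsR, hsY⟩ := hvX.wf D.hB.1.shaped
    obtain ⟨k, rfl⟩ := hs.pos
    obtain ⟨hsU0, hsU⟩ := hs.sorts_of_sortEq
    have hx := D.hchA.notMem P
    have hsP : ∀ {P1 z Z}, Decl P P1 z Z → DerAt D.TA k (.sort P1 Z) := fun hd =>
      (DerAt.sort_wf hsU0).2.2 _ _ _ hd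
    obtain ⟨σ', h1, h2⟩ := row_exists σ hu0.arg.has hsR hx
    have hsc0 := DerAt.sort_scoped D.hA.1.shaped hsU0
    have hsc := DerAt.sort_scoped D.hA.1.shaped hsU
    have S0 := rowHyp h.p0.tm.toValInv hr' hx (fun hd => (hsP hd).succ) hsU0.succ hsR hu0.arg h1 h2
    have S0' := rowHyp h.p2.tm.toValInv hr' hx (fun hd => (hsP hd).succ) hsU0.succ hsY hu0.arg h1 h2
    have S1 := rowHyp h.p1.tm.toValInv hr' hx (fun hd => (hsP hd).succ.succ) hsU.succ.succ hsR
      hu1.arg h1 h2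
    have C := colHyp (u := u) h.p2.tm.toValInv hr' hx (fun hd => (hsP hd).succ) hsY h1
    have c1 := S0.ctxRel h.p0 (nodup_snoc hr'.1 hx U0) hnR S0.near
    have a0 := (Arg.of_decl (decl_snoc_self P (D.chA P) U0) hsU0.succ)
    have a1 := (Arg.of_decl (decl_snoc_self P (D.chA P) ⟨S, ss⟩) hsU.succ)
    obtain ⟨e1, he1⟩ := evL_total σ' (a1.mono (Nat.le_succ _) (List.prefix_refl _)
      (List.prefix_refl _) a1.1).has hv'
    have hnear := h.p2.eq.h4 hs hx hdV c1 he1.ev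
    obtain ⟨S1', ss1, t1, ts1, M1, hv1, hc1, hM1, rfl⟩ := id he1
    cases hv1
    cases hc1.uniq D.hA.1 (nodup_snoc hr'.1 hx _) (canonSort_var.2 ⟨_, decl_snoc_self P _ _⟩)
    obtain ⟨e0, he0⟩ := ev_total σ' a0.has hv'
    obtain ⟨Wa, hWa⟩ := evTy_total σ' a0.up hdV.arg
    obtain ⟨W0, hW0⟩ := evTy_total σ hu0.arg hdV.arg
    obtain ⟨W, hW⟩ := evTy_total σ hu1.arg hdV.arg
    obtain ⟨e, he⟩ := ev_total σ hu1.arg.has hv'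
    have q1 := hnear _ _ _ _ (canonSort_var.2 ⟨_, decl_snoc_self P _ _⟩) hVc hWa he0
    have sx : (Expr.var (D.chA P)).subst (upd .var (D.chA P) u) = u := by
      rw [Expr.subst_var, upd_same]
    have ta := tySub (Nat.le_succ _) (Nat.le_refl _) (Nat.le_refl _) (Nat.le_succ _) h.p2.ty
      h.p0.tm h.p0.tm' h.p2.tm h.p2.tm' S0 S0'
      (by rw [sx, SortE.subst_upd hsc0 hx]; exact hu0.arg)
      (by rw [Expr.subst_id, SortE.subst_id]; exact hdV.arg) hWa
      (by rw [sx, SortE.subst_upd hsc0 hx, Expr.subst_id, SortE.subst_id]; exact hW0)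
    have q2 := sb h.p2.tm h.p2.tm' S0' he0 (by rw [sx]; exact hu0.arg.has)
      (by rw [Expr.subst_id]; exact hv')
    rw [sx, Expr.subst_id] at q2
    have q3 := q2.any h.p2.cv hr' hu0.arg hdV.arg hW0 he
    have q4 := D.conv (h.seqStep hs hu0 hu1 hvX hr' hW0 hW)
      (D.tm_trans (D.conv ta q1) q3)
    have sss : ss.map (Expr.subst (upd .var (D.chA P) u)) = ss := by
      have := congrArg SortE.args (SortE.subst_upd hsc hx u)
      rwa [SortE.subst_args] at this
    have hM1' : Mat (D.Near σ P R) (ss ++ [u]) ts M1 := by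
      have e1 : ss ++ [u] =
          (ss ++ [Expr.var (D.chA P)]).map (Expr.subst (upd .var (D.chA P) u)) := by
        rw [List.map_append, sss, List.map_singleton, sx]
      have e2 : ts = ts.map (Expr.subst .var) := by
        rw [List.map_congr_left fun a _ => Expr.subst_id a, List.map_id']
      have hua' := hua hu1.arg
      have hva' : ∀ b ∈ ts, Has D.TB m R b := fun b hb => hv'.app_args D.hB.1.shaped hb
      rw [e1] at hua' ⊢
      rw [e2] at hva' ⊢
      rw [Mat.map]
      exact hM1.imp fun a ha b hb e he => sb h.p1.tm h.p1.tm' S1 he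
        (hua' _ (List.mem_map_of_mem ha)) (hva' _ (List.mem_map_of_mem hb))
    exact near_of_eq h.cv h.val hr' hu1.arg hdV.arg hW he
      (D.tm_trans (h.wCL hr' hu1.arg hv' hVc hM0' hM1' hW) q4)

theorem Lvl.tm (h : Lvl D n m) : TmInv D (n + 1) (m + 1) where
  toValInv := h.val
  cl := h.cl

end Dom
end GATPaper

namespace GATPaper

namespace Dom

variable {D : Dom} {n m k l : ℕ}

/-- Equal sorts `U`, `U'` over `P`, and values for variables of either sort and of `R`. -/
structure SEq (D : Dom) (k l : ℕ) (σ : D.Env) (P : PreCtx D.A) (x : D.A.Var) (U U' : SortE D.A)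
    (R : PreCtx D.B) : Prop where
  eq : DerAt D.TA k (.sortEq P U U')
  notMem : x ∉ names P
  rel : D.CtxRel σ σ (P ++ [(x, U)]) R
  rel' : D.CtxRel σ σ (P ++ [(x, U')]) R

theorem SEq.mono {k' l' : ℕ} (hk : k ≤ k') {σ P x U U' R}
    (h : SEq D k l σ P x U U' R) : SEq D k' l' σ P x U U' R :=
  ⟨h.eq.mono hk, h.notMem, h.rel, h.rel'⟩

theorem SEq.sorts {σ P x U U' R} (h : SEq D k l σ P x U U' R) :
    DerAt D.TA k (.sort P U) ∧ DerAt D.TA k (.sort P U') := by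
  obtain ⟨k, rfl⟩ := h.eq.pos
  exact ⟨h.eq.sorts_of_sortEq.1.succ, h.eq.sorts_of_sortEq.2.succ⟩

theorem SEq.arg {σ P x U U' R} (h : SEq D k l σ P x U U' R) :
    Arg D.TA k P (P ++ [(x, U)]) (.var x) U ∧ Arg D.TA k P (P ++ [(x, U')]) (.var x) U' :=
  ⟨Arg.of_decl (decl_snoc_self _ _ _) h.sorts.1, Arg.of_decl (decl_snoc_self _ _ _) h.sorts.2⟩

theorem SEq.relP {σ P x U U' R} (h : SEq D k l σ P x U U' R) : D.CtxRel σ σ P R :=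
  h.rel.mono (List.prefix_append _ _) (List.prefix_refl _)

theorem SrtInv.sEq (h3 : SrtInv D k l) {σ P x U U' R} (hs : DerAt D.TA k (.sortEq P U U'))
    (hx : x ∉ names P) (hsR : ∀ {P z Z}, Decl R P z Z → DerAt D.TB l (.sort P Z))
    (c : D.CtxRel σ σ (P ++ [(x, U)]) R) : SEq D k l σ P x U U' R := by
  refine ⟨hs, hx, c, ?_⟩
  obtain ⟨k, rfl⟩ := hs.pos
  have hP := List.prefix_append P [(x, U)]
  have cP := c.mono hP (List.prefix_refl _)
  refine ⟨nodup_snoc cP.1 hx _, c.2.1, fun P1 z Z R1 y V hz hy => ?_⟩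
  rcases decl_snoc.1 hz with hz | ⟨rfl, rfl, rfl⟩
  · exact cP.2.2 _ _ _ _ _ _ hz hy
  · obtain ⟨W, hW, he⟩ := c.2.2 _ _ _ _ _ _ (decl_snoc_self _ _ _) hy
    obtain ⟨W', hW'⟩ := evTy_total σ
      (Arg.of_decl (decl_snoc_self P1 z Z) hs.sorts_of_sortEq.2) (Arg.decl hy (hsR hy))
    exact ⟨W', hW', D.conv (h3.h3 hs hx (.inr ⟨y, hy.notMem c.2.1, rfl, rfl, hsR hy⟩)
      (c.mono (List.prefix_refl _) hy.isPre) (cP.mono (List.prefix_refl _) hy) hW hW') he⟩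

theorem SEq.ty {σ P x U U' R v V W W'} (h : SEq D k l σ P x U U' R) (hT : TyInv D k l)
    (h3 : SrtInv D k l) (hv : Arg D.TB l R R v V)
    (hW : D.EvTy σ P (P ++ [(x, U)]) R R (.var x) U v V W)
    (hW' : D.EvTy σ P (P ++ [(x, U')]) R R (.var x) U' v V W') : D.TyEq W W' := by
  obtain ⟨R0, Y0, hR, hY, hvX⟩ := Arg.exact h.rel.2.1 hv
  obtain ⟨W0, hW0⟩ := evTy_total σ h.arg.1 hvX.arg
  obtain ⟨W0', hW0'⟩ := evTy_total σ h.arg.2 hvX.arg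
  exact D.ty_trans (hT.h1 h.arg.1 hv h.rel h.relP
      (hW0.mono (List.prefix_refl _) (List.prefix_refl _) hR hY) hW)
    (D.ty_trans (h3.h3 h.eq h.notMem hvX (h.rel.mono (List.prefix_refl _) hR)
        (h.relP.mono (List.prefix_refl _) hY) hW0 hW0')
      (hT.h1 h.arg.2 hv h.rel' h.relP hW'
        (hW0'.mono (List.prefix_refl _) (List.prefix_refl _) hR hY)))

/-- Transport of an equation between values from one of the two sorts to the other. -/
theorem SEq.near_of_eq {σ P x U U' R v V W' e e1} (h : SEq D k l σ P x U U' R) (hT : TyInv D k l)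
    (hC : ConvInv D k l) (hV : ValInv D k l) (h3 : SrtInv D k l) (hv : Arg D.TB l R R v V)
    (hn : D.Near σ (P ++ [(x, U)]) R (.var x) v e)
    (hW' : D.EvTy σ P (P ++ [(x, U')]) R R (.var x) U' v V W') (he : D.TmEq W' e1 e) :
    D.Near σ (P ++ [(x, U)]) R (.var x) v e1 := by
  obtain ⟨W, hW⟩ := evTy_total σ h.arg.1 hv
  exact hn.trans hC hV h.rel h.arg.1 hv hW (D.conv (D.ty_symm (h.ty hT h3 hv hW hW')) he)

theorem SEq.near {σ P x U U' R v e'} (h : SEq D k l σ P x U U' R) (p : Pack D k l)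
    (hv : Has D.TB l R v) (he' : D.Ev σ (P ++ [(x, U')]) R (.var x) v e') :
    D.Near σ (P ++ [(x, U)]) R (.var x) v e' := by
  obtain ⟨V, hv⟩ := hv
  obtain ⟨-, ⟨R0, hR, hd⟩ | ⟨R0, y, hR, hd, rfl, -⟩⟩ := id hv
  · obtain ⟨e0, he0⟩ := ev_total σ h.arg.2.has hd.arg.has
    have h0 := (p.eq.h4 h.eq h.notMem hd (h.rel.mono (List.prefix_refl _) hR) he0).up p.cv
      p.tm.toValInv (List.prefix_refl _) hR h.rel h.arg.1.has hd.arg.has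
    obtain ⟨W', hW'⟩ := evTy_total σ h.arg.2 hv
    exact h.near_of_eq p.ty p.cv p.tm.toValInv p.eq.toSrtInv hv h0 hW'
      ((p.tm.h2 h.arg.2.has hv.has h.rel' he').any p.cv h.rel' h.arg.2 hv hW'
        (he0.mono (List.prefix_refl _) hR))
  · cases he'
    exact p.tm.h2 h.arg.1.has hv.has h.rel (.vv (by simp) hd.mem)

theorem SEq.near' {σ P x U U' R v e} (h : SEq D k l σ P x U U' R) (p : Pack D k l)
    (hv : Has D.TB l R v) (he : D.Ev σ (P ++ [(x, U)]) R (.var x) v e) :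
    D.Near σ (P ++ [(x, U')]) R (.var x) v e := by
  obtain ⟨V, hv⟩ := hv
  obtain ⟨e', he'⟩ := ev_total σ h.arg.2.has hv.has
  obtain ⟨W, hW⟩ := evTy_total σ h.arg.1 hv
  obtain ⟨W', hW'⟩ := evTy_total σ h.arg.2 hv
  exact Dom.near_of_eq p.cv p.tm.toValInv h.rel' h.arg.2 hv hW' he'
    (D.conv (h.ty p.ty p.eq.toSrtInv hv hW hW')
      (D.tm_symm ((h.near p hv.has he').any p.cv h.rel h.arg.1 hv hW he)))

theorem exists_row {α β γ : Type} (τ : α → β → γ) (x : α) {l : List β} {Q : β → γ → Prop}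
    (h : ∀ w ∈ l, ∃ e, Q w e) :
    ∃ τ' : α → β → γ, (∀ z, z ≠ x → ∀ w, τ' z w = τ z w) ∧ ∀ w ∈ l, Q w (τ' x w) := by
  classical
  refine ⟨fun z w => if z = x then (if h : ∃ e, Q w e then h.choose else τ z w) else τ z w,
    fun z hz w => by simp [hz], fun w hw => ?_⟩
  simp only [if_true, h w hw, dite_true]
  exact (h w hw).choose_spec

theorem exists_col {α β γ : Type} (τ : α → β → γ) (y : β) {l : List α} {Q : α → γ → Prop}
    (h : ∀ z ∈ l, ∃ e, Q z e) :
    ∃ τ' : α → β → γ, (∀ z w, w ≠ y → τ' z w = τ z w) ∧ ∀ z ∈ l, Q z (τ' z y) := by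
  obtain ⟨τ', h1, h2⟩ := exists_row (fun w z => τ z w) y h
  exact ⟨fun z w => τ' w z, fun z w hw => h1 w hw z, h2⟩

/-- Environments for the instances of an axiom between sorts. -/
theorem Low.axEnv (h : Low D n m) {σ P x X1 U1 U1' R F YT G} (τ : D.Env)
    (ha : DerAt D.TA (n + 1) (.sortEq X1 U1 U1')) (hF : ArgMor D.TA n P X1 F)
    (hsT : ∀ {P z Z}, Decl YT P z Z → DerAt D.TB m (.sort P Z)) (hG : ArgMor D.TB m R YT G)
    (hr : SEq D (n + 1) m σ P x (U1.subst F) (U1'.subst F) R)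
    (hτ : ∀ z ∈ names X1, ∀ w ∈ names YT, D.Ev σ P R (F z) (G w) (τ z w)) :
    ∃ σ0 : D.Env, (∀ z ∈ names X1, ∀ w, σ0 z w = τ z w) ∧
      SubHyp D (n + 1) m σ (P ++ [(x, U1.subst F)]) R (upd F (D.chA X1) (.var x)) G σ0
        (X1 ++ [(D.chA X1, U1)]) YT ∧
      SubHyp D (n + 1) m σ (P ++ [(x, U1'.subst F)]) R (upd F (D.chA X1) (.var x)) G σ0
        (X1 ++ [(D.chA X1, U1')]) YT := by
  have hx1 := D.hchA.notMem X1
  obtain ⟨hsU1, hsU1'⟩ := ha.sorts_of_sortEq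
  have hwf := DerAt.sort_wf hsU1
  have hsc : ∀ v, SOccurs v U1 → v ∈ names X1 := DerAt.sort_scoped D.hA.1.shaped hsU1
  have hsc' : ∀ v, SOccurs v U1' → v ∈ names X1 := DerAt.sort_scoped D.hA.1.shaped hsU1'
  obtain ⟨σ0, h1, h2⟩ := exists_row τ (D.chA X1) (l := names YT)
    (Q := fun w e => D.Ev σ (P ++ [(x, U1.subst F)]) R (.var x) (G w) e)
    fun w hw => ev_total σ hr.arg.1.has (ArgMor.has hG hw)
  have h1' : ∀ z ∈ names X1, ∀ w, σ0 z w = τ z w := fun z hz w => h1 z (fun e => hx1 (e ▸ hz)) w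
  refine ⟨σ0, h1', ?_, ?_⟩
  · refine ⟨hr.rel, fun hd => ?_, hsT,
      ((hF.up (List.prefix_append _ _)).mono (Nat.le_succ _)).snoc hwf.2.1 hx1 hsc hr.arg.1.up, hG,
      fun {z w} hz hw => ?_⟩
    · rcases decl_snoc.1 hd with hd | ⟨rfl, rfl, rfl⟩
      · exact (hwf.2.2 _ _ _ hd).succ
      · exact hsU1.succ
    · rw [names_snoc] at hz
      rcases List.mem_append.1 hz with hz | hz
      · rw [upd_of_mem _ _ hx1 hz, h1' z hz]
        exact h.p1.tm.h2 (((ArgMor.has hF hz).mono (Nat.le_succ _) (List.prefix_append _ _)))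
          (ArgMor.has hG hw) hr.rel ((hτ z hz w hw).mono (List.prefix_append _ _)
            (List.prefix_refl _))
      · rw [List.mem_singleton.1 hz, upd_same]
        exact h.p1.tm.h2 hr.arg.1.has (ArgMor.has hG hw) hr.rel (h2 w hw)
  · refine ⟨hr.rel', fun hd => ?_, hsT,
      ((hF.up (List.prefix_append _ _)).mono (Nat.le_succ _)).snoc hwf.2.1 hx1 hsc' hr.arg.2.up, hG,
      fun {z w} hz hw => ?_⟩
    · rcases decl_snoc.1 hd with hd | ⟨rfl, rfl, rfl⟩
      · exact (hwf.2.2 _ _ _ hd).succ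
      · exact hsU1'.succ
    · rw [names_snoc] at hz
      rcases List.mem_append.1 hz with hz | hz
      · rw [upd_of_mem _ _ hx1 hz, h1' z hz]
        exact h.p1.tm.h2 (((ArgMor.has hF hz).mono (Nat.le_succ _) (List.prefix_append _ _)))
          (ArgMor.has hG hw) hr.rel' ((hτ z hz w hw).mono (List.prefix_append _ _)
            (List.prefix_refl _))
      · rw [List.mem_singleton.1 hz, upd_same]
        exact hr.near' h.p1 (ArgMor.has hG hw) (h2 w hw)

theorem evTy_total' (σ : D.Env) {P X : PreCtx D.A} {R Y : PreCtx D.B} {u U v V}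
    (hu : Arg D.TA n P X u U) (hv : Arg D.TB m R Y v V) :
    ∃ M, TyMat (D.Ev σ) P X R Y U.args u V.args v M ∧ Mat (D.Ev σ P R) U.args V.args M := by
  obtain ⟨n, rfl⟩ := hu.pos
  obtain ⟨m, rfl⟩ := hv.pos
  have hA := D.hA.1.shaped
  have hB := D.hB.1.shaped
  obtain ⟨M1, hM1⟩ := mat_exists (Q := D.Ev σ P R) (us := U.args) (vs := V.args) (fun a ha b hb =>
    ev_total σ (hu.sortAt.args hA ha) (hv.sortAt.args hB hb)) (σ (D.chA []) (D.chB []))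
  obtain ⟨M2, h1, h2⟩ := exists_row M1 U.args.length (l := List.range V.args.length)
    (Q := fun j e => ∀ hj : j < V.args.length, D.Ev σ X R u V.args[j] e) (fun j hj => by
      obtain ⟨e, he⟩ := ev_total σ hu.has
        (hv.sortAt.args hB (List.getElem_mem (List.mem_range.1 hj)))
      exact ⟨e, fun _ => he⟩)
  obtain ⟨M3, h3, h4⟩ := exists_col M2 V.args.length (l := List.range U.args.length)
    (Q := fun i e => ∀ hi : i < U.args.length, D.Ev σ P Y U.args[i] v e) (fun i hi => by
      obtain ⟨e, he⟩ := ev_total σ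
        (hu.sortAt.args hA (List.getElem_mem (List.mem_range.1 hi))) hv.has
      exact ⟨e, fun _ => he⟩)
  have h0 : Mat (D.Ev σ P R) U.args V.args M3 := fun i hi j hj => by
    rw [h3 _ _ (by omega), h1 _ (by omega)]
    exact hM1 i hi j hj
  refine ⟨M3, ⟨?_, ?_⟩, h0⟩
  · refine Mat.snoc_left (h0.imp fun _ _ _ _ _ h => h.mono hu.1 (List.prefix_refl _)) fun j hj => ?_
    rw [h3 _ _ (by omega)]
    exact h2 j (List.mem_range.2 hj) hj
  · refine Mat.tr (Mat.snoc_left (M := fun j i => M3 i j)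
      (Mat.tr (h0.imp fun _ _ _ _ _ h => h.mono (List.prefix_refl _) hv.1)) fun i hi => ?_)
    exact h4 i (List.mem_range.2 hi) hi

end Dom
end GATPaper

namespace GATPaper

namespace Dom

variable {D : Dom} {n m k l : ℕ}

theorem Mat.imp_map {ι α β γ : Type} {Q Q' : α → β → γ → Prop} {L : List ι} {f g : ι → α}
    {vs : List β} {M : ℕ → ℕ → γ} (h : Mat Q (L.map g) vs M)
    (hQ : ∀ p ∈ L, ∀ v ∈ vs, ∀ e, Q (g p) v e → Q' (f p) v e) : Mat Q' (L.map f) vs M := by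
  intro i hi j hj
  have hi' : i < L.length := by simpa using hi
  have := h i (by simpa using hi) j hj
  simp only [List.getElem_map] at this ⊢
  exact hQ _ (List.getElem_mem _) _ (List.getElem_mem _) _ this

theorem Low.srtInv (h : Low D n m) (es : D.AxSrt (n + 1) (m + 1)) :
    SrtInv D (n + 1) (m + 1) where
  h3 := by
    intro σ P x U U' R Y v V W W' hs hx hv c1 c2 hW hW'
    have hA := D.hA.1.shaped
    have hB := D.hB.1.shaped
    obtain ⟨hRY, hnR, hnY, hsR, hsY⟩ := hv.wf hB
    have hr := h.p1.eq.toSrtInv.sEq hs hx hsR c1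
    have hPx {U : SortE D.A} := List.prefix_append P [(x, U)]
    rcases sortEq_inv hs with hs' | ⟨rfl, -⟩ | hs' | ⟨U2, h2, h3⟩ | ⟨X1, U1, U1', F, hax, ha, rfl, rfl, hF⟩ |
      ⟨XS, S, F, G, hax, hd, rfl, rfl, hU, hU', heq⟩
    · exact h.p2.eq.h3 hs' hx hv c1 c2 hW hW'
    · exact h.ty.h1 hr.arg.1 hv.arg c1 c2 hW' hW
    · exact D.ty_symm (h.p2.eq.h3 hs' hx hv hr.rel' c2 hW' hW)
    · have hr2 := h.p0.eq.toSrtInv.sEq h2 hx hsR c1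
      obtain ⟨W2, hW2⟩ := evTy_total σ hr2.arg.2 hv.arg
      exact D.ty_trans (h.p2.eq.h3 h2 hx hv c1 c2 hW hW2)
        (h.p2.eq.h3 h3 hx hv hr2.rel' c2 hW2 hW')
    · obtain ⟨YT, T, G, haxT, hdT, rfl, rfl, hG, hG', hn2, hs2, hs2'⟩ := hv.arg.frame hB D.hchB
      have hx1 := D.hchA.notMem X1
      have hy1 := D.hchB.notMem YT
      obtain ⟨τ, hτ⟩ := exists_env (Q := D.Ev σ P R) (F := F) (G := G) (X := X1) (Y := YT) σ
        fun z hz w hw => ev_total σ (ArgMor.has hF hz) (ArgMor.has hG hw)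
      obtain ⟨τ', h1, h2⟩ := exists_col τ (D.chB YT) (l := names X1)
        (Q := fun z e => D.Ev σ P Y (F z) (G (D.chB YT)) e)
        fun z hz => ev_total σ (ArgMor.has hF hz) hv.arg.has
      have h1' : ∀ z, ∀ w ∈ names YT, τ' z w = τ z w := fun z w hw => h1 z w fun e => hy1 (e ▸ hw)
      obtain ⟨σ0, h0, S1, S1'⟩ := h.axEnv τ' ha hF hs2 hG hr fun z hz w hw => by
        rw [h1' z w hw]
        exact hτ z hz w hw
      obtain ⟨hsU1, hsU1'⟩ := ha.sorts_of_sortEq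
      have hwf := DerAt.sort_wf hsU1
      have hsc : ∀ v, SOccurs v U1 → v ∈ names X1 := DerAt.sort_scoped hA hsU1
      have hsc' : ∀ v, SOccurs v U1' → v ∈ names X1 := DerAt.sort_scoped hA hsU1'
      have S2 : SubHyp D n (m + 1) σ P Y (upd F (D.chA X1) (.var x)) G σ0 X1
          (YT ++ [(D.chB YT, ⟨T, ctxVars YT⟩)]) := by
        refine ⟨c2, fun hd => hwf.2.2 _ _ _ hd, hs2',
          hF.congr hwf.2.1 fun z hz => (upd_of_mem _ _ hx1 hz).symm, hG', fun {z w} hz hw => ?_⟩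
        rw [upd_of_mem _ _ hx1 hz, h0 z hz]
        rw [names_snoc] at hw
        rcases List.mem_append.1 hw with hw | hw
        · rw [h1' z w hw]
          exact h.p2.tm.h2 (ArgMor.has hF hz) ((ArgMor.has hG hw).mono (Nat.le_succ _) hRY) c2
            ((hτ z hz w hw).mono (List.prefix_refl _) hRY)
        · rw [List.mem_singleton.1 hw]
          exact h.p2.tm.h2 (ArgMor.has hF hz) hv.arg.has c2 (h2 z hz)
      obtain ⟨W1, W1', hW1, hW1', he⟩ := es hax ha haxT hdT
        (S1.ctxRel h.p1 (nodup_snoc hwf.1 hx1 _)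
          (nodup_of_isPre (List.prefix_append _ _) hn2) S1.near)
        (S2.ctxRel h.p2 hwf.1 hn2 S2.near)
      have ex : (Expr.var (D.chA X1)).subst (upd F (D.chA X1) (.var x)) = .var x := by
        rw [Expr.subst_var, upd_same]
      have eU : U1.subst (upd F (D.chA X1) (.var x)) = U1.subst F :=
        SortE.subst_congr _ fun z hz => upd_of_mem _ _ hx1 (hsc z hz)
      have eU' : U1'.subst (upd F (D.chA X1) (.var x)) = U1'.subst F :=
        SortE.subst_congr _ fun z hz => upd_of_mem _ _ hx1 (hsc' z hz)
      have eV : (⟨T, ctxVars YT⟩ : SortE D.B).subst G = ⟨T, (names YT).map G⟩ := by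
        rw [SortE.subst_mk, ctxVars_eq]
      have ta := tySub (Nat.le_refl _) (Nat.le_refl _) (Nat.le_succ _) (Nat.le_succ _) h.ty h.p1.tm
        h.p1.tm' h.p2.tm h.p2.tm' S1 S2 (W2 := W) (by rw [ex, eU]; exact hr.arg.1)
        (by rw [Expr.subst_var, eV]; exact hv.arg) hW1
        (by rw [ex, eU, Expr.subst_var, eV]; exact hW)
      have tb := tySub (Nat.le_refl _) (Nat.le_refl _) (Nat.le_succ _) (Nat.le_succ _) h.ty h.p1.tm
        h.p1.tm' h.p2.tm h.p2.tm' S1' S2 (W2 := W') (by rw [ex, eU']; exact hr.arg.2)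
        (by rw [Expr.subst_var, eV]; exact hv.arg) hW1'
        (by rw [ex, eU', Expr.subst_var, eV]; exact hW')
      exact D.ty_trans (D.ty_symm ta) (D.ty_trans he tb)
    · obtain ⟨M, hM, hM'⟩ := evTy_total' σ hr.arg.2 hv.arg
      have hva : ∀ a ∈ V.args, Has D.TB m R a := fun a ha => hv.arg.sortAt.args hB ha
      have hFG : ∀ p ∈ XS, DerAt D.TA n (.termEq P (F p.1) (G p.1) (p.2.subst F)) := by
        intro p hp
        obtain ⟨i, hi, rfl⟩ := List.mem_iff_getElem.1 hp
        exact heq _ _ _ (decl_getElem hi)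
      have hF : ∀ p ∈ XS, Has D.TA n P (F p.1) := fun p hp => by
        obtain ⟨k, rfl⟩ := hd.pos
        exact (hFG p hp).terms_of_termEq.1.succ.arg.has
      refine D.ty_trans (D.ty_symm (h.ty.ct (M0 := M) hr.arg.1 hv.arg c1 c2 ⟨?_, ?_⟩ hW)) ?_
      · refine Mat.snoc_left (Mat.imp_map (hM'.imp fun _ _ _ _ _ h => h) fun p hp b hb e he => ?_)
          fun j hj => ?_
        · exact (h.p0.eq.h5 (hFG p hp) (hva b hb) hr.relP he).up h.p0.cv h.p0.tm.toValInv hPx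
            (List.prefix_refl _) c1 (hF p hp) (hva b hb)
        · refine hr.near h.p1 (hva _ (List.getElem_mem _)) ?_
          have := hM.1.last j hj
          simpa using this
      · refine Mat.imp_map hM.2 fun p hp b hb e he => ?_
        refine h.p2.eq.h5 (hFG p hp) ?_ c2 he
        rcases List.mem_append.1 hb with hb | hb
        · exact (hva b hb).mono (Nat.le_succ _) hRY
        · rw [List.mem_singleton.1 hb]; exact hv.arg.has
      · refine h.ty.h1 hr.arg.2 hv.arg hr.rel' c2 hW' ⟨M, ?_, hM⟩
        simp [tyOf]

theorem Lvl.h3 (h : Lvl D n m) : SrtInv D (n + 1) (m + 1) := h.low.srtInv h.ax.es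

end Dom
end GATPaper

namespace GATPaper

namespace Dom

variable {D : Dom} {n m k l : ℕ}

theorem mat_exists_snoc (σ : D.Env) {P X : PreCtx D.A} {R : PreCtx D.B} {us u vs}
    (hu : Has D.TA (n + 1) X u) (hus : ∀ a ∈ us, Has D.TA n P a)
    (hvs : ∀ b ∈ vs, Has D.TB m R b) :
    ∃ M, Mat (D.Ev σ P R) us vs M ∧ ∀ j (hj : j < vs.length), D.Ev σ X R u vs[j] (M us.length j) := by
  obtain ⟨M1, hM1⟩ := mat_exists (Q := D.Ev σ P R) (us := us) (vs := vs)
    (fun a ha b hb => ev_total σ (hus a ha) (hvs b hb)) (σ (D.chA []) (D.chB []))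
  obtain ⟨M2, h1, h2⟩ := exists_row M1 us.length (l := List.range vs.length)
    (Q := fun j e => ∀ hj : j < vs.length, D.Ev σ X R u vs[j] e) (fun j hj => by
      obtain ⟨e, he⟩ := ev_total σ hu (hvs _ (List.getElem_mem (List.mem_range.1 hj)))
      exact ⟨e, fun _ => he⟩)
  refine ⟨M2, fun i hi j hj => ?_, fun j hj => h2 j (List.mem_range.2 hj) hj⟩
  rw [h1 _ (by omega)]
  exact hM1 i hi j hj

theorem Lvl.h4 (h : Lvl D n m) {σ P x U U' R v V e'} (hs : DerAt D.TA (n + 1) (.sortEq P U U'))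
    (hx : x ∉ names P) (hv : DerAt D.TB (m + 1) (.term R v V))
    (c1 : D.CtxRel σ σ (P ++ [(x, U)]) R) (he' : D.Ev σ (P ++ [(x, U')]) R (.var x) v e') :
    D.Near σ (P ++ [(x, U)]) R (.var x) v e' := by
  have hA := D.hA.1.shaped
  have hB := D.hB.1.shaped
  have hvX : ArgX D.TB (m + 1) R R v V := .inl ⟨rfl, hv⟩
  obtain ⟨-, hnR, -, hsR, hsY⟩ := hvX.wf hB
  have hr := h.p1.eq.toSrtInv.sEq hs hx hsR c1
  have hr' : SEq D (n + 1) (m + 1) σ P x U U' R := hr.mono le_rfl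
  have hPx {U : SortE D.A} := List.prefix_append P [(x, U)]
  cases v with
  | var y =>
    cases he' with
    | vv hxm hy => exact h.val.h2 hr.arg.1.has hv.arg.has c1 (.vv (by simp) hy)
  | app t ts =>
    rcases sortEq_inv hs with hs' | ⟨rfl, -⟩ | hs' | ⟨U2, h2, h3⟩ | ⟨X1, U1, U1', F, hax, ha, rfl, rfl, hF⟩ |
      ⟨XS, S, F, G, hax, hd, rfl, rfl, hU, hU', heq⟩
    · exact h.p2.eq.h4 hs' hx hv c1 he'
    · exact h.val.h2 hr.arg.1.has hv.arg.has c1 he'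
    · exact (h.p2.eq.toSrtInv.sEq hs' hx hsY hr.rel').near' h.p2 hv.arg.has he'
    · have hr2 := h.p2.eq.toSrtInv.sEq h2 hx hsY c1
      have hr3 := h.p2.eq.toSrtInv.sEq h3 hx hsY hr2.rel'
      obtain ⟨e2, he2⟩ := ev_total σ hr2.arg.2.has hv.arg.has
      obtain ⟨W2, hW2⟩ := evTy_total σ hr2.arg.2 hv.arg
      exact hr2.near_of_eq h.p2.ty h.p2.cv h.p2.tm.toValInv h.p2.eq.toSrtInv hv.arg
        (hr2.near h.p2 hv.arg.has he2) hW2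
        ((hr3.near h.p2 hv.arg.has he').any h.p2.cv hr2.rel' hr2.arg.2 hv.arg hW2 he2)
    · obtain ⟨YT, VT, G, haxT, hdT, rfl, hG, hn2, hs2, -, -, hcB, haB⟩ := hv.arg.has.app_frame D.hB
      have hx1 := D.hchA.notMem X1
      obtain ⟨τ, hτ⟩ := exists_env (Q := D.Ev σ P R) (F := F) (G := G) (X := X1) (Y := YT) σ
        fun z hz w hw => ev_total σ (ArgMor.has hF hz) (ArgMor.has hG hw)
      obtain ⟨σ0, h0, S1, S1'⟩ := h.low.axEnv τ ha hF hs2 hG hr hτ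
      have hwf := DerAt.sort_wf ha.sorts_of_sortEq.1
      have hsc : ∀ v, SOccurs v U1 → v ∈ names X1 :=
        DerAt.sort_scoped hA ha.sorts_of_sortEq.1
      have S2 : SubHyp D n (m + 1) σ P R (upd F (D.chA X1) (.var x)) G σ0 X1 YT :=
        ⟨hr.relP, fun hd => hwf.2.2 _ _ _ hd, fun hd => (hs2 hd).succ,
          hF.congr hwf.2.1 fun z hz => (upd_of_mem _ _ hx1 hz).symm, hG.mono (Nat.le_succ _),
          fun {z w} hz hw => (S1.near (by simp [hz]) hw).anti hPx (List.prefix_refl _)⟩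
      obtain ⟨e, e1, W1, he, he1, hW1, hee⟩ := h.ax.et hax ha haxT hdT
        (S1.ctxRel h.p1 (nodup_snoc hwf.1 hx1 _) hn2 S1.near)
      have ex : (Expr.var (D.chA X1)).subst (upd F (D.chA X1) (.var x)) = .var x := by
        rw [Expr.subst_var, upd_same]
      have eU : U1.subst (upd F (D.chA X1) (.var x)) = U1.subst F :=
        SortE.subst_congr _ fun z hz => upd_of_mem _ _ hx1 (hsc z hz)
      have ev : (Expr.app t (ctxVars YT)).subst G = .app t ((names YT).map G) := by
        rw [Expr.subst_app, ctxVars_eq]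
      have n1 := sb h.tm h.swap.tm (S1.mono le_rfl (Nat.le_succ _)) he (by rw [ex]; exact hr.arg.1.has)
        (by rw [ev]; exact hv.arg.has)
      have n2 := sb h.tm h.swap.tm (S1'.mono le_rfl (Nat.le_succ _)) he1
        (by rw [ex]; exact hr.arg.2.has) (by rw [ev]; exact hv.arg.has)
      rw [ex, ev] at n1 n2
      obtain ⟨W, hW⟩ := evTy_total σ hr.arg.1 haB
      obtain ⟨W', hW'⟩ := evTy_total σ hr.arg.2 haB
      have ta := tySub (Nat.le_refl _) (Nat.le_refl _) (Nat.le_succ _) (Nat.le_succ _) h.ty h.p1.tm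
        h.p1.tm' h.p2.tm h.p2.tm' S1 S2 (W2 := W) (by rw [ex, eU]; exact hr.arg.1)
        (by rw [ev]; exact haB) hW1 (by rw [ex, eU, ev]; exact hW)
      refine hr'.near_of_eq h.ty h.cv h.val h.h3 haB ?_ hW'
        (D.tm_symm (n2.any h.cv hr.rel' hr.arg.2 haB hW' he'))
      exact n1.trans h.cv h.val hr.rel hr.arg.1 haB hW (D.conv ta (D.tm_symm hee))
    · have hva : ∀ b ∈ ts, Has D.TB m R b := fun b hb => hv.arg.has.app_args hB hb
      have hFG : ∀ p ∈ XS, DerAt D.TA n (.termEq P (F p.1) (G p.1) (p.2.subst F)) := by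
        intro p hp
        obtain ⟨i, hi, rfl⟩ := List.mem_iff_getElem.1 hp
        exact heq _ _ _ (decl_getElem hi)
      have hFG' : ∀ p ∈ XS, Has D.TA n P (F p.1) ∧ Has D.TA n P (G p.1) := fun p hp => by
        obtain ⟨k, rfl⟩ := hd.pos
        exact ⟨(hFG p hp).terms_of_termEq.1.succ.arg.has, (hFG p hp).terms_of_termEq.2.succ.arg.has⟩
      obtain ⟨M, hM, hMx⟩ := mat_exists_snoc σ (us := XS.map fun p => G p.1) hr.arg.2.has
        (by
          intro a ha
          obtain ⟨p, hp, rfl⟩ := List.mem_map.1 ha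
          exact (hFG' p hp).2) hva
      have e2 : D.Ev σ (P ++ [(x, ⟨S, XS.map fun p => G p.1⟩)]) R (.var x) (.app t ts) _ :=
        .L (canonSort_var.2 ⟨P, decl_snoc_self _ _ _⟩)
          (Mat.snoc_left (hM.imp fun _ _ _ _ _ h => h.mono hPx (List.prefix_refl _)) hMx)
      have n2 := h.cl (M0 := M) c1 hr.arg.1.up hv.arg.has (by
        refine Mat.snoc_left (Mat.imp_map hM fun p hp b hb e he => ?_) fun j hj => ?_
        · exact (h.p0.eq.h5 (hFG p hp) (hva b hb) hr.relP he).up h.p0.cv h.p0.tm.toValInv hPx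
            (List.prefix_refl _) c1 (hFG' p hp).1 (hva b hb)
        · refine hr.near h.p1 (hva _ (List.getElem_mem _)) ?_
          have := hMx j hj
          simpa using this)
      obtain ⟨W', hW'⟩ := evTy_total σ hr.arg.2 hv.arg
      refine hr'.near_of_eq h.ty h.cv h.val h.h3 hv.arg n2 hW' ?_
      have := (h.val.h2 hr.arg.2.has hv.arg.has hr.rel' he').any h.cv hr.rel' hr.arg.2 hv.arg hW' e2
      simpa using this

end Dom
end GATPaper

namespace GATPaper

namespace Dom

variable {D : Dom} {n m k l : ℕ}

theorem Low.tyTermEq (h : Low D n m) {σ P u u' U Y v V W W'}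
    (hs : DerAt D.TA (n + 1) (.termEq P u u' U)) (hv : Arg D.TB (m + 1) Y Y v V)
    (hr : D.CtxRel σ σ P Y) (hW : D.EvTy σ P P Y Y u U v V W)
    (hW' : D.EvTy σ P P Y Y u' U v V W') : D.TyEq W W' := by
  obtain ⟨hu, hu'⟩ := hs.terms_of_termEq
  obtain ⟨M, rfl, hM1, hM2⟩ := hW'
  obtain ⟨k, rfl⟩ := hu.pos
  have hua : ∀ a ∈ U.args, Has D.TA (k + 1) P a := fun a ha =>
    (hu.arg.sortAt.args D.hA.1.shaped ha).mono (Nat.le_succ _) (List.prefix_refl _)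
  have hva : ∀ a ∈ V.args, Has D.TB m Y a := fun a ha => hv.sortAt.args D.hB.1.shaped ha
  refine D.ty_symm (h.p2.ty.ct (M0 := M) hu.arg hv hr hr ⟨?_, ?_⟩ hW)
  · refine Mat.snoc_left (hM1.left.imp fun a ha b hb e he =>
      h.p0.tm.h2 (hua a ha) (hva b hb) hr he) fun j hj => ?_
    exact h.p1.eq.h5 hs (hva _ (List.getElem_mem _)) hr (hM1.last j hj)
  · refine hM2.imp fun a ha b hb e he => h.p2.tm.h2 (hua a ha) ?_ hr he
    rcases List.mem_append.1 hb with hb | hb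
    · exact (hva b hb).mono (Nat.le_succ _) (List.prefix_refl _)
    · rw [List.mem_singleton.1 hb]; exact hv.has

theorem Lvl.near_of_termEq (h : Lvl D n m) {σ P u u' U Y v V W' e e'}
    (hs : DerAt D.TA (n + 1) (.termEq P u u' U)) (hv : Arg D.TB (m + 1) Y Y v V)
    (hr : D.CtxRel σ σ P Y) (hn : D.Near σ P Y u v e)
    (hW' : D.EvTy σ P P Y Y u' U v V W') (he : D.TmEq W' e' e) : D.Near σ P Y u v e' := by
  obtain ⟨hu, hu'⟩ := hs.terms_of_termEq
  obtain ⟨W, hW⟩ := evTy_total σ hu.succ.arg hv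
  exact hn.trans h.cv h.val hr hu.succ.arg hv hW
    (D.conv (D.ty_symm (h.low.tyTermEq hs hv hr hW hW')) he)

theorem Lvl.h5 (h : Lvl D n m) {σ P u u' U Y v e'} (hs : DerAt D.TA (n + 1) (.termEq P u u' U))
    (hv : Has D.TB (m + 1) Y v) (hr : D.CtxRel σ σ P Y) (he' : D.Ev σ P Y u' v e') :
    D.Near σ P Y u v e' := by
  have hA := D.hA.1.shaped
  have hB := D.hB.1.shaped
  obtain ⟨V, hVv⟩ := id hv
  obtain ⟨hu, hu'⟩ := hs.terms_of_termEq
  obtain ⟨W', hW'⟩ := evTy_total σ hu'.succ.arg hVv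
  cases v with
  | app t ts =>
    obtain ⟨S, ss⟩ := U
    have hva : ∀ b ∈ ts, Has D.TB m Y b := fun b hb => hv.app_args hB hb
    obtain ⟨k, rfl⟩ := hu.pos
    have hua : ∀ a ∈ ss, Has D.TA (k + 1) P a := fun a ha =>
      (hu.arg.sortAt.args (U := ⟨S, ss⟩) hA ha).mono (Nat.le_succ _) (List.prefix_refl _)
    obtain ⟨M, hM, hMx⟩ := mat_exists_snoc σ (us := ss) hu'.succ.arg.has hua hva
    have h0 : Mat (D.Near σ P Y) ss ts M := hM.imp fun a ha b hb e he =>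
      h.p0.tm.h2 (hua a ha) (hva b hb) hr he
    have n1 := h.cl hr hu.succ.arg hv (Mat.snoc_left h0 fun j hj =>
      h.p1.eq.h5 hs (hva _ (List.getElem_mem _)) hr (hMx j hj))
    have n2 := h.cl hr hu'.succ.arg hv (Mat.snoc_left h0 fun j hj =>
      h.p1.tm.h2 hu'.succ.arg.has (hva _ (List.getElem_mem _)) hr (hMx j hj))
    exact h.near_of_termEq hs hVv hr n1 hW' (D.tm_symm (n2.any h.cv hr hu'.succ.arg hVv hW' he'))
  | var y =>
    rcases termEq_inv hs with hs' | ⟨rfl, -⟩ | hs' | ⟨u2, h2, h3⟩ | ⟨U0, -, h2⟩ |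
      ⟨X1, u1, u1', U1, F, hax, ha, rfl, rfl, rfl, hF⟩ |
      ⟨XT, t, UT, F, G, hax, hd, rfl, rfl, rfl, -, -, heq⟩
    · exact h.p2.eq.h5 hs' hv hr he'
    · exact h.val.h2 hu.succ.arg.has hv hr he'
    · obtain ⟨e, he⟩ := ev_total σ hu.succ.arg.has hv
      exact h.near_of_termEq hs hVv hr (h.val.h2 hu.succ.arg.has hv hr he) hW'
        (D.tm_symm ((h.p2.eq.h5 hs' hv hr he).any h.cv hr hu'.succ.arg hVv hW' he'))
    · have hu2 : DerAt D.TA (n + 1) (.term P u2 U) := h2.succ.terms_of_termEq.2.succ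
      obtain ⟨e2, he2⟩ := ev_total σ hu2.arg.has hv
      obtain ⟨W2, hW2⟩ := evTy_total σ hu2.arg hVv
      exact h.near_of_termEq h2.succ hVv hr (h.p2.eq.h5 h2 hv hr he2) hW2
        ((h.p2.eq.h5 h3 hv hr he').any h.cv hr hu2.arg hVv hW2 he2)
    · exact h.p2.eq.h5 h2 hv hr he'
    · obtain ⟨YT, T, G, haxT, hdT, rfl, ey, hG, hG', hn2, hs2, hs2'⟩ := hVv.frame hB D.hchB
      have hau := ha.terms_of_termEq.1
      obtain ⟨k, rfl⟩ := hau.pos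
      have hwf := DerAt.sort_wf (DerAt.sort_of_term (n := k) hau)
      obtain ⟨σ0, hσ0⟩ := exists_env (Q := D.Ev σ P Y) (F := F) (G := G) (X := X1)
        (Y := YT ++ [(D.chB YT, ⟨T, ctxVars YT⟩)]) σ
        fun z hz w hw => ev_total σ (ArgMor.has hF hz) (ArgMor.has hG' hw)
      have S : SubHyp D (k + 1) (m + 1) σ P Y F G σ0 X1 (YT ++ [(D.chB YT, ⟨T, ctxVars YT⟩)]) :=
        ⟨hr, fun hd => (hwf.2.2 _ _ _ hd).succ, hs2', hF, hG', fun {z w} hz hw =>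
          h.p2.tm.h2 (ArgMor.has hF hz) (ArgMor.has hG' hw) hr (hσ0 z hz w hw)⟩
      obtain ⟨e, e1, W1, he, he1, hW1, hee⟩ := h.ax.qs hax ha haxT hdT
        (S.ctxRel h.p2 hwf.1 hn2 S.near)
      have ev : (Expr.var (D.chB YT)).subst G = .var y := by rw [Expr.subst_var, ey]
      have eV : (⟨T, ctxVars YT⟩ : SortE D.B).subst G = ⟨T, (names YT).map G⟩ := by
        rw [SortE.subst_mk, ctxVars_eq]
      have n1 := sb h.p2.tm h.p2.tm' S he hu.arg.has (by rw [ev]; exact hv)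
      have n2 := sb h.p2.tm h.p2.tm' S he1 hu'.arg.has (by rw [ev]; exact hv)
      rw [ev] at n1 n2
      obtain ⟨W, hW⟩ := evTy_total σ hu.arg hVv
      have ta := tySub (Nat.le_succ _) (Nat.le_succ _) (Nat.le_refl _) (Nat.le_refl _) h.p2.ty
        h.p2.tm h.p2.tm' h.p2.tm h.p2.tm'
        (S.restrict (List.prefix_refl _) (List.prefix_append _ _)) S (W2 := W) hu.arg
        (by rw [ev, eV]; exact hVv) hW1 (by rw [ev, eV]; exact hW)
      refine h.near_of_termEq hs hVv hr
        (n1.trans h.cv h.val hr hu.succ.arg hVv hW (D.conv ta (D.tm_symm hee))) hW' ?_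
      exact D.tm_symm (n2.any h.cv hr hu'.succ.arg hVv hW' he')
    · obtain ⟨T, ts⟩ := V
      have hFG : ∀ p ∈ XT, DerAt D.TA n (.termEq P (F p.1) (G p.1) (p.2.subst F)) := by
        intro p hp
        obtain ⟨i, hi, rfl⟩ := List.mem_iff_getElem.1 hp
        exact heq _ _ _ (decl_getElem hi)
      have hFG' : ∀ p ∈ XT, Has D.TA n P (G p.1) := fun p hp => by
        obtain ⟨k, rfl⟩ := hd.pos
        exact (hFG p hp).terms_of_termEq.2.succ.arg.has
      have hva : ∀ b ∈ ts ++ [Expr.var y], Has D.TB (m + 1) Y b := fun b hb => by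
        rcases List.mem_append.1 hb with hb | hb
        · exact (hVv.sortAt.args (U := ⟨T, ts⟩) hB hb).mono (Nat.le_succ _) (List.prefix_refl _)
        · rw [List.mem_singleton.1 hb]; exact hv
      obtain ⟨M, hM⟩ := mat_exists (Q := D.Ev σ P Y) (us := XT.map fun p => G p.1)
        (vs := ts ++ [.var y]) (by
          intro a ha b hb
          obtain ⟨p, hp, rfl⟩ := List.mem_map.1 ha
          obtain ⟨k, rfl⟩ := hd.pos
          exact ev_total σ (hFG' p hp) (hva b hb)) (σ (D.chA []) (D.chB []))
      have n1 := h.swap.tm.cr hr hVv hu.succ.arg.has (Mat.imp_map hM fun p hp b hb e he =>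
        h.p2.eq.h5 (hFG p hp) (hva b hb) hr he)
      have n2 := h.swap.tm.cr hr hVv hu'.succ.arg.has (Mat.imp_map hM fun p hp b hb e he =>
        h.p2.tm.h2 (hFG' p hp) (hva b hb) hr he)
      rw [List.length_map] at n1 n2
      exact h.near_of_termEq hs hVv hr n1 hW' (D.tm_symm (n2.any h.cv hr hu'.succ.arg hVv hW' he'))

theorem Lvl.eq (h : Lvl D n m) : EqInv D (n + 1) (m + 1) where
  toSrtInv := h.h3
  h4 := h.h4
  h5 := h.h5

theorem Lvl.pack (h : Lvl D n m) : Pack D (n + 1) (m + 1) :=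
  ⟨h.ty, h.swap.ty, h.cv, h.swap.cv, h.tm, h.swap.tm, h.eq, h.swap.eq⟩

end Dom
end GATPaper

namespace GATPaper

/-! ## Closure properties of derivability -/

section Closure

variable {A : Alphabet} {Ax : Set (Judg A)}

theorem Derivable.bound {N : ℕ} {J : ∀ i, i < N → Judg A} (h : ∀ i hi, Derivable Ax (J i hi)) :
    ∃ n, ∀ m, n ≤ m → ∀ i hi, DerAt Ax m (J i hi) := by
  choose k hk using h
  refine ⟨(Finset.univ : Finset (Fin N)).sup fun i => k i.1 i.2, fun m hm i hi =>
    (hk i hi).mono (le_trans ?_ hm)⟩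
  exact Finset.le_sup (f := fun i : Fin N => k i.1 i.2) (Finset.mem_univ ⟨i, hi⟩)

theorem Derivable.stable {J : Judg A} (h : Derivable Ax J) : ∃ n, ∀ m, n ≤ m → DerAt Ax m J :=
  h.imp fun _ h _ hm => h.mono hm

theorem Derivable.step {J : Judg A} (h : Step Ax (Derivable Ax) J) : Derivable Ax J := by
  suffices ∃ n, Step Ax (DerAt Ax n) J from this.elim fun n h => ⟨n + 1, Or.inr h⟩
  cases h with
  | ctx_nil => exact ⟨0, .ctx_nil⟩
  | ctx_cons hs h1 h2 => exact hs.imp fun n hs => .ctx_cons hs h1 h2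
  | s1 h => exact h.imp fun n h => .s1 h
  | s2 h => exact h.imp fun n h => .s2 h
  | s3 h1 h2 =>
    obtain ⟨n1, h1⟩ := h1.stable
    obtain ⟨n2, h2⟩ := h2.stable
    exact ⟨n1 + n2, .s3 (h1 _ (by omega)) (h2 _ (by omega))⟩
  | t1 h => exact h.imp fun n h => .t1 h
  | t2 h => exact h.imp fun n h => .t2 h
  | t3 h1 h2 =>
    obtain ⟨n1, h1⟩ := h1.stable
    obtain ⟨n2, h2⟩ := h2.stable
    exact ⟨n1 + n2, .t3 (h1 _ (by omega)) (h2 _ (by omega))⟩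
  | seqt h1 h2 =>
    obtain ⟨n1, h1⟩ := h1.stable
    obtain ⟨n2, h2⟩ := h2.stable
    exact ⟨n1 + n2, .seqt (h1 _ (by omega)) (h2 _ (by omega))⟩
  | seqteq h1 h2 h3 h4 =>
    obtain ⟨n1, h1⟩ := h1.stable
    obtain ⟨n2, h2⟩ := h2.stable
    obtain ⟨n3, h3⟩ := h3.stable
    obtain ⟨n4, h4⟩ := h4.stable
    exact ⟨n1 + n2 + n3 + n4, .seqteq (h1 _ (by omega)) (h2 _ (by omega)) (h3 _ (by omega))
      (h4 _ (by omega))⟩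
  | var hi h => exact h.imp fun n h => .var hi h
  | sA hax h hv =>
    obtain ⟨n1, h⟩ := h.stable
    obtain ⟨n2, hv⟩ := Derivable.bound hv
    exact ⟨n1 + n2, .sA hax (h _ (by omega)) (hv _ (by omega))⟩
  | tA hax h hv =>
    obtain ⟨n1, h⟩ := h.stable
    obtain ⟨n2, hv⟩ := Derivable.bound hv
    exact ⟨n1 + n2, .tA hax (h _ (by omega)) (hv _ (by omega))⟩
  | seqA hax h1 h2 =>
    obtain ⟨n1, h1⟩ := h1.stable
    obtain ⟨n2, h2⟩ := h2.stable
    exact ⟨n1 + n2, .seqA hax (h1 _ (by omega)) (h2 _ (by omega))⟩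
  | teqA hax h1 h2 =>
    obtain ⟨n1, h1⟩ := h1.stable
    obtain ⟨n2, h2⟩ := h2.stable
    exact ⟨n1 + n2, .teqA hax (h1 _ (by omega)) (h2 _ (by omega))⟩
  | sSub hax hY hlen hJ hYc hargs =>
    obtain ⟨n1, hJ⟩ := hJ.stable
    obtain ⟨n2, hYc⟩ := hYc.stable
    obtain ⟨n3, hargs⟩ := Derivable.bound fun i hi => hargs i hi (hlen ▸ hi)
    exact ⟨n1 + n2 + n3, .sSub hax hY hlen (hJ _ (by omega)) (hYc _ (by omega))
      fun i hi _ => hargs _ (by omega) i hi⟩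
  | tSub hax hY hlen hJ hU hargs =>
    obtain ⟨n1, hJ⟩ := hJ.stable
    obtain ⟨n2, hU⟩ := hU.stable
    obtain ⟨n3, hargs⟩ := Derivable.bound fun i hi => hargs i hi (hlen ▸ hi)
    exact ⟨n1 + n2 + n3, .tSub hax hY hlen (hJ _ (by omega)) (hU _ (by omega))
      fun i hi _ => hargs _ (by omega) i hi⟩
  | seqSub1 hax hY hlen hJ h1 h2 hargs =>
    obtain ⟨n1, hJ⟩ := hJ.stable
    obtain ⟨n2, h1⟩ := h1.stable
    obtain ⟨n4, h2⟩ := h2.stable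
    obtain ⟨n3, hargs⟩ := Derivable.bound fun i hi => hargs i hi (hlen ▸ hi)
    exact ⟨n1 + n2 + n3 + n4, .seqSub1 hax hY hlen (hJ _ (by omega)) (h1 _ (by omega))
      (h2 _ (by omega)) fun i hi _ => hargs _ (by omega) i hi⟩
  | seqSub2 hax hY hlen hlg hJ h1 h2 hargs =>
    obtain ⟨n1, hJ⟩ := hJ.stable
    obtain ⟨n2, h1⟩ := h1.stable
    obtain ⟨n4, h2⟩ := h2.stable
    obtain ⟨n3, hargs⟩ := Derivable.bound fun i hi => hargs i hi (hlen ▸ hi) (hlg ▸ hi)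
    exact ⟨n1 + n2 + n3 + n4, .seqSub2 hax hY hlen hlg (hJ _ (by omega)) (h1 _ (by omega))
      (h2 _ (by omega)) fun i hi _ _ => hargs _ (by omega) i hi⟩
  | teqSub1 hax hY hlen hJ h1 h2 hargs =>
    obtain ⟨n1, hJ⟩ := hJ.stable
    obtain ⟨n2, h1⟩ := h1.stable
    obtain ⟨n4, h2⟩ := h2.stable
    obtain ⟨n3, hargs⟩ := Derivable.bound fun i hi => hargs i hi (hlen ▸ hi)
    exact ⟨n1 + n2 + n3 + n4, .teqSub1 hax hY hlen (hJ _ (by omega)) (h1 _ (by omega))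
      (h2 _ (by omega)) fun i hi _ => hargs _ (by omega) i hi⟩
  | teqSub2 hax hY hlen hlg hJ h1 h2 hargs =>
    obtain ⟨n1, hJ⟩ := hJ.stable
    obtain ⟨n2, h1⟩ := h1.stable
    obtain ⟨n4, h2⟩ := h2.stable
    obtain ⟨n3, hargs⟩ := Derivable.bound fun i hi => hargs i hi (hlen ▸ hi) (hlg ▸ hi)
    exact ⟨n1 + n2 + n3 + n4, .teqSub2 hax hY hlen hlg (hJ _ (by omega)) (h1 _ (by omega))
      (h2 _ (by omega)) fun i hi _ _ => hargs _ (by omega) i hi⟩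

section Presuppositions

variable {X : PreCtx A} {U V : SortE A} {u v : Expr A}

theorem Derivable.sorts_of_sortEq (h : Derivable Ax (.sortEq X U V)) :
    Derivable Ax (.sort X U) ∧ Derivable Ax (.sort X V) :=
  let ⟨_, h⟩ := h
  ⟨⟨_, h.succ.sorts_of_sortEq.1⟩, ⟨_, h.succ.sorts_of_sortEq.2⟩⟩

theorem Derivable.terms_of_termEq (h : Derivable Ax (.termEq X u v U)) :
    Derivable Ax (.term X u U) ∧ Derivable Ax (.term X v U) :=
  let ⟨_, h⟩ := h
  ⟨⟨_, h.succ.terms_of_termEq.1⟩, ⟨_, h.succ.terms_of_termEq.2⟩⟩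

theorem Derivable.sort_of_term (h : Derivable Ax (.term X u U)) : Derivable Ax (.sort X U) :=
  let ⟨_, h⟩ := h
  ⟨_, h.succ.sort_of_term⟩

theorem Derivable.ctx_of_sort (h : Derivable Ax (.sort X U)) : Derivable Ax (.ctx X) :=
  let ⟨_, h⟩ := h
  ⟨_, h.succ.ctx_of_sort⟩

theorem Derivable.ctx_wf (h : Derivable Ax (.ctx X)) : (names X).Nodup ∧ IsPreCtx X :=
  let ⟨_, h⟩ := h
  ⟨h.succ.ctx_wf.1, h.succ.ctx_wf.2.1⟩

theorem Derivable.sort_wf (h : Derivable Ax (.sort X U)) : (names X).Nodup ∧ IsPreCtx X :=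
  h.ctx_of_sort.ctx_wf

theorem Derivable.sort_scoped (hAx : Shaped Ax) (h : Derivable Ax (.sort X U)) :
    ∀ v, SOccurs v U → v ∈ names X :=
  let ⟨_, h⟩ := h
  h.sort_scoped hAx

theorem Derivable.term_scoped (hAx : Shaped Ax) (h : Derivable Ax (.term X u U)) :
    ∀ v, Occurs v u → v ∈ names X :=
  let ⟨_, h⟩ := h
  h.term_scoped hAx

theorem Derivable.conv (h : Derivable Ax (.sortEq X U V)) (h' : Derivable Ax (.termEq X u v U)) :
    Derivable Ax (.termEq X u v V) :=
  .step (.seqteq h h' (.step (.seqt h h'.terms_of_termEq.1))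
    (.step (.seqt h h'.terms_of_termEq.2)))

end Presuppositions

section Substitution

variable {Z : PreCtx A} {σ σ' : A.Var → Expr A} {U U' : SortE A}

theorem substL_map (hs : ∀ v, SOccurs v U → v ∈ names Z) :
    U.substL (mkSub Z (Z.map fun p => σ p.1)) = U.subst σ :=
  SortE.subst_congr U fun x hx => mkSub_map Z σ (hs x hx)

theorem Expr.substL_map {u : Expr A} (hs : ∀ v, Occurs v u → v ∈ names Z) :
    u.substL (mkSub Z (Z.map fun p => σ p.1)) = u.subst σ :=
  Expr.subst_congr u fun x hx => mkSub_map Z σ (hs x hx)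

theorem subPre_map (hZ : IsPreCtx Z) {i : ℕ} (hi : i < Z.length) :
    subPre Z (Z.map fun p => σ p.1) i hi = Z[i].2.subst σ := by
  rw [subPre_eq hZ (by simp)]
  exact substL_map fun v hv => names_mono (⟨_, List.take_append_drop _ _⟩) (hZ i hi v hv)

/-- `σ` is a substitution of derivable terms over `Y` for the variables of `Z`. -/
def DerMor (Ax : Set (Judg A)) (Y Z : PreCtx A) (σ : A.Var → Expr A) : Prop :=
  ∀ P z V, Decl Z P z V → Derivable Ax (.term Y (σ z) (V.subst σ))

/-- `σ` and `σ'` are derivably equal substitutions for the variables of `Z`. -/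
def DerMorEq (Ax : Set (Judg A)) (Y Z : PreCtx A) (σ σ' : A.Var → Expr A) : Prop :=
  ∀ P z V, Decl Z P z V → Derivable Ax (.termEq Y (σ z) (σ' z) (V.subst σ))

theorem DerMorEq.left {Y : PreCtx A} (h : DerMorEq Ax Y Z σ σ') : DerMor Ax Y Z σ :=
  fun P z V hd => (h P z V hd).terms_of_termEq.1

variable {Y : PreCtx A}

theorem Derivable.sSub (hY : Derivable Ax (.ctx Y)) {S : A.SortSym} (hax : introSort Z S ∈ Ax)
    (hJ : Derivable Ax (introSort Z S)) (hσ : DerMor Ax Y Z σ) :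
    Derivable Ax (.sort Y ⟨S, Z.map fun p => σ p.1⟩) := by
  refine .step (.sSub hax hY.ctx_wf.2 (by simp) hJ hY fun i hi _ => ?_)
  rw [subPre_map hJ.sort_wf.2]
  simpa using hσ _ _ _ (decl_getElem hi)

theorem Derivable.seqSub2 (hY : Derivable Ax (.ctx Y)) {S : A.SortSym} (hax : introSort Z S ∈ Ax)
    (hJ : Derivable Ax (introSort Z S)) (hσ : DerMorEq Ax Y Z σ σ')
    (hσ' : DerMor Ax Y Z σ') :
    Derivable Ax (.sortEq Y ⟨S, Z.map fun p => σ p.1⟩ ⟨S, Z.map fun p => σ' p.1⟩) := by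
  refine .step (.seqSub2 hax hY.ctx_wf.2 (by simp) (by simp) hJ (.sSub hY hax hJ hσ.left)
    (.sSub hY hax hJ hσ') fun i hi _ _ => ?_)
  rw [subPre_map hJ.sort_wf.2]
  simpa using hσ _ _ _ (decl_getElem hi)

end Substitution
end Closure
end GATPaper

namespace GATPaper

section Substitution

variable {A : Alphabet} {Ax : Set (Judg A)} {Z Y : PreCtx A} {σ σ' : A.Var → Expr A}

theorem DerAt.subst_aux (hAx : Shaped Ax) (hY : Derivable Ax (.ctx Y)) (n : ℕ) :
    ∀ {X : PreCtx A} {σ : A.Var → Expr A}, DerMor Ax Y X σ →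
    (∀ {U}, DerAt Ax n (.sort X U) → Derivable Ax (.sort Y (U.subst σ))) ∧
    (∀ {u U}, DerAt Ax n (.term X u U) → Derivable Ax (.term Y (u.subst σ) (U.subst σ))) ∧
    (∀ {U V}, DerAt Ax n (.sortEq X U V) →
      Derivable Ax (.sortEq Y (U.subst σ) (V.subst σ))) ∧
    (∀ {u v U}, DerAt Ax n (.termEq X u v U) →
      Derivable Ax (.termEq Y (u.subst σ) (v.subst σ) (U.subst σ))) := by
  induction n with
  | zero => exact fun _ => ⟨fun h => h.elim, fun h => h.elim, fun h => h.elim, fun h => h.elim⟩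
  | succ n ih =>
    intro X σ hσ
    obtain ⟨ihs, iht, ihse, ihte⟩ := ih hσ
    have hcomp : ∀ {XS F}, MorAt Ax n X XS F → DerMor Ax Y XS fun z => (F z).subst σ :=
      fun hF P z V hd => by
        have := iht (hF P z V hd)
        rwa [SortE.subst_subst] at this
    have hcomp' : ∀ {XS F}, ArgMor Ax n X XS F → DerMor Ax Y XS fun z => (F z).subst σ := by
      intro XS F hF P z V hd
      rw [← SortE.subst_subst]
      obtain ⟨_, ⟨P0, h0, h1⟩ | ⟨P0, x, h0, h1, h2, h3⟩⟩ := hF P z V hd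
      · exact (ih fun P z V hd => hσ P z V (hd.mono h0)).2.1 h1
      · show Derivable Ax (.term Y ((F z).subst σ) _)
        rw [h2, Expr.subst_var]
        exact hσ _ _ _ h1
    have hargs : ∀ {XS : PreCtx A} {F : A.Var → Expr A} {i} (hi : i < XS.length), IsPreCtx XS →
        DerMor Ax Y XS F → Derivable Ax (.term Y (F XS[i].1)
          (subPre XS (XS.map fun p => F p.1) i hi)) := by
      intro XS F i hi hp h
      rw [subPre_map hp]
      exact h _ _ _ (decl_getElem hi)
    have hmap : ∀ (XS : PreCtx A) (F : A.Var → Expr A),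
        List.map (Expr.subst σ) (XS.map fun p => F p.1) = XS.map fun p => (F p.1).subst σ := by
      simp
    refine ⟨fun {U} h => ?_, fun {u U} h => ?_, fun {U V} h => ?_, fun {u v U} h => ?_⟩
    · obtain ⟨S, ss⟩ := U
      obtain ⟨XS, F, h1, h2, rfl, h4⟩ := sort_inv hAx h
      rw [SortE.subst_mk, hmap]
      exact .sSub hY h1 ⟨_, h2⟩ (hcomp h4)
    · rcases term_inv hAx h with ⟨U0, h1, h2⟩ | ⟨P, x, h1, rfl, h3⟩ |
        ⟨XT, t, UT, F, h1, h2, h3, rfl, rfl, h6, h7⟩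
      · exact .step (.seqt (ihse h1) (iht h2))
      · rw [Expr.subst_var]
        exact hσ _ _ _ h1
      · have h7 := ihs h7
        rw [SortE.subst_subst, ← substL_map (h3.sort_scoped hAx)] at h7
        rw [Expr.subst_app, SortE.subst_subst, ← substL_map (h3.sort_scoped hAx), hmap]
        refine .step (.tSub h1 hY.ctx_wf.2 (by simp) ⟨_, h2⟩ h7 fun i hi hif => ?_)
        simpa using hargs hi h3.sort_wf.2.1 (hcomp h6)
    · rcases sortEq_inv h with h' | ⟨rfl, h'⟩ | h' | ⟨V, h1, h2⟩ | ⟨X1, U1, U1', F, h1, h2, rfl, rfl, h5⟩ |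
        ⟨XS, S, F, G, h1, h2, rfl, rfl, h5, h6, h7⟩
      · exact ihse h'
      · exact .step (.s1 (ihs h'))
      · exact .step (.s2 (ihse h'))
      · exact .step (.s3 (ihse h1) (ihse h2))
      · have h3 := ihs h.sorts_of_sortEq.1
        have h4 := ihs h.sorts_of_sortEq.2
        have hs := h2.sorts_of_sortEq
        rw [SortE.subst_subst, ← substL_map (hs.1.sort_scoped hAx)] at h3
        rw [SortE.subst_subst, ← substL_map (hs.2.sort_scoped hAx)] at h4
        rw [SortE.subst_subst, ← substL_map (hs.1.sort_scoped hAx),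
          SortE.subst_subst, ← substL_map (hs.2.sort_scoped hAx)]
        refine .step (.seqSub1 h1 hY.ctx_wf.2 (by simp) ⟨_, h2⟩ h3 h4 fun i hi hif => ?_)
        simpa using hargs hi hs.1.sort_wf.2.1 (hcomp' h5)
      · have h3 := ihs h5
        have h4 := ihs h6
        rw [SortE.subst_mk, hmap] at h3 h4 ⊢
        rw [SortE.subst_mk, hmap]
        refine .step (.seqSub2 h1 hY.ctx_wf.2 (by simp) (by simp) ⟨_, h2⟩ h3 h4
          fun i hi hif _ => ?_)
        rw [subPre_map (σ := fun z => (F z).subst σ) h2.sort_wf.2.1]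
        have := ihte (h7 _ _ _ (decl_getElem hi))
        rw [SortE.subst_subst] at this
        simpa using this
    · rcases termEq_inv h with h' | ⟨rfl, h'⟩ | h' | ⟨v, h1, h2⟩ | ⟨U0, h1, h2⟩ |
        ⟨X1, u1, u1', U1, F, h1, h2, rfl, rfl, rfl, h5⟩ |
        ⟨XT, t, UT, F, G, h1, h2, rfl, rfl, rfl, h5, h6, h7⟩
      · exact ihte h'
      · exact .step (.t1 (iht h'))
      · exact .step (.t2 (ihte h'))
      · exact .step (.t3 (ihte h1) (ihte h2))
      · exact .conv (ihse h1) (ihte h2)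
      · have h3 := iht h.terms_of_termEq.1
        have h4 := iht h.terms_of_termEq.2
        have hs := h2.terms_of_termEq
        have hU := hs.1.succ.sort_of_term
        have e0 := substL_map (σ := fun z => (F z).subst σ) (hU.sort_scoped hAx)
        have e1 := Expr.substL_map (σ := fun z => (F z).subst σ) (hs.1.term_scoped hAx)
        have e2 := Expr.substL_map (σ := fun z => (F z).subst σ) (hs.2.term_scoped hAx)
        rw [SortE.subst_subst, Expr.subst_subst, ← e0] at h3 h4
        rw [← e1] at h3
        rw [← e2] at h4
        rw [SortE.subst_subst, Expr.subst_subst, Expr.subst_subst, ← e0, ← e1, ← e2]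
        refine .step (.teqSub1 h1 hY.ctx_wf.2 (by simp) ⟨_, h2⟩ h3 h4 fun i hi hif => ?_)
        simpa using hargs hi hU.sort_wf.2.1 (hcomp' h5)
      · have h3 := iht h5
        have h4 := iht h6
        have hU := h2.succ.sort_of_term
        have e0 := substL_map (σ := fun z => (F z).subst σ) (hU.sort_scoped hAx)
        rw [SortE.subst_subst, ← e0, Expr.subst_app, hmap] at h3 h4
        rw [SortE.subst_subst, ← e0, Expr.subst_app, Expr.subst_app, hmap, hmap]
        refine .step (.teqSub2 h1 hY.ctx_wf.2 (by simp) (by simp) ⟨_, h2⟩ h3 h4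
          fun i hi hif _ => ?_)
        rw [subPre_map (σ := fun z => (F z).subst σ) hU.sort_wf.2.1]
        have := ihte (h7 _ _ _ (decl_getElem hi))
        rw [SortE.subst_subst] at this
        simpa using this

theorem Derivable.sort_subst (hAx : Shaped Ax) (hY : Derivable Ax (.ctx Y))
    (hσ : DerMor Ax Y Z σ) {U : SortE A} (h : Derivable Ax (.sort Z U)) :
    Derivable Ax (.sort Y (U.subst σ)) :=
  let ⟨n, h⟩ := h
  (DerAt.subst_aux hAx hY n hσ).1 h

theorem Derivable.term_subst (hAx : Shaped Ax) (hY : Derivable Ax (.ctx Y))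
    (hσ : DerMor Ax Y Z σ) {u : Expr A} {U : SortE A} (h : Derivable Ax (.term Z u U)) :
    Derivable Ax (.term Y (u.subst σ) (U.subst σ)) :=
  let ⟨n, h⟩ := h
  (DerAt.subst_aux hAx hY n hσ).2.1 h

theorem Derivable.sortEq_subst (hAx : Shaped Ax) (hY : Derivable Ax (.ctx Y))
    (hσ : DerMor Ax Y Z σ) {U V : SortE A} (h : Derivable Ax (.sortEq Z U V)) :
    Derivable Ax (.sortEq Y (U.subst σ) (V.subst σ)) :=
  let ⟨n, h⟩ := h
  (DerAt.subst_aux hAx hY n hσ).2.2.1 h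

theorem Derivable.termEq_subst (hAx : Shaped Ax) (hY : Derivable Ax (.ctx Y))
    (hσ : DerMor Ax Y Z σ) {u v : Expr A} {U : SortE A} (h : Derivable Ax (.termEq Z u v U)) :
    Derivable Ax (.termEq Y (u.subst σ) (v.subst σ) (U.subst σ)) :=
  let ⟨n, h⟩ := h
  (DerAt.subst_aux hAx hY n hσ).2.2.2 h

theorem Derivable.teqSub2 (hAx : Shaped Ax) (hY : Derivable Ax (.ctx Y)) {t : A.TermSym} {U : SortE A} (hax : introTerm Z t U ∈ Ax)
    (hJ : Derivable Ax (introTerm Z t U)) (hσ : DerMorEq Ax Y Z σ σ') (hσ' : DerMor Ax Y Z σ')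
    (hU : Derivable Ax (.sortEq Y (U.subst σ) (U.subst σ'))) :
    Derivable Ax (.termEq Y (.app t (Z.map fun p => σ p.1)) (.app t (Z.map fun p => σ' p.1))
      (U.subst σ)) := by
  have h1 := Derivable.term_subst hAx hY hσ.left hJ
  have h2 := Derivable.step (.seqt (.step (.s2 hU)) (Derivable.term_subst hAx hY hσ' hJ))
  have hU := hJ.sort_of_term
  have e0 := substL_map (σ := σ) (Z := Z) (hU.sort_scoped hAx)
  rw [Expr.subst_app, ctxVars_subst, ← e0] at h1 h2
  rw [← e0]
  refine .step (.teqSub2 hax hY.ctx_wf.2 (by simp) (by simp) hJ h1 h2 fun i hi _ _ => ?_)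
  rw [subPre_map hU.sort_wf.2]
  simpa using hσ _ _ _ (decl_getElem hi)

end Substitution
end GATPaper

namespace GATPaper

/-! ## Grids -/

section Grids

variable {γ δ : Type}

/-- The lexicographically ordered entries of an `m × n` matrix. -/
def flat (m n : ℕ) (M : ℕ → ℕ → γ) : List γ := (List.range (m * n)).map fun k => M (k / n) (k % n)

theorem flat_length (m n : ℕ) (M : ℕ → ℕ → γ) : (flat m n M).length = m * n := by simp [flat]

theorem grid_div {n j : ℕ} (hj : j < n) (i : ℕ) : (i * n + j) / n = i ∧ (i * n + j) % n = j := by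
  have h0 : 0 < n := by omega
  constructor
  · rw [Nat.add_comm, Nat.add_mul_div_right _ _ h0, Nat.div_eq_of_lt hj, Nat.zero_add]
  · rw [Nat.add_comm, Nat.add_mul_mod_self_right, Nat.mod_eq_of_lt hj]

theorem grid_lt {m n i j : ℕ} (hi : i < m) (hj : j < n) : i * n + j < m * n := by
  have := Nat.mul_le_mul_right n (Nat.succ_le_of_lt hi)
  rw [Nat.succ_mul] at this
  omega

theorem exists_grid {m n k : ℕ} (hk : k < m * n) : ∃ i j, i < m ∧ j < n ∧ k = i * n + j := by
  have h0 : 0 < n := Nat.pos_of_ne_zero fun h => by simp [h] at hk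
  exact ⟨k / n, k % n, (Nat.div_lt_iff_lt_mul h0).2 hk, Nat.mod_lt _ h0,
    (Nat.div_add_mod' k n).symm⟩

theorem flat_isGrid (m n : ℕ) (M : ℕ → ℕ → γ) : IsGrid m n M (flat m n M) := by
  refine ⟨flat_length m n M, fun i j hi hj h => ?_⟩
  simp [flat, (grid_div hj i).1, (grid_div hj i).2]

theorem IsGrid.ext {m n : ℕ} {M M' : ℕ → ℕ → γ} {L L' : List γ} (h : IsGrid m n M L)
    (h' : IsGrid m n M' L') (hM : ∀ i < m, ∀ j < n, M i j = M' i j) : L = L' := by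
  refine List.ext_getElem (h.1.trans h'.1.symm) fun k h1 h2 => ?_
  obtain ⟨i, j, hi, hj, rfl⟩ := exists_grid (h.1 ▸ h1)
  rw [h.2 i j hi hj h1, h'.2 i j hi hj h2, hM i hi j hj]

theorem IsGrid.eq_flat {m n : ℕ} {M : ℕ → ℕ → γ} {L : List γ} (h : IsGrid m n M L) :
    L = flat m n M := h.ext (flat_isGrid m n M) fun _ _ _ _ => rfl

theorem flat_map (m n : ℕ) (M : ℕ → ℕ → γ) (f : γ → δ) :
    (flat m n M).map f = flat m n fun i j => f (M i j) := by
  simp [flat]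

theorem flat_dropLast_congr {m n : ℕ} {M M' : ℕ → ℕ → γ}
    (h : ∀ i ≤ m, ∀ j ≤ n, (i < m ∨ j < n) → M i j = M' i j) :
    (flat (m + 1) (n + 1) M).dropLast = (flat (m + 1) (n + 1) M').dropLast := by
  refine List.ext_getElem (by simp [flat_length]) fun k h1 h2 => ?_
  rw [List.length_dropLast, flat_length] at h1
  obtain ⟨i, j, hi, hj, rfl⟩ := exists_grid (show k < (m + 1) * (n + 1) by omega)
  rw [List.getElem_dropLast, List.getElem_dropLast,
    (flat_isGrid (m + 1) (n + 1) M).2 i j hi hj (by rw [flat_length]; exact grid_lt hi hj),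
    (flat_isGrid (m + 1) (n + 1) M').2 i j hi hj (by rw [flat_length]; exact grid_lt hi hj)]
  refine h i (by omega) j (by omega) ?_
  by_contra hc
  obtain ⟨rfl, rfl⟩ : i = m ∧ j = n := by omega
  rw [Nat.succ_mul] at h1
  omega

end Grids

/-! ## The tensor product as a target -/

/-- A pair of generalized algebraic theories with choices of fresh variables. -/
structure GPair (A B : Alphabet) where
  TA : Set (Judg A)
  TB : Set (Judg B)
  hA : IsGAT TA
  hB : IsGAT TB
  chA : PreCtx A → A.Var
  chB : PreCtx B → B.Var
  hchA : FreshCh chA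
  hchB : FreshCh chB

variable {A B : Alphabet}

/-- The axioms of the tensor product. -/
abbrev GPair.T (G : GPair A B) : Set (Judg (A.tensor B)) := tensorAx G.TA G.TB G.chA G.chB

/-- The interpretation in derivable judgments of the tensor product over a fixed context. -/
@[reducible] def GPair.dom (G : GPair A B) (Δ : PreCtx (A.tensor B)) : Dom where
  A := A
  B := B
  TA := G.TA
  TB := G.TB
  hA := G.hA
  hB := G.hB
  chA := G.chA
  chB := G.chB
  hchA := G.hchA
  hchB := G.hchB
  Tm := Expr (A.tensor B)
  Ty := SortE (A.tensor B)
  TyEq V W := Derivable G.T (.sortEq Δ V W)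
  TmEq W a b := Derivable G.T (.termEq Δ a b W)
  ty_symm h := .step (.s2 h)
  ty_trans h h' := .step (.s3 h h')
  tm_symm h := .step (.t2 h)
  tm_trans h h' := .step (.t3 h h')
  conv h h' := Derivable.conv h h'
  ss S T m n M := ⟨(S, T), (flat m n M).dropLast⟩
  st S t m n M := .app (.inl (S, t)) (flat m n M)
  ts s T m n M := .app (.inr (s, T)) (flat m n M)

/-- Substitution along the values of pairs of variables. -/
def unc (σ : A.Var → B.Var → Expr (A.tensor B)) : (A.tensor B).Var → Expr (A.tensor B) :=
  fun p => σ p.1 p.2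

/-- The generic values of pairs of variables. -/
def varEnv : A.Var → B.Var → Expr (A.tensor B) := fun x y => .var (x, y)

theorem unc_varEnv : unc (varEnv (A := A) (B := B)) = Expr.var := rfl

theorem Expr.subst_varEnv (e : Expr (A.tensor B)) : e.subst (unc varEnv) = e := by
  rw [unc_varEnv, Expr.subst_id]

theorem SortE.subst_varEnv (W : SortE (A.tensor B)) : W.subst (unc varEnv) = W := by
  rw [unc_varEnv, SortE.subst_id]

/-- Composition of substitution pairs with an environment. -/
noncomputable def after (ps : List ((A.tensor B).Var × Expr (A.tensor B)))
    (σ : A.Var → B.Var → Expr (A.tensor B)) : A.Var → B.Var → Expr (A.tensor B) :=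
  fun x y => (lookupV ps (x, y)).subst (unc σ)

theorem Expr.substL_unc (e : Expr (A.tensor B)) (ps) (σ : A.Var → B.Var → Expr (A.tensor B)) :
    (e.substL ps).subst (unc σ) = e.subst (unc (after ps σ)) := by
  rw [Expr.substL, Expr.subst_subst]
  rfl

theorem SortE.substL_unc (W : SortE (A.tensor B)) (ps)
    (σ : A.Var → B.Var → Expr (A.tensor B)) :
    (W.substL ps).subst (unc σ) = W.subst (unc (after ps σ)) := by
  rw [SortE.substL, SortE.subst_subst]
  rfl

theorem pairsR_eq (x : A.Var) (Y : PreCtx B) (g : ℕ → Expr (A.tensor B)) :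
    pairsR x Y g = (List.finRange Y.length).map fun j => ((x, Y[j.1].1), g j.1) := rfl

theorem lookupV_fst {ps : List (A.Var × Expr A)} (hn : (ps.map Prod.fst).Nodup) {p}
    (hp : p ∈ ps) : lookupV ps p.1 = p.2 := by
  induction ps with
  | nil => simp at hp
  | cons q ps ih =>
    rw [List.map_cons, List.nodup_cons] at hn
    rw [lookupV]
    rcases List.mem_cons.1 hp with rfl | hp
    · simp
    · have hne : q.1 ≠ p.1 := fun h => hn.1 (h ▸ List.mem_map_of_mem hp)
      rw [if_neg hne, ih hn.2 hp]

theorem pairsR_fst (x : A.Var) (Y : PreCtx B) (g : ℕ → Expr (A.tensor B)) :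
    (pairsR x Y g).map Prod.fst = (names Y).map fun y => (x, y) := by
  refine List.ext_getElem (by simp [pairsR]) fun k h1 h2 => ?_
  simp [pairsR]

theorem pairsL_fst (X : PreCtx A) (y : B.Var) (g : ℕ → Expr (A.tensor B)) :
    (pairsL X y g).map Prod.fst = (names X).map fun x => (x, y) := by
  refine List.ext_getElem (by simp [pairsL]) fun k h1 h2 => ?_
  simp [pairsL]

theorem lookupV_pairsR {x : A.Var} {Y : PreCtx B} {g : ℕ → Expr (A.tensor B)}
    (hn : (names Y).Nodup) {R y V} (hd : Decl Y R y V) :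
    lookupV (pairsR x Y g) (x, y) = g R.length := by
  obtain ⟨i, hi, rfl, rfl, rfl⟩ := hd.getElem
  have : ((x, Y[i].1), g i) ∈ pairsR x Y g := by
    rw [pairsR_eq, List.mem_map]
    exact ⟨⟨i, hi⟩, List.mem_finRange _, rfl⟩
  have hp : ((pairsR x Y g).map Prod.fst).Nodup := by
    rw [pairsR_fst]
    exact hn.map fun _ _ h => congrArg Prod.snd h
  rw [lookupV_fst hp this, List.length_take, Nat.min_eq_left hi.le]

theorem lookupV_pairsL {X : PreCtx A} {y : B.Var} {g : ℕ → Expr (A.tensor B)}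
    (hn : (names X).Nodup) {P x U} (hd : Decl X P x U) :
    lookupV (pairsL X y g) (x, y) = g P.length := by
  obtain ⟨i, hi, rfl, rfl, rfl⟩ := hd.getElem
  have : ((X[i].1, y), g i) ∈ pairsL X y g := by
    rw [pairsL, List.mem_map]
    exact ⟨⟨i, hi⟩, List.mem_finRange _, rfl⟩
  have hp : ((pairsL X y g).map Prod.fst).Nodup := by
    rw [pairsL_fst]
    exact hn.map fun _ _ h => congrArg Prod.fst h
  rw [lookupV_fst hp this, List.length_take, Nat.min_eq_left hi.le]

theorem lookupV_pairsR_ne {x : A.Var} {Y : PreCtx B} {g : ℕ → Expr (A.tensor B)} {a b}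
    (h : a ≠ x ∨ b ∉ names Y) : lookupV (pairsR x Y g) (a, b) = .var (a, b) := by
  refine lookupV_notMem ?_
  rw [pairsR_fst, List.mem_map]
  rintro ⟨y, hy, he⟩
  simp only [Prod.mk.injEq] at he
  rcases h with h | h
  · exact h he.1.symm
  · exact h (he.2 ▸ hy)

theorem lookupV_pairsL_ne {X : PreCtx A} {y : B.Var} {g : ℕ → Expr (A.tensor B)} {a b}
    (h : b ≠ y ∨ a ∉ names X) : lookupV (pairsL X y g) (a, b) = .var (a, b) := by
  refine lookupV_notMem ?_
  rw [pairsL_fst, List.mem_map]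
  rintro ⟨x, hx, he⟩
  simp only [Prod.mk.injEq] at he
  rcases h with h | h
  · exact h he.2.symm
  · exact h (he.1 ▸ hx)

end GATPaper

namespace GATPaper
/-! ### Substituting a term for the last variable of a context -/

theorem DerAt.decls_of_term {A : Alphabet} {Ax : Set (Judg A)} {n : ℕ} {X : PreCtx A} {u : Expr A}
    {U : SortE A} (h : DerAt Ax n (.term X u U)) :
    DerAt Ax n (.sort X U) ∧ (names X).Nodup ∧ IsPreCtx X ∧
      ∀ P x V, Decl X P x V → DerAt Ax n (.sort P V) := by
  obtain ⟨k, rfl⟩ := h.pos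
  have hs := h.sort_of_term
  obtain ⟨h1, h2, h3⟩ := hs.sort_wf
  exact ⟨hs.succ, h1, h2, fun P x V hd => (h3 P x V hd).succ⟩

namespace Dom

theorem CtxRel.near_var {D : Dom} {n m : ℕ} (hp : ValInv D n m) {σ : D.Env} {X Y}
    (hr : D.CtxRel σ σ X Y) (hX : ∀ P x V, Decl X P x V → DerAt D.TA n (.sort P V))
    (hY : ∀ P x V, Decl Y P x V → DerAt D.TB m (.sort P V)) {x y} (hx : x ∈ names X)
    (hy : y ∈ names Y) : D.Near σ X Y (.var x) (.var y) (σ x y) :=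
  hp.h2 (Has.of_mem hX hx) (Has.of_mem hY hy) hr (Ev.vv hx hy)

theorem Pack.near_subst {D : Dom} {n m : ℕ} (hp : Pack D n m) {σ : D.Env} {X Y x u U v V}
    {σ1 : D.Env} {e0} (hr : D.CtxRel σ σ X Y) (hx : x ∉ names X)
    (hu : DerAt D.TA n (.term X u U)) (hv : DerAt D.TB m (.term Y v V))
    (h1 : ∀ a ∈ names X, ∀ b ∈ names Y, σ1 a b = σ a b)
    (h2 : ∀ b ∈ names Y, D.Near σ X Y u (.var b) (σ1 x b))
    (h0 : D.CtxRel σ1 σ1 (X ++ [(x, U)]) Y → D.Near σ1 (X ++ [(x, U)]) Y (.var x) v e0) :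
    D.Near σ X Y u v e0 := by
  have hA := D.hA.1.shaped
  obtain ⟨hU, hnX, hpX, hdX⟩ := hu.decls_of_term
  obtain ⟨hV, hnY, hpY, hdY⟩ := hv.decls_of_term
  have hUf : U.subst (upd Expr.var x u) = U := by
    refine (SortE.subst_congr U fun z hz => ?_).trans (SortE.subst_id U)
    exact upd_of_mem _ u hx (DerAt.sort_scoped hA hU z hz)
  have hS : SubHyp D n m σ X Y (upd Expr.var x u) Expr.var σ1 (X ++ [(x, U)]) Y := by
    refine ⟨hr, ?_, fun hd => hdY _ _ _ hd, ?_, argMor_var hdY, ?_⟩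
    · intro P z Z hd
      rcases decl_snoc.1 hd with hd | ⟨rfl, rfl, rfl⟩
      · exact hdX _ _ _ hd
      · exact hU
    · refine (argMor_var hdX).snoc hpX hx (DerAt.sort_scoped hA hU) ?_
      rw [SortE.subst_id]
      exact hu.arg
    · intro z w hz hw
      rw [names_snoc, List.mem_append, List.mem_singleton] at hz
      rcases hz with hz | rfl
      · rw [upd_of_mem _ u hx hz, h1 z hz w hw]
        exact hr.near_var hp.tm.toValInv hdX hdY hz hw
      · rw [upd_same]
        exact h2 w hw
  have hr1 : D.CtxRel σ1 σ1 (X ++ [(x, U)]) Y :=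
    hS.ctxRel hp (nodup_snoc hnX hx U) hnY hS.near
  have hax : Arg D.TA n X (X ++ [(x, U)]) (.var x) U := Arg.decl (decl_snoc_self _ _ _) hU
  obtain ⟨e1, he1⟩ := ev_total σ1 hax.has hv.arg.has
  obtain ⟨W1, hW1⟩ := evTy_total σ1 hax hv.arg
  have hk := (h0 hr1).any hp.cv hr1 hax hv.arg hW1 he1
  have hb := sb hp.tm hp.tm' hS he1 (by rw [Expr.subst_var, upd_same]; exact hu.arg.has)
    (by rw [Expr.subst_id]; exact hv.arg.has)
  rw [Expr.subst_var, upd_same, Expr.subst_id] at hb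
  obtain ⟨W2, hW2⟩ := evTy_total σ hu.arg hv.arg
  have hT : D.TyEq W1 W2 := by
    refine tySub (n1 := n) (m1 := m) (by omega) (by omega) le_rfl le_rfl hp.ty hp.tm hp.tm' hp.tm
      hp.tm' hS (hS.restrict (List.prefix_append _ _) (List.prefix_refl _)) (u := .var x) (U := U)
      (v := v) (V := V) (P := X) (R := Y) ?_ ?_ hW1 ?_
    · rw [Expr.subst_var, upd_same, hUf]; exact hu.arg
    · rw [Expr.subst_id, SortE.subst_id]; exact hv.arg
    · rw [Expr.subst_var, upd_same, hUf, Expr.subst_id, SortE.subst_id]; exact hW2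
  exact hb.trans hp.cv hp.tm.toValInv hr hu.arg hv.arg hW2 (D.conv hT hk)

end Dom

end GATPaper

namespace GATPaper

theorem Has.arg_of_canon {A : Alphabet} {Ax : Set (Judg A)} (hA : IsGAT Ax) {n : ℕ}
    {P X : PreCtx A} (hn : (names X).Nodup) (hP : P <+: X) {u : Expr A} {U : SortE A}
    (h : Has Ax n P u) (hc : CanonSort Ax X u U) : Arg Ax n P P u U := by
  obtain ⟨U', hU', ha⟩ := h.canon hA
  rwa [(CanonSort.mono hP hU').uniq hA.1 hn hc] at ha

variable {A B : Alphabet}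

theorem after_pairsR_ne {x : A.Var} {Y : PreCtx B} {g : ℕ → Expr (A.tensor B)}
    {σ : A.Var → B.Var → Expr (A.tensor B)} {a b} (h : a ≠ x ∨ b ∉ names Y) :
    after (pairsR x Y g) σ a b = σ a b := by
  rw [after, lookupV_pairsR_ne h]
  simp [unc]

theorem after_pairsL_ne {X : PreCtx A} {y : B.Var} {g : ℕ → Expr (A.tensor B)}
    {σ : A.Var → B.Var → Expr (A.tensor B)} {a b} (h : b ≠ y ∨ a ∉ names X) :
    after (pairsL X y g) σ a b = σ a b := by
  rw [after, lookupV_pairsL_ne h]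
  simp [unc]

theorem after_pairsR {x : A.Var} {Y : PreCtx B} {g : ℕ → Expr (A.tensor B)}
    {σ : A.Var → B.Var → Expr (A.tensor B)} (hn : (names Y).Nodup) {R y V} (hd : Decl Y R y V) :
    after (pairsR x Y g) σ x y = (g R.length).subst (unc σ) := by
  rw [after, lookupV_pairsR hn hd]

theorem after_pairsL {X : PreCtx A} {y : B.Var} {g : ℕ → Expr (A.tensor B)}
    {σ : A.Var → B.Var → Expr (A.tensor B)} (hn : (names X).Nodup) {P x U} (hd : Decl X P x U) :
    after (pairsL X y g) σ x y = (g P.length).subst (unc σ) := by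
  rw [after, lookupV_pairsL hn hd]

theorem Decl.at {A : Alphabet} {X P : PreCtx A} {x U} (hd : Decl X P x U) :
    ∃ hi : P.length < X.length, X.take P.length = P ∧ X[P.length].1 = x ∧ X[P.length].2 = U := by
  obtain ⟨i, hi, rfl, rfl, rfl⟩ := hd.getElem
  have : (X.take i).length = i := by rw [List.length_take, Nat.min_eq_left hi.le]
  simp only [this]
  exact ⟨hi, trivial, trivial, trivial⟩

theorem TTg.near (G : GPair A B) {Δ : PreCtx (A.tensor B)} {n m : ℕ} (hp : Dom.Pack (G.dom Δ) n m)
    {b : Bool} {a : TArg A} {c : TArg B} {e : Expr (A.tensor B)} (h : TTg G.TA G.TB b a c e) :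
    ∀ {P X R Y} {σ : A.Var → B.Var → Expr (A.tensor B)}, (names a.ctx).Nodup →
      (names c.ctx).Nodup → P <+: a.ctx → R <+: c.ctx → Arg G.TA n P X a.tm a.srt →
      Arg G.TB m R Y c.tm c.srt → (G.dom Δ).CtxRel σ σ X Y →
      (G.dom Δ).Near σ X Y a.tm c.tm (e.subst (unc σ)) := by
  have hA := G.hA.1.shaped
  have hB := G.hB.1.shaped
  induction h with
  | varvar =>
    intro P X R Y σ hna hnc hP hR hu hv hr
    rw [Expr.subst_var]
    exact hp.tm.h2 hu.has hv.has hr (Dom.Ev.vv (hu.has.var_mem hA) (hv.has.var_mem hB))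
  | @varapp b X' x S ss Y' t ts V SS TSf hSS hTS M out hM hMx hout ihM ihMx =>
    intro P X R Y σ hna hnc hP hR hu hv hr
    rw [hout.eq_flat, Expr.subst_app, flat_map]
    have hvR : Has G.TB (m + 1) R (.app t ts) := by
      obtain ⟨R', hR', hv'⟩ := hv.term_of_app
      exact hv'.arg.has.mono (Nat.le_succ m) hR'
    have hts : ∀ j (hj : j < ts.length), Arg G.TB m R Y ts[j] (TSf j) := fun j hj =>
      ((hvR.app_args hB (List.getElem_mem hj)).arg_of_canon G.hB hnc hR (hTS j hj)).mono le_rfl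
        (List.prefix_refl _) hv.1 hv.1
    have hss : ∀ i (hi : i < ss.length), Arg G.TA n P X ss[i] (SS i) := fun i hi =>
      (((hu.sortAt.mono (Nat.le_succ n) (List.prefix_refl _)).args hA
        (List.getElem_mem hi)).arg_of_canon G.hA hna hP (hSS i hi)).mono le_rfl
        (List.prefix_refl _) hu.1 hu.1
    refine hp.tm.cl (M0 := fun i j => (M i j).subst (unc σ)) hr hu.up hv.has (Dom.Mat.snoc_left ?_ ?_)
    · exact fun i hi j hj => ihM i hi j hj hna hnc hP hR (hss i hi) (hts j hj) hr
    · exact fun j hj => ihMx j hj hna hnc hP hR hu (hts j hj) hr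
  | @appvar b X' s ss U Y' y T ts SS TSf hSS hTS M out hM hMy hout ihM ihMy =>
    intro P X R Y σ hna hnc hP hR hu hv hr
    rw [hout.eq_flat, Expr.subst_app, flat_map]
    have huP : Has G.TA (n + 1) P (.app s ss) := by
      obtain ⟨R', hR', hv'⟩ := hu.term_of_app
      exact hv'.arg.has.mono (Nat.le_succ n) hR'
    have hss : ∀ i (hi : i < ss.length), Arg G.TA n P X ss[i] (SS i) := fun i hi =>
      ((huP.app_args hA (List.getElem_mem hi)).arg_of_canon G.hA hna hP (hSS i hi)).mono le_rfl
        (List.prefix_refl _) hu.1 hu.1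
    have hts : ∀ j (hj : j < ts.length), Arg G.TB m R Y ts[j] (TSf j) := fun j hj =>
      (((hv.sortAt.mono (Nat.le_succ m) (List.prefix_refl _)).args hB
        (List.getElem_mem hj)).arg_of_canon G.hB hnc hR (hTS j hj)).mono le_rfl
        (List.prefix_refl _) hv.1 hv.1
    refine hp.tm'.cr (D := G.dom Δ) (M0 := fun i j => (M i j).subst (unc σ)) hr hv.up hu.has ?_
    intro i hi j hj
    by_cases h' : j < ts.length
    · rw [List.getElem_append_left h']
      exact ihM i hi j h' hna hnc hP hR (hss i hi) (hts j h') hr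
    · have : j = ts.length := by simp at hj; omega
      subst this
      simpa using ihMy i hi hna hnc hP hR (hss i hi) hv hr
  | @appapp_base X' s ss U Y' t ts V x hx e0 h0 g hg ih0 ihg =>
    intro P X R Y σ hna hnc hP hR hu hv hr
    obtain ⟨P', hP', hu'⟩ := hu.term_of_app
    obtain ⟨R', hR', hv'⟩ := hv.term_of_app
    have hxX : x ∉ names X' := by
      rw [List.mem_map]
      rintro ⟨p, hpm, rfl⟩
      exact hx p hpm rfl
    have hxP : x ∉ names P' := fun h => hxX (names_mono (hP'.trans hP) h)
    obtain ⟨hU, hnX, hpX, hdX⟩ := hu'.decls_of_term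
    obtain ⟨hV, hnY, hpY, hdY⟩ := hv'.decls_of_term
    have hr' := hr.mono (hP'.trans hu.1) (hR'.trans hv.1)
    rw [Expr.substL_unc]
    refine Dom.Near.up hp.cv hp.tm.toValInv (hP'.trans hu.1) (hR'.trans hv.1)
      (hp.near_subst (x := x) (σ1 := after (pairsR x Y' g) σ) hr' hxP hu' hv' ?_ ?_ ?_)
      hr hu'.arg.has hv'.arg.has
    · exact fun a ha b hb => after_pairsR_ne (.inl fun h => hxP (h ▸ ha))
    · intro b hb
      obtain ⟨Q, Z, hd⟩ := exists_decl hb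
      have hd' := hd.mono (hR'.trans hR)
      rw [after_pairsR hnc hd']
      obtain ⟨hi, h1, h2, h3⟩ := hd'.at
      have := @ihg Q.length hi P' P' Q R' σ
      rw [h1, h2, h3] at this
      exact this hna (nodup_of_isPre hd'.isPre hnc) (hP'.trans hP) (List.prefix_refl _)
        hu'.arg (Arg.of_decl hd (hdY _ _ _ hd)) hr'
    · exact fun hr1 => ih0 hna hnc (hP'.trans hP) (hR'.trans hR)
        (Arg.decl (decl_snoc_self _ _ _) hU) hv'.arg hr1
  | @appapp_star X' s ss U Y' t ts V y hy e0 h0 g hg ih0 ihg =>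
    intro P X R Y σ hna hnc hP hR hu hv hr
    obtain ⟨P', hP', hu'⟩ := hu.term_of_app
    obtain ⟨R', hR', hv'⟩ := hv.term_of_app
    have hyY : y ∉ names Y' := by
      rw [List.mem_map]
      rintro ⟨p, hpm, rfl⟩
      exact hy p hpm rfl
    have hyR : y ∉ names R' := fun h => hyY (names_mono (hR'.trans hR) h)
    obtain ⟨hU, hnX, hpX, hdX⟩ := hu'.decls_of_term
    obtain ⟨hV, hnY, hpY, hdY⟩ := hv'.decls_of_term
    have hr' := hr.mono (hP'.trans hu.1) (hR'.trans hv.1)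
    rw [Expr.substL_unc]
    refine Dom.Near.up hp.cv hp.tm.toValInv (hP'.trans hu.1) (hR'.trans hv.1)
      (Dom.Near.tr (D := (G.dom Δ).swap) (hp.swap.near_subst (x := y)
        (σ1 := Dom.Env.tr (D := G.dom Δ) (after (pairsL X' y g) σ)) hr'.tr hyR hv' hu' ?_ ?_ ?_))
      hr hu'.arg.has hv'.arg.has
    · exact fun b hb a ha => after_pairsL_ne (.inl fun h => hyR (h ▸ hb))
    · intro a ha
      obtain ⟨Q, Z, hd⟩ := exists_decl ha
      have hd' := hd.mono (hP'.trans hP)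
      refine Dom.Near.tr (D := G.dom Δ) ?_
      change (G.dom Δ).Near _ _ _ _ _ (after (pairsL X' y g) σ a y)
      rw [after_pairsL hna hd']
      obtain ⟨hi, h1, h2, h3⟩ := hd'.at
      have := @ihg Q.length hi Q P' R' R' σ
      rw [h1, h2, h3] at this
      exact this (nodup_of_isPre hd'.isPre hna) hnc (List.prefix_refl _) (hR'.trans hR)
        (Arg.of_decl hd (hdX _ _ _ hd)) hv'.arg hr'
    · exact fun hr1 => Dom.Near.tr (D := G.dom Δ) (ih0 hna hnc (hP'.trans hP) (hR'.trans hR) hu'.arg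
        (Arg.decl (decl_snoc_self _ _ _) hV) (Dom.CtxRel.tr (D := (G.dom Δ).swap) hr1))

end GATPaper

namespace GATPaper

variable {A B : Alphabet}

theorem TTd.near (G : GPair A B) {Δ : PreCtx (A.tensor B)} {n m : ℕ} (hp : Dom.Pack (G.dom Δ) n m)
    {b : Bool} {a : TArg A} {c : TArg B} {e : Expr (A.tensor B)} (h : TTd G.TA G.TB b a c e) :
    ∀ {P X R Y} {σ : A.Var → B.Var → Expr (A.tensor B)}, (names a.ctx).Nodup →
      (names c.ctx).Nodup → P <+: a.ctx → R <+: c.ctx → Arg G.TA n P X a.tm a.srt →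
      Arg G.TB m R Y c.tm c.srt → (G.dom Δ).CtxRel σ σ X Y →
      (G.dom Δ).Near σ X Y a.tm c.tm (e.subst (unc σ)) := by
  cases h with
  | varL h => exact h.near G hp
  | varR h => exact h.near G hp
  | @appapp_base X' s ss U Y' t ts V y hy e0 h0 g hg =>
    intro P X R Y σ hna hnc hP hR hu hv hr
    obtain ⟨P', hP', hu'⟩ := hu.term_of_app
    obtain ⟨R', hR', hv'⟩ := hv.term_of_app
    have hyY : y ∉ names Y' := by
      rw [List.mem_map]
      rintro ⟨p, hpm, rfl⟩
      exact hy p hpm rfl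
    have hyR : y ∉ names R' := fun h => hyY (names_mono (hR'.trans hR) h)
    obtain ⟨hU, hnX, hpX, hdX⟩ := hu'.decls_of_term
    obtain ⟨hV, hnY, hpY, hdY⟩ := hv'.decls_of_term
    have hr' := hr.mono (hP'.trans hu.1) (hR'.trans hv.1)
    rw [Expr.substL_unc]
    refine Dom.Near.up hp.cv hp.tm.toValInv (hP'.trans hu.1) (hR'.trans hv.1)
      (Dom.Near.tr (D := (G.dom Δ).swap) (hp.swap.near_subst (x := y)
        (σ1 := Dom.Env.tr (D := G.dom Δ) (after (pairsL X' y g) σ)) hr'.tr hyR hv' hu' ?_ ?_ ?_))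
      hr hu'.arg.has hv'.arg.has
    · exact fun b hb a ha => after_pairsL_ne (.inl fun h => hyR (h ▸ hb))
    · intro a ha
      obtain ⟨Q, Z, hd⟩ := exists_decl ha
      have hd' := hd.mono (hP'.trans hP)
      refine Dom.Near.tr (D := G.dom Δ) ?_
      change (G.dom Δ).Near _ _ _ _ _ (after (pairsL X' y g) σ a y)
      rw [after_pairsL hna hd']
      obtain ⟨hi, h1, h2, h3⟩ := hd'.at
      have := (hg Q.length hi).near G hp (P := Q) (X := P') (R := R') (Y := R')
        (σ := σ)
      rw [h1, h2, h3] at this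
      exact this (nodup_of_isPre hd'.isPre hna) hnc (List.prefix_refl _) (hR'.trans hR)
        (Arg.of_decl hd (hdX _ _ _ hd)) hv'.arg hr'
    · exact fun hr1 => Dom.Near.tr (D := G.dom Δ) (h0.near G hp hna hnc (hP'.trans hP) (hR'.trans hR) hu'.arg
        (Arg.decl (decl_snoc_self _ _ _) hV) (Dom.CtxRel.tr (D := (G.dom Δ).swap) hr1))
  | @appapp_star X' s ss U Y' t ts V x hx e0 h0 g hg =>
    intro P X R Y σ hna hnc hP hR hu hv hr
    obtain ⟨P', hP', hu'⟩ := hu.term_of_app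
    obtain ⟨R', hR', hv'⟩ := hv.term_of_app
    have hxX : x ∉ names X' := by
      rw [List.mem_map]
      rintro ⟨p, hpm, rfl⟩
      exact hx p hpm rfl
    have hxP : x ∉ names P' := fun h => hxX (names_mono (hP'.trans hP) h)
    obtain ⟨hU, hnX, hpX, hdX⟩ := hu'.decls_of_term
    obtain ⟨hV, hnY, hpY, hdY⟩ := hv'.decls_of_term
    have hr' := hr.mono (hP'.trans hu.1) (hR'.trans hv.1)
    rw [Expr.substL_unc]
    refine Dom.Near.up hp.cv hp.tm.toValInv (hP'.trans hu.1) (hR'.trans hv.1)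
      (hp.near_subst (x := x) (σ1 := after (pairsR x Y' g) σ) hr' hxP hu' hv' ?_ ?_ ?_)
      hr hu'.arg.has hv'.arg.has
    · exact fun a ha b hb => after_pairsR_ne (.inl fun h => hxP (h ▸ ha))
    · intro b hb
      obtain ⟨Q, Z, hd⟩ := exists_decl hb
      have hd' := hd.mono (hR'.trans hR)
      rw [after_pairsR hnc hd']
      obtain ⟨hi, h1, h2, h3⟩ := hd'.at
      have := (hg Q.length hi).near G hp (P := P') (X := P') (R := Q) (Y := R')
        (σ := σ)
      rw [h1, h2, h3] at this
      exact this hna (nodup_of_isPre hd'.isPre hnc) (hP'.trans hP) (List.prefix_refl _)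
        hu'.arg (Arg.of_decl hd (hdY _ _ _ hd)) hr'
    · exact fun hr1 => h0.near G hp hna hnc (hP'.trans hP) (hR'.trans hR)
        (Arg.decl (decl_snoc_self _ _ _) hU) hv'.arg hr1

end GATPaper

namespace GATPaper

variable {A B : Alphabet}

theorem Dom.ArgX.sort {Ax : Set (Judg A)} {m : ℕ} {R Y : PreCtx A} {v : Expr A} {V : SortE A}
    (h : Dom.ArgX Ax m R Y v V) : DerAt Ax m (.sort R V) := by
  rcases h with ⟨rfl, h⟩ | ⟨y, -, rfl, rfl, h⟩
  · exact h.decls_of_term.1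
  · exact h

theorem SortE.subst_upd_var {X : PreCtx A} {U : SortE A} {x : A.Var} {u : Expr A} (hx : x ∉ names X)
    (hU : ∀ v, SOccurs v U → v ∈ names X) : U.subst (upd Expr.var x u) = U :=
  (SortE.subst_congr U fun z hz => upd_of_mem _ u hx (hU z hz)).trans (SortE.subst_id U)

/-- A tensor product of sorts, evaluated at values of the tensor products of terms. -/
theorem TSo.tyEq (G : GPair A B) {Δ : PreCtx (A.tensor B)} {n m : ℕ}
    (p1 : Dom.Pack (G.dom Δ) (n + 1) m) (p2 : Dom.Pack (G.dom Δ) n (m + 1))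
    (ty : Dom.TyInv (G.dom Δ) (n + 1) (m + 1)) {b P x U R y V W}
    (h : TSo G.TA G.TB b P x U R y V W) {X Y u v W2}
    {σ ρ : A.Var → B.Var → Expr (A.tensor B)} (hu : Dom.ArgX G.TA (n + 1) P X u U)
    (hv : Dom.ArgX G.TB (m + 1) R Y v V) (hr1 : (G.dom Δ).CtxRel σ σ X R)
    (hr2 : (G.dom Δ).CtxRel σ σ P Y) (hρ : ∀ a ∈ names P, ∀ b ∈ names R, ρ a b = σ a b)
    (hρx : ∀ b ∈ names R, (G.dom Δ).Near σ X R u (.var b) (ρ x b))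
    (hρy : ∀ a ∈ names P, (G.dom Δ).Near σ P Y (.var a) v (ρ a y))
    (hW2 : (G.dom Δ).EvTy σ P X R Y u U v V W2) :
    Derivable G.T (.sortEq Δ (W.subst (unc ρ)) W2) := by
  have hA := G.hA.1.shaped
  have hB := G.hB.1.shaped
  obtain ⟨hPX, hnP, hnX, hdP', hdX'⟩ := hu.wf hA
  obtain ⟨hRY, hnR, hnY, hdR', hdY'⟩ := hv.wf hB
  have hdP : ∀ Q z Z, Decl P Q z Z → DerAt G.TA n (.sort Q Z) := fun _ _ _ hd => hdP' hd
  have hdX : ∀ Q z Z, Decl X Q z Z → DerAt G.TA (n + 1) (.sort Q Z) := fun _ _ _ hd => hdX' hd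
  have hdR : ∀ Q z Z, Decl R Q z Z → DerAt G.TB m (.sort Q Z) := fun _ _ _ hd => hdR' hd
  have hdY : ∀ Q z Z, Decl Y Q z Z → DerAt G.TB (m + 1) (.sort Q Z) := fun _ _ _ hd => hdY' hd
  have hsU := hu.sort
  have hsV := hv.sort
  have hpP := hsU.sort_wf.2.1
  have hpR := hsV.sort_wf.2.1
  cases h with
  | mk hx hy SS TSf hSS hTS M out hM hMx hMy hout =>
  rename_i S ss T ts
  have hxP : x ∉ names P := by
    rw [List.mem_map]
    rintro ⟨p, hp, rfl⟩
    exact hx p hp rfl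
  have hyR : y ∉ names R := by
    rw [List.mem_map]
    rintro ⟨p, hp, rfl⟩
    exact hy p hp rfl
  have hUs := DerAt.sort_scoped hA hsU
  have hVs := DerAt.sort_scoped hB hsV
  have hax : Arg G.TA (n + 1) P (P ++ [(x, ⟨S, ss⟩)]) (.var x) ⟨S, ss⟩ :=
    Arg.decl (decl_snoc_self _ _ _) hsU
  have hay : Arg G.TB (m + 1) R (R ++ [(y, ⟨T, ts⟩)]) (.var y) ⟨T, ts⟩ :=
    Arg.decl (decl_snoc_self _ _ _) hsV
  have h1 : Dom.SubHyp (G.dom Δ) (n + 1) m σ X R (upd Expr.var x u) (upd Expr.var y v) ρ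
      (P ++ [(x, ⟨S, ss⟩)]) R := by
    refine ⟨hr1, ?_, fun hd => hdR _ _ _ hd, ?_, ?_, ?_⟩
    · intro Q z Z hd
      rcases decl_snoc.1 hd with hd | ⟨rfl, rfl, rfl⟩
      · exact (hdP _ _ _ hd).succ
      · exact hsU
    · refine ((argMor_var fun Q z Z hd => (hdP _ _ _ hd).succ).up hPX).snoc hpP hxP hUs ?_
      rw [SortE.subst_id]
      exact hu.arg.up
    · exact (argMor_var hdR).congr hpR fun z hz => (upd_of_mem _ v hyR hz).symm
    · intro z w hz hw
      rw [upd_of_mem _ v hyR hw]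
      rw [names_snoc, List.mem_append, List.mem_singleton] at hz
      rcases hz with hz | rfl
      · rw [upd_of_mem _ u hxP hz, hρ z hz w hw]
        exact hr1.near_var p1.tm.toValInv hdX hdR (names_mono hPX hz) hw
      · rw [upd_same]
        exact hρx w hw
  have h2 : Dom.SubHyp (G.dom Δ) n (m + 1) σ P Y (upd Expr.var x u) (upd Expr.var y v) ρ P
      (R ++ [(y, ⟨T, ts⟩)]) := by
    refine ⟨hr2, fun hd => hdP _ _ _ hd, ?_, ?_, ?_, ?_⟩
    · intro Q z Z hd
      rcases decl_snoc.1 hd with hd | ⟨rfl, rfl, rfl⟩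
      · exact (hdR _ _ _ hd).succ
      · exact hsV
    · exact (argMor_var hdP).congr hpP fun z hz => (upd_of_mem _ u hxP hz).symm
    · refine ((argMor_var fun Q z Z hd => (hdR _ _ _ hd).succ).up hRY).snoc hpR hyR hVs ?_
      rw [SortE.subst_id]
      exact hv.arg.up
    · intro z w hz hw
      rw [upd_of_mem _ u hxP hz]
      rw [names_snoc, List.mem_append, List.mem_singleton] at hw
      rcases hw with hw | rfl
      · rw [upd_of_mem _ v hyR hw, hρ z hz w hw]
        exact hr2.near_var p2.tm.toValInv hdP hdY hz (names_mono hRY hw)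
      · rw [upd_same]
        exact hρy z hz
  have hc1 := h1.ctxRel p1 (nodup_snoc hnP hxP _) hnR h1.near
  have hc2 := h2.ctxRel p2 hnP (nodup_snoc hnR hyR _) h2.near
  have hss : ∀ i (hi : i < ss.length), Arg G.TA n P P ss[i] (SS i) := fun i hi =>
    ((SortAt.args hA ⟨P, List.prefix_refl _, hsU⟩
      (List.getElem_mem hi)).arg_of_canon G.hA hnP (List.prefix_refl _) (hSS i hi))
  have hts : ∀ j (hj : j < ts.length), Arg G.TB m R R ts[j] (TSf j) := fun j hj =>
    ((SortAt.args hB ⟨R, List.prefix_refl _, hsV⟩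
      (List.getElem_mem hj)).arg_of_canon G.hB hnR (List.prefix_refl _) (hTS j hj))
  obtain ⟨W1, hW1⟩ := Dom.evTy_total (D := G.dom Δ) ρ hax hay
  have hct := ty.ct (M0 := fun i j => (M i j).subst (unc ρ)) hax hay hc1 hc2 ⟨?_, ?_⟩ hW1
  · have hk := Dom.tySub (n1 := n) (m1 := m) le_rfl le_rfl (Nat.le_succ _) (Nat.le_succ _) ty p1.tm
      p1.tm' p2.tm p2.tm' h1 h2 (u := .var x) (v := .var y) (U := ⟨S, ss⟩) (V := ⟨T, ts⟩)
      (P := P) (R := R) (X := X) (Y := Y) (W1 := W1) (W2 := W2) ?_ ?_ hW1 ?_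
    · refine Derivable.step (.s3 ?_ hk)
      rw [hout.eq_flat]
      simpa [SortE.subst_mk, Dom.tyOf, List.map_dropLast, flat_map] using hct
    · rw [Expr.subst_var, upd_same, SortE.subst_upd_var hxP hUs]; exact hu.arg
    · rw [Expr.subst_var, upd_same, SortE.subst_upd_var hyR hVs]; exact hv.arg
    · rw [Expr.subst_var, upd_same, SortE.subst_upd_var hxP hUs, Expr.subst_var, upd_same,
        SortE.subst_upd_var hyR hVs]
      exact hW2
  · refine Dom.Mat.snoc_left (fun i hi j hj => ?_) fun j hj => ?_
    · exact (hM i hi j hj).near G p1 hnP hnR (List.prefix_refl _) (List.prefix_refl _)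
        ((hss i hi).mono (Nat.le_succ _) (List.prefix_refl _) hax.1 hax.1) (hts j hj) hc1
    · exact (hMx j hj).near G p1 hnP hnR (List.prefix_refl _) (List.prefix_refl _) hax (hts j hj) hc1
  · intro i hi j hj
    by_cases h' : j < ts.length
    · rw [List.getElem_append_left h']
      exact (hM i hi j h').near G p2 hnP hnR (List.prefix_refl _) (List.prefix_refl _)
        (hss i hi) ((hts j h').mono (Nat.le_succ _) (List.prefix_refl _) hay.1 hay.1) hc2
    · have : j = ts.length := by simp at hj; omega
      subst this
      simpa using (hMy i hi).near G p2 hnP hnR (List.prefix_refl _) (List.prefix_refl _)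
        (hss i hi) hay hc2

end GATPaper

namespace GATPaper

/-! ## Totality of the tensor operations -/

/-- A list of declarations with pairwise distinct variables and derivable sorts. -/
def WfCtx {A : Alphabet} (Ax : Set (Judg A)) (X : PreCtx A) : Prop :=
  (names X).Nodup ∧ ∀ P x U, Decl X P x U → ∃ n, DerAt Ax n (.sort P U)

theorem WfCtx.isPre {A : Alphabet} {Ax : Set (Judg A)} {P X : PreCtx A} (hX : WfCtx Ax X)
    (h : P <+: X) : WfCtx Ax P :=
  ⟨nodup_of_isPre h hX.1, fun _ _ _ hd => hX.2 _ _ _ (hd.mono h)⟩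

theorem DerAt.wfCtx {A : Alphabet} {Ax : Set (Judg A)} {X : PreCtx A} {U : SortE A} {n : ℕ}
    (h : DerAt Ax n (.sort X U)) : WfCtx Ax X :=
  ⟨h.sort_wf.1, fun _ _ _ hd => ⟨n, h.sort_wf.2.2 _ _ _ hd⟩⟩

theorem WfCtx.snoc {A : Alphabet} {Ax : Set (Judg A)} {X : PreCtx A} {U : SortE A} {n : ℕ}
    (h : DerAt Ax n (.sort X U)) {x : A.Var} (hx : x ∉ names X) : WfCtx Ax (X ++ [(x, U)]) := by
  refine ⟨nodup_snoc h.sort_wf.1 hx U, fun P z V hd => ?_⟩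
  rcases decl_snoc.1 hd with hd | ⟨rfl, rfl, rfl⟩
  · exact h.wfCtx.2 _ _ _ hd
  · exact ⟨n, h⟩

theorem Has.canon_fun {A : Alphabet} {Ax : Set (Judg A)} (hA : IsGAT Ax) {n : ℕ} {X : PreCtx A}
    {us : List (Expr A)} (h : ∀ u ∈ us, Has Ax n X u) (U0 : SortE A) :
    ∃ US : ℕ → SortE A, ∀ i (hi : i < us.length),
      CanonSort Ax X us[i] (US i) ∧ Arg Ax n X X us[i] (US i) := by
  have : ∀ i, ∃ U : SortE A, ∀ hi : i < us.length,
      CanonSort Ax X us[i] U ∧ Arg Ax n X X us[i] U := fun i => by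
    by_cases hi : i < us.length
    · obtain ⟨U, hU⟩ := (h _ (List.getElem_mem hi)).canon hA
      exact ⟨U, fun _ => hU⟩
    · exact ⟨U0, fun h => absurd h hi⟩
  choose US hUS using this
  exact ⟨US, hUS⟩

theorem Arg.app_args {A : Alphabet} {Ax : Set (Judg A)} (hA : Shaped Ax) {n : ℕ} {P X : PreCtx A}
    {t : A.TermSym} {ts : List (Expr A)} {U : SortE A} (h : Arg Ax (n + 1) P X (.app t ts) U)
    {e : Expr A} (he : e ∈ ts) : Has Ax n P e := by
  obtain ⟨Q, hQ, ht⟩ := h.term_of_app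
  exact Has.app_args hA ⟨U, List.prefix_refl _, .inl ⟨Q, hQ, ht⟩⟩ he

variable {A B : Alphabet}

theorem exists_matrix {γ : Type} (m n : ℕ) {Q : ℕ → ℕ → γ → Prop} (e0 : γ)
    (h : ∀ i < m, ∀ j < n, ∃ e, Q i j e) : ∃ M : ℕ → ℕ → γ, ∀ i < m, ∀ j < n, Q i j (M i j) := by
  have : ∀ i j, ∃ e, i < m → j < n → Q i j e := fun i j => by
    by_cases hij : i < m ∧ j < n
    · obtain ⟨e, he⟩ := h i hij.1 j hij.2
      exact ⟨e, fun _ _ => he⟩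
    · exact ⟨e0, fun h1 h2 => absurd ⟨h1, h2⟩ hij⟩
  choose M hM using this
  exact ⟨M, fun i hi j hj => hM i j hi hj⟩

theorem TTg.total (G : GPair A B) : ∀ n m {P0 P X : PreCtx A} {u : Expr A} {U : SortE A}
    {R0 R Y : PreCtx B} {v : Expr B} {V : SortE B}, (names P).Nodup → P0 <+: P →
    Arg G.TA n P0 X u U → WfCtx G.TB R → R0 <+: R → Arg G.TB m R0 Y v V →
    ∃ e, TTg G.TA G.TB false ⟨P, u, U⟩ ⟨R, v, V⟩ e := by
  have hA := G.hA.1.shaped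
  have hB := G.hB.1.shaped
  intro n
  induction n with
  | zero => intro m P0 P X u U R0 R Y v V _ _ hu; obtain ⟨k, hk⟩ := hu.pos; cases hk
  | succ n ihn =>
  have av : ∀ m {P0 P X : PreCtx A} {s : A.TermSym} {ss : List (Expr A)} {U : SortE A}
      {R0 R Y : PreCtx B} {y : B.Var} {V : SortE B}, (names P).Nodup → P0 <+: P →
      Arg G.TA (n + 1) P0 X (.app s ss) U → WfCtx G.TB R → R0 <+: R →
      Arg G.TB m R0 Y (.var y) V →
      ∃ e, TTg G.TA G.TB false ⟨P, .app s ss, U⟩ ⟨R, .var y, V⟩ e := by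
    intro m P0 P X s ss U R0 R Y y V hn hP hu hR hR0 hv
    obtain ⟨T, ts⟩ := V
    obtain ⟨m, rfl⟩ := hv.pos
    have hss : ∀ a ∈ ss, Has G.TA n P a := fun a ha =>
      (hu.app_args hA ha).mono le_rfl hP
    have hts : ∀ a ∈ ts, Has G.TB m R a := fun a ha =>
      (hv.sortAt.args hB ha).mono le_rfl hR0
    obtain ⟨SS, hSS⟩ := Has.canon_fun G.hA hss U
    obtain ⟨TSf, hTS⟩ := Has.canon_fun G.hB hts ⟨T, ts⟩
    obtain ⟨M, hM⟩ := exists_matrix ss.length (ts.length + 1)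
      (Q := fun i j e => (∀ (hi : i < ss.length) (hj : j < ts.length),
        TTg G.TA G.TB false ⟨P, ss[i], SS i⟩ ⟨R, ts[j], TSf j⟩ e) ∧ (∀ (hi : i < ss.length),
        j = ts.length → TTg G.TA G.TB false ⟨P, ss[i], SS i⟩ ⟨R, .var y, ⟨T, ts⟩⟩ e))
      (.var (G.chA [], y)) (by
        intro i hi j hj
        by_cases h : j < ts.length
        · obtain ⟨e, he⟩ := ihn m hn (List.prefix_refl _) (hSS i hi).2 hR (List.prefix_refl _)
            (hTS j h).2
          exact ⟨e, fun _ _ => he, fun _ h' => absurd h' h.ne⟩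
        · obtain ⟨e, he⟩ := ihn _ hn (List.prefix_refl _) (hSS i hi).2 hR hR0 hv
          exact ⟨e, fun _ h' => absurd h' h, fun _ _ => he⟩)
    exact ⟨_, .appvar SS TSf (fun i hi => (hSS i hi).1) (fun j hj => (hTS j hj).1) M _
      (fun i hi j hj => (hM i hi j (by omega)).1 hi hj)
      (fun i hi => (hM i hi _ (by omega)).2 hi rfl) (flat_isGrid _ _ M)⟩
  intro m
  induction m with
  | zero => intro P0 P X u U R0 R Y v V _ _ _ _ _ hv; obtain ⟨k, hk⟩ := hv.pos; cases hk
  | succ m ihm =>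
  have va : ∀ {P0 P X : PreCtx A} {x : A.Var} {U : SortE A}
      {R0 R Y : PreCtx B} {t : B.TermSym} {ts : List (Expr B)} {V : SortE B}, (names P).Nodup →
      P0 <+: P → Arg G.TA (n + 1) P0 X (.var x) U → WfCtx G.TB R → R0 <+: R →
      Arg G.TB (m + 1) R0 Y (.app t ts) V →
      ∃ e, TTg G.TA G.TB false ⟨P, .var x, U⟩ ⟨R, .app t ts, V⟩ e := by
    intro P0 P X x U R0 R Y t ts V hn hP hu hR hR0 hv
    obtain ⟨S, ss⟩ := U
    have hss : ∀ a ∈ ss, Has G.TA n P a := fun a ha =>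
      (hu.sortAt.args hA ha).mono le_rfl hP
    have hts : ∀ a ∈ ts, Has G.TB m R a := fun a ha =>
      (hv.app_args hB ha).mono le_rfl hR0
    obtain ⟨SS, hSS⟩ := Has.canon_fun G.hA hss ⟨S, ss⟩
    obtain ⟨TSf, hTS⟩ := Has.canon_fun G.hB hts V
    obtain ⟨M, hM⟩ := exists_matrix (ss.length + 1) ts.length
      (Q := fun i j e => (∀ (hi : i < ss.length) (hj : j < ts.length),
        TTg G.TA G.TB false ⟨P, ss[i], SS i⟩ ⟨R, ts[j], TSf j⟩ e) ∧ (∀ (hj : j < ts.length),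
        i = ss.length → TTg G.TA G.TB false ⟨P, .var x, ⟨S, ss⟩⟩ ⟨R, ts[j], TSf j⟩ e))
      (.var (x, G.chB [])) (by
        intro i hi j hj
        by_cases h : i < ss.length
        · obtain ⟨e, he⟩ := ihn m hn (List.prefix_refl _) (hSS i h).2 hR (List.prefix_refl _)
            (hTS j hj).2
          exact ⟨e, fun _ _ => he, fun _ h' => absurd h' h.ne⟩
        · obtain ⟨e, he⟩ := ihm hn hP hu hR (List.prefix_refl _) (hTS j hj).2
          exact ⟨e, fun h' => absurd h' h, fun _ _ => he⟩)
    exact ⟨_, .varapp SS TSf (fun i hi => (hSS i hi).1) (fun j hj => (hTS j hj).1) M _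
      (fun i hi j hj => (hM i (by omega) j hj).1 hi hj)
      (fun j hj => (hM _ (by omega) j hj).2 hj rfl) (flat_isGrid _ _ M)⟩
  intro P0 P X u U R0 R Y v V hn hP hu hR hR0 hv
  rcases u with x | ⟨s, ss⟩ <;> rcases v with y | ⟨t, ts⟩
  · exact ⟨_, .varvar⟩
  · exact va hn hP hu hR hR0 hv
  · exact av _ hn hP hu hR hR0 hv
  · obtain ⟨Q, hQ, hs⟩ := hu.sort
    obtain ⟨e0, h0⟩ := va (x := G.chA P) hn (hQ.trans hP)
      (Arg.decl (decl_snoc_self Q (G.chA P) U) hs) hR hR0 hv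
    have hg : ∀ j, ∃ e, ∀ hj : j < R.length, TTg G.TA G.TB false ⟨P, .app s ss, U⟩
        ⟨R.take j, .var R[j].1, R[j].2⟩ e := fun j => by
      by_cases hj : j < R.length
      · obtain ⟨k, hk⟩ := hR.2 _ _ _ (decl_getElem hj)
        obtain ⟨e, he⟩ := av k hn hP hu (hR.isPre (List.take_prefix j R)) (List.prefix_refl _)
          (Arg.decl (decl_snoc_self (R.take j) R[j].1 R[j].2) hk)
        exact ⟨e, fun _ => he⟩
      · exact ⟨.var (G.chA [], G.chB []), fun h => absurd h hj⟩
    choose g hg using hg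
    exact ⟨_, .appapp_base (fun p hp => G.hchA P p hp) e0 h0 g fun j hj => hg j hj⟩

theorem TSo.total (G : GPair A B) {n m : ℕ} {P : PreCtx A} {x : A.Var} {U : SortE A}
    {R : PreCtx B} {y : B.Var} {V : SortE B} (hx : x ∉ names P) (hy : y ∉ names R)
    (hU : DerAt G.TA n (.sort P U)) (hV : DerAt G.TB m (.sort R V)) :
    ∃ W, TSo G.TA G.TB false P x U R y V W := by
  have hA := G.hA.1.shaped
  have hB := G.hB.1.shaped
  obtain ⟨n, rfl⟩ := hU.pos
  obtain ⟨m, rfl⟩ := hV.pos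
  obtain ⟨S, ss⟩ := U
  obtain ⟨T, ts⟩ := V
  have hn := hU.wfCtx.1
  have hR := hV.wfCtx
  have hss : ∀ a ∈ ss, Has G.TA n P a := fun a ha => SortAt.args hA ⟨P, List.prefix_refl _, hU⟩ ha
  have hts : ∀ a ∈ ts, Has G.TB m R a := fun a ha => SortAt.args hB ⟨R, List.prefix_refl _, hV⟩ ha
  obtain ⟨SS, hSS⟩ := Has.canon_fun G.hA hss ⟨S, ss⟩
  obtain ⟨TSf, hTS⟩ := Has.canon_fun G.hB hts ⟨T, ts⟩
  have hax := Arg.decl (decl_snoc_self P x ⟨S, ss⟩) hU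
  have hay := Arg.decl (decl_snoc_self R y ⟨T, ts⟩) hV
  have hr {Q : PreCtx A} := List.prefix_refl Q
  have hr' {Q : PreCtx B} := List.prefix_refl Q
  obtain ⟨M, hM⟩ := exists_matrix (ss.length + 1) (ts.length + 1)
    (Q := fun i j e => (∀ (hi : i < ss.length) (hj : j < ts.length),
        TTg G.TA G.TB false ⟨P, ss[i], SS i⟩ ⟨R, ts[j], TSf j⟩ e) ∧ (∀ (hj : j < ts.length),
        i = ss.length → TTg G.TA G.TB false ⟨P, .var x, ⟨S, ss⟩⟩ ⟨R, ts[j], TSf j⟩ e) ∧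
        (∀ (hi : i < ss.length),
        j = ts.length → TTg G.TA G.TB false ⟨P, ss[i], SS i⟩ ⟨R, .var y, ⟨T, ts⟩⟩ e))
    (.var (x, y)) (by
      intro i hi j hj
      by_cases h : i < ss.length <;> by_cases h' : j < ts.length
      · obtain ⟨e, he⟩ := TTg.total G n m hn hr (hSS i h).2 hR hr' (hTS j h').2
        exact ⟨e, fun _ _ => he, fun _ h => by omega, fun _ h => by omega⟩
      · obtain ⟨e, he⟩ := TTg.total G n (m + 1) hn hr (hSS i h).2 hR hr' hay
        exact ⟨e, fun _ h => by omega, fun _ h => by omega, fun _ _ => he⟩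
      · obtain ⟨e, he⟩ := TTg.total G (n + 1) m hn hr hax hR hr' (hTS j h').2
        exact ⟨e, fun _ h => by omega, fun _ _ => he, fun _ h => by omega⟩
      · exact ⟨.var (x, y), fun _ h => by omega, fun _ h => by omega, fun _ h => by omega⟩)
  refine ⟨_, .mk (fun p hp h => hx ?_) (fun p hp h => hy ?_) SS TSf (fun i hi => (hSS i hi).1)
    (fun j hj => (hTS j hj).1) M _ (fun i hi j hj => (hM i (by omega) j (by omega)).1 hi hj)
    (fun j hj => (hM _ (by omega) j (by omega)).2.1 hj rfl)
    (fun i hi => (hM i (by omega) _ (by omega)).2.2 hi rfl) (flat_isGrid _ _ M)⟩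
  · exact h ▸ List.mem_map_of_mem hp
  · exact h ▸ List.mem_map_of_mem hp

theorem TCtx.total (G : GPair A B) {X : PreCtx A} {Y : PreCtx B} (hX : WfCtx G.TA X)
    (hY : WfCtx G.TB Y) : ∃ Z, TCtx G.TA G.TB false X Y Z := by
  by_cases h0 : X.length * Y.length = 0
  · refine ⟨[], by simpa using h0.symm, fun i j _ _ h => by simp at h⟩
  have hx0 : 0 < X.length := Nat.pos_of_ne_zero fun h => h0 (by simp [h])
  have hy0 : 0 < Y.length := Nat.pos_of_ne_zero fun h => h0 (by simp [h])
  obtain ⟨M, hM⟩ := exists_matrix X.length Y.length (γ := SortE (A.tensor B))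
    (Q := fun i j W => ∀ (hi : i < X.length) (hj : j < Y.length),
      TSo G.TA G.TB false (X.take i) X[i].1 X[i].2 (Y.take j) Y[j].1 Y[j].2 W)
    ⟨(X[0].2.head, Y[0].2.head), []⟩ (by
      intro i hi j hj
      have d1 := decl_getElem hi
      have d2 := decl_getElem hj
      obtain ⟨n, hn⟩ := hX.2 _ _ _ d1
      obtain ⟨m, hm⟩ := hY.2 _ _ _ d2
      obtain ⟨W, hW⟩ := TSo.total G (d1.notMem hX.1) (d2.notMem hY.1) hn hm
      exact ⟨W, fun _ _ => hW⟩)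
  let M' : ℕ → ℕ → (A.Var × B.Var) × SortE (A.tensor B) := fun i j =>
    (if h : i < X.length ∧ j < Y.length then (X[i].1, Y[j].1) else (X[0].1, Y[0].1), M i j)
  refine ⟨flat X.length Y.length M', flat_length _ _ _, fun i j hi hj h => ?_⟩
  rw [(flat_isGrid X.length Y.length M').2 i j hi hj h]
  exact ⟨by simp [M', hi, hj], hM i hi j hj hi hj⟩

end GATPaper

namespace GATPaper

/-! ## Tensor products of contexts -/

theorem DerMor.id {A : Alphabet} {Ax : Set (Judg A)} (hAx : Shaped Ax) {Δ : PreCtx A}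
    (h : Derivable Ax (.ctx Δ)) {Q : PreCtx A} (hQ : Q <+: Δ) : DerMor Ax Δ Q .var := by
  induction hk : Q.length using Nat.strong_induction_on generalizing Q with
  | _ k ih =>
  intro P z V hd
  have hlt : P.length < k := by
    have := hd.length_le
    simp at this
    omega
  obtain ⟨n, hn⟩ := h
  obtain ⟨n, rfl⟩ := DerAt.pos hn
  have hs := (DerAt.ctx_wf hn).2.2 _ _ _ (hd.mono hQ)
  have hs' := Derivable.sort_subst hAx ⟨_, hn⟩ (ih _ hlt (hd.isPre.trans hQ) rfl) ⟨_, hs⟩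
  rw [SortE.subst_id] at hs' ⊢
  obtain ⟨i, hi, rfl, rfl, rfl⟩ := (hd.mono hQ).getElem
  exact .step (.var hi hs')

theorem Derivable.var_decl {A : Alphabet} {Ax : Set (Judg A)} (hAx : Shaped Ax) {Δ : PreCtx A}
    (h : Derivable Ax (.ctx Δ)) {Q : PreCtx A} {p : A.Var} {W : SortE A} (hd : Decl Δ Q p W) :
    Derivable Ax (.term Δ (.var p) W) := by
  have := DerMor.id hAx h (List.prefix_refl _) _ _ _ hd
  rwa [SortE.subst_id] at this

variable {A B : Alphabet} {TA : Set (Judg A)} {TB : Set (Judg B)} {b : Bool} {X : PreCtx A}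
  {Y : PreCtx B} {Z : PreCtx (A.tensor B)}

theorem TCtx.decl (h : TCtx TA TB b X Y Z) {Q p W} (hd : Decl Z Q p W) :
    ∃ P x U R y V, Decl X P x U ∧ Decl Y R y V ∧ p = (x, y) ∧ TSo TA TB b P x U R y V W ∧
      Q.length = P.length * Y.length + R.length := by
  obtain ⟨k, hk, rfl, rfl, rfl⟩ := hd.getElem
  obtain ⟨i, j, hi, hj, rfl⟩ := exists_grid (h.1 ▸ hk)
  obtain ⟨h1, h2⟩ := h.2 i j hi hj hk
  refine ⟨_, _, _, _, _, _, decl_getElem hi, decl_getElem hj, h1, h2, ?_⟩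
  simp only [List.length_take]
  rw [min_eq_left hk.le, min_eq_left hi.le, min_eq_left hj.le]

theorem TCtx.exists_decl (h : TCtx TA TB b X Y Z) {P x U R y V} (hX : Decl X P x U)
    (hY : Decl Y R y V) : ∃ Q W, Decl Z Q (x, y) W ∧ TSo TA TB b P x U R y V W ∧
      Q.length = P.length * Y.length + R.length := by
  obtain ⟨i, hi, rfl, rfl, rfl⟩ := hX.getElem
  obtain ⟨j, hj, rfl, rfl, rfl⟩ := hY.getElem
  have hk : i * Y.length + j < Z.length := h.1 ▸ grid_lt hi hj
  obtain ⟨h1, h2⟩ := h.2 i j hi hj hk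
  refine ⟨_, _, h1 ▸ decl_getElem hk, h2, ?_⟩
  simp only [List.length_take]
  rw [min_eq_left hk.le, min_eq_left hi.le, min_eq_left hj.le]

theorem TCtx.grid (h : TCtx TA TB b X Y Z) {M : ℕ → ℕ → Expr (A.tensor B)}
    (hM : ∀ i (hi : i < X.length) j (hj : j < Y.length), M i j = .var (X[i].1, Y[j].1)) :
    IsGrid X.length Y.length M (ctxVars Z) := by
  refine ⟨by simp [ctxVars, h.1], fun i j hi hj hk => ?_⟩
  have hk' : i * Y.length + j < Z.length := h.1 ▸ grid_lt hi hj
  rw [hM i hi j hj, ← (h.2 i j hi hj hk').1]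
  simp [ctxVars]

theorem TTg.var_var {P U R V x y e} (h : TTg TA TB b ⟨P, .var x, U⟩ ⟨R, .var y, V⟩ e) :
    e = .var (x, y) := by
  cases h
  rfl

theorem getElem_ctxVars {A : Alphabet} {X : PreCtx A} {i : ℕ} (hi : i < (ctxVars X).length) :
    (ctxVars X)[i] = .var (X[i]'(by simpa [ctxVars] using hi)).1 := by
  simp [ctxVars]

theorem length_ctxVars {A : Alphabet} (X : PreCtx A) : (ctxVars X).length = X.length := by
  simp [ctxVars]

theorem TSo.args_ctxVars {S T W x y} (hZ : TCtx TA TB b (X ++ [(x, ⟨S, ctxVars X⟩)])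
      (Y ++ [(y, ⟨T, ctxVars Y⟩)]) Z)
    (hW : TSo TA TB b X x ⟨S, ctxVars X⟩ Y y ⟨T, ctxVars Y⟩ W) :
    W = ⟨(S, T), ctxVars Z.dropLast⟩ := by
  cases hW with
  | mk hx hy SS TSf hSS hTS M out hM hMx hMy hout =>
  rw [length_ctxVars, length_ctxVars] at hout
  congr 1
  rw [show ctxVars Z.dropLast = (ctxVars Z).dropLast by simp [ctxVars, List.map_dropLast]]
  classical
  have := hZ.grid (M := fun i j => if i = X.length ∧ j = Y.length then .var (x, y) else M i j) (by
    intro i hi j hj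
    simp only [List.length_append, List.length_singleton] at hi hj
    rcases Nat.lt_succ_iff_lt_or_eq.1 hi with hi | rfl <;>
      rcases Nat.lt_succ_iff_lt_or_eq.1 hj with hj | rfl
    · have h := hM i (by rwa [length_ctxVars]) j (by rwa [length_ctxVars])
      rw [getElem_ctxVars, getElem_ctxVars] at h
      simp [hi.ne, h.var_var, List.getElem_append_left hi, List.getElem_append_left hj]
    · have h := hMy i (by rwa [length_ctxVars])
      rw [getElem_ctxVars] at h
      have h := h.var_var
      rw [length_ctxVars] at h
      simp [hi.ne, h, List.getElem_append_left hi]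
    · have h := hMx j (by rwa [length_ctxVars])
      rw [getElem_ctxVars] at h
      have h := h.var_var
      rw [length_ctxVars] at h
      simp [hj.ne, h, List.getElem_append_left hj]
    · simp)
  simp only [List.length_append, List.length_singleton] at this
  rw [hout.eq_flat, this.eq_flat]
  refine flat_dropLast_congr fun i hi j hj h => ?_
  rw [if_neg (by omega)]

theorem TTg.app_ctxVars_inl {S t x V P R e} (hZ : TCtx TA TB b (X ++ [(x, ⟨S, ctxVars X⟩)]) Y Z)
    (h : TTg TA TB b ⟨P, .var x, ⟨S, ctxVars X⟩⟩ ⟨R, .app t (ctxVars Y), V⟩ e) :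
    e = .app (.inl (S, t)) (ctxVars Z) := by
  cases h with
  | varapp SS TSf hSS hTS M out hM hMx hout =>
  rw [length_ctxVars, length_ctxVars] at hout
  congr 1
  refine hout.ext (M' := M) ?_ fun _ _ _ _ => rfl
  have := hZ.grid (M := M) (by
    intro i hi j hj
    simp only [List.length_append, List.length_singleton] at hi
    rcases Nat.lt_succ_iff_lt_or_eq.1 hi with hi | rfl
    · have h := hM i (by rwa [length_ctxVars]) j (by rwa [length_ctxVars])
      rw [getElem_ctxVars, getElem_ctxVars] at h
      simp [h.var_var, List.getElem_append_left hi]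
    · have h := hMx j (by rwa [length_ctxVars])
      rw [getElem_ctxVars] at h
      have h := h.var_var
      rw [length_ctxVars] at h
      simp [h])
  simpa using this

theorem TTg.app_ctxVars_inr {T s y U P R e} (hZ : TCtx TA TB b X (Y ++ [(y, ⟨T, ctxVars Y⟩)]) Z)
    (h : TTg TA TB b ⟨P, .app s (ctxVars X), U⟩ ⟨R, .var y, ⟨T, ctxVars Y⟩⟩ e) :
    e = .app (.inr (s, T)) (ctxVars Z) := by
  cases h with
  | appvar SS TSf hSS hTS M out hM hMy hout =>
  rw [length_ctxVars, length_ctxVars] at hout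
  congr 1
  refine hout.ext (M' := M) ?_ fun _ _ _ _ => rfl
  have := hZ.grid (M := M) (by
    intro i hi j hj
    simp only [List.length_append, List.length_singleton] at hj
    rcases Nat.lt_succ_iff_lt_or_eq.1 hj with hj | rfl
    · have h := hM i (by rwa [length_ctxVars]) j (by rwa [length_ctxVars])
      rw [getElem_ctxVars, getElem_ctxVars] at h
      simp [h.var_var, List.getElem_append_left hj]
    · have h := hMy i (by rwa [length_ctxVars])
      rw [getElem_ctxVars] at h
      have h := h.var_var
      rw [length_ctxVars] at h
      simp [h])
  simpa using this

theorem GPair.shaped (G : GPair A B) : Shaped G.T := by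
  have hA := G.hA.1.shaped
  have hB := G.hB.1.shaped
  constructor
  · rintro X U ⟨J, J', hJ, hJ', h⟩
    cases h with
    | @ss X U Y V Z W hZ hW =>
    obtain ⟨S, ss⟩ := U
    obtain ⟨T, ts⟩ := V
    obtain rfl : ss = _ := hA.sort_shape _ _ hJ
    obtain rfl : ts = _ := hB.sort_shape _ _ hJ'
    rw [hW.args_ctxVars hZ]
  · rintro X u U ⟨J, J', hJ, hJ', h⟩
    cases h with
    | @st X U Y v V Z e W g hZ he hW hg =>
      obtain ⟨S, ss⟩ := U
      obtain rfl : ss = _ := hA.sort_shape _ _ hJ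
      obtain ⟨t, rfl⟩ := hB.term_shape _ _ _ hJ'
      exact ⟨_, he.app_ctxVars_inl hZ⟩
    | @ts X u U Y V Z e W g hZ he hW hg =>
      obtain ⟨T, ts⟩ := V
      obtain rfl : ts = _ := hB.sort_shape _ _ hJ'
      obtain ⟨s, rfl⟩ := hA.term_shape _ _ _ hJ
      exact ⟨_, he.app_ctxVars_inr hZ⟩

end GATPaper

namespace GATPaper

/-! ## Derivability of the tensor product of contexts -/

variable {A B : Alphabet}

/-- The invariants of the interpretation, at given levels and over every context. -/
def GPair.Hyp (G : GPair A B) (n m : ℕ) : Prop :=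
  ∀ Δ, Derivable G.T (.ctx Δ) → Dom.Pack (G.dom Δ) n m

theorem GPair.Hyp.mono {G : GPair A B} {n m n' m' : ℕ} (h : G.Hyp n m) (hn : n' ≤ n)
    (hm : m' ≤ m) : G.Hyp n' m' := fun Δ hΔ => (h Δ hΔ).mono hn hm

/-- The first `k` pairs of variables of `X` and `Y` have sorts at levels where the invariants
hold. -/
def GPair.LvAt (G : GPair A B) (k : ℕ) (X : PreCtx A) (Y : PreCtx B) : Prop :=
  ∀ {P x U R y V}, Decl X P x U → Decl Y R y V → P.length * Y.length + R.length < k →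
    ∃ n m, DerAt G.TA n (.sort P U) ∧ DerAt G.TB m (.sort R V) ∧ G.Hyp n m

theorem TSo.notMem {TA : Set (Judg A)} {TB : Set (Judg B)} {b P x U R y V W}
    (h : TSo TA TB b P x U R y V W) : x ∉ names P ∧ y ∉ names R := by
  cases h with
  | mk hx hy =>
  constructor <;> rw [List.mem_map] <;> rintro ⟨p, hp, rfl⟩
  exacts [hx p hp rfl, hy p hp rfl]

theorem TSo.tyEq_var (G : GPair A B) {Δ : PreCtx (A.tensor B)} {n m : ℕ}
    (p : Dom.Low (G.dom Δ) n m) {b P x U R y V W}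
    (h : TSo G.TA G.TB b P x U R y V W) {W2} {σ : A.Var → B.Var → Expr (A.tensor B)}
    (hU : DerAt G.TA (n + 1) (.sort P U)) (hV : DerAt G.TB (m + 1) (.sort R V))
    (hr1 : (G.dom Δ).CtxRel σ σ (P ++ [(x, U)]) R) (hr2 : (G.dom Δ).CtxRel σ σ P (R ++ [(y, V)]))
    (hW2 : (G.dom Δ).EvTy σ P (P ++ [(x, U)]) R (R ++ [(y, V)]) (.var x) U (.var y) V W2) :
    Derivable G.T (.sortEq Δ (W.subst (unc σ)) W2) := by
  have hA := G.hA.1.shaped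
  have hB := G.hB.1.shaped
  obtain ⟨hx, hy⟩ := h.notMem
  have hu : Dom.ArgX G.TA (n + 1) P (P ++ [(x, U)]) (.var x) U := .inr ⟨x, hx, rfl, rfl, hU⟩
  have hv : Dom.ArgX G.TB (m + 1) R (R ++ [(y, V)]) (.var y) V := .inr ⟨y, hy, rfl, rfl, hV⟩
  obtain ⟨-, -, -, hdP, hdX⟩ := hu.wf hA
  obtain ⟨-, -, -, hdR, hdY⟩ := hv.wf hB
  refine h.tyEq G p.p1 p.p2 p.ty hu hv hr1 hr2 (fun _ _ _ _ => rfl) (fun b hb => ?_)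
    (fun a ha => ?_) hW2
  · exact hr1.near_var p.p1.tm.toValInv (fun _ _ _ hd => hdX hd) (fun _ _ _ hd => hdR hd)
      (by simp) hb
  · exact hr2.near_var p.p2.tm.toValInv (fun _ _ _ hd => hdP hd) (fun _ _ _ hd => hdY hd)
      ha (by simp)

theorem DerAt.evTy_var (D : Dom) {n m P x U R y V} (hU : DerAt D.TA n (.sort P U))
    (hV : DerAt D.TB m (.sort R V)) (σ : D.Env) :
    ∃ W, D.EvTy σ P (P ++ [(x, U)]) R (R ++ [(y, V)]) (.var x) U (.var y) V W :=
  Dom.evTy_total σ (Arg.decl (decl_snoc_self _ _ _) hU) (Arg.decl (decl_snoc_self _ _ _) hV)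

section

variable {G : GPair A B} {b : Bool} {X X0 : PreCtx A} {Y Y0 : PreCtx B}
  {Z Δ : PreCtx (A.tensor B)} {k : ℕ}

theorem TCtx.ctxRel_var (hZ : TCtx G.TA G.TB b X Y Z) (hΔ : Derivable G.T (.ctx Δ))
    (hk : Z.take k <+: Δ) (lv : G.LvAt k X Y) (hnX : (names X).Nodup) (hnY : (names Y).Nodup)
    (hX0 : X0 <+: X) (hY0 : Y0 <+: Y)
    (hlt : ∀ i < X0.length, ∀ j < Y0.length, i * Y.length + j < k) :
    (G.dom Δ).CtxRel varEnv varEnv X0 Y0 := by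
  induction hl : X0.length + Y0.length using Nat.strong_induction_on generalizing X0 Y0 with
  | _ l ih =>
  refine ⟨nodup_of_isPre hX0 hnX, nodup_of_isPre hY0 hnY, fun P x U R y V hP hR => ?_⟩
  have hPl := hP.length_le
  have hRl := hR.length_le
  simp only [List.length_append, List.length_singleton] at hPl hRl
  have hidx := hlt P.length (by omega) R.length (by omega)
  obtain ⟨n, m, hU, hV, hp⟩ := lv (hP.mono hX0) (hR.mono hY0) hidx
  obtain ⟨n, rfl⟩ := hU.pos
  obtain ⟨m, rfl⟩ := hV.pos
  have hr1 : (G.dom Δ).CtxRel varEnv varEnv (P ++ [(x, U)]) R := by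
    refine ih _ ?_ ((show P ++ [(x, U)] <+: X0 from hP).trans hX0) (hR.isPre.trans hY0) ?_ rfl
    · simp only [List.length_append, List.length_singleton]
      omega
    · simp only [List.length_append, List.length_singleton]
      exact fun i hi j hj => hlt i (by omega) j (by omega)
  have hr2 : (G.dom Δ).CtxRel varEnv varEnv P (R ++ [(y, V)]) := by
    refine ih _ ?_ (hP.isPre.trans hX0) ((show R ++ [(y, V)] <+: Y0 from hR).trans hY0) ?_ rfl
    · simp only [List.length_append, List.length_singleton]
      omega
    · simp only [List.length_append, List.length_singleton]
      exact fun i hi j hj => hlt i (by omega) j (by omega)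
  obtain ⟨Q, W, hd, hW, hQ⟩ := hZ.exists_decl (hP.mono hX0) (hR.mono hY0)
  obtain ⟨W2, hW2⟩ := DerAt.evTy_var (G.dom Δ) (x := x) (y := y) hU hV varEnv
  have he := hW.tyEq_var G (hp Δ hΔ).low hU hV hr1 hr2 hW2
  rw [unc_varEnv, SortE.subst_id] at he
  have hd' : Decl Δ Q (x, y) W := by
    refine (List.prefix_of_prefix_length_le hd (List.take_prefix k Z) ?_).trans hk
    have := hd.length_le
    simp only [List.length_append, List.length_singleton, List.length_take] at this ⊢
    omega
  exact ⟨W2, hW2, .step (.t1 (.step (.seqt he (hΔ.var_decl G.shaped hd'))))⟩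

theorem LvAt.mono (lv : G.LvAt k X Y) {k' : ℕ} (h : k' ≤ k) : G.LvAt k' X Y :=
  fun hP hR hlt => lv hP hR (hlt.trans_le h)

theorem TCtx.ctx (hZ : TCtx G.TA G.TB b X Y Z) (hnX : (names X).Nodup) (hnY : (names Y).Nodup)
    (lv : G.LvAt k X Y) : Derivable G.T (.ctx (Z.take k)) := by
  induction k with
  | zero => exact .step .ctx_nil
  | succ k ih =>
  have hc := ih (LvAt.mono lv k.le_succ)
  by_cases hk : k < Z.length
  swap
  · rwa [List.take_of_length_le (i := k + 1) (by omega),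
      ← List.take_of_length_le (l := Z) (i := k) (by omega)]
  have hd := decl_getElem hk
  generalize hW : Z[k].2 = W at hd
  generalize hp : Z[k].1 = p at hd
  rw [List.take_succ_eq_append_getElem hk]
  obtain ⟨P, x, U, R, y, V, hP, hR, rfl, hs, hl⟩ := hZ.decl hd
  rw [List.length_take, min_eq_left hk.le] at hl
  obtain ⟨n, m, hU, hV, hp'⟩ := lv hP hR (by omega)
  obtain ⟨n, rfl⟩ := hU.pos
  obtain ⟨m, rfl⟩ := hV.pos
  have hPl := hP.length_le
  have hRl := hR.length_le
  simp only [List.length_append, List.length_singleton] at hPl hRl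
  have hr1 : (G.dom (Z.take k)).CtxRel varEnv varEnv (P ++ [(x, U)]) R := by
    refine hZ.ctxRel_var hc (List.prefix_refl _) (LvAt.mono lv k.le_succ) hnX hnY hP hR.isPre ?_
    intro i hi j hj
    rw [List.length_append, List.length_singleton] at hi
    have := Nat.mul_le_mul_right Y.length (show i ≤ P.length by omega)
    omega
  have hr2 : (G.dom (Z.take k)).CtxRel varEnv varEnv P (R ++ [(y, V)]) := by
    refine hZ.ctxRel_var hc (List.prefix_refl _) (LvAt.mono lv k.le_succ) hnX hnY hP.isPre hR ?_
    intro i hi j hj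
    rw [List.length_append, List.length_singleton] at hj
    have := Nat.mul_le_mul_right Y.length (show i + 1 ≤ P.length by omega)
    rw [Nat.succ_mul] at this
    omega
  obtain ⟨W2, hW2⟩ := DerAt.evTy_var (G.dom (Z.take k)) (x := x) (y := y) hU hV varEnv
  have he := hs.tyEq_var G (hp' _ hc).low hU hV hr1 hr2 hW2
  rw [unc_varEnv, SortE.subst_id] at he
  have hsort := he.sorts_of_sortEq.1
  rw [show Z[k] = ((x, y), W) from Prod.ext hp hW]
  refine .step (.ctx_cons hsort ?_ ?_)
  · rintro ⟨q, W'⟩ hq rfl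
    obtain ⟨Q', W2', hd'⟩ := GATPaper.exists_decl (List.mem_map_of_mem (f := Prod.fst) hq)
    have hQl := hd'.length_le
    simp only [List.length_append, List.length_singleton, List.length_take] at hQl
    obtain ⟨P', x', U', R', y', V', hP', hR', he', -, hl'⟩ :=
      hZ.decl (hd'.mono (⟨_, List.take_append_drop _ _⟩))
    obtain ⟨rfl, rfl⟩ := Prod.mk.inj he'
    obtain ⟨rfl, rfl⟩ := hP.uniq hnX hP'
    obtain ⟨rfl, rfl⟩ := hR.uniq hnY hR'
    omega
  · rw [isPreCtx_iff]
    intro Q q V' hd' v hv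
    rcases decl_snoc.1 hd' with hd' | ⟨rfl, rfl, rfl⟩
    · exact isPreCtx_iff.1 hc.ctx_wf.2 _ _ _ hd' v hv
    · exact hsort.sort_scoped G.shaped v hv

theorem TCtx.derMorEq (hZ : TCtx G.TA G.TB b X Y Z) (hΔ : Derivable G.T (.ctx Δ))
    (lv : G.LvAt k X Y) {σ σ' : A.Var → B.Var → Expr (A.tensor B)}
    (hr : ∀ P x U R y V, Decl X P x U → Decl Y R y V → P.length * Y.length + R.length < k →
      (G.dom Δ).CtxRel σ σ' (P ++ [(x, U)]) (R ++ [(y, V)])) :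
    DerMorEq G.T Δ (Z.take k) (unc σ) (unc σ') := by
  intro Q p W hd
  have hQl := hd.length_le
  simp only [List.length_append, List.length_singleton, List.length_take] at hQl
  obtain ⟨P, x, U, R, y, V, hP, hR, rfl, hs, hl⟩ := hZ.decl (hd.mono (⟨_, List.take_append_drop _ _⟩))
  obtain ⟨n, m, hU, hV, hp'⟩ := lv hP hR (by omega)
  obtain ⟨n, rfl⟩ := hU.pos
  obtain ⟨m, rfl⟩ := hV.pos
  have h := hr P x U R y V hP hR (by omega)
  obtain ⟨W2, hW2, he⟩ := h.2.2 _ _ _ _ _ _ (decl_snoc_self P x U) (decl_snoc_self R y V)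
  have h' := hs.tyEq_var G (hp' _ hΔ).low hU hV
    (h.refl.mono (List.prefix_refl _) (List.prefix_append _ _))
    (h.refl.mono (List.prefix_append _ _) (List.prefix_refl _)) hW2
  exact Derivable.conv (.step (.s2 h')) he

end

/-- The values of the second environment also form a substitution. -/
theorem Dom.CtxRel.right {D : Dom} {X Y} {σ σ' : D.Env} (h : D.CtxRel σ σ' X Y)
    (lv : ∀ P x U R y V, Decl X P x U → Decl Y R y V →
      ∃ n m, DerAt D.TA n (.sort P U) ∧ DerAt D.TB m (.sort R V) ∧ Dom.TyInv D n m) :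
    D.CtxRel σ' σ' X Y := by
  refine ⟨h.1, h.2.1, fun P x U R y V hP hR => ?_⟩
  obtain ⟨n, m, hU, hV, ht⟩ := lv P x U R y V hP hR
  obtain ⟨W, hW, he⟩ := h.2.2 P x U R y V hP hR
  obtain ⟨W', hW'⟩ := DerAt.evTy_var D (x := x) (y := y) hU hV σ'
  have hr1 := h.mono (show P ++ [(x, U)] <+: X from hP) hR.isPre
  have hr2 := h.mono hP.isPre (show R ++ [(y, V)] <+: Y from hR)
  have ht' := ht.h1 (Arg.decl (decl_snoc_self _ _ _) hU) (Arg.decl (decl_snoc_self _ _ _) hV)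
    hr1 hr2 hW hW'
  exact ⟨W', hW', D.conv (D.ty_symm ht') (D.tm_trans (D.tm_symm he) he)⟩

end GATPaper

namespace GATPaper

/-! ## Sorts of tensor products of terms -/

variable {A B : Alphabet} {G : GPair A B} {Δ : PreCtx (A.tensor B)} {n m : ℕ} {b : Bool}
  {X : PreCtx A} {Y : PreCtx B} {x : A.Var} {y : B.Var} {u : Expr A} {v : Expr B} {U : SortE A}
  {V : SortE B} {W W2 : SortE (A.tensor B)} {g : ℕ → Expr (A.tensor B)}
  {σ : A.Var → B.Var → Expr (A.tensor B)}

theorem near_column (hp : Dom.Pack (G.dom Δ) n m)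
    (hg : ∀ i (hi : i < X.length), TTg G.TA G.TB b
      ⟨X.take i, .var (X[i]'hi).1, (X[i]'hi).2⟩ ⟨Y, v, V⟩ (g i))
    (hX : ∀ P z Z, Decl X P z Z → DerAt G.TA n (.sort P Z)) (hv : Arg G.TB m Y Y v V)
    (hr : (G.dom Δ).CtxRel σ σ X Y) {P a Z} (hd : Decl X P a Z) :
    (G.dom Δ).Near σ X Y (.var a) v ((g P.length).subst (unc σ)) := by
  obtain ⟨hi, e1, e2, e3⟩ := hd.at
  have h := hg _ hi
  rw [e1, e2, e3] at h
  exact h.near G hp (nodup_of_isPre hd.isPre hr.1) hr.2.1 (List.prefix_refl _) (List.prefix_refl _)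
    (Arg.of_decl hd (hX _ _ _ hd)) hv hr

theorem near_row (hp : Dom.Pack (G.dom Δ) n m)
    (hg : ∀ j (hj : j < Y.length), TTg G.TA G.TB b ⟨X, u, U⟩
      ⟨Y.take j, .var (Y[j]'hj).1, (Y[j]'hj).2⟩ (g j))
    (hY : ∀ P z Z, Decl Y P z Z → DerAt G.TB m (.sort P Z)) (hu : Arg G.TA n X X u U)
    (hr : (G.dom Δ).CtxRel σ σ X Y) {R c Z} (hd : Decl Y R c Z) :
    (G.dom Δ).Near σ X Y u (.var c) ((g R.length).subst (unc σ)) := by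
  obtain ⟨hi, e1, e2, e3⟩ := hd.at
  have h := hg _ hi
  rw [e1, e2, e3] at h
  exact h.near G hp hr.1 (nodup_of_isPre hd.isPre hr.2.1) (List.prefix_refl _) (List.prefix_refl _)
    hu (Arg.of_decl hd (hY _ _ _ hd)) hr

theorem TSo.tyEq_pairsL (p : Dom.Low (G.dom Δ) n m) (h : TSo G.TA G.TB b X x U Y y V W)
    (hU : DerAt G.TA (n + 1) (.sort X U)) (hv : DerAt G.TB (m + 1) (.term Y v V))
    (hg : ∀ i (hi : i < X.length), TTg G.TA G.TB b
      ⟨X.take i, .var (X[i]'hi).1, (X[i]'hi).2⟩ ⟨Y, v, V⟩ (g i))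
    (hr : (G.dom Δ).CtxRel σ σ (X ++ [(x, U)]) Y)
    (hW2 : (G.dom Δ).EvTy σ X (X ++ [(x, U)]) Y Y (.var x) U v V W2) :
    Derivable G.T (.sortEq Δ ((W.substL (pairsL X y g)).subst (unc σ)) W2) := by
  have hA := G.hA.1.shaped
  have hB := G.hB.1.shaped
  obtain ⟨hx, hy⟩ := h.notMem
  have hu : Dom.ArgX G.TA (n + 1) X (X ++ [(x, U)]) (.var x) U := .inr ⟨x, hx, rfl, rfl, hU⟩
  have hv' : Dom.ArgX G.TB (m + 1) Y Y v V := .inl ⟨rfl, hv⟩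
  obtain ⟨-, -, -, hdP, hdX⟩ := hu.wf hA
  obtain ⟨-, -, -, hdR, hdY⟩ := hv'.wf hB
  have hr2 := hr.mono (List.prefix_append X [(x, U)]) (List.prefix_refl Y)
  rw [SortE.substL_unc]
  refine h.tyEq G p.p1 p.p2 p.ty hu hv' hr hr2 (fun a ha c hc => ?_) (fun c hc => ?_)
    (fun a ha => ?_) hW2
  · exact after_pairsL_ne (.inl (ne_of_mem_of_not_mem hc hy))
  · rw [after_pairsL_ne (.inr hx)]
    exact hr.near_var p.p1.tm.toValInv (fun _ _ _ hd => hdX hd) (fun _ _ _ hd => hdR hd)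
      (by simp) hc
  · obtain ⟨P, Z, hd⟩ := GATPaper.exists_decl ha
    rw [after_pairsL hr2.1 hd]
    exact near_column p.p2 hg (fun _ _ _ hd => hdP hd) hv'.arg hr2 hd

theorem TSo.tyEq_pairsR (p : Dom.Low (G.dom Δ) n m) (h : TSo G.TA G.TB b X x U Y y V W)
    (hu : DerAt G.TA (n + 1) (.term X u U)) (hV : DerAt G.TB (m + 1) (.sort Y V))
    (hg : ∀ j (hj : j < Y.length), TTg G.TA G.TB b ⟨X, u, U⟩
      ⟨Y.take j, .var (Y[j]'hj).1, (Y[j]'hj).2⟩ (g j))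
    (hr : (G.dom Δ).CtxRel σ σ X (Y ++ [(y, V)]))
    (hW2 : (G.dom Δ).EvTy σ X X Y (Y ++ [(y, V)]) u U (.var y) V W2) :
    Derivable G.T (.sortEq Δ ((W.substL (pairsR x Y g)).subst (unc σ)) W2) := by
  have hA := G.hA.1.shaped
  have hB := G.hB.1.shaped
  obtain ⟨hx, hy⟩ := h.notMem
  have hu' : Dom.ArgX G.TA (n + 1) X X u U := .inl ⟨rfl, hu⟩
  have hv : Dom.ArgX G.TB (m + 1) Y (Y ++ [(y, V)]) (.var y) V := .inr ⟨y, hy, rfl, rfl, hV⟩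
  obtain ⟨-, -, -, hdP, hdX⟩ := hu'.wf hA
  obtain ⟨-, -, -, hdR, hdY⟩ := hv.wf hB
  have hr2 := hr.mono (List.prefix_refl X) (List.prefix_append Y [(y, V)])
  rw [SortE.substL_unc]
  refine h.tyEq G p.p1 p.p2 p.ty hu' hv hr2 hr (fun a ha c hc => ?_) (fun c hc => ?_)
    (fun a ha => ?_) hW2
  · exact after_pairsR_ne (.inl (ne_of_mem_of_not_mem ha hx))
  · obtain ⟨R, Z, hd⟩ := GATPaper.exists_decl hc
    rw [after_pairsR hr2.2.1 hd]
    exact near_row p.p1 hg (fun _ _ _ hd => hdR hd) hu'.arg hr2 hd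
  · rw [after_pairsR_ne (.inr hy)]
    exact hr.near_var p.p2.tm.toValInv (fun _ _ _ hd => hdP hd) (fun _ _ _ hd => hdY hd)
      ha (by simp)

theorem TSo.tyEq_pairs {g' : ℕ → Expr (A.tensor B)} (p : Dom.Low (G.dom Δ) n m)
    (h : TSo G.TA G.TB b X x U Y y V W)
    (hu : DerAt G.TA (n + 1) (.term X u U)) (hv : DerAt G.TB (m + 1) (.term Y v V))
    (hg : ∀ i (hi : i < X.length), TTg G.TA G.TB b
      ⟨X.take i, .var (X[i]'hi).1, (X[i]'hi).2⟩ ⟨Y, v, V⟩ (g i))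
    (hg' : ∀ j (hj : j < Y.length), TTg G.TA G.TB b ⟨X, u, U⟩
      ⟨Y.take j, .var (Y[j]'hj).1, (Y[j]'hj).2⟩ (g' j))
    (hr : (G.dom Δ).CtxRel σ σ X Y) (hW2 : (G.dom Δ).EvTy σ X X Y Y u U v V W2) :
    Derivable G.T
      (.sortEq Δ ((W.substL (pairsL X y g ++ pairsR x Y g')).subst (unc σ)) W2) := by
  have hA := G.hA.1.shaped
  have hB := G.hB.1.shaped
  obtain ⟨hx, hy⟩ := h.notMem
  have hu' : Dom.ArgX G.TA (n + 1) X X u U := .inl ⟨rfl, hu⟩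
  have hv' : Dom.ArgX G.TB (m + 1) Y Y v V := .inl ⟨rfl, hv⟩
  obtain ⟨-, -, -, hdP, hdX⟩ := hu'.wf hA
  obtain ⟨-, -, -, hdR, hdY⟩ := hv'.wf hB
  have hL : ∀ {a c}, c ≠ y ∨ a ∉ names X → after (pairsL X y g ++ pairsR x Y g') σ a c =
      after (pairsR x Y g') σ a c := by
    intro a c hc
    rw [after, lookupV_append_notMem, after]
    rw [pairsL_fst, List.mem_map]
    rintro ⟨z, hz, he⟩
    obtain ⟨rfl, rfl⟩ := Prod.mk.inj he
    simp_all
  rw [SortE.substL_unc]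
  refine h.tyEq G p.p1 p.p2 p.ty hu' hv' hr hr (fun a ha c hc => ?_) (fun c hc => ?_)
    (fun a ha => ?_) hW2
  · rw [hL (.inl (ne_of_mem_of_not_mem hc hy))]
    exact after_pairsR_ne (.inl (ne_of_mem_of_not_mem ha hx))
  · obtain ⟨R, Z, hd⟩ := GATPaper.exists_decl hc
    rw [hL (.inr hx), after_pairsR hr.2.1 hd]
    exact near_row p.p1 hg' (fun _ _ _ hd => hdR hd) hu'.arg hr hd
  · obtain ⟨P, Z, hd⟩ := GATPaper.exists_decl ha
    have he : after (pairsL X y g ++ pairsR x Y g') σ a y = after (pairsL X y g) σ a y := by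
      rw [after, lookupV_append_mem, after]
      rw [pairsL_fst, List.mem_map]
      exact ⟨a, ha, rfl⟩
    rw [he, after_pairsL hr.1 hd]
    exact near_column p.p2 hg (fun _ _ _ hd => hdP hd) hv'.arg hr hd

end GATPaper

namespace GATPaper

/-! ## Substitutions between tensor products of contexts -/

variable {A B : Alphabet} {G : GPair A B} {n m k : ℕ} {b : Bool} {X : PreCtx A} {Y : PreCtx B}
  {x : A.Var} {y : B.Var} {U : SortE A} {V : SortE B} {Z Δ : PreCtx (A.tensor B)}
  {σ σ' : A.Var → B.Var → Expr (A.tensor B)}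

theorem GPair.Hyp.lvAt (h : G.Hyp n m) (hX : ∀ P z Z, Decl X P z Z → DerAt G.TA n (.sort P Z))
    (hY : ∀ P z Z, Decl Y P z Z → DerAt G.TB m (.sort P Z)) : G.LvAt k X Y :=
  fun hP hR _ => ⟨n, m, hX _ _ _ hP, hY _ _ _ hR, h⟩

theorem GPair.Hyp.lvAt_corner (h1 : G.Hyp (n + 1) m) (h2 : G.Hyp n (m + 1))
    (hU : DerAt G.TA (n + 1) (.sort X U)) (hV : DerAt G.TB (m + 1) (.sort Y V)) :
    G.LvAt ((X.length + 1) * (Y.length + 1) - 1) (X ++ [(x, U)]) (Y ++ [(y, V)]) := by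
  intro P z S R w T hP hR hlt
  rcases decl_snoc.1 hP with hP | ⟨rfl, rfl, rfl⟩ <;> rcases decl_snoc.1 hR with hR | ⟨rfl, rfl, rfl⟩
  · exact ⟨n, m + 1, DerAt.sort_decl hU hP, DerAt.succ (DerAt.sort_decl hV hR), h2⟩
  · exact ⟨n, m + 1, DerAt.sort_decl hU hP, hV, h2⟩
  · exact ⟨n + 1, m, hU, DerAt.sort_decl hV hR, h1⟩
  · simp only [List.length_append, List.length_singleton, Nat.succ_mul] at hlt
    omega

theorem TCtx.derMors (hZ : TCtx G.TA G.TB b X Y Z) (hΔ : Derivable G.T (.ctx Δ))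
    (lv : G.LvAt k X Y)
    (hr : ∀ P x U R y V, Decl X P x U → Decl Y R y V → P.length * Y.length + R.length < k →
      (G.dom Δ).CtxRel σ σ' (P ++ [(x, U)]) (R ++ [(y, V)])) :
    DerMor G.T Δ (Z.take k) (unc σ) ∧ DerMor G.T Δ (Z.take k) (unc σ') ∧
      DerMorEq G.T Δ (Z.take k) (unc σ) (unc σ') := by
  have he := hZ.derMorEq hΔ lv hr
  refine ⟨he.left, (hZ.derMorEq (σ := σ') (σ' := σ') hΔ lv fun P x U R y V hP hR hlt => ?_).left,
    he⟩
  refine (hr P x U R y V hP hR hlt).right fun P' x' U' R' y' V' hP' hR' => ?_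
  have h1 := hP'.length_le
  have h2 := hR'.length_le
  simp only [List.length_append, List.length_singleton] at h1 h2
  have := Nat.mul_le_mul_right Y.length (show P'.length ≤ P.length by omega)
  obtain ⟨n, m, hU, hV, h⟩ := lv (hP'.mono hP) (hR'.mono hR) (by omega)
  exact ⟨n, m, hU, hV, (h Δ hΔ).ty⟩

/-- Substitutions into a tensor product of contexts. -/
theorem TCtx.whole (hZ : TCtx G.TA G.TB b X Y Z) (hnX : (names X).Nodup) (hnY : (names Y).Nodup)
    (h : G.Hyp n m) (hX : ∀ P z Z, Decl X P z Z → DerAt G.TA n (.sort P Z))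
    (hY : ∀ P z Z, Decl Y P z Z → DerAt G.TB m (.sort P Z)) :
    Derivable G.T (.ctx Z) ∧ (G.dom Z).CtxRel varEnv varEnv X Y ∧
      ∀ {Δ σ σ'}, Derivable G.T (.ctx Δ) → (G.dom Δ).CtxRel σ σ' X Y →
        DerMor G.T Δ Z (unc σ) ∧ DerMor G.T Δ Z (unc σ') ∧
          DerMorEq G.T Δ Z (unc σ) (unc σ') := by
  have lv : G.LvAt Z.length X Y := h.lvAt hX hY
  have hc := hZ.ctx hnX hnY lv
  rw [List.take_length] at hc
  refine ⟨hc, hZ.ctxRel_var hc (by rw [List.take_length]) lv hnX hnY (List.prefix_refl _)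
    (List.prefix_refl _) fun i hi j hj => hZ.1 ▸ grid_lt hi hj, fun {Δ σ σ'} hΔ hr => ?_⟩
  have := hZ.derMors hΔ lv fun P x U R y V hP hR _ => hr.mono hP hR
  rwa [List.take_length] at this

/-- Substitutions into a tensor product of contexts without its last variable. -/
theorem TCtx.corner (hZ : TCtx G.TA G.TB b (X ++ [(x, U)]) (Y ++ [(y, V)]) Z)
    (hx : x ∉ names X) (hy : y ∉ names Y) (h1 : G.Hyp (n + 1) m) (h2 : G.Hyp n (m + 1))
    (hU : DerAt G.TA (n + 1) (.sort X U)) (hV : DerAt G.TB (m + 1) (.sort Y V)) :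
    Derivable G.T (.ctx Z.dropLast) ∧
      (G.dom Z.dropLast).CtxRel varEnv varEnv (X ++ [(x, U)]) Y ∧
      (G.dom Z.dropLast).CtxRel varEnv varEnv X (Y ++ [(y, V)]) ∧
      ∀ {Δ σ σ'}, Derivable G.T (.ctx Δ) → (G.dom Δ).CtxRel σ σ' (X ++ [(x, U)]) Y →
        (G.dom Δ).CtxRel σ σ' X (Y ++ [(y, V)]) →
        DerMor G.T Δ Z.dropLast (unc σ) ∧ DerMor G.T Δ Z.dropLast (unc σ') ∧
          DerMorEq G.T Δ Z.dropLast (unc σ) (unc σ') := by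
  have lv : G.LvAt ((X.length + 1) * (Y.length + 1) - 1) (X ++ [(x, U)]) (Y ++ [(y, V)]) :=
    h1.lvAt_corner h2 hU hV
  have hnX := nodup_snoc (DerAt.sort_wf hU).1 hx U
  have hnY := nodup_snoc (DerAt.sort_wf hV).1 hy V
  have hd : Z.dropLast = Z.take ((X.length + 1) * (Y.length + 1) - 1) := by
    rw [List.dropLast_eq_take, hZ.1]
    simp
  have hc := hZ.ctx hnX hnY lv
  have hl : (Y ++ [(y, V)]).length = Y.length + 1 := by simp
  rw [hd]
  refine ⟨hc, hZ.ctxRel_var hc (List.prefix_refl _) lv hnX hnY (List.prefix_refl _)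
    (List.prefix_append _ _) ?_, hZ.ctxRel_var hc (List.prefix_refl _) lv hnX hnY
    (List.prefix_append _ _) (List.prefix_refl _) ?_, fun {Δ σ σ'} hΔ hr1 hr2 =>
    hZ.derMors hΔ lv fun P z S R w T hP hR hlt => ?_⟩
  · intro i hi j hj
    simp only [List.length_append, List.length_singleton] at hi ⊢
    have := Nat.mul_le_mul_right (Y.length + 1) (show i ≤ X.length by omega)
    rw [Nat.succ_mul]
    omega
  · intro i hi j hj
    simp only [List.length_append, List.length_singleton] at hj ⊢
    have := Nat.mul_le_mul_right (Y.length + 1) (show i + 1 ≤ X.length by omega)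
    rw [Nat.succ_mul] at this ⊢
    omega
  · rcases decl_snoc.1 hP with hP' | ⟨rfl, rfl, rfl⟩
    · exact hr2.mono hP' hR
    · rcases decl_snoc.1 hR with hR' | ⟨rfl, rfl, rfl⟩
      · exact hr1.mono hP hR'
      · simp only [List.length_append, List.length_singleton, Nat.succ_mul] at hlt
        omega

theorem TCtx.map_unc (hZ : TCtx G.TA G.TB b X Y Z) {M : ℕ → ℕ → Expr (A.tensor B)}
    (hM : Dom.Mat (γ := Expr (A.tensor B)) (fun z w e => e = σ z w) (names X) (names Y) M) :
    (Z.map fun p => unc σ p.1) = flat X.length Y.length M := by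
  refine IsGrid.eq_flat ⟨by simp [hZ.1], fun i j hi hj hk => ?_⟩
  have hk' : i * Y.length + j < Z.length := by simpa using hk
  rw [List.getElem_map, (hZ.2 i j hi hj hk').1]
  rw [hM i (by simpa using hi) j (by simpa using hj)]
  have e1 : (names X)[i]'(by simpa using hi) = X[i].1 := List.getElem_map _
  have e2 : (names Y)[j]'(by simpa using hj) = Y[j].1 := List.getElem_map _
  exact (congrArg₂ σ e1 e2).symm

end GATPaper

namespace GATPaper

/-! ## Equations from pairs of introducing sort axioms -/

theorem Dom.AxSort.swap {D : Dom} {n m : ℕ} (h : D.AxSort n m) : D.swap.AxSort m n := by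
  intro XS S YT T σ0 σ1 M0 M1 h1 h2 h3 h4 c1 c2 m1 m2 m1' m2'
  exact h h3 h4 h1 h2 c2.tr c1.tr m2.tr m1.tr m2'.tr m1'.tr

variable {A B : Alphabet} {G : GPair A B} {n m k : ℕ} {b : Bool} {X : PreCtx A} {Y : PreCtx B}
  {x : A.Var} {y : B.Var} {U : SortE A} {V : SortE B} {Z Δ : PreCtx (A.tensor B)}
  {σ σ' : A.Var → B.Var → Expr (A.tensor B)}

theorem TCtx.map_unc_dropLast (hZ : TCtx G.TA G.TB b (X ++ [(x, U)]) (Y ++ [(y, V)]) Z)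
    {M : ℕ → ℕ → Expr (A.tensor B)}
    (h1 : Dom.Mat (γ := Expr (A.tensor B)) (fun z w e => e = σ z w) (names X ++ [x]) (names Y) M)
    (h2 : Dom.Mat (γ := Expr (A.tensor B)) (fun z w e => e = σ z w) (names X) (names Y ++ [y]) M) :
    (Z.dropLast.map fun p => unc σ p.1) =
      (flat (X.length + 1) (Y.length + 1) M).dropLast := by
  classical
  have h := hZ.map_unc (σ := σ)
    (M := fun i j => if i = X.length ∧ j = Y.length then σ x y else M i j) (by
      intro i hi j hj
      have hi' : i < X.length + 1 := by simpa using hi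
      have hj' : j < Y.length + 1 := by simpa using hj
      simp only [names_snoc]
      by_cases hc : i = X.length ∧ j = Y.length
      · obtain ⟨rfl, rfl⟩ := hc
        simp
      · rw [if_neg hc]
        by_cases hj2 : j < Y.length
        · rw [h1 i (by simpa using hi') j (by simpa using hj2),
            List.getElem_append_left (as := names Y) (by simpa using hj2)]
        · rw [h2 i (by simp; omega) j (by simpa using hj'),
            List.getElem_append_left (as := names X) (by simp; omega)])
  rw [List.map_dropLast, h]
  simp only [List.length_append, List.length_singleton]
  exact flat_dropLast_congr fun i hi j hj hc => if_neg (by omega)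

theorem GPair.introSort_tensor {S : A.SortSym} {T : B.SortSym}
    (h1 : G.Hyp (n + 1) m) (h2 : G.Hyp n (m + 1)) (haxX : introSort X S ∈ G.TA)
    (hU : DerAt G.TA (n + 1) (introSort X S)) (haxY : introSort Y T ∈ G.TB)
    (hV : DerAt G.TB (m + 1) (introSort Y T)) :
    ∃ Z, TCtx G.TA G.TB false (X ++ [(G.chA X, ⟨S, ctxVars X⟩)])
        (Y ++ [(G.chB Y, ⟨T, ctxVars Y⟩)]) Z ∧ introSort Z.dropLast ((S, T) : (A.tensor B).SortSym) ∈ G.T ∧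
      Derivable G.T (introSort Z.dropLast ((S, T) : (A.tensor B).SortSym)) := by
  have hx := FreshCh.notMem G.hchA X
  have hy := FreshCh.notMem G.hchB Y
  obtain ⟨Z, hZ⟩ := TCtx.total G (WfCtx.snoc hU hx) (WfCtx.snoc hV hy)
  obtain ⟨W, hW⟩ := TSo.total G hx hy hU hV
  have hax : Judg.sort Z.dropLast W ∈ G.T := ⟨_, _, haxX, haxY, .ss hZ hW⟩
  rw [hW.args_ctxVars hZ] at hax
  have hc := (hZ.corner hx hy h1 h2 hU hV).1
  exact ⟨Z, hZ, hax, .step (.sA hax hc fun i hi => hc.var_decl G.shaped (decl_getElem hi))⟩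

theorem GPair.axSort (h1 : G.Hyp (n + 1) m) (h2 : G.Hyp n (m + 1))
    (hΔ : Derivable G.T (.ctx Δ)) : (G.dom Δ).AxSort (n + 1) (m + 1) := by
  intro XS S YT T σ0 σ1 M0 M1 haxX hU haxY hV c1 c2 m1 m2 m1' m2'
  obtain ⟨Z, hZ, hax, hd⟩ := GPair.introSort_tensor h1 h2 haxX hU haxY hV
  have hx := FreshCh.notMem G.hchA XS
  have hy := FreshCh.notMem G.hchB YT
  obtain ⟨-, hσ, he⟩ := (hZ.corner hx hy h1 h2 hU hV).2.2.2 hΔ c1 c2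
  have := Derivable.seqSub2 hΔ hax hd he hσ
  rwa [hZ.map_unc_dropLast m1 m2, hZ.map_unc_dropLast m1' m2'] at this

end GATPaper

namespace GATPaper

/-! ## Equations from pairs of axioms with a sort equation -/

variable {A B : Alphabet} {G : GPair A B} {n m k : ℕ} {b : Bool} {X X' : PreCtx A}
  {Y Y' : PreCtx B} {x : A.Var} {y : B.Var} {u : Expr A} {v : Expr B} {U : SortE A} {V : SortE B}
  {Z Δ : PreCtx (A.tensor B)} {σ σ' : A.Var → B.Var → Expr (A.tensor B)}

theorem GPair.lowAt (h1 : G.Hyp (n + 1) m) (h2 : G.Hyp n (m + 1))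
    (hΔ : Derivable G.T (.ctx Δ)) : Dom.Low (G.dom Δ) n m :=
  ⟨h1 Δ hΔ, h2 Δ hΔ, Dom.tyInv_step (h1 Δ hΔ) (h2 Δ hΔ) (GPair.axSort h1 h2 hΔ)⟩

theorem TTg.termEq_ev {e e0 W} (h : TTg G.TA G.TB b ⟨X, u, U⟩ ⟨Y, v, V⟩ e)
    (hp : Dom.Pack (G.dom Δ) n m) (hu : Arg G.TA n X X' u U) (hv : Arg G.TB m Y Y' v V)
    (hr : (G.dom Δ).CtxRel σ σ X' Y') (hW : (G.dom Δ).EvTy σ X X' Y Y' u U v V W)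
    (he : (G.dom Δ).Ev σ X' Y' u v e0) : Derivable G.T (.termEq Δ (e.subst (unc σ)) e0 W) :=
  (h.near G hp (nodup_of_isPre hu.1 hr.1) (nodup_of_isPre hv.1 hr.2.1) (List.prefix_refl _)
    (List.prefix_refl _) hu hv hr).any hp.cv hr hu hv hW he

theorem GPair.axSrt (h1 : G.Hyp (n + 1) m) (h2 : G.Hyp n (m + 1))
    (hΔ : Derivable G.T (.ctx Δ)) : (G.dom Δ).AxSrt (n + 1) (m + 1) := by
  intro X U U' YT T σ0 hax hJ haxT hT c1 c2
  have hU := hJ.sorts_of_sortEq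
  obtain ⟨k, rfl⟩ := hU.1.pos
  have hx := FreshCh.notMem G.hchA X
  have hy := FreshCh.notMem G.hchB YT
  obtain ⟨Z, hZ⟩ := TCtx.total G (WfCtx.snoc hU.1 hx) (WfCtx.snoc hT hy)
  obtain ⟨W, hW⟩ := TSo.total G hx hy hU.1 hT
  obtain ⟨W', hW'⟩ := TSo.total G hx hy hU.2 hT
  have key : ∀ {Δ σ}, Derivable G.T (.ctx Δ) →
      (G.dom Δ).CtxRel σ σ (X ++ [(G.chA X, U)]) YT →
      (G.dom Δ).CtxRel σ σ X (YT ++ [(G.chB YT, ⟨T, ctxVars YT⟩)]) →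
      ∃ W2 W2', (G.dom Δ).EvTy σ X (X ++ [(G.chA X, U)]) YT
          (YT ++ [(G.chB YT, ⟨T, ctxVars YT⟩)]) (.var (G.chA X)) U (.var (G.chB YT))
          ⟨T, ctxVars YT⟩ W2 ∧
        (G.dom Δ).EvTy σ X (X ++ [(G.chA X, U')]) YT
          (YT ++ [(G.chB YT, ⟨T, ctxVars YT⟩)]) (.var (G.chA X)) U' (.var (G.chB YT))
          ⟨T, ctxVars YT⟩ W2' ∧
        Derivable G.T (.sortEq Δ (W.subst (unc σ)) W2) ∧
        Derivable G.T (.sortEq Δ (W'.subst (unc σ)) W2') := by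
    intro Δ σ hΔ c1 c2
    have hs := (h1 Δ hΔ).eq.toSrtInv.sEq hJ hx (DerAt.sort_decl hT) c1
    obtain ⟨W2, hW2⟩ := DerAt.evTy_var (G.dom Δ) (x := G.chA X) (y := G.chB YT) hU.1 hT σ
    obtain ⟨W2', hW2'⟩ := DerAt.evTy_var (G.dom Δ) (x := G.chA X) (y := G.chB YT) hU.2 hT σ
    have low := (h2 Δ hΔ).low
    exact ⟨W2, W2', hW2, hW2', hW.tyEq_var G low hU.1 hT c1 c2 hW2,
      hW'.tyEq_var G low hU.2 hT hs.rel' c2 hW2'⟩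
  obtain ⟨hc, r1, r2, hmor⟩ := hZ.corner hx hy (h1.mono (Nat.le_succ _) le_rfl)
    (h2.mono (Nat.le_succ _) le_rfl) hU.1 hT
  have hax' : Judg.sortEq Z.dropLast W W' ∈ G.T := ⟨_, _, hax, haxT, .seqs hZ hW hW'⟩
  obtain ⟨_, _, -, -, e, e'⟩ := key hc r1 r2
  rw [SortE.subst_varEnv] at e e'
  have hd := Derivable.step (.seqA hax' e.sorts_of_sortEq.1 e'.sorts_of_sortEq.1)
  obtain ⟨W2, W2', hW2, hW2', f, f'⟩ := key hΔ c1 c2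
  have hd' := Derivable.sortEq_subst G.shaped hΔ (hmor hΔ c1 c2).1 hd
  exact ⟨W2, W2', hW2, hW2', .step (.s3 (.step (.s2 f)) (.step (.s3 hd' f')))⟩

theorem GPair.axSrt_swap (h1 : G.Hyp (n + 1) m) (h2 : G.Hyp n (m + 1))
    (hΔ : Derivable G.T (.ctx Δ)) : (G.dom Δ).swap.AxSrt (m + 1) (n + 1) := by
  intro Y V V' XT S σ0 hax hJ haxS hS c1 c2
  have hV := hJ.sorts_of_sortEq
  obtain ⟨k, rfl⟩ := hV.1.pos
  have hx := FreshCh.notMem G.hchA XT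
  have hy := FreshCh.notMem G.hchB Y
  obtain ⟨Z, hZ⟩ := TCtx.total G (WfCtx.snoc hS hx) (WfCtx.snoc hV.1 hy)
  obtain ⟨W, hW⟩ := TSo.total G hx hy hS hV.1
  obtain ⟨W', hW'⟩ := TSo.total G hx hy hS hV.2
  have key : ∀ {Δ σ}, Derivable G.T (.ctx Δ) →
      (G.dom Δ).CtxRel σ σ (XT ++ [(G.chA XT, ⟨S, ctxVars XT⟩)]) Y →
      (G.dom Δ).CtxRel σ σ XT (Y ++ [(G.chB Y, V)]) →
      ∃ W2 W2', (G.dom Δ).EvTy σ XT (XT ++ [(G.chA XT, ⟨S, ctxVars XT⟩)]) Y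
          (Y ++ [(G.chB Y, V)]) (.var (G.chA XT)) ⟨S, ctxVars XT⟩ (.var (G.chB Y)) V W2 ∧
        (G.dom Δ).EvTy σ XT (XT ++ [(G.chA XT, ⟨S, ctxVars XT⟩)]) Y
          (Y ++ [(G.chB Y, V')]) (.var (G.chA XT)) ⟨S, ctxVars XT⟩ (.var (G.chB Y)) V' W2' ∧
        Derivable G.T (.sortEq Δ (W.subst (unc σ)) W2) ∧
        Derivable G.T (.sortEq Δ (W'.subst (unc σ)) W2') := by
    intro Δ σ hΔ c1 c2
    have hs := (h2 Δ hΔ).eq'.toSrtInv.sEq hJ hy (DerAt.sort_decl hS)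
      (Dom.CtxRel.tr (D := G.dom Δ) c2)
    obtain ⟨W2, hW2⟩ := DerAt.evTy_var (G.dom Δ) (x := G.chA XT) (y := G.chB Y) hS hV.1 σ
    obtain ⟨W2', hW2'⟩ := DerAt.evTy_var (G.dom Δ) (x := G.chA XT) (y := G.chB Y) hS hV.2 σ
    have low := (h1 Δ hΔ).low
    exact ⟨W2, W2', hW2, hW2', hW.tyEq_var G low hS hV.1 c1 c2 hW2,
      hW'.tyEq_var G low hS hV.2 c1 (Dom.CtxRel.tr (D := (G.dom Δ).swap) hs.rel') hW2'⟩
  obtain ⟨hc, r1, r2, hmor⟩ := hZ.corner hx hy (h1.mono le_rfl (Nat.le_succ _))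
    (h2.mono le_rfl (Nat.le_succ _)) hS hV.1
  have hax' : Judg.sortEq Z.dropLast W W' ∈ G.T := ⟨_, _, haxS, hax, .sseq hZ hW hW'⟩
  obtain ⟨_, _, -, -, e, e'⟩ := key hc r1 r2
  rw [SortE.subst_varEnv] at e e'
  have hd := Derivable.step (.seqA hax' e.sorts_of_sortEq.1 e'.sorts_of_sortEq.1)
  have t1 := Dom.CtxRel.tr (D := (G.dom Δ).swap) c2
  have t2 := Dom.CtxRel.tr (D := (G.dom Δ).swap) c1
  obtain ⟨W2, W2', hW2, hW2', f, f'⟩ := key hΔ t1 t2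
  have hd' := Derivable.sortEq_subst G.shaped hΔ (hmor hΔ t1 t2).1 hd
  exact ⟨W2, W2', Dom.EvTy.tr (D := G.dom Δ) hW2, Dom.EvTy.tr (D := G.dom Δ) hW2',
    .step (.s3 (.step (.s2 f)) (.step (.s3 hd' f')))⟩

end GATPaper

namespace GATPaper

/-! ## Equations from an introducing sort axiom and an introducing term axiom -/

variable {A B : Alphabet} {G : GPair A B} {n m k : ℕ} {b : Bool} {X X' : PreCtx A}
  {Y Y' : PreCtx B} {x : A.Var} {y : B.Var} {u : Expr A} {v : Expr B} {U : SortE A} {V : SortE B}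
  {Z Δ : PreCtx (A.tensor B)} {σ σ' : A.Var → B.Var → Expr (A.tensor B)}

theorem TTg.total_column (hX : WfCtx G.TA X) (hv : DerAt G.TB m (.term Y v V)) :
    ∃ g : ℕ → Expr (A.tensor B), ∀ i (hi : i < X.length), TTg G.TA G.TB false
      ⟨X.take i, .var (X[i]'hi).1, (X[i]'hi).2⟩ ⟨Y, v, V⟩ (g i) := by
  obtain ⟨k, rfl⟩ := hv.pos
  have : ∀ i, ∃ e, ∀ (hi : i < X.length), TTg G.TA G.TB false
      ⟨X.take i, .var (X[i]'hi).1, (X[i]'hi).2⟩ ⟨Y, v, V⟩ e := by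
    intro i
    by_cases hi : i < X.length
    · have hd := decl_getElem hi
      obtain ⟨n, hn⟩ := hX.2 _ _ _ hd
      obtain ⟨e, he⟩ := TTg.total G n (k + 1) (nodup_of_isPre hd.isPre hX.1) (List.prefix_refl _)
        (Arg.decl hd hn) hv.sort_of_term.wfCtx (List.prefix_refl _) hv.arg
      exact ⟨e, fun _ => he⟩
    · exact ⟨.var (G.chA X, G.chB Y), fun h => absurd h hi⟩
  choose g hg using this
  exact ⟨g, hg⟩

theorem TTg.total_row (hu : DerAt G.TA n (.term X u U)) (hY : WfCtx G.TB Y) :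
    ∃ g : ℕ → Expr (A.tensor B), ∀ j (hj : j < Y.length), TTg G.TA G.TB false
      ⟨X, u, U⟩ ⟨Y.take j, .var (Y[j]'hj).1, (Y[j]'hj).2⟩ (g j) := by
  obtain ⟨k, rfl⟩ := hu.pos
  have : ∀ j, ∃ e, ∀ (hj : j < Y.length), TTg G.TA G.TB false
      ⟨X, u, U⟩ ⟨Y.take j, .var (Y[j]'hj).1, (Y[j]'hj).2⟩ e := by
    intro j
    by_cases hj : j < Y.length
    · have hd := decl_getElem hj
      obtain ⟨m, hm⟩ := hY.2 _ _ _ hd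
      obtain ⟨e, he⟩ := TTg.total G (k + 1) m hu.sort_of_term.wfCtx.1 (List.prefix_refl _)
        hu.arg (hY.isPre hd.isPre) (List.prefix_refl _) (Arg.decl hd hm)
      exact ⟨e, fun _ => he⟩
    · exact ⟨.var (G.chA X, G.chB Y), fun h => absurd h hj⟩
  choose g hg using this
  exact ⟨g, hg⟩

theorem DerAt.sort_decls {A : Alphabet} {Ax : Set (Judg A)} {n : ℕ} {X : PreCtx A} {U : SortE A}
    (hU : DerAt Ax n (.sort X U)) (x : A.Var) :
    ∀ P z Z, Decl (X ++ [(x, U)]) P z Z → DerAt Ax n (.sort P Z) := by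
  intro P z Z hd
  rcases decl_snoc.1 hd with hd | ⟨rfl, rfl, rfl⟩
  exacts [hU.sort_wf.2.2 _ _ _ hd, hU]

theorem TSo.sort_pairsL {W : SortE (A.tensor B)} {g : ℕ → Expr (A.tensor B)}
    (p : Dom.Low (G.dom Z) n m) (h : TSo G.TA G.TB b X x U Y y V W)
    (hU : DerAt G.TA (n + 1) (.sort X U)) (hv : DerAt G.TB (m + 1) (.term Y v V))
    (hg : ∀ i (hi : i < X.length), TTg G.TA G.TB b
      ⟨X.take i, .var (X[i]'hi).1, (X[i]'hi).2⟩ ⟨Y, v, V⟩ (g i))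
    (hr : (G.dom Z).CtxRel varEnv varEnv (X ++ [(x, U)]) Y) :
    Derivable G.T (.sort Z (W.substL (pairsL X y g))) := by
  obtain ⟨W2, hW2⟩ := Dom.evTy_total (D := G.dom Z) varEnv (Arg.decl (decl_snoc_self X x U) hU)
    hv.arg
  have := h.tyEq_pairsL p hU hv hg hr hW2
  rw [SortE.subst_varEnv] at this
  exact this.sorts_of_sortEq.1

theorem TSo.sort_pairsR {W : SortE (A.tensor B)} {g : ℕ → Expr (A.tensor B)}
    (p : Dom.Low (G.dom Z) n m) (h : TSo G.TA G.TB b X x U Y y V W)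
    (hu : DerAt G.TA (n + 1) (.term X u U)) (hV : DerAt G.TB (m + 1) (.sort Y V))
    (hg : ∀ j (hj : j < Y.length), TTg G.TA G.TB b ⟨X, u, U⟩
      ⟨Y.take j, .var (Y[j]'hj).1, (Y[j]'hj).2⟩ (g j))
    (hr : (G.dom Z).CtxRel varEnv varEnv X (Y ++ [(y, V)])) :
    Derivable G.T (.sort Z (W.substL (pairsR x Y g))) := by
  obtain ⟨W2, hW2⟩ := Dom.evTy_total (D := G.dom Z) varEnv hu.arg
    (Arg.decl (decl_snoc_self Y y V) hV)
  have := h.tyEq_pairsR p hu hV hg hr hW2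
  rw [SortE.subst_varEnv] at this
  exact this.sorts_of_sortEq.1

theorem GPair.ax_st (h1 : G.Hyp (n + 1) m) (h2 : G.Hyp n (m + 1))
    (hΔ : Derivable G.T (.ctx Δ)) {XS : PreCtx A} {S YT t VT M0 M1}
    (haxS : introSort XS S ∈ G.TA) (hS : DerAt G.TA (n + 1) (introSort XS S))
    (haxT : introTerm YT t VT ∈ G.TB) (hT : DerAt G.TB (m + 1) (introTerm YT t VT))
    (c : (G.dom Δ).CtxRel σ σ' (XS ++ [(G.chA XS, ⟨S, ctxVars XS⟩)]) YT)
    (m0 : Dom.Mat (γ := Expr (A.tensor B)) (fun z w e => e = σ z w) (names XS ++ [G.chA XS])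
      (names YT) M0)
    (m1 : Dom.Mat (γ := Expr (A.tensor B)) (fun z w e => e = σ' z w) (names XS ++ [G.chA XS])
      (names YT) M1) :
    ∃ W, (G.dom Δ).EvTy σ XS (XS ++ [(G.chA XS, ⟨S, ctxVars XS⟩)]) YT YT (.var (G.chA XS))
        ⟨S, ctxVars XS⟩ (.app t (ctxVars YT)) VT W ∧
      Derivable G.T (.termEq Δ (.app (.inl (S, t)) (flat (XS.length + 1) YT.length M0))
        (.app (.inl (S, t)) (flat (XS.length + 1) YT.length M1)) W) := by
  have hx := FreshCh.notMem G.hchA XS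
  have hy := FreshCh.notMem G.hchB YT
  have hV := hT.sort_of_term
  have hdX := hS.sort_decls (G.chA XS)
  have hdY := hV.sort_wf.2.2
  have hu := Arg.decl (decl_snoc_self XS (G.chA XS) _) hS
  obtain ⟨Z, hZ⟩ := TCtx.total G (WfCtx.snoc hS hx) hV.wfCtx
  obtain ⟨W, hW⟩ := TSo.total G hx hy hS hV
  obtain ⟨g, hg⟩ := TTg.total_column (G := G) hS.wfCtx hT
  obtain ⟨e, he⟩ := TTg.total G (n + 1) (m + 1) hS.wfCtx.1 (List.prefix_refl _) hu hV.wfCtx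
    (List.prefix_refl _) hT.arg
  have hax : Judg.term Z e (W.substL (pairsL XS (G.chB YT) g)) ∈ G.T :=
    ⟨_, _, haxS, haxT, .st hZ he hW hg⟩
  obtain rfl := he.app_ctxVars_inl hZ
  obtain ⟨hc, hr, hmor⟩ := hZ.whole c.1 c.2.1 h1 hdX hdY
  have hd : Derivable G.T (introTerm Z _ _) := .step (.tA hax
    (hW.sort_pairsL (GPair.lowAt h1 h2 hc) hS hT hg hr)
    fun i hi => hc.var_decl G.shaped (decl_getElem hi))
  have low := GPair.lowAt h1 h2 hΔ
  obtain ⟨W0, hW0⟩ := Dom.evTy_total (D := G.dom Δ) σ hu hT.arg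
  obtain ⟨W1, hW1⟩ := Dom.evTy_total (D := G.dom Δ) σ' hu hT.arg
  have c' := c.right fun P x U R y V hP hR => ⟨_, _, hdX _ _ _ hP, hdY _ _ _ hR, (h1 Δ hΔ).ty⟩
  have q0 := hW.tyEq_pairsL low hS hT hg c.refl hW0
  have q1 := hW.tyEq_pairsL low hS hT hg c' hW1
  have q := low.ty.h1 hu hT.arg c (c.mono (List.prefix_append _ _) (List.prefix_refl _)) hW0 hW1
  have hmor := hmor hΔ c
  have hd' := Derivable.teqSub2 G.shaped hΔ hax hd hmor.2.2 hmor.2.1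
    (.step (.s3 q0 (.step (.s3 (.step (.s2 q)) (.step (.s2 q1))))))
  rw [hZ.map_unc (by rwa [names_snoc]), hZ.map_unc (by rwa [names_snoc]), List.length_append] at hd'
  exact ⟨W0, hW0, Derivable.conv q0 hd'⟩

theorem GPair.ax_ts (h1 : G.Hyp (n + 1) m) (h2 : G.Hyp n (m + 1))
    (hΔ : Derivable G.T (.ctx Δ)) {XT : PreCtx A} {YS : PreCtx B} {s UT T M0 M1}
    (haxS : introTerm XT s UT ∈ G.TA) (hS : DerAt G.TA (n + 1) (introTerm XT s UT))
    (haxT : introSort YS T ∈ G.TB) (hT : DerAt G.TB (m + 1) (introSort YS T))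
    (c : (G.dom Δ).CtxRel σ σ' XT (YS ++ [(G.chB YS, ⟨T, ctxVars YS⟩)]))
    (m0 : Dom.Mat (γ := Expr (A.tensor B)) (fun z w e => e = σ z w) (names XT)
      (names YS ++ [G.chB YS]) M0)
    (m1 : Dom.Mat (γ := Expr (A.tensor B)) (fun z w e => e = σ' z w) (names XT)
      (names YS ++ [G.chB YS]) M1) :
    ∃ W, (G.dom Δ).EvTy σ XT XT YS (YS ++ [(G.chB YS, ⟨T, ctxVars YS⟩)]) (.app s (ctxVars XT))
        UT (.var (G.chB YS)) ⟨T, ctxVars YS⟩ W ∧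
      Derivable G.T (.termEq Δ (.app (.inr (s, T)) (flat XT.length (YS.length + 1) M0))
        (.app (.inr (s, T)) (flat XT.length (YS.length + 1) M1)) W) := by
  have hx := FreshCh.notMem G.hchA XT
  have hy := FreshCh.notMem G.hchB YS
  have hU := hS.sort_of_term
  have hdX := hU.sort_wf.2.2
  have hdY := hT.sort_decls (G.chB YS)
  have hv := Arg.decl (decl_snoc_self YS (G.chB YS) _) hT
  obtain ⟨Z, hZ⟩ := TCtx.total G hU.wfCtx (WfCtx.snoc hT hy)
  obtain ⟨W, hW⟩ := TSo.total G hx hy hU hT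
  obtain ⟨g, hg⟩ := TTg.total_row (G := G) hS hT.wfCtx
  obtain ⟨e, he⟩ := TTg.total G (n + 1) (m + 1) hU.wfCtx.1 (List.prefix_refl _) hS.arg hT.wfCtx
    (List.prefix_refl _) hv
  have hax : Judg.term Z e (W.substL (pairsR (G.chA XT) YS g)) ∈ G.T :=
    ⟨_, _, haxS, haxT, .ts hZ he hW hg⟩
  obtain rfl := he.app_ctxVars_inr hZ
  obtain ⟨hc, hr, hmor⟩ := hZ.whole c.1 c.2.1 h2 hdX hdY
  have hd : Derivable G.T (introTerm Z _ _) := .step (.tA hax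
    (hW.sort_pairsR (GPair.lowAt h1 h2 hc) hS hT hg hr)
    fun i hi => hc.var_decl G.shaped (decl_getElem hi))
  have low := GPair.lowAt h1 h2 hΔ
  obtain ⟨W0, hW0⟩ := Dom.evTy_total (D := G.dom Δ) σ hS.arg hv
  obtain ⟨W1, hW1⟩ := Dom.evTy_total (D := G.dom Δ) σ' hS.arg hv
  have c' := c.right fun P x U R y V hP hR => ⟨_, _, hdX _ _ _ hP, hdY _ _ _ hR, (h2 Δ hΔ).ty⟩
  have q0 := hW.tyEq_pairsR low hS hT hg c.refl hW0
  have q1 := hW.tyEq_pairsR low hS hT hg c' hW1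
  have q := low.ty.h1 hS.arg hv (c.mono (List.prefix_refl _) (List.prefix_append _ _)) c hW0 hW1
  have hmor := hmor hΔ c
  have hd' := Derivable.teqSub2 G.shaped hΔ hax hd hmor.2.2 hmor.2.1
    (.step (.s3 q0 (.step (.s3 (.step (.s2 q)) (.step (.s2 q1))))))
  rw [hZ.map_unc (by rwa [names_snoc]), hZ.map_unc (by rwa [names_snoc]), List.length_append] at hd'
  exact ⟨W0, hW0, Derivable.conv q0 hd'⟩

end GATPaper

namespace GATPaper

/-! ## Equations from a sort equation axiom and an introducing term axiom -/

variable {A B : Alphabet} {G : GPair A B} {n m k : ℕ} {b : Bool} {X X' : PreCtx A}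
  {Y Y' : PreCtx B} {x : A.Var} {y : B.Var} {u : Expr A} {v : Expr B} {U : SortE A} {V : SortE B}
  {Z Δ : PreCtx (A.tensor B)} {σ σ' : A.Var → B.Var → Expr (A.tensor B)}

theorem GPair.lowAt_swap (h1 : G.Hyp (n + 1) m) (h2 : G.Hyp n (m + 1))
    (hΔ : Derivable G.T (.ctx Δ)) : Dom.Low (G.dom Δ).swap m n :=
  ⟨(h2 Δ hΔ).swap, (h1 Δ hΔ).swap, Dom.tyInv_step (D := (G.dom Δ).swap) (h2 Δ hΔ).swap
    (h1 Δ hΔ).swap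
    (Dom.AxSort.swap (D := G.dom Δ) (GPair.axSort h1 h2 hΔ))⟩

theorem GPair.ax_et (h1 : G.Hyp (n + 1) m) (h2 : G.Hyp n (m + 1))
    (hΔ : Derivable G.T (.ctx Δ)) {X : PreCtx A} {U U' YT t VT σ0}
    (hax : Judg.sortEq X U U' ∈ G.TA) (hJ : DerAt G.TA (n + 1) (.sortEq X U U'))
    (haxT : introTerm YT t VT ∈ G.TB) (hT : DerAt G.TB (m + 1) (introTerm YT t VT))
    (c : (G.dom Δ).CtxRel σ0 σ0 (X ++ [(G.chA X, U)]) YT) :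
    ∃ e e' W, (G.dom Δ).Ev σ0 (X ++ [(G.chA X, U)]) YT (.var (G.chA X)) (.app t (ctxVars YT)) e ∧
      (G.dom Δ).Ev σ0 (X ++ [(G.chA X, U')]) YT (.var (G.chA X)) (.app t (ctxVars YT)) e' ∧
      (G.dom Δ).EvTy σ0 X (X ++ [(G.chA X, U)]) YT YT (.var (G.chA X)) U (.app t (ctxVars YT))
        VT W ∧
      Derivable G.T (.termEq Δ e e' W) := by
  have hU := hJ.sorts_of_sortEq
  have hV := hT.sort_of_term
  have hx := FreshCh.notMem G.hchA X
  have hy := FreshCh.notMem G.hchB YT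
  have hdX := hU.1.sort_decls (G.chA X)
  have hdY := hV.sort_wf.2.2
  have hu := Arg.decl (decl_snoc_self X (G.chA X) _) hU.1
  have hu' := Arg.decl (decl_snoc_self X (G.chA X) _) hU.2
  obtain ⟨Z, hZ⟩ := TCtx.total G (WfCtx.snoc hU.1 hx) hV.wfCtx
  obtain ⟨W, hW⟩ := TSo.total G hx hy hU.1 hV
  obtain ⟨g, hg⟩ := TTg.total_column (G := G) hU.1.wfCtx hT
  obtain ⟨e, he⟩ := TTg.total G n (m + 1) hU.1.wfCtx.1 (List.prefix_refl _) hu hV.wfCtx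
    (List.prefix_refl _) hT.arg
  obtain ⟨e', he'⟩ := TTg.total G n (m + 1) hU.1.wfCtx.1 (List.prefix_refl _) hu' hV.wfCtx
    (List.prefix_refl _) hT.arg
  have hax' : Judg.termEq Z e e' (W.substL (pairsL X (G.chB YT) g)) ∈ G.T :=
    ⟨_, _, hax, haxT, .seqt hZ he he' hW hg⟩
  obtain ⟨hc, hr, hmor⟩ := hZ.whole c.1 c.2.1 h1
    (fun P z Z hd => (hdX P z Z hd).succ) hdY
  have key : ∀ {Δ σ}, Derivable G.T (.ctx Δ) →
      (G.dom Δ).CtxRel σ σ (X ++ [(G.chA X, U)]) YT →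
      ∃ W2 e0 e0', (G.dom Δ).EvTy σ X (X ++ [(G.chA X, U)]) YT YT (.var (G.chA X)) U
          (.app t (ctxVars YT)) VT W2 ∧
        (G.dom Δ).Ev σ (X ++ [(G.chA X, U)]) YT (.var (G.chA X)) (.app t (ctxVars YT)) e0 ∧
        (G.dom Δ).Ev σ (X ++ [(G.chA X, U')]) YT (.var (G.chA X)) (.app t (ctxVars YT)) e0' ∧
        Derivable G.T (.sortEq Δ ((W.substL (pairsL X (G.chB YT) g)).subst (unc σ)) W2) ∧
        Derivable G.T (.termEq Δ (e.subst (unc σ)) e0 W2) ∧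
        Derivable G.T (.termEq Δ (e'.subst (unc σ)) e0' W2) := by
    intro Δ σ hΔ c
    have p := h2 Δ hΔ
    have low := GPair.lowAt h1 h2 hΔ
    have hs := (h1 Δ hΔ).eq.toSrtInv.sEq hJ hx (fun hd => hdY _ _ _ hd) c
    obtain ⟨W2, hW2⟩ := Dom.evTy_total (D := G.dom Δ) σ hu hT.arg
    obtain ⟨W2', hW2'⟩ := Dom.evTy_total (D := G.dom Δ) σ hu' hT.arg
    obtain ⟨e0, he0⟩ := Dom.ev_total (D := G.dom Δ) σ hu.has hT.arg.has
    obtain ⟨e0', he0'⟩ := Dom.ev_total (D := G.dom Δ) σ hu'.has hT.arg.has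
    have q := (low.srtInv (GPair.axSrt h1 h2 hΔ)).h3 hJ hx (.inl ⟨rfl, hT⟩) c
      (c.mono (List.prefix_append _ _) (List.prefix_refl _)) hW2 hW2'
    exact ⟨W2, e0, e0', hW2, he0, he0', hW.tyEq_pairsL low hU.1.succ hT hg c hW2,
      he.termEq_ev p hu hT.arg c hW2 he0,
      .conv (.step (.s2 q)) (he'.termEq_ev p hu' hT.arg hs.rel' hW2' he0')⟩
  obtain ⟨_, _, _, -, -, -, q, f, f'⟩ := key hc hr
  rw [SortE.subst_varEnv] at q
  rw [Expr.subst_varEnv] at f f'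
  have q' := Derivable.step (.s2 q)
  have hd := Derivable.step (.teqA hax' (Derivable.conv q' f).terms_of_termEq.1
    (Derivable.conv q' f').terms_of_termEq.1)
  obtain ⟨W2, e0, e0', hW2, he0, he0', q, f, f'⟩ := key hΔ c
  have hd' := Derivable.conv q (Derivable.termEq_subst G.shaped hΔ (hmor hΔ c).1 hd)
  exact ⟨e0, e0', W2, he0, he0', hW2, .step (.t3 (.step (.t2 f)) (.step (.t3 hd' f')))⟩

theorem GPair.ax_te (h1 : G.Hyp (n + 1) m) (h2 : G.Hyp n (m + 1))
    (hΔ : Derivable G.T (.ctx Δ)) {Y : PreCtx B} {V V' XT s UT σ0}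
    (haxS : introTerm XT s UT ∈ G.TA) (hS : DerAt G.TA (n + 1) (introTerm XT s UT))
    (hax : Judg.sortEq Y V V' ∈ G.TB) (hJ : DerAt G.TB (m + 1) (.sortEq Y V V'))
    (c : (G.dom Δ).CtxRel σ0 σ0 XT (Y ++ [(G.chB Y, V)])) :
    ∃ e e' W, (G.dom Δ).Ev σ0 XT (Y ++ [(G.chB Y, V)]) (.app s (ctxVars XT)) (.var (G.chB Y)) e ∧
      (G.dom Δ).Ev σ0 XT (Y ++ [(G.chB Y, V')]) (.app s (ctxVars XT)) (.var (G.chB Y)) e' ∧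
      (G.dom Δ).EvTy σ0 XT XT Y (Y ++ [(G.chB Y, V)]) (.app s (ctxVars XT)) UT (.var (G.chB Y)) V
        W ∧
      Derivable G.T (.termEq Δ e e' W) := by
  have hV := hJ.sorts_of_sortEq
  have hU := hS.sort_of_term
  have hx := FreshCh.notMem G.hchA XT
  have hy := FreshCh.notMem G.hchB Y
  have hdY := hV.1.sort_decls (G.chB Y)
  have hdX := hU.sort_wf.2.2
  have hv := Arg.decl (decl_snoc_self Y (G.chB Y) _) hV.1
  have hv' := Arg.decl (decl_snoc_self Y (G.chB Y) _) hV.2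
  obtain ⟨Z, hZ⟩ := TCtx.total G hU.wfCtx (WfCtx.snoc hV.1 hy)
  obtain ⟨W, hW⟩ := TSo.total G hx hy hU hV.1
  obtain ⟨g, hg⟩ := TTg.total_row (G := G) hS hV.1.wfCtx
  obtain ⟨e, he⟩ := TTg.total G (n + 1) m hU.wfCtx.1 (List.prefix_refl _) hS.arg hV.1.wfCtx
    (List.prefix_refl _) hv
  obtain ⟨e', he'⟩ := TTg.total G (n + 1) m hU.wfCtx.1 (List.prefix_refl _) hS.arg hV.1.wfCtx
    (List.prefix_refl _) hv'
  have hax' : Judg.termEq Z e e' (W.substL (pairsR (G.chA XT) Y g)) ∈ G.T :=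
    ⟨_, _, haxS, hax, .tseq hZ he he' hW hg⟩
  obtain ⟨hc, hr, hmor⟩ := hZ.whole c.1 c.2.1 h2 hdX fun P z Z hd => (hdY P z Z hd).succ
  have key : ∀ {Δ σ}, Derivable G.T (.ctx Δ) →
      (G.dom Δ).CtxRel σ σ XT (Y ++ [(G.chB Y, V)]) →
      ∃ W2 e0 e0', (G.dom Δ).EvTy σ XT XT Y (Y ++ [(G.chB Y, V)]) (.app s (ctxVars XT)) UT
          (.var (G.chB Y)) V W2 ∧
        (G.dom Δ).Ev σ XT (Y ++ [(G.chB Y, V)]) (.app s (ctxVars XT)) (.var (G.chB Y)) e0 ∧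
        (G.dom Δ).Ev σ XT (Y ++ [(G.chB Y, V')]) (.app s (ctxVars XT)) (.var (G.chB Y)) e0' ∧
        Derivable G.T (.sortEq Δ ((W.substL (pairsR (G.chA XT) Y g)).subst (unc σ)) W2) ∧
        Derivable G.T (.termEq Δ (e.subst (unc σ)) e0 W2) ∧
        Derivable G.T (.termEq Δ (e'.subst (unc σ)) e0' W2) := by
    intro Δ σ hΔ c
    have p := h1 Δ hΔ
    have low := GPair.lowAt h1 h2 hΔ
    have t := Dom.CtxRel.tr (D := G.dom Δ) c
    have hs := (h2 Δ hΔ).eq'.toSrtInv.sEq hJ hy (fun hd => hdX _ _ _ hd) t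
    obtain ⟨W2, hW2⟩ := Dom.evTy_total (D := G.dom Δ) σ hS.arg hv
    obtain ⟨W2', hW2'⟩ := Dom.evTy_total (D := G.dom Δ) σ hS.arg hv'
    obtain ⟨e0, he0⟩ := Dom.ev_total (D := G.dom Δ) σ hS.arg.has hv.has
    obtain ⟨e0', he0'⟩ := Dom.ev_total (D := G.dom Δ) σ hS.arg.has hv'.has
    have low' := GPair.lowAt_swap h1 h2 hΔ
    have q := (low'.srtInv (GPair.axSrt_swap h1 h2 hΔ)).h3 hJ hy (.inl ⟨rfl, hS⟩) t
      (t.mono (List.prefix_append _ _) (List.prefix_refl _)) (Dom.EvTy.tr (D := G.dom Δ) hW2)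
      (Dom.EvTy.tr (D := G.dom Δ) hW2')
    exact ⟨W2, e0, e0', hW2, he0, he0', hW.tyEq_pairsR low hS hV.1.succ hg c hW2,
      he.termEq_ev p hS.arg hv c hW2 he0,
      .conv (.step (.s2 q)) (he'.termEq_ev p hS.arg hv' (Dom.CtxRel.tr (D := (G.dom Δ).swap) hs.rel')
        hW2' he0')⟩
  obtain ⟨_, _, _, -, -, -, q, f, f'⟩ := key hc hr
  rw [SortE.subst_varEnv] at q
  rw [Expr.subst_varEnv] at f f'
  have q' := Derivable.step (.s2 q)
  have hd := Derivable.step (.teqA hax' (Derivable.conv q' f).terms_of_termEq.1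
    (Derivable.conv q' f').terms_of_termEq.1)
  obtain ⟨W2, e0, e0', hW2, he0, he0', q, f, f'⟩ := key hΔ c
  have hd' := Derivable.conv q (Derivable.termEq_subst G.shaped hΔ (hmor hΔ c).1 hd)
  exact ⟨e0, e0', W2, he0, he0', hW2, .step (.t3 (.step (.t2 f)) (.step (.t3 hd' f')))⟩

end GATPaper

namespace GATPaper

/-! ## Equations from a term equation axiom and an introducing sort axiom -/

variable {A B : Alphabet} {G : GPair A B} {n m k : ℕ} {b : Bool} {X X' : PreCtx A}
  {Y Y' : PreCtx B} {x : A.Var} {y : B.Var} {u : Expr A} {v : Expr B} {U : SortE A} {V : SortE B}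
  {Z Δ : PreCtx (A.tensor B)} {σ σ' : A.Var → B.Var → Expr (A.tensor B)}

theorem GPair.ax_qs (h1 : G.Hyp (n + 1) m) (h2 : G.Hyp n (m + 1))
    (hΔ : Derivable G.T (.ctx Δ)) {X : PreCtx A} {u u' U YT T σ0}
    (hax : Judg.termEq X u u' U ∈ G.TA) (hJ : DerAt G.TA (n + 1) (.termEq X u u' U))
    (haxT : introSort YT T ∈ G.TB) (hT : DerAt G.TB (m + 1) (introSort YT T))
    (c : (G.dom Δ).CtxRel σ0 σ0 X (YT ++ [(G.chB YT, ⟨T, ctxVars YT⟩)])) :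
    ∃ e e' W, (G.dom Δ).Ev σ0 X (YT ++ [(G.chB YT, ⟨T, ctxVars YT⟩)]) u (.var (G.chB YT)) e ∧
      (G.dom Δ).Ev σ0 X (YT ++ [(G.chB YT, ⟨T, ctxVars YT⟩)]) u' (.var (G.chB YT)) e' ∧
      (G.dom Δ).EvTy σ0 X X YT (YT ++ [(G.chB YT, ⟨T, ctxVars YT⟩)]) u U (.var (G.chB YT))
        ⟨T, ctxVars YT⟩ W ∧
      Derivable G.T (.termEq Δ e e' W) := by
  have hu := hJ.terms_of_termEq
  have hU := hu.1.succ.sort_of_term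
  have hx := FreshCh.notMem G.hchA X
  have hy := FreshCh.notMem G.hchB YT
  have hdX := hU.sort_wf.2.2
  have hdY := hT.sort_decls (G.chB YT)
  have hv := Arg.decl (decl_snoc_self YT (G.chB YT) _) hT
  obtain ⟨Z, hZ⟩ := TCtx.total G hU.wfCtx (WfCtx.snoc hT hy)
  obtain ⟨W, hW⟩ := TSo.total G hx hy hU hT
  obtain ⟨g, hg⟩ := TTg.total_row (G := G) hu.1 hT.wfCtx
  obtain ⟨e, he⟩ := TTg.total G n (m + 1) hU.wfCtx.1 (List.prefix_refl _) hu.1.arg hT.wfCtx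
    (List.prefix_refl _) hv
  obtain ⟨e', he'⟩ := TTg.total G n (m + 1) hU.wfCtx.1 (List.prefix_refl _) hu.2.arg hT.wfCtx
    (List.prefix_refl _) hv
  have hax' : Judg.termEq Z e e' (W.substL (pairsR (G.chA X) YT g)) ∈ G.T :=
    ⟨_, _, hax, haxT, .teqs hZ he he' hW hg⟩
  obtain ⟨hc, hr, hmor⟩ := hZ.whole c.1 c.2.1 h2 hdX hdY
  have key : ∀ {Δ σ}, Derivable G.T (.ctx Δ) →
      (G.dom Δ).CtxRel σ σ X (YT ++ [(G.chB YT, ⟨T, ctxVars YT⟩)]) →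
      ∃ W2 e0 e0', (G.dom Δ).EvTy σ X X YT (YT ++ [(G.chB YT, ⟨T, ctxVars YT⟩)]) u U
          (.var (G.chB YT)) ⟨T, ctxVars YT⟩ W2 ∧
        (G.dom Δ).Ev σ X (YT ++ [(G.chB YT, ⟨T, ctxVars YT⟩)]) u (.var (G.chB YT)) e0 ∧
        (G.dom Δ).Ev σ X (YT ++ [(G.chB YT, ⟨T, ctxVars YT⟩)]) u' (.var (G.chB YT)) e0' ∧
        Derivable G.T (.sortEq Δ ((W.substL (pairsR (G.chA X) YT g)).subst (unc σ)) W2) ∧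
        Derivable G.T (.termEq Δ (e.subst (unc σ)) e0 W2) ∧
        Derivable G.T (.termEq Δ (e'.subst (unc σ)) e0' W2) := by
    intro Δ σ hΔ c
    have p := h2 Δ hΔ
    have low := GPair.lowAt h1 h2 hΔ
    obtain ⟨W2, hW2⟩ := Dom.evTy_total (D := G.dom Δ) σ hu.1.arg hv
    obtain ⟨W2', hW2'⟩ := Dom.evTy_total (D := G.dom Δ) σ hu.2.arg hv
    obtain ⟨e0, he0⟩ := Dom.ev_total (D := G.dom Δ) σ hu.1.arg.has hv.has
    obtain ⟨e0', he0'⟩ := Dom.ev_total (D := G.dom Δ) σ hu.2.arg.has hv.has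
    have r := List.prefix_refl X
    have r' := List.prefix_refl (YT ++ [(G.chB YT, (⟨T, ctxVars YT⟩ : SortE B))])
    have q := low.tyTermEq hJ (hv.mono le_rfl (List.prefix_append _ _) r' r') c
      (hW2.mono r r (List.prefix_append _ _) r') (hW2'.mono r r (List.prefix_append _ _) r')
    exact ⟨W2, e0, e0', hW2, he0, he0', hW.tyEq_pairsR low hu.1.succ hT hg c hW2,
      he.termEq_ev p hu.1.arg hv c hW2 he0,
      .conv (.step (.s2 q)) (he'.termEq_ev p hu.2.arg hv c hW2' he0')⟩
  obtain ⟨_, _, _, -, -, -, q, f, f'⟩ := key hc hr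
  rw [SortE.subst_varEnv] at q
  rw [Expr.subst_varEnv] at f f'
  have q' := Derivable.step (.s2 q)
  have hd := Derivable.step (.teqA hax' (Derivable.conv q' f).terms_of_termEq.1
    (Derivable.conv q' f').terms_of_termEq.1)
  obtain ⟨W2, e0, e0', hW2, he0, he0', q, f, f'⟩ := key hΔ c
  have hd' := Derivable.conv q (Derivable.termEq_subst G.shaped hΔ (hmor hΔ c).1 hd)
  exact ⟨e0, e0', W2, he0, he0', hW2, .step (.t3 (.step (.t2 f)) (.step (.t3 hd' f')))⟩

theorem GPair.ax_sq (h1 : G.Hyp (n + 1) m) (h2 : G.Hyp n (m + 1))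
    (hΔ : Derivable G.T (.ctx Δ)) {Y : PreCtx B} {v v' V XS S σ0}
    (haxS : introSort XS S ∈ G.TA) (hS : DerAt G.TA (n + 1) (introSort XS S))
    (hax : Judg.termEq Y v v' V ∈ G.TB) (hJ : DerAt G.TB (m + 1) (.termEq Y v v' V))
    (c : (G.dom Δ).CtxRel σ0 σ0 (XS ++ [(G.chA XS, ⟨S, ctxVars XS⟩)]) Y) :
    ∃ e e' W, (G.dom Δ).Ev σ0 (XS ++ [(G.chA XS, ⟨S, ctxVars XS⟩)]) Y (.var (G.chA XS)) v e ∧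
      (G.dom Δ).Ev σ0 (XS ++ [(G.chA XS, ⟨S, ctxVars XS⟩)]) Y (.var (G.chA XS)) v' e' ∧
      (G.dom Δ).EvTy σ0 XS (XS ++ [(G.chA XS, ⟨S, ctxVars XS⟩)]) Y Y (.var (G.chA XS))
        ⟨S, ctxVars XS⟩ v V W ∧
      Derivable G.T (.termEq Δ e e' W) := by
  have hv := hJ.terms_of_termEq
  have hV := hv.1.succ.sort_of_term
  have hx := FreshCh.notMem G.hchA XS
  have hy := FreshCh.notMem G.hchB Y
  have hdX := hS.sort_decls (G.chA XS)
  have hdY := hV.sort_wf.2.2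
  have hu := Arg.decl (decl_snoc_self XS (G.chA XS) _) hS
  obtain ⟨Z, hZ⟩ := TCtx.total G (WfCtx.snoc hS hx) hV.wfCtx
  obtain ⟨W, hW⟩ := TSo.total G hx hy hS hV
  obtain ⟨g, hg⟩ := TTg.total_column (G := G) hS.wfCtx hv.1
  obtain ⟨e, he⟩ := TTg.total G (n + 1) m hS.wfCtx.1 (List.prefix_refl _) hu hV.wfCtx
    (List.prefix_refl _) hv.1.arg
  obtain ⟨e', he'⟩ := TTg.total G (n + 1) m hS.wfCtx.1 (List.prefix_refl _) hu hV.wfCtx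
    (List.prefix_refl _) hv.2.arg
  have hax' : Judg.termEq Z e e' (W.substL (pairsL XS (G.chB Y) g)) ∈ G.T :=
    ⟨_, _, haxS, hax, .steq hZ he he' hW hg⟩
  obtain ⟨hc, hr, hmor⟩ := hZ.whole c.1 c.2.1 h1 hdX hdY
  have key : ∀ {Δ σ}, Derivable G.T (.ctx Δ) →
      (G.dom Δ).CtxRel σ σ (XS ++ [(G.chA XS, ⟨S, ctxVars XS⟩)]) Y →
      ∃ W2 e0 e0', (G.dom Δ).EvTy σ XS (XS ++ [(G.chA XS, ⟨S, ctxVars XS⟩)]) Y Y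
          (.var (G.chA XS)) ⟨S, ctxVars XS⟩ v V W2 ∧
        (G.dom Δ).Ev σ (XS ++ [(G.chA XS, ⟨S, ctxVars XS⟩)]) Y (.var (G.chA XS)) v e0 ∧
        (G.dom Δ).Ev σ (XS ++ [(G.chA XS, ⟨S, ctxVars XS⟩)]) Y (.var (G.chA XS)) v' e0' ∧
        Derivable G.T (.sortEq Δ ((W.substL (pairsL XS (G.chB Y) g)).subst (unc σ)) W2) ∧
        Derivable G.T (.termEq Δ (e.subst (unc σ)) e0 W2) ∧
        Derivable G.T (.termEq Δ (e'.subst (unc σ)) e0' W2) := by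
    intro Δ σ hΔ c
    have p := h1 Δ hΔ
    have low := GPair.lowAt h1 h2 hΔ
    obtain ⟨W2, hW2⟩ := Dom.evTy_total (D := G.dom Δ) σ hu hv.1.arg
    obtain ⟨W2', hW2'⟩ := Dom.evTy_total (D := G.dom Δ) σ hu hv.2.arg
    obtain ⟨e0, he0⟩ := Dom.ev_total (D := G.dom Δ) σ hu.has hv.1.arg.has
    obtain ⟨e0', he0'⟩ := Dom.ev_total (D := G.dom Δ) σ hu.has hv.2.arg.has
    have r := List.prefix_refl Y
    have r' := List.prefix_refl (XS ++ [(G.chA XS, (⟨S, ctxVars XS⟩ : SortE A))])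
    have q := (GPair.lowAt_swap h1 h2 hΔ).tyTermEq hJ
      (hu.mono le_rfl (List.prefix_append _ _) r' r') (Dom.CtxRel.tr (D := G.dom Δ) c)
      (Dom.EvTy.tr (D := G.dom Δ) (hW2.mono (List.prefix_append _ _) r' r r))
      (Dom.EvTy.tr (D := G.dom Δ) (hW2'.mono (List.prefix_append _ _) r' r r))
    exact ⟨W2, e0, e0', hW2, he0, he0', hW.tyEq_pairsL low hS hv.1.succ hg c hW2,
      he.termEq_ev p hu hv.1.arg c hW2 he0,
      .conv (.step (.s2 q)) (he'.termEq_ev p hu hv.2.arg c hW2' he0')⟩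
  obtain ⟨_, _, _, -, -, -, q, f, f'⟩ := key hc hr
  rw [SortE.subst_varEnv] at q
  rw [Expr.subst_varEnv] at f f'
  have q' := Derivable.step (.s2 q)
  have hd := Derivable.step (.teqA hax' (Derivable.conv q' f).terms_of_termEq.1
    (Derivable.conv q' f').terms_of_termEq.1)
  obtain ⟨W2, e0, e0', hW2, he0, he0', q, f, f'⟩ := key hΔ c
  have hd' := Derivable.conv q (Derivable.termEq_subst G.shaped hΔ (hmor hΔ c).1 hd)
  exact ⟨e0, e0', W2, he0, he0', hW2, .step (.t3 (.step (.t2 f)) (.step (.t3 hd' f')))⟩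

end GATPaper

namespace GATPaper

/-! ## Equations from a pair of introducing term axioms -/

namespace Dom

variable {D : Dom} {n m : ℕ}

theorem getElem_ctxVars' {A : Alphabet} (X : PreCtx A) (j) (hj : j < (ctxVars X).length) :
    ∃ y ∈ names X, (ctxVars X)[j] = .var y := by
  have h : (ctxVars X)[j] ∈ ctxVars X := List.getElem_mem hj
  obtain ⟨p, hp, he⟩ := List.mem_map.1 h
  exact ⟨p.1, List.mem_map_of_mem hp, he.symm⟩

/-- The value of `u ⊗ t(y₁,…)` obtained by substitution from `x ⊗ t(y₁,…)`. -/
theorem Low.evL_subst (h : Low D n m) {σ σr : D.Env} {X Y x u U t V e}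
    (hu : DerAt D.TA (n + 1) (.term X u U)) (hc : CanonSort D.TA X u U)
    (hv : DerAt D.TB (m + 1) (.term Y (.app t (ctxVars Y)) V)) (hr : D.CtxRel σ σ X Y)
    (hx : x ∉ names X) (hr1 : ∀ z ∈ names X, ∀ w ∈ names Y, σr z w = σ z w)
    (hr2 : ∀ w ∈ names Y, D.Near σ X Y u (.var w) (σr x w))
    (he : D.CtxRel σr σr (X ++ [(x, U)]) Y →
      D.Near σr (X ++ [(x, U)]) Y (.var x) (.app t (ctxVars Y)) e) :
    ∃ eL, D.EvL σ X Y u (.app t (ctxVars Y)) eL ∧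
      ∀ W, D.EvTy σ X X Y Y u U (.app t (ctxVars Y)) V W → D.TmEq W e eL := by
  have hU := DerAt.sort_of_term hu
  have hV := DerAt.sort_of_term hv
  have hsX : ∀ {P z Z}, Decl X P z Z → DerAt D.TA n (.sort P Z) := fun hd =>
    (DerAt.sort_wf hU).2.2 _ _ _ hd
  have hsY : ∀ {P z Z}, Decl Y P z Z → DerAt D.TB m (.sort P Z) := fun hd =>
    (DerAt.sort_wf hV).2.2 _ _ _ hd
  have hsc := DerAt.sort_scoped D.hA.1.shaped hU
  obtain ⟨σ', h1, h2⟩ := row_exists σ hu.arg.has hsY hx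
  have S1 := rowHyp h.p1.tm.toValInv hr hx (fun hd => (hsX hd).succ) hU.succ hsY hu.arg h1 h2
  have C := colHyp (u := u) h.p2.tm.toValInv hr hx hsX (fun hd => (hsY hd).succ) h1
  have hn := nodup_snoc hr.1 hx U
  have c1 := S1.ctxRel h.p1 hn hr.2.1 S1.near
  have c2 : D.CtxRel σ' σr (X ++ [(x, U)]) Y := S1.ctxRel h.p1 hn hr.2.1 fun {z w} hz hw => by
    rw [names_snoc] at hz
    rcases List.mem_append.1 hz with hz' | hz'
    · rw [hr1 z hz' w hw, h1 z hz' w]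
      exact S1.near (by rw [names_snoc]; exact hz) hw
    · rw [List.mem_singleton.1 hz', upd_same]
      exact hr2 w hw
  have c3 : D.CtxRel σr σr (X ++ [(x, U)]) Y := c2.right fun P z Z R w Z' hd hd' =>
    ⟨n + 1, m, S1.srcA hd, hsY hd', h.p1.ty⟩
  have c4 : D.CtxRel σ' σ' X Y := c1.mono (List.prefix_append _ _) (List.prefix_refl _)
  have c5 : D.CtxRel σ' σr X Y := c2.mono (List.prefix_append _ _) (List.prefix_refl _)
  have hax := Arg.decl (decl_snoc_self X x U) hU
  obtain ⟨S, ss⟩ := U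
  have hss : ∀ a ∈ ss, Has D.TA n X a := fun a ha =>
    hu.arg.sortAt.args (U := ⟨S, ss⟩) D.hA.1.shaped ha
  have hys : ∀ b ∈ ctxVars Y, Has D.TB m Y b := fun b hb => hv.arg.has.app_args D.hB.1.shaped hb
  obtain ⟨M0, hM0⟩ := mat_exists (Q := D.Ev σ X Y) (us := ss) (vs := ctxVars Y)
    (fun a ha b hb => ev_total σ (hss a ha) (hys b hb)) (σ (D.chA []) (D.chB []))
  obtain ⟨M, hM1, hM2⟩ := exists_row M0 ss.length (l := List.range (ctxVars Y).length)
    (Q := fun j e => ∀ hj : j < (ctxVars Y).length, ∃ y ∈ names Y, (ctxVars Y)[j] = .var y ∧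
      e = σ' x y) fun j hj => by
        obtain ⟨y, hy, he⟩ := getElem_ctxVars' Y j (List.mem_range.1 hj)
        exact ⟨σ' x y, fun _ => ⟨y, hy, he, rfl⟩⟩
  have hM : Mat (D.Ev σ X Y) ss (ctxVars Y) M := by
    intro i hi j hj
    rw [hM1 i (by omega)]
    exact hM0 i hi j hj
  have hL : D.EvL σ X Y u (.app t (ctxVars Y)) _ := ⟨S, ss, t, ctxVars Y, M, rfl, hc,
    hM.snoc_left fun j hj => by
      obtain ⟨y, hy, e1, e2⟩ := hM2 j (List.mem_range.2 hj) hj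
      rw [e1, e2]
      exact h2 y hy, rfl⟩
  have hM' : Mat (D.Ev σ' (X ++ [(x, ⟨S, ss⟩)]) Y) (ss ++ [.var x]) (ctxVars Y) M := by
    refine Mat.snoc_left (hM.imp fun a _ b _ e he => (he.congr fun z hz w _ => h1 z hz w).mono
      (List.prefix_append _ _) (List.prefix_refl _)) fun j hj => ?_
    obtain ⟨y, hy, e1, e2⟩ := hM2 j (List.mem_range.2 hj) hj
    rw [e1, e2]
    exact .vv (by simp [names]) hy
  have hL' : D.Ev σ' (X ++ [(x, ⟨S, ss⟩)]) Y (.var x) (.app t (ctxVars Y)) _ :=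
    .L (canonSort_var.2 ⟨X, decl_snoc_self X x _⟩) hM'
  refine ⟨_, hL, fun W hW => ?_⟩
  obtain ⟨e1, he1⟩ := ev_total σr hax.has hv.arg.has
  obtain ⟨Wr, hWr⟩ := evTy_total σr hax hv.arg
  obtain ⟨W', hW'⟩ := evTy_total σ' hax hv.arg
  have q1 := (he c3).any h.p2.cv c3 hax hv.arg hWr he1
  have q2 := (h.p2.tm.h2 hax.has hv.arg.has c2 he1).any h.p2.cv c1 hax hv.arg hW' hL'
  have q3 := h.p2.ty.h1 hax hv.arg c2 c5 hW' hWr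
  have tb := tySub (Nat.le_refl _) (Nat.le_refl _) (Nat.le_succ _) (Nat.le_succ _) h.ty h.p1.tm
    h.p1.tm' h.p2.tm h.p2.tm' S1 C
    (by rw [Expr.subst_var, upd_same, SortE.subst_upd hsc hx]; exact hu.arg)
    (by rw [Expr.subst_id, SortE.subst_id]; exact hv.arg) hW'
    (by
      rw [Expr.subst_var, upd_same, SortE.subst_upd hsc hx, Expr.subst_id, SortE.subst_id]
      exact hW)
  exact D.tm_trans (D.conv (D.ty_trans q3 tb) q1) (D.conv tb q2)

end Dom
end GATPaper

namespace GATPaper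

variable {A B : Alphabet} {G : GPair A B} {n m k : ℕ} {b : Bool} {X X' : PreCtx A}
  {Y Y' : PreCtx B} {x : A.Var} {y : B.Var} {u : Expr A} {v : Expr B} {U : SortE A} {V : SortE B}
  {Z Δ : PreCtx (A.tensor B)} {σ σ' : A.Var → B.Var → Expr (A.tensor B)}

/-- The canonical sort of the term of an introducing axiom. -/
theorem canonSort_ctxVars {Ax : Set (Judg A)} (hA : IsGAT Ax) {s : A.TermSym}
    (hax : introTerm X s U ∈ Ax) : CanonSort Ax X (.app s (ctxVars X)) U := by
  simpa [SortE.subst_var_id, ctxVars] using canonSort_app_map hA hax (X := X) .var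

theorem GPair.ax_tt (h1 : G.Hyp (n + 1) m) (h2 : G.Hyp n (m + 1))
    (hΔ : Derivable G.T (.ctx Δ)) {XT s UT YT t VT σ0}
    (haxS : introTerm XT s UT ∈ G.TA) (hu : DerAt G.TA (n + 1) (introTerm XT s UT))
    (haxT : introTerm YT t VT ∈ G.TB) (hv : DerAt G.TB (m + 1) (introTerm YT t VT))
    (c : (G.dom Δ).CtxRel σ0 σ0 XT YT) :
    ∃ eL eR W, (G.dom Δ).EvL σ0 XT YT (.app s (ctxVars XT)) (.app t (ctxVars YT)) eL ∧
      (G.dom Δ).EvR σ0 XT YT (.app s (ctxVars XT)) (.app t (ctxVars YT)) eR ∧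
      (G.dom Δ).EvTy σ0 XT XT YT YT (.app s (ctxVars XT)) UT (.app t (ctxVars YT)) VT W ∧
      Derivable G.T (.termEq Δ eL eR W) := by
  have hU := DerAt.sort_of_term hu
  have hV := DerAt.sort_of_term hv
  have hx := FreshCh.notMem G.hchA XT
  have hy := FreshCh.notMem G.hchB YT
  have hdX := hU.sort_wf.2.2
  have hdY := hV.sort_wf.2.2
  have hau := Arg.decl (decl_snoc_self XT (G.chA XT) _) hU
  have hav := Arg.decl (decl_snoc_self YT (G.chB YT) _) hV
  have r := List.prefix_refl XT
  have r' := List.prefix_refl YT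
  obtain ⟨Z, hZ⟩ := TCtx.total G hU.wfCtx hV.wfCtx
  obtain ⟨W, hW⟩ := TSo.total G hx hy hU hV
  obtain ⟨gx, hgx⟩ := TTg.total_column (G := G) hU.wfCtx hv
  obtain ⟨gy, hgy⟩ := TTg.total_row (G := G) hu hV.wfCtx
  obtain ⟨e1, he1⟩ := TTg.total G n (m + 1) hU.wfCtx.1 r hau hV.wfCtx r' hv.arg
  obtain ⟨e2, he2⟩ := TTg.total G (n + 1) m hU.wfCtx.1 r hu.arg hV.wfCtx r' hav
  have hax : Judg.termEq Z (e1.substL (pairsR (G.chA XT) YT gy))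
      (e2.substL (pairsL XT (G.chB YT) gx))
      (W.substL (pairsL XT (G.chB YT) gx ++ pairsR (G.chA XT) YT gy)) ∈ G.T :=
    ⟨_, _, haxS, haxT, .tt hZ (.appapp_base (G.hchA XT) e1 he1 gy hgy)
      (.appapp_base (G.hchB YT) e2 he2 gx hgx) hW hgx hgy⟩
  obtain ⟨hc, hr, hmor⟩ := hZ.whole c.1 c.2.1 (h1.mono n.le_succ le_rfl) hdX hdY
  have key : ∀ {Δ σ}, Derivable G.T (.ctx Δ) → (G.dom Δ).CtxRel σ σ XT YT →
      ∃ W2 eL eR,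
        (G.dom Δ).EvL σ XT YT (.app s (ctxVars XT)) (.app t (ctxVars YT)) eL ∧
        (G.dom Δ).EvR σ XT YT (.app s (ctxVars XT)) (.app t (ctxVars YT)) eR ∧
        (G.dom Δ).EvTy σ XT XT YT YT (.app s (ctxVars XT)) UT (.app t (ctxVars YT)) VT W2 ∧
        Derivable G.T (.sortEq Δ ((W.substL (pairsL XT (G.chB YT) gx ++
          pairsR (G.chA XT) YT gy)).subst (unc σ)) W2) ∧
        Derivable G.T (.termEq Δ ((e1.substL (pairsR (G.chA XT) YT gy)).subst (unc σ)) eL W2) ∧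
        Derivable G.T (.termEq Δ ((e2.substL (pairsL XT (G.chB YT) gx)).subst (unc σ)) eR W2) := by
    intro Δ σ hΔ c
    have low := GPair.lowAt h1 h2 hΔ
    obtain ⟨W2, hW2⟩ := Dom.evTy_total (D := G.dom Δ) σ hu.arg hv.arg
    obtain ⟨eL, hL, qL⟩ := low.evL_subst (σ := σ) (σr := after (pairsR (G.chA XT) YT gy) σ)
      (e := (e1.substL (pairsR (G.chA XT) YT gy)).subst (unc σ)) hu
      (canonSort_ctxVars G.hA haxS) hv c hx
      (fun z hz w _ => after_pairsR_ne (.inl fun h => hx (h ▸ hz)))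
      (fun w hw => by
        obtain ⟨R, Z', hd⟩ := exists_decl hw
        rw [after_pairsR c.2.1 hd]
        exact near_row low.p1 hgy hdY hu.arg c hd)
      (fun c' => by
        rw [Expr.substL_unc]
        exact he1.near G low.p2 c.1 c.2.1 r r' hau hv.arg c')
    obtain ⟨eR, hR, qR⟩ := (GPair.lowAt_swap h1 h2 hΔ).evL_subst (σ := Dom.Env.tr (D := G.dom Δ) σ)
      (σr := Dom.Env.tr (D := G.dom Δ) (after (pairsL XT (G.chB YT) gx) σ))
      (e := (e2.substL (pairsL XT (G.chB YT) gx)).subst (unc σ)) hv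
      (canonSort_ctxVars G.hB haxT) hu (Dom.CtxRel.tr (D := G.dom Δ) c) hy
      (fun z hz w _ => after_pairsL_ne (.inl fun h => hy (h ▸ hz)))
      (fun w hw => by
        obtain ⟨P, Z', hd⟩ := exists_decl hw
        refine Dom.Near.tr (D := G.dom Δ) ?_
        show (G.dom Δ).Near σ XT YT (.var w) _ (after (pairsL XT (G.chB YT) gx) σ w (G.chB YT))
        rw [after_pairsL c.1 hd]
        exact near_column low.p2 hgx hdX hv.arg c hd)
      (fun c' => by
        rw [Expr.substL_unc]
        exact Dom.Near.tr (D := G.dom Δ)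
          (he2.near G low.p1 c.1 c.2.1 r r' hu.arg hav (Dom.CtxRel.tr (D := (G.dom Δ).swap) c')))
    exact ⟨W2, eL, eR, hL, hR, hW2, hW.tyEq_pairs low hu hv hgx hgy c hW2, qL _ hW2,
      qR _ (Dom.EvTy.tr (D := G.dom Δ) hW2)⟩
  obtain ⟨_, _, _, -, -, -, q, f, f'⟩ := key hc hr
  rw [SortE.subst_varEnv] at q
  rw [Expr.subst_varEnv] at f f'
  have q' := Derivable.step (.s2 q)
  have hd := Derivable.step (.teqA hax (Derivable.conv q' f).terms_of_termEq.1
    (Derivable.conv q' f').terms_of_termEq.1)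
  obtain ⟨W2, eL, eR, hL, hR, hW2, q, f, f'⟩ := key hΔ c
  have hd' := Derivable.conv q (Derivable.termEq_subst G.shaped hΔ (hmor hΔ c).1 hd)
  exact ⟨eL, eR, W2, hL, hR, hW2, .step (.t3 (.step (.t2 f)) (.step (.t3 hd' f')))⟩

end GATPaper

namespace GATPaper

theorem Dom.Pack.zero (D : Dom) (m : ℕ) : Dom.Pack D 0 m where
  ty := ⟨fun h => (nomatch h.pos), fun h => (nomatch h.pos)⟩
  ty' := ⟨fun _ h => (nomatch h.pos), fun _ h => (nomatch h.pos)⟩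
  cv := ⟨fun h => (nomatch h.pos)⟩
  cv' := ⟨fun _ _ h => (nomatch h.pos)⟩
  tm := { h2 := fun h => (nomatch h.pos), cl := fun _ h => (nomatch h.pos) }
  tm' := { h2 := fun _ h => (nomatch h.pos), cl := fun _ _ h => (nomatch h.pos) }
  eq := { h3 := fun h => h.elim, h4 := fun h => h.elim, h5 := fun h => h.elim }
  eq' :=
    { h3 := fun _ _ h => h.elim (fun h => h.2.elim) fun ⟨_, h⟩ => h.2.2.2.elim
      h4 := fun _ _ h => h.elim
      h5 := fun _ h => (nomatch h.pos) }

variable {A B : Alphabet} {G : GPair A B} {n m : ℕ} {Δ : PreCtx (A.tensor B)}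

theorem GPair.axs (h1 : G.Hyp (n + 1) m) (h2 : G.Hyp n (m + 1))
    (hΔ : Derivable G.T (.ctx Δ)) : (G.dom Δ).Axs (n + 1) (m + 1) where
  st haxS hS haxT hT c m0 m1 := GPair.ax_st h1 h2 hΔ haxS hS haxT hT c m0 m1
  tt haxS hS haxT hT c := GPair.ax_tt h1 h2 hΔ haxS hS haxT hT c
  es := GPair.axSrt h1 h2 hΔ
  et hax hJ haxT hT c := GPair.ax_et h1 h2 hΔ hax hJ haxT hT c
  qs hax hJ haxT hT c := GPair.ax_qs h1 h2 hΔ hax hJ haxT hT c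

theorem GPair.axs_swap (h1 : G.Hyp (n + 1) m) (h2 : G.Hyp n (m + 1))
    (hΔ : Derivable G.T (.ctx Δ)) : (G.dom Δ).swap.Axs (m + 1) (n + 1) where
  st haxT hT haxS hS c m0 m1 := by
    obtain ⟨W, hW, h⟩ := GPair.ax_ts h1 h2 hΔ haxS hS haxT hT
      (Dom.CtxRel.tr (D := (G.dom Δ).swap) c) m0.tr m1.tr
    exact ⟨W, Dom.EvTy.tr (D := G.dom Δ) hW, h⟩
  tt haxT hT haxS hS c := by
    obtain ⟨eL, eR, W, hL, hR, hW, h⟩ := GPair.ax_tt h1 h2 hΔ haxS hS haxT hT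
      (Dom.CtxRel.tr (D := (G.dom Δ).swap) c)
    exact ⟨eR, eL, W, hR, hL, Dom.EvTy.tr (D := G.dom Δ) hW, .step (.t2 h)⟩
  es := GPair.axSrt_swap h1 h2 hΔ
  et hax hJ haxS hS c := by
    obtain ⟨e, e', W, he, he', hW, h⟩ := GPair.ax_te h1 h2 hΔ haxS hS hax hJ
      (Dom.CtxRel.tr (D := (G.dom Δ).swap) c)
    exact ⟨e, e', W, Dom.Ev.tr (D := G.dom Δ) he, Dom.Ev.tr (D := G.dom Δ) he',
      Dom.EvTy.tr (D := G.dom Δ) hW, h⟩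
  qs hax hJ haxS hS c := by
    obtain ⟨e, e', W, he, he', hW, h⟩ := GPair.ax_sq h1 h2 hΔ haxS hS hax hJ
      (Dom.CtxRel.tr (D := (G.dom Δ).swap) c)
    exact ⟨e, e', W, Dom.Ev.tr (D := G.dom Δ) he, Dom.Ev.tr (D := G.dom Δ) he',
      Dom.EvTy.tr (D := G.dom Δ) hW, h⟩

theorem GPair.hyp (G : GPair A B) (n m : ℕ) : G.Hyp n m := by
  induction n generalizing m with
  | zero => exact fun Δ _ => Dom.Pack.zero _ _
  | succ n ihn =>
    induction m with
    | zero => exact fun Δ _ => (Dom.Pack.zero (G.dom Δ).swap _).swap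
    | succ m ihm =>
      exact fun Δ hΔ => Dom.Lvl.pack ⟨ihm Δ hΔ, ihn _ Δ hΔ, (GPair.lowAt ihm (ihn _) hΔ).ty,
        (GPair.lowAt_swap ihm (ihn _) hΔ).ty, GPair.axs ihm (ihn _) hΔ, GPair.axs_swap ihm (ihn _) hΔ⟩

end GATPaper

namespace GATPaper

variable {A B : Alphabet} {G : GPair A B} {n m : ℕ} {b : Bool} {Z : PreCtx (A.tensor B)}

theorem Derivable.termEq_of_values {Ax : Set (Judg (A.tensor B))} {W W0 e e' e0 e0'}
    (q : Derivable Ax (.sortEq Z (W.subst (unc varEnv)) W0))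
    (f : Derivable Ax (.termEq Z (e.subst (unc varEnv)) e0 W0))
    (f' : Derivable Ax (.termEq Z (e'.subst (unc varEnv)) e0' W0))
    (h : Derivable Ax (.termEq Z e0' e0 W0)) : Derivable Ax (.termEq Z e e' W) := by
  rw [SortE.subst_varEnv] at q
  rw [Expr.subst_varEnv] at f f'
  exact .conv (.step (.s2 q)) (.step (.t3 f (.step (.t2 (.step (.t3 f' h))))))

theorem Derivable.term_of_value {Ax : Set (Judg (A.tensor B))} {W W0 e e0}
    (q : Derivable Ax (.sortEq Z (W.subst (unc varEnv)) W0))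
    (f : Derivable Ax (.termEq Z (e.subst (unc varEnv)) e0 W0)) :
    Derivable Ax (.term Z e W) := by
  rw [SortE.subst_varEnv] at q
  rw [Expr.subst_varEnv] at f
  exact (Derivable.conv (.step (.s2 q)) f).terms_of_termEq.1

theorem GPair.tJudg_derivable (G : GPair A B) {J J' K} (hJ : DerAt G.TA n J)
    (hJ' : DerAt G.TB m J') (hK : TJudg G.TA G.TB G.chA G.chB b J J' K) : Derivable G.T K := by
  have h1 := G.hyp (n + 1) m
  have h2 := G.hyp n (m + 1)
  have h3 := G.hyp (n + 1) (m + 1)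
  have nx := fun X => FreshCh.notMem G.hchA X
  have ny := fun Y => FreshCh.notMem G.hchB Y
  cases hK with
  | @ss X U Y V Z W hZ hW =>
    obtain ⟨hc, r1, r2, -⟩ := hZ.corner (nx _) (ny _) h1 h2 hJ.succ hJ'.succ
    obtain ⟨W0, hW0⟩ := Dom.evTy_total (D := G.dom Z.dropLast) varEnv
      (Arg.decl (decl_snoc_self X (G.chA X) U) hJ) (Arg.decl (decl_snoc_self Y (G.chB Y) V) hJ')
    have q := hW.tyEq_var G (h3 _ hc).low hJ.succ hJ'.succ r1 r2 hW0
    rw [SortE.subst_varEnv] at q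
    exact q.sorts_of_sortEq.1
  | @sseq X U Y V V' Z W W' hZ hW hW' =>
    have hV := hJ'.succ.sorts_of_sortEq
    obtain ⟨hc, r1, r2, -⟩ := hZ.corner (nx _) (ny _) h1 h2 hJ.succ hV.1.succ
    have p := h3 _ hc
    have hu := Arg.decl (decl_snoc_self X (G.chA X) U) hJ
    obtain ⟨W0, hW0⟩ := Dom.evTy_total (D := G.dom Z.dropLast) varEnv hu
      (Arg.decl (decl_snoc_self Y (G.chB Y) V) hV.1)
    obtain ⟨W0', hW0'⟩ := Dom.evTy_total (D := G.dom Z.dropLast) varEnv hu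
      (Arg.decl (decl_snoc_self Y (G.chB Y) V') hV.2)
    have t1 := Dom.CtxRel.tr (D := G.dom Z.dropLast) r1
    have t2 := Dom.CtxRel.tr (D := G.dom Z.dropLast) r2
    have hs := p.eq'.toSrtInv.sEq hJ'.succ (ny _)
      (fun hd => (hJ.sort_wf.2.2 _ _ _ hd).succ) t2
    have q := hW.tyEq_var G p.low hJ.succ hV.1.succ r1 r2 hW0
    have q' := hW'.tyEq_var G p.low hJ.succ hV.2.succ r1
      (Dom.CtxRel.tr (D := (G.dom Z.dropLast).swap) hs.rel') hW0'
    have q0 := p.eq'.h3 hJ'.succ (ny _) (.inr ⟨_, nx _, rfl, rfl, hJ.succ⟩) t2 t1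
      (Dom.EvTy.tr (D := G.dom Z.dropLast) hW0) (Dom.EvTy.tr (D := G.dom Z.dropLast) hW0')
    rw [SortE.subst_varEnv] at q q'
    exact .step (.s3 q (.step (.s3 q0 (.step (.s2 q')))))
  | @seqs X U U' Y V Z W W' hZ hW hW' =>
    have hU := hJ.succ.sorts_of_sortEq
    obtain ⟨hc, r1, r2, -⟩ := hZ.corner (nx _) (ny _) h1 h2 hU.1.succ hJ'.succ
    have p := h3 _ hc
    have hv := Arg.decl (decl_snoc_self Y (G.chB Y) V) hJ'
    obtain ⟨W0, hW0⟩ := Dom.evTy_total (D := G.dom Z.dropLast) varEnv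
      (Arg.decl (decl_snoc_self X (G.chA X) U) hU.1) hv
    obtain ⟨W0', hW0'⟩ := Dom.evTy_total (D := G.dom Z.dropLast) varEnv
      (Arg.decl (decl_snoc_self X (G.chA X) U') hU.2) hv
    have hs := p.eq.toSrtInv.sEq hJ.succ (nx _) (fun hd => (hJ'.sort_wf.2.2 _ _ _ hd).succ) r1
    have q := hW.tyEq_var G p.low hU.1.succ hJ'.succ r1 r2 hW0
    have q' := hW'.tyEq_var G p.low hU.2.succ hJ'.succ hs.rel' r2 hW0'
    have q0 := p.eq.h3 hJ.succ (nx _) (.inr ⟨_, ny _, rfl, rfl, hJ'.succ⟩) r1 r2 hW0 hW0'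
    rw [SortE.subst_varEnv] at q q'
    exact .step (.s3 q (.step (.s3 q0 (.step (.s2 q')))))
  | @st X U Y v V Z e W g hZ he hW hg =>
    have hV := hJ'.succ.sort_of_term
    obtain ⟨hc, hr, -⟩ := hZ.whole (nodup_snoc hJ.sort_wf.1 (nx _) _) hV.sort_wf.1 (G.hyp n m)
      (hJ.sort_decls _) hV.sort_wf.2.2
    have hu := Arg.decl (decl_snoc_self X (G.chA X) U) hJ
    obtain ⟨W0, hW0⟩ := Dom.evTy_total (D := G.dom Z) varEnv hu hJ'.arg
    obtain ⟨e0, he0⟩ := Dom.ev_total (D := G.dom Z) varEnv hu.has hJ'.arg.has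
    exact .term_of_value (hW.tyEq_pairsL (h3 _ hc).low hJ.succ hJ'.succ hg hr hW0)
      (he.termEq_ev (G.hyp n m _ hc) hu hJ'.arg hr hW0 he0)
  | @ts X u U Y V Z e W g hZ he hW hg =>
    have hU := hJ.succ.sort_of_term
    obtain ⟨hc, hr, -⟩ := hZ.whole hU.sort_wf.1 (nodup_snoc hJ'.sort_wf.1 (ny _) _) (G.hyp n m)
      hU.sort_wf.2.2 (hJ'.sort_decls _)
    have hv := Arg.decl (decl_snoc_self Y (G.chB Y) V) hJ'
    obtain ⟨W0, hW0⟩ := Dom.evTy_total (D := G.dom Z) varEnv hJ.arg hv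
    obtain ⟨e0, he0⟩ := Dom.ev_total (D := G.dom Z) varEnv hJ.arg.has hv.has
    exact .term_of_value (hW.tyEq_pairsR (h3 _ hc).low hJ.succ hJ'.succ hg hr hW0)
      (he.termEq_ev (G.hyp n m _ hc) hJ.arg hv hr hW0 he0)
  | @tt X u U Y v V Z e1 e2 W gx gy hZ he1 he2 hW hgx hgy =>
    have hU := hJ.succ.sort_of_term
    have hV := hJ'.succ.sort_of_term
    obtain ⟨hc, hr, -⟩ := hZ.whole hU.sort_wf.1 hV.sort_wf.1 (G.hyp n m) hU.sort_wf.2.2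
      hV.sort_wf.2.2
    have p := G.hyp n m _ hc
    obtain ⟨W0, hW0⟩ := Dom.evTy_total (D := G.dom Z) varEnv hJ.arg hJ'.arg
    obtain ⟨e0, he0⟩ := Dom.ev_total (D := G.dom Z) varEnv hJ.arg.has hJ'.arg.has
    have f := he1.termEq_ev p hJ.arg hJ'.arg hr hW0 he0
    have f' := (he2.near G p hr.1 hr.2.1 (List.prefix_refl _) (List.prefix_refl _) hJ.arg hJ'.arg
      hr).any p.cv hr hJ.arg hJ'.arg hW0 he0
    exact .termEq_of_values (hW.tyEq_pairs (h3 _ hc).low hJ.succ hJ'.succ hgx hgy hr hW0) f f'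
      (.step (.t3 (.step (.t2 f')) f'))
  | @steq X U Y v v' V Z e e' W g hZ he he' hW hg =>
    have hv := hJ'.succ.terms_of_termEq
    have hV := hv.1.succ.sort_of_term
    have hu := Arg.decl (decl_snoc_self X (G.chA X) U) hJ
    obtain ⟨hc, hr, -⟩ := hZ.whole (nodup_snoc hJ.sort_wf.1 (nx _) _) hV.sort_wf.1 (G.hyp n m)
      (hJ.sort_decls _) hV.sort_wf.2.2
    have p := G.hyp n m _ hc
    have t := Dom.CtxRel.tr (D := G.dom Z) hr
    obtain ⟨W0, hW0⟩ := Dom.evTy_total (D := G.dom Z) varEnv hu hv.1.arg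
    obtain ⟨W0', hW0'⟩ := Dom.evTy_total (D := G.dom Z) varEnv hu hv.2.arg
    obtain ⟨e0, he0⟩ := Dom.ev_total (D := G.dom Z) varEnv hu.has hv.1.arg.has
    obtain ⟨e0', he0'⟩ := Dom.ev_total (D := G.dom Z) varEnv hu.has hv.2.arg.has
    have r := List.prefix_refl Y
    have r' := List.prefix_refl (X ++ [(G.chA X, U)])
    have q := (GPair.lowAt_swap h1 h2 hc).tyTermEq hJ'.succ
      (hu.mono n.le_succ (List.prefix_append _ _) r' r') t
      (Dom.EvTy.tr (D := G.dom Z) (hW0.mono (List.prefix_append _ _) r' r r))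
      (Dom.EvTy.tr (D := G.dom Z) (hW0'.mono (List.prefix_append _ _) r' r r))
    exact .termEq_of_values (hW.tyEq_pairsL (h3 _ hc).low hJ.succ hv.1.succ hg hr hW0)
      (he.termEq_ev p hu hv.1.arg hr hW0 he0)
      (.conv (.step (.s2 q)) (he'.termEq_ev p hu hv.2.arg hr hW0' he0'))
      ((Dom.Near.tr (D := (G.dom Z).swap)
        (p.eq'.h5 hJ' hu.has t (Dom.Ev.tr (D := G.dom Z) he0'))).any p.cv hr hu hv.1.arg hW0 he0)
  | @teqs X u u' U Y V Z e e' W g hZ he he' hW hg =>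
    have hu := hJ.succ.terms_of_termEq
    have hU := hu.1.succ.sort_of_term
    have hv := Arg.decl (decl_snoc_self Y (G.chB Y) V) hJ'
    obtain ⟨hc, hr, -⟩ := hZ.whole hU.sort_wf.1 (nodup_snoc hJ'.sort_wf.1 (ny _) _) (G.hyp n m)
      hU.sort_wf.2.2 (hJ'.sort_decls _)
    have p := G.hyp n m _ hc
    obtain ⟨W0, hW0⟩ := Dom.evTy_total (D := G.dom Z) varEnv hu.1.arg hv
    obtain ⟨W0', hW0'⟩ := Dom.evTy_total (D := G.dom Z) varEnv hu.2.arg hv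
    obtain ⟨e0, he0⟩ := Dom.ev_total (D := G.dom Z) varEnv hu.1.arg.has hv.has
    obtain ⟨e0', he0'⟩ := Dom.ev_total (D := G.dom Z) varEnv hu.2.arg.has hv.has
    have r := List.prefix_refl X
    have r' := List.prefix_refl (Y ++ [(G.chB Y, V)])
    have q := (GPair.lowAt h1 h2 hc).tyTermEq hJ.succ
      (hv.mono m.le_succ (List.prefix_append _ _) r' r') hr
      (hW0.mono r r (List.prefix_append _ _) r') (hW0'.mono r r (List.prefix_append _ _) r')
    exact .termEq_of_values (hW.tyEq_pairsR (h3 _ hc).low hu.1.succ hJ'.succ hg hr hW0)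
      (he.termEq_ev p hu.1.arg hv hr hW0 he0)
      (.conv (.step (.s2 q)) (he'.termEq_ev p hu.2.arg hv hr hW0' he0'))
      ((p.eq.h5 hJ hv.has hr he0').any p.cv hr hu.1.arg hv hW0 he0)
  | @seqt X U U' Y v V Z e e' W g hZ he he' hW hg =>
    have hU := hJ.succ.sorts_of_sortEq
    have hV := hJ'.succ.sort_of_term
    have hu := Arg.decl (decl_snoc_self X (G.chA X) U) hU.1
    have hu' := Arg.decl (decl_snoc_self X (G.chA X) U') hU.2
    obtain ⟨hc, hr, -⟩ := hZ.whole (nodup_snoc hU.1.sort_wf.1 (nx _) _) hV.sort_wf.1 (G.hyp n m)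
      (hU.1.sort_decls _) hV.sort_wf.2.2
    have p := G.hyp n m _ hc
    have hs := p.eq.toSrtInv.sEq hJ (nx _) (fun hd => hV.sort_wf.2.2 _ _ _ hd) hr
    obtain ⟨W0, hW0⟩ := Dom.evTy_total (D := G.dom Z) varEnv hu hJ'.arg
    obtain ⟨W0', hW0'⟩ := Dom.evTy_total (D := G.dom Z) varEnv hu' hJ'.arg
    obtain ⟨e0, he0⟩ := Dom.ev_total (D := G.dom Z) varEnv hu.has hJ'.arg.has
    obtain ⟨e0', he0'⟩ := Dom.ev_total (D := G.dom Z) varEnv hu'.has hJ'.arg.has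
    have q := p.eq.h3 hJ (nx _) (.inl ⟨rfl, hJ'⟩) hr
      (hr.mono (List.prefix_append _ _) (List.prefix_refl _)) hW0 hW0'
    exact .termEq_of_values (hW.tyEq_pairsL (h3 _ hc).low hU.1.succ hJ'.succ hg hr hW0)
      (he.termEq_ev p hu hJ'.arg hr hW0 he0)
      (.conv (.step (.s2 q)) (he'.termEq_ev p hu' hJ'.arg hs.rel' hW0' he0'))
      ((p.eq.h4 hJ (nx _) hJ' hr he0').any p.cv hr hu hJ'.arg hW0 he0)
  | @tseq X u U Y V V' Z e e' W g hZ he he' hW hg =>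
    have hV := hJ'.succ.sorts_of_sortEq
    have hU := hJ.succ.sort_of_term
    have hv := Arg.decl (decl_snoc_self Y (G.chB Y) V) hV.1
    have hv' := Arg.decl (decl_snoc_self Y (G.chB Y) V') hV.2
    obtain ⟨hc, hr, -⟩ := hZ.whole hU.sort_wf.1 (nodup_snoc hV.1.sort_wf.1 (ny _) _) (G.hyp n m)
      hU.sort_wf.2.2 (hV.1.sort_decls _)
    have p := G.hyp n m _ hc
    have t := Dom.CtxRel.tr (D := G.dom Z) hr
    have hs := p.eq'.toSrtInv.sEq hJ' (ny _) (fun hd => hU.sort_wf.2.2 _ _ _ hd) t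
    obtain ⟨W0, hW0⟩ := Dom.evTy_total (D := G.dom Z) varEnv hJ.arg hv
    obtain ⟨W0', hW0'⟩ := Dom.evTy_total (D := G.dom Z) varEnv hJ.arg hv'
    obtain ⟨e0, he0⟩ := Dom.ev_total (D := G.dom Z) varEnv hJ.arg.has hv.has
    obtain ⟨e0', he0'⟩ := Dom.ev_total (D := G.dom Z) varEnv hJ.arg.has hv'.has
    have q := p.eq'.h3 hJ' (ny _) (.inl ⟨rfl, hJ⟩) t
      (t.mono (List.prefix_append _ _) (List.prefix_refl _))
      (Dom.EvTy.tr (D := G.dom Z) hW0) (Dom.EvTy.tr (D := G.dom Z) hW0')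
    exact .termEq_of_values (hW.tyEq_pairsR (h3 _ hc).low hJ.succ hV.1.succ hg hr hW0)
      (he.termEq_ev p hJ.arg hv hr hW0 he0)
      (.conv (.step (.s2 q)) (he'.termEq_ev p hJ.arg hv'
        (Dom.CtxRel.tr (D := (G.dom Z).swap) hs.rel') hW0' he0'))
      ((Dom.Near.tr (D := (G.dom Z).swap)
        (p.eq'.h4 hJ' (ny _) hJ t (Dom.Ev.tr (D := G.dom Z) he0'))).any p.cv hr hJ.arg hv hW0 he0)

end GATPaper

namespace GATPaper

/-- For generalized algebraic theories `𝔸`, `𝔹` and derivable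
judgments `J` of `𝔸` and `J'` of `𝔹` for which `J ⊙* J'` is defined (i.e. of one
of the admissible kinds of Table 1), the judgment `J ⊙* J'` is derivable in the
generalized algebraic theory `𝔸 ⊗ 𝔹`. -/
theorem star_tensor_judgment_derivable
    (A B : Alphabet) (TA : Set (Judg A)) (TB : Set (Judg B))
    (hA : IsGAT TA) (hB : IsGAT TB)
    (chA : PreCtx A → A.Var) (hchA : FreshCh chA)
    (chB : PreCtx B → B.Var) (hchB : FreshCh chB)
    (J : Judg A) (J' : Judg B) (K : Judg (A.tensor B))
    (hJ : Derivable TA J) (hJ' : Derivable TB J')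
    (hK : TJudg TA TB chA chB true J J' K) :
    Derivable (tensorAx TA TB chA chB) K := by
  obtain ⟨n, h⟩ := hJ
  obtain ⟨m, h'⟩ := hJ'
  exact GPair.tJudg_derivable ⟨TA, TB, hA, hB, chA, chB, hchA, hchB⟩ h h' hK

end GATPaper
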